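/- For every η > 0 there exists a subset ℱ ⊆ ℛ of measure zero with the following property: for all α ∈ ℛ \ ℱ one has P(α, N, [0,Δ]) = (1 + o(1))·Δ as N → ∞, uniformly in the range N^{−1+η} ≤ Δ ≤ C for any fixed constant C. Precisely: for every δ > 0 there exists N₀ (depending on α, η, δ, C) such that for all N ≥ N₀ and all Δ with N^{−1+η} ≤ Δ ≤ C one has |P(α, N, [0,Δ]) − Δ| ≤ δ·Δ. -/

import Mathlib

open MeasureTheory

noncomputable section

/-- The diagonal binary quadratic form `q_α(m,n) = α₁m² + α₃n²` for `α = (α₁, α₃)`. -/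
def qf (α : ℝ × ℝ) (m n : ℤ) : ℝ := α.1 * (m : ℝ) ^ 2 + α.2 * (n : ℝ) ^ 2

/-- The normalized eigenvalue `(π/(4√(α₁α₃))) q_α(m,n)`. -/
def lam (α : ℝ × ℝ) (m n : ℤ) : ℝ :=
  Real.pi / (4 * Real.sqrt (α.1 * α.2)) * qf α m n

/-- The index set: `m > 0`, `n ≥ 0`. -/
def idx : Set (ℤ × ℤ) := {p | 0 < p.1 ∧ 0 ≤ p.2}

/-- The pair correlation counting function `P(α, N, I)`: the ordered multiset
`0 < Λ₁ ≤ Λ₂ ≤ …` of values `(π/(4√(α₁α₃))) q_α(m,n)` over `(m,n) ∈ idx` is in bijection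
with `idx`, so pairs of distinct indices `(j,k)` correspond to pairs of distinct points. -/
def Pcorr (α : ℝ × ℝ) (N : ℝ) (I : Set ℝ) : ℝ :=
  (1 / N) * Nat.card {pq : (ℤ × ℤ) × (ℤ × ℤ) //
    pq.1 ∈ idx ∧ pq.2 ∈ idx ∧ pq.1 ≠ pq.2 ∧
    lam α pq.1.1 pq.1.2 ≤ N ∧ lam α pq.2.1 pq.2.2 ≤ N ∧
    lam α pq.1.1 pq.1.2 - lam α pq.2.1 pq.2.2 ∈ I}

/-- The set `ℛ = ℝ²_{>0}`. -/
def Rset : Set (ℝ × ℝ) := {α | 0 < α.1 ∧ 0 < α.2}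

/-- The measure `dα₁dα₃/(α₁α₃)` on `ℛ`. -/
def Rmeasure : Measure (ℝ × ℝ) :=
  volume.withDensity fun α => ENNReal.ofReal (1 / (α.1 * α.2))

end

section Plancherel
open FourierTransform SchwartzMap ContDiff

theorem fourier_toLp_ae_eq (f : ℝ → ℂ) (hf1 : Integrable f) (hf2 : MemLp f 2) :
    ((𝓕 (hf2.toLp f) : Lp ℂ 2 (volume : Measure ℝ)) : ℝ → ℂ) =ᵐ[volume] 𝓕 f := by
  have hc : Continuous (𝓕 f) :=
    VectorFourier.fourierIntegral_continuous Real.continuous_fourierChar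
      (by exact continuous_inner) hf1
  have hloc : LocallyIntegrable ((𝓕 (hf2.toLp f) : Lp ℂ 2 (volume : Measure ℝ)) : ℝ → ℂ) :=
    (Lp.memLp _).locallyIntegrable (by norm_num)
  refine ae_eq_of_integral_contDiff_smul_eq hloc hc.locallyIntegrable ?_
  intro g g_smooth g_cpt
  have hg₁ : HasCompactSupport (Complex.ofRealCLM ∘ g) := g_cpt.comp_left rfl
  have hg₂ : ContDiff ℝ ∞ (Complex.ofRealCLM ∘ g) := by fun_prop
  set G : 𝓢(ℝ, ℂ) := hg₁.toSchwartzMap hg₂ with hG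
  have hGa : ∀ x, G x = (g x : ℂ) := fun x => rfl
  have h1 := congrArg (fun T => T G) (Lp.fourier_toTemperedDistribution_eq (hf2.toLp f))
  simp only [TemperedDistribution.fourier_apply, Lp.toTemperedDistribution_apply] at h1
  have h2 : ∫ x, (𝓕 G) x • (hf2.toLp f) x = ∫ x, (𝓕 G) x • f x :=
    integral_congr_ae (by filter_upwards [hf2.coeFn_toLp] with x hx; rw [hx])
  have h3 : ∫ ξ, (𝓕 (G : ℝ → ℂ) ξ) • f ξ = ∫ x, G x • (𝓕 f x) := by
    have := VectorFourier.integral_fourierIntegral_smul_eq_flip (L := innerₗ ℝ) (μ := volume)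
      (ν := volume) (f := (G : ℝ → ℂ)) (g := f) Real.continuous_fourierChar
      (by exact continuous_inner) G.integrable hf1
    rw [flip_innerₗ] at this
    exact this
  have h4 : ∀ (u : ℝ → ℂ), ∫ x, G x • u x = ∫ x, g x • u x := fun u =>
    integral_congr_ae (Filter.Eventually.of_forall fun x => by simp [hGa])
  rw [← h4, ← h4, ← h3, ← h1, h2]
  rfl

theorem plancherel_memLp (f : ℝ → ℂ) (hf1 : Integrable f) (hf2 : MemLp f 2) :
    MemLp (𝓕 f) 2 :=
  (memLp_congr_ae (fourier_toLp_ae_eq f hf1 hf2)).1 (Lp.memLp _)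

theorem plancherel_integral (f : ℝ → ℂ) (hf1 : Integrable f) (hf2 : MemLp f 2) :
    ∫ ξ, ‖𝓕 f ξ‖ ^ 2 = ∫ x, ‖f x‖ ^ 2 := by
  have h := Lp.norm_fourier_eq (hf2.toLp f)
  have e : ∀ (u : Lp ℂ 2 (volume : Measure ℝ)), ‖u‖ ^ 2 = ∫ x, ‖u x‖ ^ 2 := by
    intro u
    have := MeasureTheory.L2.inner_def (𝕜 := ℂ) u u
    have h2 : inner ℂ u u = ((‖u‖ ^ 2 : ℝ) : ℂ) := by
      rw [inner_self_eq_norm_sq_to_K]; push_cast; rfl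
    rw [h2] at this
    have h3 : (∫ a, inner ℂ (u a) (u a)) = ((∫ a, ‖u a‖ ^ 2 : ℝ) : ℂ) := by
      rw [← integral_complex_ofReal]
      refine integral_congr_ae (Filter.Eventually.of_forall fun x => ?_)
      simp only [inner_self_eq_norm_sq_to_K]; push_cast; rfl
    rw [h3] at this
    exact_mod_cast this
  have h5 : ‖(𝓕 (hf2.toLp f) : Lp ℂ 2 (volume : Measure ℝ))‖ ^ 2 = ‖hf2.toLp f‖ ^ 2 := by rw [h]
  rw [e, e] at h5
  have h6 : ∫ x, ‖(hf2.toLp f) x‖ ^ 2 = ∫ x, ‖f x‖ ^ 2 :=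
    integral_congr_ae (by filter_upwards [hf2.coeFn_toLp] with x hx; rw [hx])
  rw [← h6, ← h5]
  exact integral_congr_ae (by filter_upwards [fourier_toLp_ae_eq f hf1 hf2] with x hx; rw [hx])

end Plancherel

section Kernel
open FourierTransform

/-- Normalised indicator of `[0, w]`. -/
noncomputable def stepKer (w : ℝ) : ℝ → ℂ := Set.indicator (Set.Icc 0 w) (fun _ => ((1 / w : ℝ) : ℂ))

/-- Exponential sum with frequencies `l t`. -/
noncomputable def expSum {ι : Type*} (T : Finset ι) (l : ι → ℝ) (ξ : ℝ) : ℂ :=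
  ∑ t ∈ T, Complex.exp (((-2 * Real.pi * l t * ξ : ℝ) : ℂ) * Complex.I)

theorem stepKer_integrable (w : ℝ) : Integrable (stepKer w) := by
  refine (integrable_indicator_iff measurableSet_Icc).2 ?_
  exact integrableOn_const (by simp) (by simp)

theorem stepKer_memLp (w : ℝ) : MemLp (stepKer w) 2 :=
  memLp_indicator_const 2 measurableSet_Icc _ (Or.inr (by simp))

theorem fourier_sum_translate {ι : Type*} (T : Finset ι) (l : ι → ℝ) (k : ℝ → ℂ)
    (hk : Integrable k) (ξ : ℝ) :
    𝓕 (fun θ => ∑ t ∈ T, k (θ - l t)) ξ = expSum T l ξ * 𝓕 k ξ := by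
  rw [Real.fourier_real_eq_integral_exp_smul]
  simp only [Finset.smul_sum]
  rw [integral_finsetSum]
  · rw [expSum, Finset.sum_mul]
    refine Finset.sum_congr rfl fun t _ => ?_
    rw [Real.fourier_real_eq_integral_exp_smul, ← integral_const_mul]
    rw [← integral_sub_right_eq_self (fun v => Complex.exp (((-2 * Real.pi * l t * ξ : ℝ) : ℂ) * Complex.I) * (Complex.exp (((-2 * Real.pi * v * ξ : ℝ) : ℂ) * Complex.I) • k v)) (l t)]
    refine integral_congr_ae (Filter.Eventually.of_forall fun x => ?_)
    simp only [smul_eq_mul, ← mul_assoc, ← Complex.exp_add]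
    congr 2
    push_cast; ring
  · intro t _
    have := (hk.comp_sub_right (l t))
    refine this.bdd_mul (c := 1) (Continuous.aestronglyMeasurable (by fun_prop)) ?_
    refine Filter.Eventually.of_forall fun x => ?_
    rw [Complex.norm_exp_ofReal_mul_I]

theorem expSum_plancherel {ι : Type*} (T : Finset ι) (l : ι → ℝ) (k : ℝ → ℂ)
    (hk : Integrable k) (hk2 : MemLp k 2) :
    Integrable (fun ξ => ‖expSum T l ξ‖ ^ 2 * ‖𝓕 k ξ‖ ^ 2) ∧
    ∫ ξ, ‖expSum T l ξ‖ ^ 2 * ‖𝓕 k ξ‖ ^ 2 = ∫ θ, ‖∑ t ∈ T, k (θ - l t)‖ ^ 2 := by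
  set f : ℝ → ℂ := fun θ => ∑ t ∈ T, k (θ - l t)
  have h1 : Integrable f := integrable_finsetSum _ fun t _ => hk.comp_sub_right _
  have h2 : MemLp f 2 := memLp_finsetSum _ fun t _ =>
    hk2.comp_measurePreserving (measurePreserving_sub_right volume (l t))
  have e : (fun ξ => ‖expSum T l ξ‖ ^ 2 * ‖𝓕 k ξ‖ ^ 2) = fun ξ => ‖𝓕 f ξ‖ ^ 2 := by
    funext ξ
    rw [fourier_sum_translate T l k hk, norm_mul, mul_pow]
  rw [e]
  refine ⟨?_, plancherel_integral f h1 h2⟩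
  exact (memLp_two_iff_integrable_sq_norm (plancherel_memLp f h1 h2).1).1
    (plancherel_memLp f h1 h2)

theorem stepKer_fourier (w ξ : ℝ) (hw : 0 < w) :
    𝓕 (stepKer w) ξ = ((1 / w : ℝ) : ℂ) *
      ∫ x in (0 : ℝ)..w, Complex.exp (((-2 * Real.pi * x * ξ : ℝ) : ℂ) * Complex.I) := by
  rw [Real.fourier_real_eq_integral_exp_smul, intervalIntegral.integral_of_le hw.le,
    ← integral_Icc_eq_integral_Ioc, ← integral_const_mul, ← integral_indicator measurableSet_Icc]
  refine integral_congr_ae (Filter.Eventually.of_forall fun x => ?_)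
  by_cases hx : x ∈ Set.Icc 0 w <;> simp [stepKer, hx, mul_comm]

theorem norm_exp_ofReal_mul_I_sub_one_le (x : ℝ) : ‖Complex.exp ((x : ℂ) * Complex.I) - 1‖ ≤ |x| := by
  have := Real.norm_exp_I_mul_ofReal_sub_one_le (x := x)
  rwa [mul_comm] at this

theorem stepKer_fourier_le_one (w ξ : ℝ) (hw : 0 < w) : ‖𝓕 (stepKer w) ξ‖ ≤ 1 := by
  rw [stepKer_fourier w ξ hw, norm_mul, Complex.norm_real, Real.norm_of_nonneg (by positivity)]
  have : ‖∫ x in (0 : ℝ)..w, Complex.exp (((-2 * Real.pi * x * ξ : ℝ) : ℂ) * Complex.I)‖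
      ≤ 1 * |w - 0| :=
    intervalIntegral.norm_integral_le_of_norm_le_const fun x _ => by
      rw [Complex.norm_exp_ofReal_mul_I]
  rw [sub_zero, abs_of_pos hw, one_mul] at this
  calc _ ≤ 1 / w * w := by gcongr
    _ = 1 := by field_simp

theorem stepKer_fourier_sub_one_le (w ξ : ℝ) (hw : 0 < w) :
    ‖𝓕 (stepKer w) ξ - 1‖ ≤ 2 * Real.pi * |ξ| * w := by
  have e : 𝓕 (stepKer w) ξ - 1 = ((1 / w : ℝ) : ℂ) *
      ∫ x in (0 : ℝ)..w, (Complex.exp (((-2 * Real.pi * x * ξ : ℝ) : ℂ) * Complex.I) - 1) := by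
    rw [stepKer_fourier w ξ hw, intervalIntegral.integral_sub
      (Continuous.intervalIntegrable (by fun_prop) _ _) (by simp)]
    simp only [intervalIntegral.integral_const, sub_zero, mul_sub]
    congr 1
    have : (w : ℂ) ≠ 0 := by exact_mod_cast hw.ne'
    simp; field_simp
  rw [e, norm_mul, Complex.norm_real, Real.norm_of_nonneg (by positivity)]
  have : ‖∫ x in (0 : ℝ)..w, (Complex.exp (((-2 * Real.pi * x * ξ : ℝ) : ℂ) * Complex.I) - 1)‖
      ≤ (2 * Real.pi * |ξ| * w) * |w - 0| :=
    intervalIntegral.norm_integral_le_of_norm_le_const fun x hx => by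
      refine (norm_exp_ofReal_mul_I_sub_one_le _).trans ?_
      rw [Set.uIoc_of_le hw.le] at hx
      rw [abs_mul, abs_mul, abs_mul, abs_of_pos hx.1, abs_of_pos Real.pi_pos]
      norm_num
      nlinarith [hx.2, mul_nonneg Real.pi_pos.le (abs_nonneg ξ)]
  rw [sub_zero, abs_of_pos hw] at this
  calc _ ≤ 1 / w * (2 * Real.pi * |ξ| * w * w) := by gcongr
    _ = _ := by field_simp

theorem stepKer_fourier_decay (w ξ : ℝ) (hw : 0 < w) (hξ : ξ ≠ 0) :
    ‖𝓕 (stepKer w) ξ‖ ≤ 1 / (Real.pi * |ξ| * w) := by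
  have hc : ((-2 * Real.pi * ξ : ℝ) : ℂ) * Complex.I ≠ 0 := by
    simp [Real.pi_ne_zero, hξ]
  have e : ∫ x in (0 : ℝ)..w, Complex.exp (((-2 * Real.pi * x * ξ : ℝ) : ℂ) * Complex.I)
      = (Complex.exp (((-2 * Real.pi * ξ : ℝ) : ℂ) * Complex.I * w) - 1)
        / (((-2 * Real.pi * ξ : ℝ) : ℂ) * Complex.I) := by
    have := integral_exp_mul_complex (a := 0) (b := w) hc
    simp only [Complex.ofReal_zero, mul_zero, Complex.exp_zero] at this
    rw [← this]
    congr 1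
    funext x
    congr 1
    push_cast; ring
  rw [stepKer_fourier w ξ hw, e, norm_mul, Complex.norm_real,
    Real.norm_of_nonneg (by positivity), norm_div]
  have h2 : ‖Complex.exp (((-2 * Real.pi * ξ : ℝ) : ℂ) * Complex.I * w) - 1‖ ≤ 2 := by
    refine (norm_sub_le _ _).trans ?_
    have : ((-2 * Real.pi * ξ : ℝ) : ℂ) * Complex.I * w = ((-2 * Real.pi * ξ * w : ℝ) : ℂ) * Complex.I := by
      push_cast; ring
    rw [this, Complex.norm_exp_ofReal_mul_I]; norm_num
  have h3 : ‖((-2 * Real.pi * ξ : ℝ) : ℂ) * Complex.I‖ = 2 * Real.pi * |ξ| := by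
    rw [norm_mul, Complex.norm_I, Complex.norm_real, Real.norm_eq_abs, abs_mul, abs_mul,
      abs_of_pos Real.pi_pos]; norm_num
  rw [h3]
  have hx : 0 < |ξ| := abs_pos.2 hξ
  have := Real.pi_pos
  calc _ ≤ 1 / w * (2 / (2 * Real.pi * |ξ|)) := by gcongr
    _ = _ := by field_simp

/-- Number of frequencies `l t` with `0 ≤ θ - l t ≤ w`. -/
noncomputable def winCount {ι : Type*} (T : Finset ι) (l : ι → ℝ) (w θ : ℝ) : ℕ :=
  {t ∈ T | 0 ≤ θ - l t ∧ θ - l t ≤ w}.card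

theorem sum_stepKer_eq {ι : Type*} (T : Finset ι) (l : ι → ℝ) (w θ : ℝ) :
    ∑ t ∈ T, stepKer w (θ - l t) = ((winCount T l w θ / w : ℝ) : ℂ) := by
  simp only [stepKer, Set.indicator_apply, Set.mem_Icc]
  rw [← Finset.sum_filter, Finset.sum_const, winCount]
  push_cast
  simp only [nsmul_eq_mul]
  ring

theorem winCount_eq_indicator {ι : Type*} (T : Finset ι) (l : ι → ℝ) (w θ : ℝ) :
    (winCount T l w θ : ℝ) = ∑ t ∈ T, Set.indicator (Set.Icc (l t) (l t + w)) (fun _ => (1 : ℝ)) θ := by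
  simp only [winCount, Set.indicator_apply, Set.mem_Icc]
  rw [← Finset.sum_filter, Finset.sum_const, nsmul_eq_mul, mul_one]
  congr 2
  ext t
  simp only [Finset.mem_filter]
  constructor <;> rintro ⟨h1, h2, h3⟩ <;> exact ⟨h1, by linarith, by linarith⟩

theorem winCount_integrable {ι : Type*} (T : Finset ι) (l : ι → ℝ) (w : ℝ) :
    Integrable (fun θ => (winCount T l w θ : ℝ)) := by
  simp only [winCount_eq_indicator]
  refine integrable_finsetSum _ fun t _ => ?_
  refine (integrable_indicator_iff measurableSet_Icc).2 ?_
  exact integrableOn_const (by simp) (by simp)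

theorem integral_indicator_Icc_one (a w : ℝ) (hw : 0 ≤ w) :
    ∫ θ, Set.indicator (Set.Icc a (a + w)) (fun _ => (1 : ℝ)) θ = w := by
  rw [integral_indicator measurableSet_Icc]
  simp [hw]

theorem integral_winCount {ι : Type*} (T : Finset ι) (l : ι → ℝ) (w : ℝ) (hw : 0 ≤ w) :
    ∫ θ, (winCount T l w θ : ℝ) = w * T.card := by
  simp only [winCount_eq_indicator]
  rw [integral_finsetSum]
  · simp only [integral_indicator_Icc_one _ _ hw]
    simp [mul_comm]
  · intro t _
    refine (integrable_indicator_iff measurableSet_Icc).2 ?_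
    exact integrableOn_const (by simp) (by simp)

theorem card_le_of_diff_le (S : Finset ℕ) (D : ℝ) (hD : 0 ≤ D)
    (h : ∀ n ∈ S, ∀ m ∈ S, (n : ℝ) - m ≤ D) : (S.card : ℝ) ≤ 1 + D := by
  rcases S.eq_empty_or_nonempty with rfl | hS
  · simp; linarith
  have hsub : S ⊆ Finset.Icc (S.min' hS) (S.max' hS) := fun n hn =>
    Finset.mem_Icc.2 ⟨S.min'_le n hn, S.le_max' n hn⟩
  have h1 := Finset.card_le_card hsub
  rw [Nat.card_Icc] at h1
  have h2 := h _ (S.max'_mem hS) _ (S.min'_mem hS)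
  have h3 : S.min' hS ≤ S.max' hS := S.min'_le _ (S.max'_mem hS)
  have h4 : ((S.max' hS + 1 - S.min' hS : ℕ) : ℝ) = S.max' hS + 1 - S.min' hS := by
    rw [Nat.cast_sub (by omega)]; push_cast; ring
  have h5 : (S.card : ℝ) ≤ ((S.max' hS + 1 - S.min' hS : ℕ) : ℝ) := by exact_mod_cast h1
  rw [h4] at h5
  linarith

/-- Mean value estimate for Dirichlet polynomials on short logarithmic windows. -/
theorem expSum_log_mean_value {ι : Type*} (T : Finset ι) (ν : ι → ℕ) (X δ : ℝ) (hδ : 0 < δ)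
    (hX : 0 ≤ X) (hν : ∀ t ∈ T, 1 ≤ ν t ∧ (ν t : ℝ) ≤ X) :
    ∫ ξ, ‖expSum T (fun t => Real.log (ν t)) ξ‖ ^ 2 * ‖𝓕 (stepKer δ) ξ‖ ^ 2 ≤
      (1 / δ + X) * ∑ n ∈ T.image ν, (({t ∈ T | ν t = n}.card : ℝ)) ^ 2 := by
  rw [(expSum_plancherel T _ _ (stepKer_integrable δ) (stepKer_memLp δ)).2]
  set r : ℕ → ℝ := fun n => ({t ∈ T | ν t = n}.card : ℝ) with hr
  set ch : ℕ → ℝ → ℝ := fun n =>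
    Set.indicator (Set.Icc (Real.log n) (Real.log n + δ)) (fun _ => (1 : ℝ)) with hch
  have h_int : ∀ n, Integrable (ch n) := fun n => by
    refine (integrable_indicator_iff measurableSet_Icc).2 ?_
    exact integrableOn_const (by simp) (by simp)
  have hc : ∀ θ, (winCount T (fun t => Real.log (ν t)) δ θ : ℝ) = ∑ n ∈ T.image ν, r n * ch n θ := by
    intro θ
    rw [winCount_eq_indicator]
    rw [← Finset.sum_fiberwise_of_maps_to (g := ν) (t := T.image ν)
      (fun t ht => Finset.mem_image_of_mem _ ht)]
    refine Finset.sum_congr rfl fun n _ => ?_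
    rw [Finset.sum_congr rfl (g := fun _ => ch n θ)]
    · rw [Finset.sum_const, nsmul_eq_mul]
    · intro t ht
      rw [← (Finset.mem_filter.1 ht).2]
  have hchv : ∀ n θ, ch n θ * ch n θ = ch n θ := by
    intro n θ
    simp only [hch, Set.indicator_apply]
    split_ifs <;> simp
  have hW : ∀ θ, ∑ n ∈ T.image ν, ch n θ ≤ 1 + X * δ := by
    intro θ
    simp only [hch, Set.indicator_apply]
    rw [← Finset.sum_filter, Finset.sum_const, nsmul_eq_mul, mul_one]
    refine card_le_of_diff_le _ _ (by positivity) ?_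
    intro n hn m hm
    simp only [Finset.mem_filter, Finset.mem_image, Set.mem_Icc] at hn hm
    obtain ⟨⟨t, ht, rfl⟩, hn1, hn2⟩ := hn
    obtain ⟨⟨s, hs, rfl⟩, hm1, hm2⟩ := hm
    have p1 : (0 : ℝ) < ν t := by exact_mod_cast (hν t ht).1
    have p2 : (0 : ℝ) < ν s := by exact_mod_cast (hν s hs).1
    have h1 : Real.log (ν t) - δ ≤ Real.log (ν s) := by linarith
    have h2 : (ν t : ℝ) * Real.exp (-δ) ≤ ν s := by
      have := Real.exp_le_exp.2 h1
      rwa [sub_eq_add_neg, Real.exp_add, Real.exp_log p1, Real.exp_log p2] at this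
    have h3 : 1 - δ ≤ Real.exp (-δ) := by linarith [Real.add_one_le_exp (-δ)]
    nlinarith [(hν t ht).2]
  have hpt : ∀ θ, ‖∑ t ∈ T, stepKer δ (θ - Real.log (ν t))‖ ^ 2 ≤
      (1 / δ ^ 2 * (1 + X * δ)) * ∑ n ∈ T.image ν, r n ^ 2 * ch n θ := by
    intro θ
    rw [sum_stepKer_eq T (fun t => Real.log (ν t)) δ θ, Complex.norm_real, Real.norm_eq_abs, sq_abs, div_pow]
    rw [hc]
    have cs := Finset.sum_mul_sq_le_sq_mul_sq (T.image ν) (fun n => r n * ch n θ) (fun n => ch n θ)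
    have e1 : ∑ n ∈ T.image ν, r n * ch n θ * ch n θ = ∑ n ∈ T.image ν, r n * ch n θ :=
      Finset.sum_congr rfl fun n _ => by rw [mul_assoc, hchv]
    have e2 : ∑ n ∈ T.image ν, (r n * ch n θ) ^ 2 = ∑ n ∈ T.image ν, r n ^ 2 * ch n θ :=
      Finset.sum_congr rfl fun n _ => by rw [mul_pow, sq (ch n θ), hchv]
    have e3 : ∑ n ∈ T.image ν, (ch n θ) ^ 2 = ∑ n ∈ T.image ν, ch n θ :=
      Finset.sum_congr rfl fun n _ => by rw [sq, hchv]
    rw [e1, e2, e3] at cs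
    have h0 : 0 ≤ ∑ n ∈ T.image ν, r n ^ 2 * ch n θ := Finset.sum_nonneg fun n _ =>
      mul_nonneg (sq_nonneg _) (Set.indicator_nonneg (fun _ _ => zero_le_one) _)
    have := cs.trans (mul_le_mul_of_nonneg_left (hW θ) h0)
    rw [div_eq_mul_one_div]
    calc _ ≤ ((∑ n ∈ T.image ν, r n ^ 2 * ch n θ) * (1 + X * δ)) * (1 / δ ^ 2) := by gcongr
      _ = _ := by ring
  have hi2 : Integrable (fun θ => (1 / δ ^ 2 * (1 + X * δ)) * ∑ n ∈ T.image ν, r n ^ 2 * ch n θ) :=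
    (integrable_finsetSum _ fun n _ => (h_int n).const_mul _).const_mul _
  refine (integral_mono_of_nonneg (Filter.Eventually.of_forall fun _ => by positivity) hi2
    (Filter.Eventually.of_forall hpt)).trans ?_
  rw [integral_const_mul, integral_finsetSum _ fun n _ => (h_int n).const_mul _]
  simp only [integral_const_mul, hch, integral_indicator_Icc_one _ _ hδ.le]
  rw [← Finset.sum_mul]
  apply le_of_eq
  field_simp
  rfl

end Kernel

section DivisorMoments

theorem card_divisors_mul_le (m n : ℕ) :
    (m * n).divisors.card ≤ m.divisors.card * n.divisors.card := by
  classical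
  rw [Nat.divisors_mul]
  exact Finset.card_mul_le

theorem sum_inv_Icc_le (X : ℕ) :
    ∑ n ∈ Finset.Icc 1 X, (1 : ℝ) / n ≤ 1 + Real.log X := by
  have h := harmonic_le_one_add_log X
  rw [harmonic_eq_sum_Icc] at h
  push_cast at h
  simpa [one_div] using h

theorem sum_card_divisors_pow_div_le (k X : ℕ) :
    ∑ n ∈ Finset.Icc 1 X, ((n.divisors.card : ℝ) ^ k) / n ≤ (1 + Real.log X) ^ (2 ^ k) := by
  induction k with
  | zero => simpa using sum_inv_Icc_le X
  | succ k ih =>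
    have key : ∑ n ∈ Finset.Icc 1 X, ((n.divisors.card : ℝ) ^ (k + 1)) / n ≤
        (∑ n ∈ Finset.Icc 1 X, ((n.divisors.card : ℝ) ^ k) / n) ^ 2 := by
      have e : ∀ n ∈ Finset.Icc 1 X, ((n.divisors.card : ℝ) ^ (k + 1)) / n ≤
          ∑ p ∈ (Finset.Icc 1 X ×ˢ Finset.Icc 1 X) with p.1 * p.2 = n,
            ((p.1.divisors.card : ℝ) ^ k / p.1) * ((p.2.divisors.card : ℝ) ^ k / p.2) := by
        intro n hn
        have hn' := Finset.mem_Icc.1 hn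
        have e1 : {p ∈ Finset.Icc 1 X ×ˢ Finset.Icc 1 X | p.1 * p.2 = n} = n.divisorsAntidiagonal := by
          ext p
          simp only [Finset.mem_filter, Finset.mem_product, Finset.mem_Icc,
            Nat.mem_divisorsAntidiagonal]
          constructor
          · rintro ⟨_, h⟩; exact ⟨h, by omega⟩
          · rintro ⟨h, h0⟩
            have h1 : 0 < p.1 := Nat.pos_of_ne_zero fun h' => by simp [h'] at h; omega
            have h2 : 0 < p.2 := Nat.pos_of_ne_zero fun h' => by simp [h'] at h; omega
            have h3 : p.1 ≤ p.1 * p.2 := Nat.le_mul_of_pos_right _ h2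
            have h4 : p.2 ≤ p.1 * p.2 := Nat.le_mul_of_pos_left _ h1
            exact ⟨⟨⟨h1, by omega⟩, ⟨h2, by omega⟩⟩, h⟩
        rw [e1]
        have e2 : ((n.divisors.card : ℝ) ^ (k + 1)) / n =
            ∑ p ∈ n.divisorsAntidiagonal, ((n.divisors.card : ℝ) ^ k) / n := by
          rw [Finset.sum_const, ← Nat.map_div_right_divisors, Finset.card_map, nsmul_eq_mul]
          ring
        rw [e2]
        refine Finset.sum_le_sum fun p hp => ?_
        obtain ⟨h, h0⟩ := Nat.mem_divisorsAntidiagonal.1 hp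
        rw [div_mul_div_comm, ← mul_pow, ← Nat.cast_mul, ← Nat.cast_mul, h]
        have := card_divisors_mul_le p.1 p.2
        rw [h] at this
        gcongr
      refine (Finset.sum_le_sum e).trans ?_
      rw [sq, Finset.sum_mul_sum, ← Finset.sum_product']
      rw [← Finset.sum_biUnion]
      · refine Finset.sum_le_sum_of_subset_of_nonneg ?_ fun _ _ _ => by positivity
        intro p hp
        simp only [Finset.mem_biUnion, Finset.mem_filter] at hp
        obtain ⟨_, _, h, _⟩ := hp
        exact h
      · intro a _ b _ hab
        rw [Function.onFun, Finset.disjoint_left]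
        intro p hp hq
        exact hab ((Finset.mem_filter.1 hp).2.symm.trans (Finset.mem_filter.1 hq).2)
    refine key.trans ?_
    rw [pow_succ 2 k, pow_mul]
    have : 0 ≤ ∑ n ∈ Finset.Icc 1 X, ((n.divisors.card : ℝ) ^ k) / n :=
      Finset.sum_nonneg fun _ _ => by positivity
    gcongr

theorem sum_card_divisors_pow_six_le (X : ℝ) (hX : 1 ≤ X) :
    ∑ n ∈ Finset.Icc 1 ⌊X⌋₊, ((n.divisors.card : ℝ) ^ 6) ≤ X * (1 + Real.log X) ^ 64 := by
  have h1 : 1 ≤ ⌊X⌋₊ := Nat.le_floor (by exact_mod_cast hX)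
  have hfl : (⌊X⌋₊ : ℝ) ≤ X := Nat.floor_le (by linarith)
  have h := sum_card_divisors_pow_div_le 6 ⌊X⌋₊
  have h2 : ∑ n ∈ Finset.Icc 1 ⌊X⌋₊, ((n.divisors.card : ℝ) ^ 6) ≤
      X * ∑ n ∈ Finset.Icc 1 ⌊X⌋₊, ((n.divisors.card : ℝ) ^ 6) / n := by
    rw [Finset.mul_sum]
    refine Finset.sum_le_sum fun n hn => ?_
    have hn' := Finset.mem_Icc.1 hn
    have p1 : (0 : ℝ) < n := by exact_mod_cast hn'.1
    have p2 : (n : ℝ) ≤ X := le_trans (by exact_mod_cast hn'.2) hfl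
    rw [mul_div_assoc', le_div_iff₀ p1, mul_comm]
    gcongr
  have h3 : Real.log ⌊X⌋₊ ≤ Real.log X := Real.log_le_log (by exact_mod_cast h1) hfl
  have h4 : 0 ≤ Real.log ⌊X⌋₊ := Real.log_natCast_nonneg _
  refine h2.trans ?_
  norm_num at h
  calc _ ≤ X * (1 + Real.log ⌊X⌋₊) ^ 64 := by gcongr
    _ ≤ _ := by gcongr

/-- Number of representations as a product of four factors is at most `d(n)^3`. -/
theorem card_four_factor_le (A B C D : Finset ℕ) (n : ℕ) (hn : n ≠ 0) :
    {t ∈ A ×ˢ B ×ˢ C ×ˢ D | t.1 * t.2.1 * t.2.2.1 * t.2.2.2 = n}.card ≤ n.divisors.card ^ 3 := by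
  have : n.divisors.card ^ 3 = (n.divisors ×ˢ n.divisors ×ˢ n.divisors).card := by
    simp only [Finset.card_product]; ring
  rw [this]
  refine Finset.card_le_card_of_injOn (fun t => (t.1, t.2.1, t.2.2.1)) ?_ ?_
  · intro t ht
    have h := (Finset.mem_filter.1 ht).2
    simp only [Finset.coe_product, Set.mem_prod, Finset.mem_coe, Nat.mem_divisors]
    refine ⟨⟨⟨t.2.1 * t.2.2.1 * t.2.2.2, ?_⟩, hn⟩, ⟨⟨t.1 * t.2.2.1 * t.2.2.2, ?_⟩, hn⟩,
      ⟨t.1 * t.2.1 * t.2.2.2, ?_⟩, hn⟩ <;> rw [← h] <;> ring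
  · intro t ht s hs hts
    have h1 := (Finset.mem_filter.1 ht).2
    have h2 := (Finset.mem_filter.1 hs).2
    simp only [Prod.mk.injEq] at hts
    obtain ⟨e1, e2, e3⟩ := hts
    have h3 : t.1 * t.2.1 * t.2.2.1 ≠ 0 := fun h0 => hn (by rw [← h1, h0, zero_mul])
    have e4 : t.2.2.2 = s.2.2.2 := by
      rw [← e1, ← e2, ← e3, ← h1] at h2
      exact (Nat.eq_of_mul_eq_mul_left (Nat.pos_of_ne_zero h3) h2).symm
    exact Prod.ext e1 (Prod.ext e2 (Prod.ext e3 e4))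

theorem expSum_product {ι κ : Type*} (S : Finset ι) (T : Finset κ) (l : ι → ℝ) (m : κ → ℝ) (ξ : ℝ) :
    expSum (S ×ˢ T) (fun p => l p.1 + m p.2) ξ = expSum S l ξ * expSum T m ξ := by
  simp only [expSum]
  rw [Finset.sum_mul_sum, ← Finset.sum_product']
  refine Finset.sum_congr rfl fun p _ => ?_
  rw [← Complex.exp_add]
  congr 1
  push_cast; ring

theorem expSum_congr {ι : Type*} (S : Finset ι) (l m : ι → ℝ) (ξ : ℝ) (h : ∀ t ∈ S, l t = m t) :
    expSum S l ξ = expSum S m ξ :=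
  Finset.sum_congr rfl fun t ht => by rw [h t ht]

/-- The Dirichlet polynomial `∑ n^{-2πiξ}` over a finite set of naturals. -/
noncomputable def dirPoly (S : Finset ℕ) (ξ : ℝ) : ℂ := expSum S (fun n => Real.log n) ξ

theorem expSum_four (A B C D : Finset ℕ) (hA : ∀ n ∈ A, 1 ≤ n) (hB : ∀ n ∈ B, 1 ≤ n)
    (hC : ∀ n ∈ C, 1 ≤ n) (hD : ∀ n ∈ D, 1 ≤ n) (ξ : ℝ) :
    expSum (A ×ˢ B ×ˢ C ×ˢ D)
      (fun t => Real.log ((t.1 * t.2.1 * t.2.2.1 * t.2.2.2 : ℕ) : ℝ)) ξ =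
    dirPoly A ξ * dirPoly B ξ * dirPoly C ξ * dirPoly D ξ := by
  rw [dirPoly, dirPoly, dirPoly, dirPoly, mul_assoc, mul_assoc, ← expSum_product, ← expSum_product,
    ← expSum_product]
  refine expSum_congr _ _ _ _ fun t ht => ?_
  simp only [Finset.mem_product] at ht
  have e : ∀ n : ℕ, 1 ≤ n → (n : ℝ) ≠ 0 := fun n hn => by positivity
  have h1 := e _ (hA _ ht.1)
  have h2 := e _ (hB _ ht.2.1)
  have h3 := e _ (hC _ ht.2.2.1)
  have h4 := e _ (hD _ ht.2.2.2)
  push_cast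
  rw [Real.log_mul (by positivity) h4, Real.log_mul (by positivity) h3, Real.log_mul h1 h2]
  ring

theorem dirPoly_four_mean_value (A B C D : Finset ℕ) (hA : ∀ n ∈ A, 1 ≤ n) (hB : ∀ n ∈ B, 1 ≤ n)
    (hC : ∀ n ∈ C, 1 ≤ n) (hD : ∀ n ∈ D, 1 ≤ n) (X δ : ℝ) (hδ : 0 < δ) (hX1 : 1 ≤ X)
    (hX : ∀ a ∈ A, ∀ b ∈ B, ∀ c ∈ C, ∀ d ∈ D, (a : ℝ) * b * c * d ≤ X) :
    ∫ ξ, ‖dirPoly A ξ * dirPoly B ξ * dirPoly C ξ * dirPoly D ξ‖ ^ 2 *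
      ‖FourierTransform.fourier (stepKer δ) ξ‖ ^ 2 ≤ (1 / δ + X) * (X * (1 + Real.log X) ^ 64) := by
  have hmem : ∀ t ∈ A ×ˢ B ×ˢ C ×ˢ D, 1 ≤ t.1 * t.2.1 * t.2.2.1 * t.2.2.2 ∧
      ((t.1 * t.2.1 * t.2.2.1 * t.2.2.2 : ℕ) : ℝ) ≤ X := by
    intro t ht
    simp only [Finset.mem_product] at ht
    refine ⟨?_, ?_⟩
    · have h1 := hA _ ht.1
      have h2 := hB _ ht.2.1
      have h3 := hC _ ht.2.2.1
      have h4 := hD _ ht.2.2.2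
      exact Nat.succ_le_of_lt (by positivity)
    · push_cast
      exact hX _ ht.1 _ ht.2.1 _ ht.2.2.1 _ ht.2.2.2
  have := expSum_log_mean_value (A ×ˢ B ×ˢ C ×ˢ D)
    (fun t => t.1 * t.2.1 * t.2.2.1 * t.2.2.2) X δ hδ (by linarith) hmem
  simp only [expSum_four A B C D hA hB hC hD] at this
  refine this.trans ?_
  gcongr
  refine le_trans ?_ (sum_card_divisors_pow_six_le X hX1)
  refine le_trans (Finset.sum_le_sum (g := fun n => (n.divisors.card : ℝ) ^ 6) ?_) ?_
  · intro n hn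
    obtain ⟨t, ht, rfl⟩ := Finset.mem_image.1 hn
    have h := card_four_factor_le A B C D (t.1 * t.2.1 * t.2.2.1 * t.2.2.2)
      (by have := (hmem t ht).1; omega)
    have h2 : ((({s ∈ A ×ˢ B ×ˢ C ×ˢ D | s.1 * s.2.1 * s.2.2.1 * s.2.2.2 =
      t.1 * t.2.1 * t.2.2.1 * t.2.2.2}.card : ℕ) : ℝ)) ≤
      ((t.1 * t.2.1 * t.2.2.1 * t.2.2.2).divisors.card : ℝ) ^ 3 := by exact_mod_cast h
    calc _ ≤ (((t.1 * t.2.1 * t.2.2.1 * t.2.2.2).divisors.card : ℝ) ^ 3) ^ 2 := by gcongr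
      _ = _ := by ring
  · refine Finset.sum_le_sum_of_subset_of_nonneg ?_ fun _ _ _ => by positivity
    intro n hn
    obtain ⟨t, ht, rfl⟩ := Finset.mem_image.1 hn
    exact Finset.mem_Icc.2 ⟨(hmem t ht).1, Nat.le_floor (hmem t ht).2⟩

end DivisorMoments

section LargeValues
open FourierTransform

theorem card_prime_tuples_le (P : Finset ℕ) (hP : ∀ p ∈ P, p.Prime) (l n : ℕ) :
    {t ∈ Fintype.piFinset (fun _ : Fin l => P) | ∏ i, t i = n}.card ≤ l.factorial := by
  classical
  by_cases hlen : n.primeFactorsList.length = l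
  · have h1 : {t ∈ Fintype.piFinset (fun _ : Fin l => P) | ∏ i, t i = n}.card ≤
        (n.primeFactorsList.permutations.toFinset).card := by
      refine Finset.card_le_card_of_injOn (fun t => List.ofFn t) ?_ ?_
      · intro t ht
        obtain ⟨h, hn⟩ := Finset.mem_filter.1 ht
        rw [Fintype.mem_piFinset] at h
        simp only [List.coe_toFinset, Set.mem_ofPred_eq, List.mem_permutations]
        refine Nat.primeFactorsList_unique (by rw [List.prod_ofFn, hn]) ?_
        intro p hp
        obtain ⟨i, rfl⟩ := (List.mem_ofFn' _ _).1 hp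
        exact hP _ (h i)
      · exact fun t _ s _ h => List.ofFn_injective h
    refine h1.trans ((List.toFinset_card_le _).trans ?_)
    rw [List.length_permutations, hlen]
  · rw [Finset.card_eq_zero.2]
    · exact Nat.zero_le _
    · rw [Finset.filter_eq_empty_iff]
      intro t ht hn
      rw [Fintype.mem_piFinset] at ht
      refine hlen ?_
      have : List.Perm (List.ofFn t) n.primeFactorsList := by
        refine Nat.primeFactorsList_unique (by rw [List.prod_ofFn, hn]) ?_
        intro p hp
        obtain ⟨i, rfl⟩ := (List.mem_ofFn' _ _).1 hp
        exact hP _ (ht i)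
      rw [← this.length_eq, List.length_ofFn]

theorem expSum_tuples (P : Finset ℕ) (hP : ∀ p ∈ P, 1 ≤ p) (l : ℕ) (ξ : ℝ) :
    expSum (Fintype.piFinset (fun _ : Fin l => P)) (fun t => Real.log ((∏ i, t i : ℕ) : ℝ)) ξ =
      dirPoly P ξ ^ l := by
  rw [dirPoly, expSum]
  have h := Finset.prod_univ_sum (fun _ : Fin l => P)
    (fun _ p => Complex.exp (((-2 * Real.pi * Real.log (p : ℝ) * ξ : ℝ) : ℂ) * Complex.I))
  rw [Finset.prod_const, Finset.card_univ, Fintype.card_fin] at h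
  rw [expSum, h]
  refine Finset.sum_congr rfl fun t ht => ?_
  rw [Fintype.mem_piFinset] at ht
  rw [← Complex.exp_sum]
  congr 1
  push_cast
  rw [← Finset.sum_mul]
  congr 1
  have : Real.log (∏ i, (t i : ℝ)) = ∑ i, Real.log (t i) :=
    Real.log_prod fun i _ => by have := hP _ (ht i); positivity
  rw [this]
  push_cast
  rw [Finset.mul_sum, Finset.sum_mul]

theorem dirPoly_continuous (P : Finset ℕ) : Continuous (dirPoly P) := by
  unfold dirPoly expSum
  fun_prop

theorem prime_large_values (P : Finset ℕ) (hP : ∀ p ∈ P, p.Prime) (W : ℝ) (hW : 0 < W)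
    (hPW : ∀ p ∈ P, (p : ℝ) ≤ W) (l : ℕ) (T lam : ℝ) (hT : 0 < T) (hlam : 0 < lam) :
    lam ^ (2 * l) * volume.real {ξ : ℝ | |ξ| ≤ T ∧ lam ≤ ‖dirPoly P ξ‖} ≤
      4 * (4 * Real.pi * T + W ^ l) * (l.factorial * (P.card : ℝ) ^ l) := by
  have hpi := Real.pi_pos
  set w : ℝ := 1 / (4 * Real.pi * T) with hw
  have hwpos : 0 < w := by positivity
  have hP1 : ∀ p ∈ P, 1 ≤ p := fun p hp => (hP p hp).one_lt.le
  set TT := Fintype.piFinset (fun _ : Fin l => P)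
  have hmem : ∀ t ∈ TT, 1 ≤ ∏ i, t i ∧ ((∏ i, t i : ℕ) : ℝ) ≤ W ^ l := by
    intro t ht
    rw [Fintype.mem_piFinset] at ht
    refine ⟨Finset.one_le_prod' fun i _ => hP1 _ (ht i), ?_⟩
    push_cast
    refine (Finset.prod_le_prod (fun i _ => by positivity) fun i _ => hPW _ (ht i)).trans ?_
    simp
  have hmv := expSum_log_mean_value TT (fun t => ∏ i, t i) (W ^ l) w hwpos (by positivity) hmem
  have hi := (expSum_plancherel TT (fun t => Real.log ((∏ i, t i : ℕ) : ℝ)) _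
    (stepKer_integrable w) (stepKer_memLp w)).1
  simp only [TT, expSum_tuples P hP1] at hmv hi
  have hmar := mul_meas_ge_le_integral_of_nonneg (μ := volume)
    (Filter.Eventually.of_forall fun ξ => by positivity) hi (lam ^ (2 * l) / 4)
  have hsub : volume.real {ξ : ℝ | |ξ| ≤ T ∧ lam ≤ ‖dirPoly P ξ‖} ≤
      volume.real {ξ | lam ^ (2 * l) / 4 ≤ ‖dirPoly P ξ ^ l‖ ^ 2 * ‖𝓕 (stepKer w) ξ‖ ^ 2} := by
    refine measureReal_mono ?_ ?_
    · rintro ξ ⟨h1, h2⟩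
      have h3 := stepKer_fourier_sub_one_le w ξ hwpos
      have h4 : 2 * Real.pi * |ξ| * w ≤ 1 / 2 := by
        calc _ ≤ 2 * Real.pi * T * w := by gcongr
          _ = 1 / 2 := by rw [hw]; field_simp; norm_num
      have h5 : 1 / 2 ≤ ‖𝓕 (stepKer w) ξ‖ := by
        have := norm_sub_norm_le (1 : ℂ) (1 - 𝓕 (stepKer w) ξ)
        rw [norm_sub_rev 1, sub_sub_cancel, norm_one] at this
        linarith
      have h6 : lam ^ (2 * l) ≤ ‖dirPoly P ξ ^ l‖ ^ 2 := by
        rw [norm_pow, ← pow_mul, mul_comm l 2]; gcongr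
      have h7 : (1 / 4 : ℝ) ≤ ‖𝓕 (stepKer w) ξ‖ ^ 2 := by nlinarith
      simp only [Set.mem_ofPred_eq]
      calc lam ^ (2 * l) / 4 = lam ^ (2 * l) * (1 / 4) := by ring
        _ ≤ _ := by gcongr
    · exact (hi.measure_ge_lt_top (by positivity)).ne
  have hr : ∑ n ∈ TT.image (fun t => ∏ i, t i), (({t ∈ TT | ∏ i, t i = n}.card : ℝ)) ^ 2 ≤
      l.factorial * (P.card : ℝ) ^ l := by
    have e : (P.card : ℝ) ^ l = ∑ n ∈ TT.image (fun t => ∏ i, t i), ({t ∈ TT | ∏ i, t i = n}.card : ℝ) := by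
      have := Finset.card_eq_sum_card_image (fun t : Fin l → ℕ => ∏ i, t i) TT
      have h2 : TT.card = P.card ^ l := by simp [TT]
      rw [h2] at this
      exact_mod_cast this
    rw [e, Finset.mul_sum]
    refine Finset.sum_le_sum fun n _ => ?_
    rw [sq]
    have := card_prime_tuples_le P hP l n
    gcongr
  have h8 : (1 / w + W ^ l) = 4 * Real.pi * T + W ^ l := by rw [hw, one_div_one_div]
  rw [h8] at hmv
  have h9 : lam ^ (2 * l) / 4 * volume.real {ξ : ℝ | |ξ| ≤ T ∧ lam ≤ ‖dirPoly P ξ‖} ≤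
      (4 * Real.pi * T + W ^ l) * (l.factorial * (P.card : ℝ) ^ l) := by
    calc _ ≤ lam ^ (2 * l) / 4 * volume.real {ξ | lam ^ (2 * l) / 4 ≤ ‖dirPoly P ξ ^ l‖ ^ 2 * ‖𝓕 (stepKer w) ξ‖ ^ 2} := by gcongr
      _ ≤ _ := hmar.trans (hmv.trans (by gcongr))
  linarith

end LargeValues

section VanDerCorput

/-- The additive character `e(x) = exp(2πix)`. -/
noncomputable def ee (x : ℝ) : ℂ := Complex.exp (((2 * Real.pi * x : ℝ) : ℂ) * Complex.I)

theorem norm_ee (x : ℝ) : ‖ee x‖ = 1 := Complex.norm_exp_ofReal_mul_I _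

theorem ee_add (x y : ℝ) : ee (x + y) = ee x * ee y := by
  rw [ee, ee, ee, ← Complex.exp_add]; congr 1; push_cast; ring

theorem conj_ee (x : ℝ) : (starRingEnd ℂ) (ee x) = ee (-x) := by
  rw [ee, ee, ← Complex.exp_conj, map_mul, Complex.conj_ofReal, Complex.conj_I]
  congr 1; push_cast; ring

theorem four_mul_le_norm_ee_sub_one (d : ℝ) (h0 : 0 ≤ d) (h1 : d ≤ 1 / 2) : 4 * d ≤ ‖ee d - 1‖ := by
  have h := Complex.norm_exp_I_mul_ofReal_sub_one (x := 2 * Real.pi * d)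
  rw [mul_comm] at h
  rw [ee, h]
  have hpi := Real.pi_pos
  have h2 : 2 * Real.pi * d / 2 = Real.pi * d := by ring
  have h3 := Real.mul_le_sin (x := Real.pi * d) (by positivity) (by nlinarith)
  have h4 : 2 / Real.pi * (Real.pi * d) = 2 * d := by field_simp
  rw [h2, Real.norm_eq_abs, abs_of_nonneg (by linarith)]
  linarith

theorem norm_ee_sub_ee_le (a b : ℝ) : ‖ee a - ee b‖ ≤ 2 * Real.pi * |a - b| := by
  have e : ee a - ee b = ee b * (ee (a - b) - 1) := by
    rw [mul_sub, ← ee_add]; congr 2 <;> ring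
  have h := Real.norm_exp_I_mul_ofReal_sub_one_le (x := 2 * Real.pi * (a - b))
  rw [mul_comm] at h
  rw [e, norm_mul, norm_ee, one_mul, ee]
  refine h.trans (le_of_eq ?_)
  rw [Real.norm_eq_abs, abs_mul, abs_of_pos (by positivity)]

/-- Kusmin–Landau inequality. -/
theorem kusmin_landau (f : ℕ → ℝ) (a : ℝ) (ha : 0 < a) (L : ℕ)
    (h1 : ∀ n < L, a ≤ f (n + 1) - f n ∧ f (n + 1) - f n ≤ 1 / 2)
    (h2 : ∀ n, n + 1 < L → f (n + 2) - f (n + 1) ≤ f (n + 1) - f n) :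
    ‖∑ n ∈ Finset.range L, ee (f n)‖ ≤ 1 / a := by
  rcases L with _ | M
  · simpa using ha.le
  set d : ℕ → ℝ := fun n => f (n + 1) - f n with hd
  set u : ℕ → ℂ := fun n => 1 / (ee (d n) - 1) with hu
  have hdpos : ∀ n < M + 1, 0 < d n := fun n hn => ha.trans_le (h1 n hn).1
  have hlow : ∀ n < M + 1, 4 * d n ≤ ‖ee (d n) - 1‖ := fun n hn =>
    four_mul_le_norm_ee_sub_one _ (hdpos n hn).le (h1 n hn).2
  have hne : ∀ n < M + 1, ee (d n) - 1 ≠ 0 := fun n hn h => by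
    have := hlow n hn; rw [h, norm_zero] at this; linarith [hdpos n hn]
  have hunorm : ∀ n < M + 1, ‖u n‖ ≤ 1 / (4 * d n) := fun n hn => by
    have := hdpos n hn
    rw [hu, norm_div, norm_one]
    exact one_div_le_one_div_of_le (by positivity) (hlow n hn)
  have hrel : ∀ n < M + 1, ee (f n) - ee (f (n + 1)) * u n = -(ee (f n) * u n) := fun n hn => by
    have e1 : ee (f (n + 1)) = ee (f n) * ee (d n) := by rw [← ee_add]; congr 1; simp [hd]
    have := hne n hn
    rw [e1, hu]; field_simp; ring
  have claim : ∀ m < M + 1, ‖∑ n ∈ Finset.range (m + 1), ee (f n) - ee (f (m + 1)) * u m‖ ≤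
      1 / (4 * d 0) + Real.pi / 8 * (1 / d m - 1 / d 0) := by
    intro m
    induction m with
    | zero =>
      intro hm
      simp only [zero_add, Finset.sum_range_one, sub_self, mul_zero, add_zero]
      have := hrel 0 hm
      rw [zero_add] at this
      rw [this, norm_neg, norm_mul, norm_ee, one_mul]
      exact hunorm 0 hm
    | succ m ih =>
      intro hm
      have hm' : m < M + 1 := by omega
      have e : ∑ n ∈ Finset.range (m + 1 + 1), ee (f n) - ee (f (m + 1 + 1)) * u (m + 1) =
          (∑ n ∈ Finset.range (m + 1), ee (f n) - ee (f (m + 1)) * u m) +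
            ee (f (m + 1)) * (u m - u (m + 1)) := by
        rw [Finset.sum_range_succ, add_sub_assoc, hrel (m + 1) hm]; ring
      rw [e]
      refine (norm_add_le _ _).trans ?_
      rw [norm_mul, norm_ee, one_mul]
      have hdd : d (m + 1) ≤ d m := h2 m hm
      have p0 := hdpos m hm'
      have p1 := hdpos (m + 1) hm
      have e2 : u m - u (m + 1) = (ee (d (m + 1)) - ee (d m)) /
          ((ee (d m) - 1) * (ee (d (m + 1)) - 1)) := by
        have := hne m hm'
        have := hne (m + 1) hm
        rw [hu]; field_simp; ring
      have h3 : ‖u m - u (m + 1)‖ ≤ Real.pi / 8 * (1 / d (m + 1) - 1 / d m) := by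
        rw [e2, norm_div, norm_mul]
        have n1 := norm_ee_sub_ee_le (d (m + 1)) (d m)
        rw [abs_sub_comm, abs_of_nonneg (by linarith)] at n1
        calc _ ≤ (2 * Real.pi * (d m - d (m + 1))) / ((4 * d m) * (4 * d (m + 1))) := by
              have := hlow m hm'
              have := hlow (m + 1) hm
              gcongr
          _ = _ := by field_simp; ring
      have := ih hm'
      linarith
  have hc := claim M (by omega)
  have hM := hunorm M (by omega)
  have pM := hdpos M (by omega)
  have p0 := hdpos 0 (by omega)
  have hs : ‖∑ n ∈ Finset.range (M + 1), ee (f n)‖ ≤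
      ‖∑ n ∈ Finset.range (M + 1), ee (f n) - ee (f (M + 1)) * u M‖ + ‖ee (f (M + 1)) * u M‖ := by
    have := norm_add_le (∑ n ∈ Finset.range (M + 1), ee (f n) - ee (f (M + 1)) * u M)
      (ee (f (M + 1)) * u M)
    simpa using this
  rw [norm_mul, norm_ee, one_mul] at hs
  have hpi : Real.pi ≤ 4 := Real.pi_le_four
  have hpi3 := Real.pi_gt_three
  have i0 : 0 < 1 / d 0 := by positivity
  have iM : 0 < 1 / d M := by positivity
  have e1 : 1 / (4 * d 0) = 1 / d 0 / 4 := by field_simp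
  have e2 : 1 / (4 * d M) = 1 / d M / 4 := by field_simp
  rw [e1] at hc; rw [e2] at hM
  have : 1 / d M ≤ 1 / a := one_div_le_one_div_of_le ha (h1 M (by omega)).1
  nlinarith

/-- Weyl–van der Corput differencing. -/
theorem weyl_differencing (z : ℕ → ℂ) (hz : ∀ n, ‖z n‖ ≤ 1) (L H : ℕ) (hH : 1 ≤ H) (hHL : H ≤ L) :
    ‖∑ n ∈ Finset.range L, z n‖ ^ 2 ≤ 2 * L / H * (L + 2 * ∑ h ∈ Finset.Ico 1 H,
      ‖∑ n ∈ Finset.range (L - h), z (n + h) * (starRingEnd ℂ) (z n)‖) := by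
  set s : ℕ → ℝ := fun h => ‖∑ n ∈ Finset.range (L - h), z (n + h) * (starRingEnd ℂ) (z n)‖ with hs
  set y : ℕ → ℕ → ℂ := fun m h => if m ∈ Finset.Ico h (L + h) then z (m - h) else 0 with hy
  have hsub : ∀ h < H, Finset.Ico h (L + h) ⊆ Finset.range (L + H) := fun h hh m hm => by
    simp only [Finset.mem_Ico, Finset.mem_range] at *; omega
  have hsumy : ∀ h < H, ∑ m ∈ Finset.range (L + H), y m h = ∑ n ∈ Finset.range L, z n := by
    intro h hh
    rw [hy, ← Finset.sum_filter, Finset.filter_mem_eq_inter,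
      Finset.inter_eq_right.2 (hsub h hh), Finset.sum_Ico_eq_sum_range]
    simp
  have hcorr : ∀ h k, h ≤ k → k < H →
      ∑ m ∈ Finset.range (L + H), y m h * (starRingEnd ℂ) (y m k) =
      ∑ n ∈ Finset.range (L - (k - h)), z (n + (k - h)) * (starRingEnd ℂ) (z n) := by
    intro h k hhk hk
    have e : ∀ m, y m h * (starRingEnd ℂ) (y m k) =
        if m ∈ Finset.Ico k (L + h) then z (m - h) * (starRingEnd ℂ) (z (m - k)) else 0 := by
      intro m
      simp only [hy, Finset.mem_Ico]
      split_ifs <;> first | rfl | (exfalso; omega) | simp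
    simp only [e]
    rw [← Finset.sum_filter, Finset.filter_mem_eq_inter, Finset.inter_eq_right.2
      (fun m hm => by simp only [Finset.mem_Ico, Finset.mem_range] at *; omega),
      Finset.sum_Ico_eq_sum_range]
    rw [show L + h - k = L - (k - h) by omega]
    refine Finset.sum_congr rfl fun n _ => ?_
    congr 2
    · omega
    · congr 1; omega
  have hcorr' : ∀ h < H, ∀ k < H,
      ‖∑ m ∈ Finset.range (L + H), y m h * (starRingEnd ℂ) (y m k)‖ ≤ s (k - h + (h - k)) := by
    intro h hh k hk
    rcases le_total h k with hle | hle
    · rw [hcorr h k hle hk, show h - k = 0 by omega, add_zero]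
    · have : ∑ m ∈ Finset.range (L + H), y m h * (starRingEnd ℂ) (y m k) =
          (starRingEnd ℂ) (∑ m ∈ Finset.range (L + H), y m k * (starRingEnd ℂ) (y m h)) := by
        rw [map_sum]
        refine Finset.sum_congr rfl fun m _ => ?_
        rw [map_mul, Complex.conj_conj, mul_comm]
      rw [this, Complex.norm_conj, hcorr k h hle hh, show k - h = 0 by omega, zero_add]
  have hs0 : s 0 ≤ L := by
    refine (norm_sum_le _ _).trans ?_
    refine (Finset.sum_le_sum (g := fun _ => (1 : ℝ)) fun n _ => ?_).trans (by simp)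
    rw [norm_mul, Complex.norm_conj]
    have := hz (n + 0); have := hz n
    exact mul_le_one₀ (hz _) (norm_nonneg _) (hz _)
  have hspos : ∀ h, 0 ≤ s h := fun h => norm_nonneg _
  have hrow : ∀ h < H, ∑ k ∈ Finset.range H, s (k - h + (h - k)) ≤
      L + 2 * ∑ j ∈ Finset.Ico 1 H, s j := by
    intro h hh
    have e1 : Finset.range H = (Finset.range h ∪ {h}) ∪ Finset.Ico (h + 1) H := by
      ext k; simp only [Finset.mem_union, Finset.mem_range, Finset.mem_singleton, Finset.mem_Ico]; omega
    rw [e1, Finset.sum_union, Finset.sum_union]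
    · have a1 : ∑ k ∈ Finset.range h, s (k - h + (h - k)) ≤ ∑ j ∈ Finset.Ico 1 H, s j := by
        rw [← Finset.sum_image (f := s) (g := fun k => k - h + (h - k))]
        · refine Finset.sum_le_sum_of_subset_of_nonneg ?_ fun _ _ _ => hspos _
          intro j hj
          simp only [Finset.mem_image, Finset.mem_range, Finset.mem_Ico] at *
          obtain ⟨k, hk, rfl⟩ := hj; omega
        · intro a ha b hb hab
          simp only [Finset.coe_range, Set.mem_Iio] at *; omega
      have a2 : ∑ k ∈ Finset.Ico (h + 1) H, s (k - h + (h - k)) ≤ ∑ j ∈ Finset.Ico 1 H, s j := by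
        rw [← Finset.sum_image (f := s) (g := fun k => k - h + (h - k))]
        · refine Finset.sum_le_sum_of_subset_of_nonneg ?_ fun _ _ _ => hspos _
          intro j hj
          simp only [Finset.mem_image, Finset.mem_Ico] at *
          obtain ⟨k, hk, rfl⟩ := hj; omega
        · intro a ha b hb hab
          simp only [Finset.coe_Ico, Set.mem_Ico] at *; omega
      rw [Finset.sum_singleton, show h - h + (h - h) = 0 by omega]
      linarith
    · rw [Finset.disjoint_left]; intro k hk; simp only [Finset.mem_range, Finset.mem_singleton] at *; omega
    · rw [Finset.disjoint_left]; intro k hk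
      simp only [Finset.mem_union, Finset.mem_range, Finset.mem_singleton, Finset.mem_Ico] at *; omega
  set S := ∑ n ∈ Finset.range L, z n
  set R : ℝ := L + 2 * ∑ j ∈ Finset.Ico 1 H, s j
  have hHS : (H : ℂ) * S = ∑ m ∈ Finset.range (L + H), ∑ h ∈ Finset.range H, y m h := by
    rw [Finset.sum_comm, Finset.sum_congr rfl (fun h hh => hsumy h (Finset.mem_range.1 hh))]
    simp
  have hCS : ((H : ℝ) * ‖S‖) ^ 2 ≤ ((L + H : ℕ) : ℝ) *
      ∑ m ∈ Finset.range (L + H), ‖∑ h ∈ Finset.range H, y m h‖ ^ 2 := by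
    have e : (H : ℝ) * ‖S‖ = ‖(H : ℂ) * S‖ := by simp
    rw [e, hHS]
    have := sq_sum_le_card_mul_sum_sq (s := Finset.range (L + H))
      (f := fun m => ‖∑ h ∈ Finset.range H, y m h‖)
    rw [Finset.card_range] at this
    refine le_trans ?_ this
    gcongr
    exact norm_sum_le _ _
  have hexp : ∑ m ∈ Finset.range (L + H), ‖∑ h ∈ Finset.range H, y m h‖ ^ 2 ≤ H * R := by
    have e : ((∑ m ∈ Finset.range (L + H), ‖∑ h ∈ Finset.range H, y m h‖ ^ 2 : ℝ) : ℂ) =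
        ∑ h ∈ Finset.range H, ∑ k ∈ Finset.range H, ∑ m ∈ Finset.range (L + H),
          y m h * (starRingEnd ℂ) (y m k) := by
      push_cast
      rw [Finset.sum_congr rfl (g := fun m => ∑ h ∈ Finset.range H, ∑ k ∈ Finset.range H,
        y m h * (starRingEnd ℂ) (y m k))]
      · rw [Finset.sum_comm]
        refine Finset.sum_congr rfl fun h _ => ?_
        rw [Finset.sum_comm]
      · intro m _
        rw [← Complex.mul_conj', map_sum, Finset.sum_mul_sum]
    have h1 : ∑ m ∈ Finset.range (L + H), ‖∑ h ∈ Finset.range H, y m h‖ ^ 2 =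
        ‖((∑ m ∈ Finset.range (L + H), ‖∑ h ∈ Finset.range H, y m h‖ ^ 2 : ℝ) : ℂ)‖ := by
      rw [Complex.norm_real, Real.norm_of_nonneg (Finset.sum_nonneg fun _ _ => by positivity)]
    rw [h1, e]
    refine (norm_sum_le _ _).trans ?_
    refine (Finset.sum_le_sum (g := fun _ => R) fun h hh => ?_).trans (by simp)
    refine (norm_sum_le _ _).trans (le_trans ?_ (hrow h (Finset.mem_range.1 hh)))
    exact Finset.sum_le_sum fun k hk => hcorr' h (Finset.mem_range.1 hh) k (Finset.mem_range.1 hk)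
  have hR : 0 ≤ R := add_nonneg (by positivity) (mul_nonneg (by norm_num) (Finset.sum_nonneg fun _ _ => hspos _))
  have hHpos : (0 : ℝ) < H := by exact_mod_cast hH
  have hLH : ((L + H : ℕ) : ℝ) ≤ 2 * L := by exact_mod_cast (by omega : L + H ≤ 2 * L)
  have h5 : ((H : ℝ) * ‖S‖) ^ 2 ≤ 2 * L * (H * R) :=
    hCS.trans (mul_le_mul hLH hexp (Finset.sum_nonneg fun _ _ => by positivity) (by positivity))
  rw [div_mul_eq_mul_div, le_div_iff₀ hHpos]
  have : ‖S‖ ^ 2 * H * H ≤ 2 * L * R * H := by nlinarith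
  exact le_of_mul_le_mul_right this hHpos

/-- `f` has derivative `g 0`, with alternating-sign derivatives `g i' = -g (i+1)` for `i < q`, and
`g q` is antitone of size between `A / C` and `A` on `[0, L]`. -/
def VdC (q : ℕ) (A C : ℝ) (f : ℝ → ℝ) (L : ℕ) : Prop :=
  ∃ g : ℕ → ℝ → ℝ, (∀ x ∈ Set.Icc (0 : ℝ) L, HasDerivAt f (g 0 x) x) ∧
    (∀ i < q, ∀ x ∈ Set.Icc (0 : ℝ) L, HasDerivAt (g i) (-g (i + 1) x) x) ∧
    AntitoneOn (g q) (Set.Icc (0 : ℝ) L) ∧ ∀ x ∈ Set.Icc (0 : ℝ) L, A / C ≤ g q x ∧ g q x ≤ A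

theorem exists_eq_sub_of_hasDerivAt (f f' : ℝ → ℝ) (a h : ℝ) (hh : 0 < h)
    (hf : ∀ x ∈ Set.Icc a (a + h), HasDerivAt f (f' x) x) :
    ∃ ξ ∈ Set.Ioo a (a + h), f (a + h) - f a = h * f' ξ := by
  obtain ⟨c, hc, e⟩ := exists_hasDerivAt_eq_slope f f' (show a < a + h by linarith)
    (fun x hx => (hf x hx).continuousAt.continuousWithinAt)
    (fun x hx => hf x (Set.Ioo_subset_Icc_self hx))
  refine ⟨c, hc, ?_⟩
  rw [e, add_sub_cancel_left]; field_simp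

theorem VdC.diff {q : ℕ} {A C : ℝ} {f : ℝ → ℝ} {L : ℕ} (H : VdC (q + 1) A C f L) (h : ℕ)
    (h0 : 0 < h) (hL : h ≤ L) : VdC q (h * A) C (fun x => f x - f (x + h)) (L - h) := by
  obtain ⟨g, hf, hg, hanti, hb⟩ := H
  have hh : (0 : ℝ) < h := by exact_mod_cast h0
  have hin : ∀ x ∈ Set.Icc (0 : ℝ) ((L - h : ℕ) : ℝ), x ∈ Set.Icc (0 : ℝ) L ∧
      x + h ∈ Set.Icc (0 : ℝ) L := by
    intro x hx
    rw [Nat.cast_sub hL] at hx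
    exact ⟨⟨hx.1, by linarith [hx.2]⟩, ⟨by linarith [hx.1], by linarith [hx.2]⟩⟩
  have hG : ∀ i < q + 1, ∀ x ∈ Set.Icc (0 : ℝ) ((L - h : ℕ) : ℝ),
      HasDerivAt (fun x => g i x - g i (x + h)) (-(g (i + 1) x - g (i + 1) (x + h))) x := by
    intro i hi x hx
    have := (hg i hi x (hin x hx).1).sub ((hg i hi (x + h) (hin x hx).2).comp_add_const x h)
    exact this.congr_deriv (by ring)
  refine ⟨fun i x => g i x - g i (x + h), fun x hx => ?_, fun i hi => hG i (by omega), ?_, ?_⟩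
  · exact (hf x (hin x hx).1).sub ((hf (x + h) (hin x hx).2).comp_add_const x h)
  · refine antitoneOn_of_deriv_nonpos (convex_Icc _ _)
      (fun x hx => (hG q (by omega) x hx).continuousAt.continuousWithinAt)
      (fun x hx => (hG q (by omega) x (interior_subset hx)).differentiableAt.differentiableWithinAt)
      fun x hx => ?_
    have hx := interior_subset hx
    rw [(hG q (by omega) x hx).deriv]
    have := hanti (hin x hx).1 (hin x hx).2 (by linarith)
    linarith
  · intro x hx
    obtain ⟨ξ, hξ, e⟩ := exists_eq_sub_of_hasDerivAt (g q) (fun x => -g (q + 1) x) x h hh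
      (fun y hy => hg q (by omega) y ⟨(hin x hx).1.1.trans hy.1, hy.2.trans (hin x hx).2.2⟩)
    have := hb ξ ⟨(hin x hx).1.1.trans hξ.1.le, hξ.2.le.trans (hin x hx).2.2⟩
    have e2 : g q x - g q (x + h) = h * g (q + 1) ξ := by linarith
    simp only [e2]
    exact ⟨by rw [mul_div_assoc]; exact mul_le_mul_of_nonneg_left this.1 hh.le,
      mul_le_mul_of_nonneg_left this.2 hh.le⟩

theorem VdC.kusmin_landau {A C : ℝ} {f : ℝ → ℝ} {L : ℕ} (H : VdC 0 A C f L) (hA : 0 < A)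
    (hC : 0 < C) (hA2 : A ≤ 1 / 2) : ‖∑ n ∈ Finset.range L, ee (f n)‖ ≤ C / A := by
  obtain ⟨g, hf, -, hanti, hb⟩ := H
  have key : ∀ n < L, ∃ ξ ∈ Set.Ioo (n : ℝ) (n + 1), f ((n + 1 : ℕ) : ℝ) - f n = g 0 ξ ∧
      ξ ∈ Set.Icc (0 : ℝ) L := by
    intro n hn
    have hnL : (n : ℝ) + 1 ≤ L := by exact_mod_cast hn
    have hn0 : (0 : ℝ) ≤ n := n.cast_nonneg
    obtain ⟨ξ, hξ, e⟩ := exists_eq_sub_of_hasDerivAt f (g 0) n 1 one_pos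
      (fun y hy => hf y ⟨hn0.trans hy.1, hy.2.trans hnL⟩)
    exact ⟨ξ, hξ, by push_cast; linarith, hn0.trans hξ.1.le, hξ.2.le.trans hnL⟩
  have h := _root_.kusmin_landau (fun n => f n) (A / C) (by positivity) L
    (fun n hn => by
      obtain ⟨ξ, -, e, hξ⟩ := key n hn
      simp only [e]
      exact ⟨(hb ξ hξ).1, (hb ξ hξ).2.trans hA2⟩)
    (fun n hn => by
      obtain ⟨ξ, h1, e, hξ⟩ := key n (by omega)
      obtain ⟨ξ', h1', e', hξ'⟩ := key (n + 1) hn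
      simp only [e, show n + 2 = n + 1 + 1 from rfl, e']
      have := h1'.1
      push_cast at this
      exact hanti hξ hξ' (h1.2.le.trans this.le))
  rwa [one_div_div] at h

theorem sum_sqrt_div_le (H : ℕ) : ∑ h ∈ Finset.Ico 1 H, Real.sqrt (H / h) ≤ 2 * H := by
  have key : ∀ n : ℕ, ∑ h ∈ Finset.Ico 1 (n + 1), 1 / Real.sqrt h ≤ 2 * Real.sqrt n := by
    intro n
    induction n with
    | zero => simp
    | succ n ih =>
      rw [Finset.sum_Ico_succ_top (by omega)]
      refine (add_le_add_left ih _).trans ?_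
      push_cast
      have hn : (0 : ℝ) ≤ n := n.cast_nonneg
      have s1 := Real.sq_sqrt hn
      have s2 := Real.sq_sqrt (show (0 : ℝ) ≤ n + 1 by linarith)
      have p1 := Real.sqrt_nonneg (n : ℝ)
      have p2 := Real.sqrt_pos.2 (show (0 : ℝ) < n + 1 by linarith)
      rw [← le_sub_iff_add_le', div_le_iff₀ p2]
      nlinarith [sq_nonneg (Real.sqrt (n + 1 : ℝ) - Real.sqrt n)]
  rcases H with _ | n
  · simp
  have hn : (0 : ℝ) ≤ ((n + 1 : ℕ) : ℝ) := Nat.cast_nonneg _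
  calc ∑ h ∈ Finset.Ico 1 (n + 1), Real.sqrt ((n + 1 : ℕ) / h)
      = Real.sqrt (n + 1 : ℕ) * ∑ h ∈ Finset.Ico 1 (n + 1), 1 / Real.sqrt h := by
        rw [Finset.mul_sum]
        refine Finset.sum_congr rfl fun h _ => ?_
        rw [Real.sqrt_div hn]; ring
    _ ≤ Real.sqrt (n + 1 : ℕ) * (2 * Real.sqrt (n + 1 : ℕ)) := by
        gcongr
        exact (key n).trans (by gcongr; omega)
    _ = _ := by rw [mul_left_comm, Real.mul_self_sqrt hn]

theorem vdc_bound (q : ℕ) (C : ℝ) (hC : 1 ≤ C) : ∃ K : ℝ, 1 ≤ K ∧ ∀ (A : ℝ) (f : ℝ → ℝ) (L H : ℕ)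
    (Z : ℝ), 0 < A → VdC q A C f L → A * H ^ q ≤ 1 / 2 → 1 ≤ H → 2 ^ q * H ≤ L → 1 / H ≤ Z →
      1 / (L * A * H ^ q) ≤ Z →
      ‖∑ n ∈ Finset.range L, ee (f n)‖ ≤ K * L * Z ^ ((1 / 2 : ℝ) ^ (q + 1)) := by
  have triv : ∀ (f : ℝ → ℝ) (L : ℕ), ‖∑ n ∈ Finset.range L, ee (f n)‖ ≤ L := fun f L => by
    refine (norm_sum_le _ _).trans (le_of_eq ?_)
    simp [norm_ee]
  induction q with
  | zero =>
    refine ⟨C, hC, fun A f L H Z hA hV hA2 hH hHL hZ hZ2 => ?_⟩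
    simp only [pow_zero, mul_one, one_mul, zero_add, pow_one] at *
    have hLpos : (0 : ℝ) < L := by exact_mod_cast (by omega : 0 < L)
    have hZ0 : 0 < Z := lt_of_lt_of_le (by positivity) hZ2
    rcases le_total 1 Z with h1 | h1
    · refine (triv f L).trans ?_
      have := Real.one_le_rpow h1 (show (0 : ℝ) ≤ 1 / 2 by norm_num)
      have : 1 * L * 1 ≤ C * L * Z ^ (1 / 2 : ℝ) := by gcongr
      linarith
    · refine (hV.kusmin_landau hA (by linarith) hA2).trans ?_
      have h2 : Z ≤ Z ^ (1 / 2 : ℝ) := by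
        have := Real.rpow_le_rpow_of_exponent_ge hZ0 h1 (show (1 / 2 : ℝ) ≤ 1 by norm_num)
        rwa [Real.rpow_one] at this
      calc C / A = C * L * (1 / (L * A)) := by field_simp
        _ ≤ C * L * Z ^ (1 / 2 : ℝ) := by gcongr; exact hZ2.trans h2
  | succ q ih =>
    obtain ⟨K, hK, ih⟩ := ih
    refine ⟨2 + 16 * K, by linarith, fun A f L H Z hA hV hA2 hH hHL hZ hZ2 => ?_⟩
    have hH0 : (0 : ℝ) < H := by exact_mod_cast hH
    have hHL' : H ≤ L := le_trans (Nat.le_mul_of_pos_left H (by positivity)) hHL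
    have hLpos : (0 : ℝ) < L := by exact_mod_cast (by omega : 0 < L)
    have hZ0 : 0 < Z := lt_of_lt_of_le (by positivity) hZ
    set e : ℝ := (1 / 2 : ℝ) ^ (q + 1) with he
    have he0 : 0 < e := by positivity
    have he1 : e ≤ 1 / 2 := by
      rw [he, pow_succ]
      have : (1 / 2 : ℝ) ^ q ≤ 1 := pow_le_one₀ (by norm_num) (by norm_num)
      linarith
    have hee : (1 / 2 : ℝ) ^ (q + 1 + 1) = e / 2 := by rw [pow_succ, ← he]; ring
    rw [hee]
    rcases le_total 1 Z with h1 | h1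
    · refine (triv f L).trans ?_
      have := Real.one_le_rpow h1 (show (0 : ℝ) ≤ e / 2 by positivity)
      have : 1 * L * 1 ≤ (2 + 16 * K) * L * Z ^ (e / 2) := by gcongr; linarith
      linarith
    have hterm : ∀ h ∈ Finset.Ico 1 H, ‖∑ n ∈ Finset.range (L - h),
        ee (f ((n + h : ℕ) : ℝ)) * (starRingEnd ℂ) (ee (f n))‖ ≤
        2 * K * L * Z ^ e * Real.sqrt (H / h) := by
      intro h hh
      rw [Finset.mem_Ico] at hh
      have hh0 : (0 : ℝ) < h := by exact_mod_cast hh.1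
      have hhH : (h : ℝ) ≤ H := by exact_mod_cast hh.2.le
      have e1 : ‖∑ n ∈ Finset.range (L - h),
          ee (f ((n + h : ℕ) : ℝ)) * (starRingEnd ℂ) (ee (f n))‖ =
          ‖∑ n ∈ Finset.range (L - h), ee (f n - f (n + h))‖ := by
        rw [← Complex.norm_conj, map_sum]
        congr 1
        refine Finset.sum_congr rfl fun n _ => ?_
        rw [map_mul, Complex.conj_conj, conj_ee, ← ee_add]
        congr 1; push_cast; ring
      have h2H : 2 * (2 ^ q * H) ≤ L := by rw [← mul_assoc, ← pow_succ']; exact hHL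
      have hqH : H ≤ 2 ^ q * H := Nat.le_mul_of_pos_left H (by positivity)
      have hLh : (L : ℝ) ≤ 2 * ((L - h : ℕ) : ℝ) := by exact_mod_cast (by omega : L ≤ 2 * (L - h))
      have hLh0 : (0 : ℝ) < ((L - h : ℕ) : ℝ) := by linarith
      have hr1 : 1 ≤ (H : ℝ) / h := by rw [le_div_iff₀ hh0]; linarith
      have hih := ih (h * A) (fun x => f x - f (x + h)) (L - h) H (2 * Z * (H / h)) (by positivity)
        (hV.diff h hh.1 (by omega)) ?_ hH (by omega) ?_ ?_
      · rw [e1]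
        refine hih.trans ?_
        rw [Real.mul_rpow (by positivity) (by positivity), Real.mul_rpow (by norm_num) hZ0.le]
        have a1 : (2 : ℝ) ^ e ≤ 2 := by
          have := Real.rpow_le_rpow_of_exponent_le (show (1 : ℝ) ≤ 2 by norm_num)
            (show e ≤ 1 by linarith)
          rwa [Real.rpow_one] at this
        have a2 : ((H : ℝ) / h) ^ e ≤ Real.sqrt (H / h) := by
          rw [Real.sqrt_eq_rpow]
          exact Real.rpow_le_rpow_of_exponent_le hr1 he1
        have a3 : ((L - h : ℕ) : ℝ) ≤ L := by exact_mod_cast Nat.sub_le _ _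
        calc _ ≤ K * L * (2 * Z ^ e * Real.sqrt (H / h)) := by gcongr
          _ = _ := by ring
      · refine le_trans ?_ hA2
        rw [pow_succ]
        have : (0 : ℝ) < H ^ q := by positivity
        nlinarith [mul_le_mul_of_nonneg_right hhH (show 0 ≤ A * (H : ℝ) ^ q by positivity)]
      · refine hZ.trans ?_
        nlinarith
      · calc 1 / (((L - h : ℕ) : ℝ) * (h * A) * H ^ q) ≤ 1 / ((L / 2) * (h * A) * H ^ q) := by
              gcongr; linarith
          _ = 2 * (1 / (L * A * H ^ (q + 1))) * (H / h) := by field_simp; ring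
          _ ≤ _ := by gcongr
    have hW := weyl_differencing (fun n => ee (f n)) (fun n => (norm_ee _).le) L H hH hHL'
    have hsum : ∑ h ∈ Finset.Ico 1 H, ‖∑ n ∈ Finset.range (L - h),
        ee (f ((n + h : ℕ) : ℝ)) * (starRingEnd ℂ) (ee (f n))‖ ≤ 2 * K * L * Z ^ e * (2 * H) := by
      refine (Finset.sum_le_sum hterm).trans ?_
      rw [← Finset.mul_sum]
      exact mul_le_mul_of_nonneg_left (sum_sqrt_div_le H) (by positivity)
    have hZe : Z ≤ Z ^ e := by
      have := Real.rpow_le_rpow_of_exponent_ge hZ0 h1 (show e ≤ 1 by linarith)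
      rwa [Real.rpow_one] at this
    refine abs_le_of_sq_le_sq' ?_ (by positivity) |>.2
    refine hW.trans ?_
    have h3 : (2 : ℝ) * L / H * (L + 2 * (2 * K * L * Z ^ e * (2 * H))) ≤
        (2 + 16 * K) * L ^ 2 * Z ^ e := by
      have : (2 : ℝ) * L / H * (L + 2 * (2 * K * L * Z ^ e * (2 * H))) =
        2 * L ^ 2 * (1 / H) + 16 * K * L ^ 2 * Z ^ e := by field_simp; ring
      rw [this]
      nlinarith [mul_le_mul_of_nonneg_left (hZ.trans hZe) (show (0 : ℝ) ≤ 2 * L ^ 2 by positivity)]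
    have h4 : ((2 + 16 * K) * L * Z ^ (e / 2)) ^ 2 = (2 + 16 * K) ^ 2 * L ^ 2 * Z ^ e := by
      rw [mul_pow, mul_pow, ← Real.rpow_natCast (Z ^ (e / 2)), ← Real.rpow_mul hZ0.le]
      congr 2; push_cast; ring
    rw [h4]
    refine le_trans (by gcongr) (h3.trans ?_)
    gcongr
    nlinarith

theorem vdc_log (q : ℕ) (ξ Y : ℝ) (hξ : 0 < ξ) (hY : 0 < Y) (L : ℕ) (hL : L ≤ 2 * Y) :
    VdC q (ξ * q.factorial / Y ^ (q + 1)) (3 ^ (q + 1)) (fun x => ξ * Real.log (x + Y)) L := by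
  refine ⟨fun i x => ξ * i.factorial / (x + Y) ^ (i + 1), ?_, ?_, ?_, ?_⟩
  · intro x hx
    have hp : x + Y ≠ 0 := by linarith [hx.1]
    have := (((hasDerivAt_id x).add_const Y).log hp).const_mul ξ
    refine this.congr_deriv ?_
    simp [div_eq_mul_inv]
  · intro i _ x hx
    have hp : x + Y ≠ 0 := by linarith [hx.1]
    have := ((((hasDerivAt_id x).add_const Y).pow (i + 1)).inv (pow_ne_zero _ hp)).const_mul
      (ξ * i.factorial)
    refine this.congr_deriv ?_
    simp only [id, Nat.factorial_succ, Pi.pow_apply]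
    push_cast
    field_simp
    ring_nf
  · intro x hx y hy hxy
    have := hx.1
    have h0 : 0 < x + Y := by linarith
    simp only
    gcongr
  · intro x hx
    have h0 := hx.1
    have h1 := hx.2
    constructor
    · rw [div_div, ← mul_pow]
      simp only
      have : x + Y ≤ Y * 3 := by linarith
      gcongr
    · simp only
      gcongr
      linarith

theorem norm_sum_ee_log_le : ∃ σ : ℝ, 0 < σ ∧ σ ≤ 1 ∧ ∃ K Y0 : ℝ, 1 ≤ Y0 ∧ ∀ (Y ξ : ℝ) (L : ℕ), Y0 ≤ Y →
    Y ^ (1 / 16 : ℝ) ≤ ξ → ξ ≤ Y ^ (11 : ℕ) → L ≤ 2 * Y →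
    ‖∑ n ∈ Finset.range L, ee (ξ * Real.log (n + Y))‖ ≤ K * Y ^ (1 - σ) := by
  obtain ⟨K, hK, hb⟩ := vdc_bound 13 (3 ^ 14) (by norm_num)
  set e : ℝ := (1 / 2 : ℝ) ^ (13 + 1) with he
  have he0 : 0 < e := by positivity
  have he1 : e ≤ 1 / 16 := by rw [he]; norm_num
  refine ⟨11 * e / 60, by positivity, by linarith, K * 2 * 2 ^ 13 + 3, (2 * Nat.factorial 13 : ℝ) ^ 60,
    one_le_pow₀ (by norm_num [Nat.factorial]), ?_⟩
  intro Y ξ L hY hξ1 hξ2 hL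
  set σ := 11 * e / 60 with hσ
  set F : ℝ := (Nat.factorial 13 : ℝ) with hF
  have hF1 : 2 ^ 13 ≤ F := by rw [hF]; norm_num [Nat.factorial]
  have hY1 : 1 ≤ Y := le_trans (one_le_pow₀ (by linarith)) hY
  have hY0 : 0 < Y := by linarith
  set U : ℝ := Y ^ (1 / 60 : ℝ) with hU
  have hU60 : Y = U ^ 60 := by
    rw [hU, ← Real.rpow_natCast, ← Real.rpow_mul hY0.le]; norm_num
  have hUpos : 0 < U := Real.rpow_pos_of_pos hY0 _
  have hUF : 2 * F ≤ U := by
    rw [hU60] at hY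
    exact le_of_pow_le_pow_left₀ (by norm_num) hUpos.le hY
  have hU1 : 1 ≤ U := by linarith
  have hξ0 : 0 < ξ := lt_of_lt_of_le (Real.rpow_pos_of_pos hY0 _) hξ1
  have hYσ : 0 < Y ^ (1 - σ) := Real.rpow_pos_of_pos hY0 _
  rcases le_total ξ (Y / 2) with hc | hc
  · have h := (vdc_log 0 ξ Y hξ0 hY0 L hL).kusmin_landau (by positivity) (by norm_num)
      (by simp only [Nat.factorial, Nat.cast_one, mul_one, zero_add, pow_one]
          rw [div_le_iff₀ hY0]; linarith)
    refine h.trans ?_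
    have h2 : Y / ξ ≤ Y ^ (1 - σ) := by
      rw [div_le_iff₀ hξ0]
      calc Y = Y ^ (1 - σ) * Y ^ σ := by rw [← Real.rpow_add hY0]; simp
        _ ≤ Y ^ (1 - σ) * ξ := by
          gcongr
          exact (Real.rpow_le_rpow_of_exponent_le hY1 (by linarith)).trans hξ1
    calc _ = 3 * (Y / ξ) := by simp [div_div_eq_mul_div]; ring
      _ ≤ 3 * Y ^ (1 - σ) := by gcongr
      _ ≤ _ := by gcongr; nlinarith
  rcases lt_or_ge (L : ℝ) (U ^ 59) with hLU | hLU
  · refine (norm_sum_le _ _).trans ?_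
    simp only [norm_ee, Finset.sum_const, Finset.card_range, nsmul_eq_mul, mul_one]
    refine hLU.le.trans ?_
    have : U ^ 59 = Y ^ (1 - 1 / 60 : ℝ) := by
      rw [hU, ← Real.rpow_natCast, ← Real.rpow_mul hY0.le]; norm_num
    rw [this]
    calc Y ^ (1 - 1 / 60 : ℝ) ≤ 1 * Y ^ (1 - σ) := by
          rw [one_mul]; exact Real.rpow_le_rpow_of_exponent_le hY1 (by linarith)
      _ ≤ _ := by gcongr; nlinarith
  set A : ℝ := ξ * F / Y ^ 14 with hA
  have hF0 : 0 < F := by linarith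
  have hA0 : 0 < A := by positivity
  set B : ℝ := ((U ^ 30)⁻¹ / A) ^ (1 / 13 : ℝ) with hB
  have hB0 : 0 < B := Real.rpow_pos_of_pos (by positivity) _
  have hB13 : B ^ 13 = (U ^ 30)⁻¹ / A := by
    rw [hB, ← Real.rpow_natCast, ← Real.rpow_mul (by positivity)]; norm_num
  have hBA : B ^ 13 * (U ^ 30 * A) = 1 := by rw [hB13]; field_simp
  have hAY : A * U ^ 840 = ξ * F := by
    rw [hA, hU60]; field_simp
  have hBlow : U ^ 11 ≤ B := by
    refine le_of_pow_le_pow_left₀ (n := 13) (by norm_num) hB0.le ?_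
    have h1 : U ^ 173 * A * U ^ 667 ≤ 1 * U ^ 667 := by
      calc U ^ 173 * A * U ^ 667 = ξ * F := by rw [← hAY]; ring
        _ ≤ U ^ 660 * U := by
          gcongr
          · refine hξ2.trans (le_of_eq ?_); rw [hU60]; ring
          · linarith
        _ = U ^ 661 := by ring
        _ ≤ 1 * U ^ 667 := by rw [one_mul]; exact pow_le_pow_right₀ hU1 (by norm_num)
    have h2 := le_of_mul_le_mul_right h1 (by positivity)
    rw [← hBA] at h2
    refine le_of_mul_le_mul_right (a := U ^ 30 * A) ?_ (by positivity)
    calc _ = U ^ 173 * A := by ring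
      _ ≤ _ := h2
  have hBup : B ≤ U ^ 58 := by
    refine le_of_pow_le_pow_left₀ (n := 13) (by norm_num) (by positivity) ?_
    have h1 : 1 * U ^ 56 ≤ U ^ 784 * A * U ^ 56 := by
      calc 1 * U ^ 56 ≤ U ^ 60 := by rw [one_mul]; exact pow_le_pow_right₀ hU1 (by norm_num)
        _ ≤ ξ * F := by rw [← hU60]; nlinarith
        _ = _ := by rw [← hAY]; ring
    have h2 := le_of_mul_le_mul_right h1 (by positivity)
    rw [← hBA] at h2
    refine le_of_mul_le_mul_right (a := U ^ 30 * A) ?_ (by positivity)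
    calc _ ≤ U ^ 784 * A := h2
      _ = _ := by ring
  set H : ℕ := ⌊B⌋₊ with hH
  have hU11 : U ≤ U ^ 11 := le_self_pow₀ hU1 (by norm_num)
  have hHB : (H : ℝ) ≤ B := Nat.floor_le hB0.le
  have hBH : B / 2 ≤ H := by
    have := Nat.lt_floor_add_one B
    rw [← hH] at this
    linarith
  have hH1 : 1 ≤ H := by
    have : (1 : ℝ) ≤ H := by linarith
    exact_mod_cast this
  have hH0 : (0 : ℝ) < H := by exact_mod_cast hH1
  have h13 : (2 : ℝ) ^ 13 ≤ U := by linarith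
  have hfin := hb A _ L H (2 ^ 13 * (U ^ 11)⁻¹) hA0 (vdc_log 13 ξ Y hξ0 hY0 L hL) ?_ hH1 ?_ ?_ ?_
  · refine hfin.trans ?_
    rw [Real.mul_rpow (by norm_num) (by positivity), Real.inv_rpow (by positivity)]
    have a1 : ((2 : ℝ) ^ 13) ^ e ≤ 2 ^ 13 := by
      have := Real.rpow_le_rpow_of_exponent_le (show (1 : ℝ) ≤ 2 ^ 13 by norm_num)
        (show e ≤ 1 from he1.trans (by norm_num))
      rwa [Real.rpow_one] at this
    have a2 : ((U ^ 11) ^ e)⁻¹ = Y ^ (-σ) := by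
      rw [hU, ← Real.rpow_natCast, ← Real.rpow_mul hY0.le, ← Real.rpow_mul hY0.le,
        ← Real.rpow_neg hY0.le]
      congr 1; rw [hσ]; push_cast; ring
    rw [a2]
    have a3 : Y ^ (1 - σ) = Y * Y ^ (-σ) := by
      rw [sub_eq_add_neg, Real.rpow_add hY0, Real.rpow_one]
    have a4 : 0 < Y ^ (-σ) := Real.rpow_pos_of_pos hY0 _
    calc K * L * ((2 ^ 13) ^ e * Y ^ (-σ)) ≤ K * (2 * Y) * (2 ^ 13 * Y ^ (-σ)) := by gcongr
      _ = K * 2 * 2 ^ 13 * Y ^ (1 - σ) := by rw [a3]; ring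
      _ ≤ _ := by gcongr; linarith
  · have h1 : A * (H : ℝ) ^ 13 ≤ A * B ^ 13 := by gcongr
    have h2 : A * B ^ 13 = (U ^ 30)⁻¹ := by rw [hB13]; field_simp
    have h3 : (U ^ 30)⁻¹ ≤ 2⁻¹ := by
      apply inv_anti₀ (by norm_num)
      exact le_trans (by linarith) (le_self_pow₀ hU1 (n := 30) (by norm_num))
    linarith
  · have : (2 : ℝ) ^ 13 * H ≤ L := by
      calc (2 : ℝ) ^ 13 * H ≤ U * U ^ 58 := by gcongr; exact hHB.trans hBup
        _ = U ^ 59 := by ring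
        _ ≤ L := hLU
    exact_mod_cast this
  · rw [one_div, ← div_eq_mul_inv, inv_le_comm₀ hH0 (by positivity), inv_div]
    refine le_trans ?_ hBH
    refine (div_le_div_of_nonneg_right hBlow (by positivity)).trans ?_
    exact div_le_div_of_nonneg_left hB0.le (by norm_num) (by norm_num)
  · have h1 : (2 ^ 13 * U ^ 30)⁻¹ ≤ A * (H : ℝ) ^ 13 := by
      calc (2 ^ 13 * U ^ 30)⁻¹ = A * (B / 2) ^ 13 := by rw [div_pow, hB13]; field_simp
        _ ≤ _ := by gcongr
    have h2 : U ^ 59 * (2 ^ 13 * U ^ 30)⁻¹ ≤ L * A * (H : ℝ) ^ 13 := by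
      rw [mul_assoc]; gcongr
    refine (one_div_le_one_div_of_le (by positivity) h2).trans ?_
    have : 1 / (U ^ 59 * (2 ^ 13 * U ^ 30)⁻¹) = 2 ^ 13 * (U ^ 29)⁻¹ := by field_simp
    rw [this]
    gcongr
    norm_num

end VanDerCorput

section Progressions

/-- The integers `n ∈ (y, q y]` with `n ≡ r` modulo `2`. -/
noncomputable def ivl (q y : ℝ) (r : ℕ) : Finset ℕ :=
  (Finset.Ioc ⌊y⌋₊ ⌊q * y⌋₊).filter fun n => n % 2 = r

theorem mem_ivl {q y : ℝ} (hq : 0 ≤ q) (hy : 0 ≤ y) {r n : ℕ} :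
    n ∈ ivl q y r ↔ (y < n ∧ n ≤ q * y) ∧ n % 2 = r := by
  rw [ivl, Finset.mem_filter, Finset.mem_Ioc, Nat.floor_lt hy, Nat.le_floor_iff (by positivity)]

theorem norm_dirPoly_eq (S : Finset ℕ) (ξ : ℝ) :
    ‖dirPoly S ξ‖ = ‖∑ n ∈ S, ee (|ξ| * Real.log n)‖ := by
  have h1 : dirPoly S ξ = ∑ n ∈ S, ee (-ξ * Real.log n) := by
    rw [dirPoly, expSum]
    refine Finset.sum_congr rfl fun n _ => ?_
    rw [ee]; congr 3; ring
  rcases abs_cases ξ with h | h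
  · rw [h1, h.1, ← Complex.norm_conj, map_sum]
    congr 1
    refine Finset.sum_congr rfl fun n _ => ?_
    rw [conj_ee]; congr 1; ring
  · rw [h1, h.1]

theorem norm_dirPoly_ivl_le : ∃ σ : ℝ, 0 < σ ∧ σ ≤ 1 ∧ ∃ K Y0 : ℝ, 0 ≤ K ∧ 1 ≤ Y0 ∧
    ∀ (q y ξ : ℝ) (r : ℕ), Y0 ≤ y → 1 ≤ q → q ≤ 2 → y ^ (1 / 16 : ℝ) ≤ |ξ| → |ξ| ≤ y ^ (10 : ℕ) →
    ‖dirPoly (ivl q y r) ξ‖ ≤ K * y ^ (1 - σ) := by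
  obtain ⟨σ, hσ, hσ1, K, Y0, hY0, h⟩ := norm_sum_ee_log_le
  refine ⟨σ, hσ, hσ1, |K|, 2 * Y0 + 2 ^ 11, abs_nonneg _, by linarith, fun q y ξ r hy hq hq2 h1 h2 => ?_⟩
  have hy0 : 0 < y := by linarith
  by_cases hr : r < 2
  swap
  · have : ivl q y r = ∅ := by
      rw [ivl, Finset.filter_eq_empty_iff]; intro n _; omega
    rw [this, dirPoly, expSum]
    simp only [Finset.sum_empty, norm_zero]
    have := Real.rpow_pos_of_pos hy0 (1 - σ)
    positivity
  set a := ⌊y⌋₊ with ha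
  set b := ⌊q * y⌋₊ with hb
  have hay : (a : ℝ) ≤ y := Nat.floor_le hy0.le
  have hya : y < a + 1 := Nat.lt_floor_add_one y
  have hbq : (b : ℝ) ≤ q * y := Nat.floor_le (by positivity)
  have hba : b < 2 * (a + 1) := by
    have : (b : ℝ) < 2 * (a + 1) := by nlinarith
    exact_mod_cast this
  set s := a + 1 + (a + 1 + r) % 2 with hs
  set L := (b + 2 - s) / 2 with hL
  have hset : ivl q y r = (Finset.range L).image fun m => s + 2 * m := by
    ext n
    rw [ivl, Finset.mem_filter, Finset.mem_Ioc, Finset.mem_image]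
    simp only [Finset.mem_range]
    constructor
    · rintro ⟨⟨h1, h2⟩, h3⟩
      exact ⟨(n - s) / 2, by omega, by omega⟩
    · rintro ⟨m, hm, rfl⟩
      omega
  have hinj : Set.InjOn (fun m => s + 2 * m) (Finset.range L : Set ℕ) := fun x _ y _ hxy => by
    simp only at hxy; omega
  have hs1 : (a : ℝ) + 1 ≤ s := by exact_mod_cast (by omega : a + 1 ≤ s)
  have hs2 : (s : ℝ) ≤ a + 2 := by exact_mod_cast (by omega : s ≤ a + 2)
  have hspos : (0 : ℝ) < s := by linarith
  set Y : ℝ := s / 2 with hY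
  have hYy : Y ≤ y := by rw [hY]; linarith
  have hyY : y / 2 ≤ Y := by rw [hY]; linarith
  have hY0' : 0 < Y := by linarith
  have hL2 : (L : ℝ) ≤ 2 * Y := by
    rw [hY, mul_div_cancel₀ _ (by norm_num)]
    have : 2 ≤ a := by
      have : (2 : ℝ) < a + 1 := by linarith
      have : 2 < a + 1 := by exact_mod_cast this
      omega
    exact_mod_cast (by omega : L ≤ s)
  have hmain := h Y |ξ| L (by linarith) ((Real.rpow_le_rpow hY0'.le hYy (by norm_num)).trans h1)
    (by
      refine h2.trans ?_
      calc y ^ 10 ≤ (y / 2) ^ 11 := by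
            rw [div_pow, le_div_iff₀ (by norm_num), pow_succ y 10]
            gcongr; linarith
        _ ≤ Y ^ 11 := by gcongr) hL2
  have e : ‖dirPoly (ivl q y r) ξ‖ = ‖∑ n ∈ Finset.range L, ee (|ξ| * Real.log (n + Y))‖ := by
    rw [norm_dirPoly_eq, hset, Finset.sum_image hinj]
    have : ∀ n : ℕ, ee (|ξ| * Real.log ((s + 2 * n : ℕ) : ℝ)) =
        ee (|ξ| * Real.log 2) * ee (|ξ| * Real.log (n + Y)) := by
      intro n
      have hp : (0 : ℝ) < n + Y := by positivity
      rw [← ee_add, ← mul_add, ← Real.log_mul (by norm_num) hp.ne']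
      congr 3; rw [hY]; push_cast; ring
    simp only [this]
    rw [← Finset.mul_sum, norm_mul, norm_ee, one_mul]
  rw [e]
  refine hmain.trans ?_
  have p1 := Real.rpow_le_rpow hY0'.le hYy (show 0 ≤ 1 - σ by linarith)
  have p2 := Real.rpow_pos_of_pos hY0' (1 - σ)
  calc K * Y ^ (1 - σ) ≤ |K| * Y ^ (1 - σ) := by gcongr; exact le_abs_self K
    _ ≤ _ := by gcongr

end Progressions

section Sifted

open ArithmeticFunction in
/-- Upper bound for the count of integers in `(y, 2y]` lying in a divisor-closed set `A`. -/
theorem card_mul_log_le_sum_inv (A : Set ℕ) (hA : ∀ m n, n ∈ A → m ∣ n → m ∈ A) (y : ℝ)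
    (hy : 1 ≤ y) (S M : Finset ℕ) (hS : ∀ n ∈ S, n ∈ A ∧ y < n ∧ n ≤ 2 * y)
    (hM : ∀ m ∈ A, 1 ≤ m → (m : ℝ) ≤ 2 * y → m ∈ M) (hM1 : ∀ m ∈ M, 1 ≤ m) :
    S.card * Real.log y ≤ 12 * y * ∑ m ∈ M, (m : ℝ)⁻¹ := by
  have h1 : S.card * Real.log y ≤ ∑ n ∈ S, Real.log n := by
    rw [← nsmul_eq_mul]
    exact Finset.card_nsmul_le_sum _ _ _ fun n hn => Real.log_le_log (by linarith) (hS n hn).2.1.le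
  have h2 : ∑ n ∈ S, Real.log n ≤ ∑ m ∈ M, Chebyshev.psi (2 * y / m) := by
    simp only [← vonMangoldt_sum, Chebyshev.psi]
    rw [Finset.sum_sigma', Finset.sum_sigma']
    have hinj : Set.InjOn (fun p : (_ : ℕ) × ℕ => (⟨p.1 / p.2, p.2⟩ : (_ : ℕ) × ℕ))
        (S.sigma fun n => n.divisors : Finset ((_ : ℕ) × ℕ)) := by
      rintro ⟨n, d⟩ h ⟨n', d'⟩ h' e
      simp only [Finset.coe_sigma, Set.mem_sigma_iff, Finset.mem_coe, Nat.mem_divisors] at h h'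
      simp only [Sigma.mk.injEq, heq_eq_eq] at e
      obtain ⟨e1, rfl⟩ := e
      have : n = n' := by
        rw [← Nat.div_mul_cancel h.2.1, ← Nat.div_mul_cancel h'.2.1, e1]
      simp [this]
    have e := Finset.sum_image (f := fun p : (_ : ℕ) × ℕ => Λ p.2) hinj
    simp only at e
    rw [← e]
    refine Finset.sum_le_sum_of_subset_of_nonneg ?_ fun _ _ _ => vonMangoldt_nonneg
    intro p hp
    rw [Finset.mem_image] at hp
    obtain ⟨⟨n, d⟩, h, rfl⟩ := hp
    simp only [Finset.mem_sigma, Nat.mem_divisors] at h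
    obtain ⟨hn, hd, hn0⟩ := h
    have hd0 : 0 < d := Nat.pos_of_dvd_of_pos hd (Nat.pos_of_ne_zero hn0)
    have hq : 0 < n / d := Nat.div_pos (Nat.le_of_dvd (Nat.pos_of_ne_zero hn0) hd) hd0
    have hmul : ((n / d : ℕ) : ℝ) * d = n := by exact_mod_cast Nat.div_mul_cancel hd
    have hqR : (0 : ℝ) < ((n / d : ℕ) : ℝ) := by exact_mod_cast hq
    have hd1 : (1 : ℝ) ≤ d := by exact_mod_cast hd0
    have hn2 := (hS n hn).2.2
    simp only [Finset.mem_sigma, Finset.mem_Ioc]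
    refine ⟨hM _ (hA _ n (hS n hn).1 (Nat.div_dvd_of_dvd hd)) hq (by nlinarith), hd0, ?_⟩
    rw [Nat.le_floor_iff (by positivity), le_div_iff₀ hqR]
    linarith
  have h3 : ∑ m ∈ M, Chebyshev.psi (2 * y / m) ≤ ∑ m ∈ M, 12 * y * (m : ℝ)⁻¹ := by
    refine Finset.sum_le_sum fun m hm => ?_
    have hm1 : (1 : ℝ) ≤ m := by exact_mod_cast hM1 m hm
    have h := Chebyshev.psi_le_const_mul_self (x := 2 * y / m) (by positivity)
    have h4 : Real.log 4 + 4 ≤ 6 := by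
      have : Real.log 4 = 2 * Real.log 2 := by
        rw [show (4 : ℝ) = 2 ^ 2 by norm_num, Real.log_pow]; norm_num
      have := Real.log_two_lt_d9
      linarith
    refine h.trans ?_
    calc _ ≤ 6 * (2 * y / m) := by gcongr
      _ = _ := by rw [div_eq_mul_inv]; ring
  rw [Finset.mul_sum]
  exact h1.trans (h2.trans h3)

theorem sum_inv_factored_le (s M : Finset ℕ) (hM : ∀ m ∈ M, m ∈ Nat.factoredNumbers s) :
    ∑ m ∈ M, (m : ℝ)⁻¹ ≤ Real.exp (2 * ∑ p ∈ s with p.Prime, (p : ℝ)⁻¹) := by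
  let f : ℕ →* ℝ := ⟨⟨fun n => (n : ℝ)⁻¹, by simp⟩, fun a b => by push_cast; rw [mul_inv]⟩
  have hf : ∀ n : ℕ, f n = (n : ℝ)⁻¹ := fun n => rfl
  have h := EulerProduct.summable_and_hasSum_factoredNumbers_prod_filter_prime_geometric (f := f)
    (fun {p} hp => by
      rw [hf, norm_inv, RCLike.norm_natCast]
      exact inv_lt_one_of_one_lt₀ (by exact_mod_cast hp.one_lt)) s
  have h1 : ∑ m ∈ M, (m : ℝ)⁻¹ ≤ ∏ p ∈ s with p.Prime, (1 - f p)⁻¹ := by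
    rw [← h.2.tsum_eq]
    have e : ∑ m ∈ M, (m : ℝ)⁻¹ = ∑ m ∈ M.attach.image
        (fun m => (⟨m.1, hM m.1 m.2⟩ : Nat.factoredNumbers s)), f m := by
      rw [Finset.sum_image fun a _ b _ hab => by
        simp only [Subtype.mk.injEq] at hab; exact Subtype.ext hab]
      simp only [hf]
      rw [Finset.sum_attach M fun m => (m : ℝ)⁻¹]
    rw [e]
    exact h.2.summable.sum_le_tsum _ fun m _ => by rw [hf]; positivity
  refine h1.trans ?_
  rw [Finset.mul_sum, Real.exp_sum]
  refine Finset.prod_le_prod (fun p hp => ?_) fun p hp => ?_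
  all_goals
    have hp2 : (2 : ℝ) ≤ p := by exact_mod_cast (Finset.mem_filter.1 hp).2.two_le
    have hu : (p : ℝ)⁻¹ ≤ 2⁻¹ := inv_anti₀ (by norm_num) hp2
    have hu0 : 0 < (p : ℝ)⁻¹ := by positivity
    rw [hf]
  · exact inv_nonneg.2 (by linarith)
  · rw [inv_le_comm₀ (by linarith) (Real.exp_pos _), ← Real.exp_neg]
    set u := (p : ℝ)⁻¹
    have := Real.add_one_le_exp (2 * u)
    rw [Real.exp_neg, inv_le_comm₀ (Real.exp_pos _) (by linarith)]
    refine le_trans ?_ this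
    rw [inv_le_iff_one_le_mul₀ (by linarith)]
    nlinarith

/-- Sum of reciprocals of the primes in `(a, b]`. -/
noncomputable def primeRecip (a b : ℝ) : ℝ := ∑ p ∈ Finset.Ioc ⌊a⌋₊ ⌊b⌋₊ with p.Prime, (p : ℝ)⁻¹

theorem primeRecip_add (a b c : ℝ) : primeRecip a c ≤ primeRecip a b + primeRecip b c := by
  have h : (Finset.Ioc ⌊a⌋₊ ⌊c⌋₊).filter Nat.Prime ⊆
      (Finset.Ioc ⌊a⌋₊ ⌊b⌋₊).filter Nat.Prime ∪ (Finset.Ioc ⌊b⌋₊ ⌊c⌋₊).filter Nat.Prime := by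
    intro p hp
    simp only [Finset.mem_union, Finset.mem_filter, Finset.mem_Ioc] at *
    rcases le_or_gt p ⌊b⌋₊ with h | h <;> tauto
  refine (Finset.sum_le_sum_of_subset_of_nonneg h fun _ _ _ => by positivity).trans ?_
  have := Finset.sum_union_inter (s₁ := (Finset.Ioc ⌊a⌋₊ ⌊b⌋₊).filter Nat.Prime)
    (s₂ := (Finset.Ioc ⌊b⌋₊ ⌊c⌋₊).filter Nat.Prime) (f := fun p : ℕ => (p : ℝ)⁻¹)
  have h0 : 0 ≤ ∑ p ∈ (Finset.Ioc ⌊a⌋₊ ⌊b⌋₊).filter Nat.Prime ∩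
    (Finset.Ioc ⌊b⌋₊ ⌊c⌋₊).filter Nat.Prime, (p : ℝ)⁻¹ := Finset.sum_nonneg fun _ _ => by positivity
  rw [primeRecip, primeRecip]
  linarith

theorem primeRecip_mono (a b c : ℝ) (hbc : b ≤ c) : primeRecip a b ≤ primeRecip a c := by
  refine Finset.sum_le_sum_of_subset_of_nonneg ?_ fun _ _ _ => by positivity
  exact Finset.filter_subset_filter _ (Finset.Ioc_subset_Ioc_right (Nat.floor_mono hbc))

theorem primeRecip_two_mul_le (w : ℝ) (hw : 1 < w) : primeRecip w (2 * w) ≤ 4 / Real.log w := by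
  have hlog : 0 < Real.log w := Real.log_pos hw
  rw [le_div_iff₀ hlog, primeRecip, Finset.sum_mul]
  have h1 : ∀ p ∈ (Finset.Ioc ⌊w⌋₊ ⌊2 * w⌋₊).filter Nat.Prime,
      (p : ℝ)⁻¹ * Real.log w ≤ w⁻¹ * Real.log p := by
    intro p hp
    simp only [Finset.mem_filter, Finset.mem_Ioc] at hp
    have : w < p := (Nat.floor_lt (by linarith)).1 hp.1.1
    gcongr
  refine (Finset.sum_le_sum h1).trans ?_
  rw [← Finset.mul_sum]
  have h2 : ∑ p ∈ (Finset.Ioc ⌊w⌋₊ ⌊2 * w⌋₊).filter Nat.Prime, Real.log p ≤ Chebyshev.theta (2 * w) := by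
    rw [Chebyshev.theta]
    refine Finset.sum_le_sum_of_subset_of_nonneg ?_ fun p _ _ => Real.log_natCast_nonneg p
    exact Finset.filter_subset_filter _ (Finset.Ioc_subset_Ioc_left (Nat.zero_le _))
  have h3 := Chebyshev.theta_le_log4_mul_x (x := 2 * w) (by linarith)
  have h4 : Real.log 4 ≤ 2 := by
    have : Real.log 4 = 2 * Real.log 2 := by
      rw [show (4 : ℝ) = 2 ^ 2 by norm_num, Real.log_pow]; norm_num
    have := Real.log_two_lt_d9
    linarith
  calc _ ≤ w⁻¹ * (2 * (2 * w)) := by gcongr; exact h2.trans (h3.trans (by gcongr))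
    _ = 4 := by field_simp; norm_num

theorem primeRecip_two_pow_mul_le (w : ℝ) (hw : 1 < w) (j : ℕ) :
    primeRecip w (2 ^ j * w) ≤ j * (4 / Real.log w) := by
  induction j with
  | zero => simp [primeRecip]
  | succ j ih =>
    refine (primeRecip_add w (2 ^ j * w) _).trans ?_
    have hw' : w ≤ 2 ^ j * w := le_mul_of_one_le_left (by linarith) (one_le_pow₀ (by norm_num))
    have h := primeRecip_two_mul_le (2 ^ j * w) (by linarith)
    rw [← mul_assoc, ← pow_succ'] at h
    have : 4 / Real.log (2 ^ j * w) ≤ 4 / Real.log w := by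
      have := Real.log_pos hw
      gcongr
    push_cast
    linarith

theorem primeRecip_sq_le (w : ℝ) (hw : 2 ≤ w) : primeRecip w (w ^ 2) ≤ 12 := by
  have hlog : 0 < Real.log w := Real.log_pos (by linarith)
  have hl2 : 0 < Real.log 2 := Real.log_pos (by norm_num)
  set j := ⌈Real.log w / Real.log 2⌉₊ with hj
  have h1 : w ≤ 2 ^ j := by
    rw [← Real.log_le_log_iff (by linarith) (by positivity), Real.log_pow, ← div_le_iff₀ hl2]
    exact Nat.le_ceil _
  have h2 : (j : ℝ) ≤ 3 * Real.log w := by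
    have := (Nat.ceil_lt_add_one (show 0 ≤ Real.log w / Real.log 2 by positivity)).le
    have h3 : Real.log 2 ≤ Real.log w := Real.log_le_log (by norm_num) hw
    have := Real.log_two_gt_d9
    have h4 : Real.log w / Real.log 2 + 1 ≤ 3 * Real.log w := by
      have : Real.log w / Real.log 2 + 1 ≤ 2 * (Real.log w / Real.log 2) := by
        have : 1 ≤ Real.log w / Real.log 2 := by rw [le_div_iff₀ hl2]; linarith
        linarith
      refine this.trans ?_
      rw [← mul_div_assoc, div_le_iff₀ hl2]
      nlinarith
    linarith
  calc primeRecip w (w ^ 2) ≤ primeRecip w (2 ^ j * w) := by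
        apply primeRecip_mono; rw [sq]; gcongr
    _ ≤ j * (4 / Real.log w) := primeRecip_two_pow_mul_le w (by linarith) j
    _ ≤ 3 * Real.log w * (4 / Real.log w) := by gcongr
    _ = 12 := by field_simp; norm_num

theorem primeRecip_pow_le (w : ℝ) (hw : 2 ≤ w) (i : ℕ) : primeRecip w (w ^ 2 ^ i) ≤ 12 * i := by
  induction i with
  | zero => simp [primeRecip]
  | succ i ih =>
    refine (primeRecip_add w (w ^ 2 ^ i) _).trans ?_
    have h := primeRecip_sq_le (w ^ 2 ^ i)
      (hw.trans (le_self_pow₀ (by linarith) (by positivity)))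
    rw [← pow_mul, ← pow_succ] at h
    push_cast
    linarith

theorem primeRecip_zero_le (i : ℕ) : primeRecip 0 (2 ^ 2 ^ i) ≤ 1 + 12 * i := by
  refine (primeRecip_add 0 2 _).trans ?_
  have h := primeRecip_pow_le 2 le_rfl i
  have h2 : primeRecip 0 2 ≤ 1 := by
    have : (Finset.Ioc 0 2).filter Nat.Prime = {2} := by decide
    rw [primeRecip]
    norm_num [this]
  linarith

/-- Few integers in `(y, 2y]` have no prime factor in `(P, Q]`. -/
theorem sifted_card_le (y P Q : ℝ) (i j : ℕ) (hy : 1 ≤ y) (hP : P ≤ 2 ^ 2 ^ i) (hQ : 2 ≤ Q)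
    (hyQ : 2 * y ≤ Q ^ 2 ^ j) (S : Finset ℕ) (hS : ∀ n ∈ S, y < n ∧ n ≤ 2 * y ∧
      ∀ p : ℕ, p.Prime → p ∣ n → P < p → ¬ (p : ℝ) ≤ Q) :
    S.card * Real.log y ≤ 12 * y * Real.exp (2 + 24 * i + 24 * j) := by
  classical
  set A : Set ℕ := {n | ∀ p : ℕ, p.Prime → p ∣ n → P < p → ¬ (p : ℝ) ≤ Q} with hA
  set M : Finset ℕ := (Finset.Icc 1 ⌊2 * y⌋₊).filter (· ∈ A) with hM
  set s : Finset ℕ := Finset.Ioc 0 ⌊P⌋₊ ∪ Finset.Ioc ⌊Q⌋₊ ⌊2 * y⌋₊ with hs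
  have h1 := card_mul_log_le_sum_inv A (fun m n hn hmn p hp hpm => hn p hp (hpm.trans hmn)) y hy S M
    (fun n hn => ⟨(hS n hn).2.2, (hS n hn).1, (hS n hn).2.1⟩)
    (fun m hm h1 h2 => by
      rw [hM, Finset.mem_filter, Finset.mem_Icc]
      exact ⟨⟨h1, Nat.le_floor h2⟩, hm⟩)
    (fun m hm => (Finset.mem_Icc.1 (Finset.mem_filter.1 hm).1).1)
  refine h1.trans ?_
  have h2 : ∑ m ∈ M, (m : ℝ)⁻¹ ≤ Real.exp (2 * ∑ p ∈ s with p.Prime, (p : ℝ)⁻¹) := by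
    refine sum_inv_factored_le s M fun m hm => ?_
    rw [hM, Finset.mem_filter, Finset.mem_Icc] at hm
    rw [Nat.mem_factoredNumbers_iff_forall_le]
    refine ⟨by omega, fun p hple hp hpm => ?_⟩
    rw [hs, Finset.mem_union, Finset.mem_Ioc, Finset.mem_Ioc]
    rcases le_or_gt (p : ℝ) P with h | h
    · exact Or.inl ⟨hp.pos, Nat.le_floor h⟩
    · have := not_le.1 (hm.2 p hp hpm h)
      exact Or.inr ⟨(Nat.floor_lt (by linarith)).2 this, hple.trans hm.1.2⟩
  have h3 : ∑ p ∈ s with p.Prime, (p : ℝ)⁻¹ ≤ 1 + 12 * i + 12 * j := by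
    have a : ∑ p ∈ s with p.Prime, (p : ℝ)⁻¹ ≤ primeRecip 0 P + primeRecip Q (2 * y) := by
      rw [hs, Finset.filter_union, primeRecip, primeRecip, ← Finset.sum_union_inter, Nat.floor_zero]
      exact le_add_of_nonneg_right (Finset.sum_nonneg fun _ _ => by positivity)
    have b := (primeRecip_mono 0 _ _ hP).trans (primeRecip_zero_le i)
    have c := (primeRecip_mono Q _ _ hyQ).trans (primeRecip_pow_le Q hQ j)
    linarith
  gcongr
  refine h2.trans ?_
  gcongr
  linarith

end Sifted

section Decomposition

/-- Primes in `(P ρ^v, P ρ^(v+1)]`. -/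
noncomputable def cls (P ρ : ℝ) (v : ℕ) : Finset ℕ :=
  (Finset.Ioc ⌊P * ρ ^ v⌋₊ ⌊P * ρ ^ (v + 1)⌋₊).filter Nat.Prime

open Classical in
/-- The cofactors paired with the primes of `cls P ρ v`. -/
noncomputable def cof (q y : ℝ) (r : ℕ) (P ρ : ℝ) (v : ℕ) : Finset ℕ :=
  (Finset.Ioc ⌊y / (P * ρ ^ v)⌋₊ ⌊q * y / (P * ρ ^ (v + 1))⌋₊).filter fun m => m % 2 = r ∧
    ∀ p : ℕ, p.Prime → p ∣ m → P < p → ¬ (p : ℝ) ≤ P * ρ ^ (v + 1)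

/-- Products of a prime in some class below `n` with one of its cofactors. -/
noncomputable def good (q y : ℝ) (r : ℕ) (P ρ : ℝ) (n : ℕ) : Finset ℕ :=
  (Finset.range n).biUnion fun v => (cls P ρ v ×ˢ cof q y r P ρ v).image fun p => p.1 * p.2

variable {q y P ρ : ℝ} {r n : ℕ}

theorem mem_cls (hP : 0 ≤ P) (hρ : 0 ≤ ρ) {v p : ℕ} :
    p ∈ cls P ρ v ↔ (P * ρ ^ v < p ∧ p ≤ P * ρ ^ (v + 1)) ∧ p.Prime := by
  rw [cls, Finset.mem_filter, Finset.mem_Ioc, Nat.floor_lt (by positivity),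
    Nat.le_floor_iff (by positivity)]

theorem mem_cof (hq : 0 ≤ q) (hy : 0 ≤ y) (hP : 0 ≤ P) (hρ : 0 ≤ ρ) {v m : ℕ} :
    m ∈ cof q y r P ρ v ↔ (y / (P * ρ ^ v) < m ∧ m ≤ q * y / (P * ρ ^ (v + 1))) ∧ m % 2 = r ∧
      ∀ p : ℕ, p.Prime → p ∣ m → P < p → ¬ (p : ℝ) ≤ P * ρ ^ (v + 1) := by
  classical
  simp only [cof, Finset.mem_filter, Finset.mem_Ioc]
  rw [Nat.floor_lt (by positivity), Nat.le_floor_iff (by positivity)]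

theorem cls_lt (hP : 0 < P) (hρ : 1 ≤ ρ) {v p : ℕ} (hp : p ∈ cls P ρ v) : P < p := by
  rw [mem_cls hP.le (by linarith)] at hp
  exact lt_of_le_of_lt (le_mul_of_one_le_right hP.le (one_le_pow₀ hρ)) hp.1.1

theorem mul_inj_cls_cof (hq : 0 ≤ q) (hy : 0 ≤ y) (hP : 0 < P) (hρ : 1 ≤ ρ) {v v' p p' m m' : ℕ}
    (hvv : v ≤ v') (hp : p ∈ cls P ρ v) (hp' : p' ∈ cls P ρ v') (hm' : m' ∈ cof q y r P ρ v')
    (h : p * m = p' * m') : p = p' ∧ m = m' := by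
  have hPp := cls_lt hP hρ hp
  rw [mem_cls hP.le (by linarith)] at hp hp'
  rw [mem_cof hq hy hP.le (by linarith)] at hm'
  have hd : p ∣ p' * m' := ⟨m, h.symm⟩
  have hpp : p = p' := by
    rcases (Nat.Prime.dvd_mul hp.2).1 hd with h1 | h1
    · exact (Nat.prime_dvd_prime_iff_eq hp.2 hp'.2).1 h1
    · refine absurd (hp.1.2.trans ?_) (hm'.2.2 p hp.2 h1 hPp)
      gcongr
  subst hpp
  exact ⟨rfl, Nat.eq_of_mul_eq_mul_left hp.2.pos h⟩

theorem cls_disjoint (hP : 0 < P) (hρ : 1 ≤ ρ) {v v' p : ℕ} (h : v < v') (hp : p ∈ cls P ρ v) :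
    p ∉ cls P ρ v' := by
  intro hp'
  rw [mem_cls hP.le (by linarith)] at hp hp'
  have : P * ρ ^ (v + 1) ≤ P * ρ ^ v' := by gcongr; exact h
  linarith [hp.1.2, hp'.1.1]

theorem good_subset (hq : 0 ≤ q) (hy : 0 ≤ y) (hP : 2 ≤ P) (hρ : 1 ≤ ρ) :
    good q y r P ρ n ⊆ ivl q y r := by
  intro a ha
  simp only [good, Finset.mem_biUnion, Finset.mem_image, Finset.mem_product, Prod.exists] at ha
  obtain ⟨v, -, p, m, ⟨hp, hm⟩, rfl⟩ := ha
  have hPp := cls_lt (by linarith) hρ hp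
  rw [mem_cls (by linarith) (by linarith)] at hp
  rw [mem_cof hq hy (by linarith) (by linarith)] at hm
  have hP0 : 0 < P := by linarith
  have hV0 : 0 < P * ρ ^ v := by positivity
  have hV1 : 0 < P * ρ ^ (v + 1) := by positivity
  rw [mem_ivl hq hy]
  push_cast
  have hm0 : (0 : ℝ) < m := lt_of_le_of_lt (by positivity) hm.1.1
  have hp0 : (0 : ℝ) < p := by linarith
  refine ⟨⟨?_, ?_⟩, ?_⟩
  · have := hm.1.1
    rw [div_lt_iff₀ hV0] at this
    nlinarith [hp.1.1]
  · have := hm.1.2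
    rw [le_div_iff₀ hV1] at this
    nlinarith [hp.1.2]
  · have hodd : p % 2 = 1 := by
      rcases hp.2.eq_two_or_odd with h | h
      · rw [h] at hPp; norm_num at hPp; linarith
      · exact h
    rw [Nat.mul_mod, hodd, hm.2.1, one_mul]
    rw [← hm.2.1]; omega

theorem dirPoly_good (hq : 0 ≤ q) (hy : 0 ≤ y) (hP : 2 ≤ P) (hρ : 1 ≤ ρ) (ξ : ℝ) :
    dirPoly (good q y r P ρ n) ξ =
      ∑ v ∈ Finset.range n, dirPoly (cls P ρ v) ξ * dirPoly (cof q y r P ρ v) ξ := by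
  have hP0 : 0 < P := by linarith
  rw [good, dirPoly, expSum, Finset.sum_biUnion]
  · refine Finset.sum_congr rfl fun v _ => ?_
    rw [Finset.sum_image]
    · rw [dirPoly, dirPoly, ← expSum_product, expSum]
      refine Finset.sum_congr rfl fun p hp => ?_
      rw [Finset.mem_product] at hp
      have h1 := cls_lt hP0 hρ hp.1
      have h2 := ((mem_cof hq hy hP0.le (by linarith)).1 hp.2).1.1
      have h3 : 0 ≤ y / (P * ρ ^ v) := by positivity
      rw [Nat.cast_mul,
        Real.log_mul (by linarith : (0 : ℝ) < p.1).ne' (by linarith : (0 : ℝ) < p.2).ne']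
    · rintro ⟨p, m⟩ h ⟨p', m'⟩ h' e
      simp only [Finset.coe_product, Set.mem_prod, Finset.mem_coe] at h h'
      have := mul_inj_cls_cof hq hy hP0 hρ le_rfl h.1 h'.1 h'.2 e
      exact Prod.ext this.1 this.2
  · have key : ∀ v v', v < v' → Disjoint
        ((cls P ρ v ×ˢ cof q y r P ρ v).image fun p => p.1 * p.2)
        ((cls P ρ v' ×ˢ cof q y r P ρ v').image fun p => p.1 * p.2) := by
      intro v v' hvv
      rw [Finset.disjoint_left]
      intro a ha ha'
      simp only [Finset.mem_image, Finset.mem_product, Prod.exists] at ha ha'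
      obtain ⟨p, m, ⟨hp, hm⟩, rfl⟩ := ha
      obtain ⟨p', m', ⟨hp', hm'⟩, e⟩ := ha'
      have := (mul_inj_cls_cof hq hy hP0 hρ hvv.le hp hp' hm' e.symm).1
      exact cls_disjoint hP0 hρ hvv hp (this ▸ hp')
    intro v _ v' _ hne
    rcases lt_or_gt_of_ne hne with h | h
    · exact key v v' h
    · exact (key v' v h).symm

theorem exists_cls (hP : 0 < P) (hρ : 1 ≤ ρ) {p : ℕ} (hp : p.Prime) (h1 : P < p) (k : ℕ)
    (h2 : p ≤ P * ρ ^ k) : ∃ v < k, p ∈ cls P ρ v := by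
  induction k with
  | zero => rw [pow_zero, mul_one] at h2; linarith
  | succ k ih =>
    rcases le_or_gt (p : ℝ) (P * ρ ^ k) with h | h
    · obtain ⟨v, hv, hh⟩ := ih h
      exact ⟨v, by omega, hh⟩
    · exact ⟨k, by omega, (mem_cls hP.le (by linarith)).2 ⟨⟨h, h2⟩, hp⟩⟩

theorem sdiff_good_cases (hq : 0 ≤ q) (hy : 0 ≤ y) (hP : 2 ≤ P) (hρ : 1 ≤ ρ) {a : ℕ}
    (ha : a ∈ ivl q y r) (hg : a ∉ good q y r P ρ n) :
    (∀ p : ℕ, p.Prime → p ∣ a → P < p → ¬ (p : ℝ) ≤ P * ρ ^ n) ∨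
    (∃ v < n, ∃ p ∈ cls P ρ v, ∃ p' ∈ cls P ρ v, p * p' ∣ a) ∨ a ≤ ρ * y ∨ q * y / ρ < a := by
  have hP0 : 0 < P := by linarith
  by_contra! hcon
  obtain ⟨⟨p₀, hp₀, hpa₀, hPp₀, hle₀⟩, h2, h3, h4⟩ := hcon
  have hex : ∃ v, ∃ p ∈ cls P ρ v, p ∣ a := by
    obtain ⟨v, -, hv⟩ := exists_cls hP0 hρ hp₀ hPp₀ n hle₀
    exact ⟨v, p₀, hv, hpa₀⟩
  classical
  obtain ⟨p, hp, m, rfl⟩ := Nat.find_spec hex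
  set v := Nat.find hex with hv
  have hvn : v < n := by
    obtain ⟨v', hv', h⟩ := exists_cls hP0 hρ hp₀ hPp₀ n hle₀
    exact lt_of_le_of_lt (Nat.find_min' hex ⟨p₀, h, hpa₀⟩) hv'
  have hPp := cls_lt hP0 hρ hp
  have hp1 := (mem_cls hP0.le (by linarith)).1 hp
  have ha' := (mem_ivl hq hy).1 ha
  have hp0 : (0 : ℝ) < p := by linarith
  have hV0 : 0 < P * ρ ^ v := by positivity
  have hV1 : 0 < P * ρ ^ (v + 1) := by positivity
  push_cast at h3 h4
  have hm0 : (0 : ℝ) ≤ m := m.cast_nonneg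
  have hm0' : (0 : ℝ) < m := by
    rcases hm0.eq_or_lt with h | h
    · rw [← h, mul_zero] at h3
      nlinarith [mul_nonneg (by linarith : 0 ≤ ρ) hy]
    · exact h
  apply hg
  simp only [good, Finset.mem_biUnion, Finset.mem_image, Finset.mem_product, Prod.exists]
  refine ⟨v, Finset.mem_range.2 hvn, p, m, ⟨hp, ?_⟩, rfl⟩
  rw [mem_cof hq hy hP0.le (by linarith)]
  refine ⟨⟨?_, ?_⟩, ?_, ?_⟩
  · rw [div_lt_iff₀ hV0]
    have h5 : (p : ℝ) * m ≤ P * ρ ^ v * ρ * m := by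
      rw [mul_assoc P, ← pow_succ]; gcongr; exact hp1.1.2
    have : ρ * y < ρ * (m * (P * ρ ^ v)) := by nlinarith
    exact lt_of_mul_lt_mul_left this (by linarith)
  · rw [le_div_iff₀ hV1]
    rw [le_div_iff₀ (by linarith)] at h4
    calc (m : ℝ) * (P * ρ ^ (v + 1)) = (P * ρ ^ v) * m * ρ := by ring
      _ ≤ p * m * ρ := by gcongr; exact hp1.1.1.le
      _ ≤ q * y := h4
  · have hodd : p % 2 = 1 := by
      rcases hp1.2.eq_two_or_odd with h | h
      · rw [h] at hPp; norm_num at hPp; linarith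
      · exact h
    have := ha'.2
    rw [Nat.mul_mod, hodd, one_mul] at this
    omega
  · intro p' hp' hpm hPp' hle
    obtain ⟨v', hv', h⟩ := exists_cls hP0 hρ hp' hPp' (v + 1) hle
    have h5 : v ≤ v' := Nat.find_min' hex ⟨p', h, hpm.trans (Dvd.intro_left p rfl)⟩
    have h6 : v' = v := by omega
    subst h6
    exact h2 v hvn p hp p' h (Nat.mul_dvd_mul_left p hpm)

theorem card_Ioc_floor_le {a b : ℝ} (ha : 0 ≤ a) (hab : a ≤ b) :
    ((Finset.Ioc ⌊a⌋₊ ⌊b⌋₊).card : ℝ) ≤ b - a + 1 := by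
  rw [Nat.card_Ioc, Nat.cast_sub (Nat.floor_le_floor hab)]
  have h1 := Nat.floor_le (ha.trans hab)
  have h2 := Nat.lt_floor_add_one a
  linarith

theorem card_cls_le (hP : 0 ≤ P) (hρ : 1 ≤ ρ) (v : ℕ) :
    ((cls P ρ v).card : ℝ) ≤ P * ρ ^ v * (ρ - 1) + 1 := by
  have h1 : ((cls P ρ v).card : ℝ) ≤ ((Finset.Ioc ⌊P * ρ ^ v⌋₊ ⌊P * ρ ^ (v + 1)⌋₊).card : ℝ) := by
    exact_mod_cast Finset.card_filter_le _ _
  have h2 : P * ρ ^ v ≤ P * ρ ^ (v + 1) := by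
    gcongr
    omega
  refine h1.trans ((card_Ioc_floor_le (by positivity) h2).trans (le_of_eq ?_))
  rw [pow_succ]; ring

theorem card_pair_multiples_le {z : ℝ} (hz : 0 ≤ z) (hP : 0 < P) (hρ : 1 ≤ ρ)
    (h1 : 1 ≤ P * (ρ - 1)) :
    (((Finset.Ioc 0 ⌊z⌋₊).filter fun a => ∃ v < n, ∃ p ∈ cls P ρ v, ∃ p' ∈ cls P ρ v,
      p * p' ∣ a).card : ℝ) ≤ n * (4 * (ρ - 1) ^ 2 * z) := by
  classical
  have hsub : ((Finset.Ioc 0 ⌊z⌋₊).filter fun a => ∃ v < n, ∃ p ∈ cls P ρ v, ∃ p' ∈ cls P ρ v,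
      p * p' ∣ a) ⊆ (Finset.range n).biUnion fun v => (cls P ρ v ×ˢ cls P ρ v).biUnion
        fun p => (Finset.Ioc 0 ⌊z⌋₊).filter fun a => p.1 * p.2 ∣ a := by
    intro a ha
    simp only [Finset.mem_filter, Finset.mem_biUnion, Finset.mem_range, Finset.mem_product,
      Prod.exists] at ha ⊢
    obtain ⟨h0, v, hv, p, hp, p', hp', hd⟩ := ha
    exact ⟨v, hv, p, p', ⟨hp, hp'⟩, h0, hd⟩
  have h2 : ∀ v, (((cls P ρ v ×ˢ cls P ρ v).biUnion
        fun p => (Finset.Ioc 0 ⌊z⌋₊).filter fun a => p.1 * p.2 ∣ a).card : ℝ)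
        ≤ 4 * (ρ - 1) ^ 2 * z := by
    intro v
    have hV : 0 < P * ρ ^ v := by positivity
    have hPV : P ≤ P * ρ ^ v := le_mul_of_one_le_right hP.le (one_le_pow₀ hρ)
    have hc : ((cls P ρ v).card : ℝ) ≤ 2 * (P * ρ ^ v) * (ρ - 1) := by
      have := card_cls_le hP.le hρ v
      nlinarith [mul_le_mul_of_nonneg_right hPV (by linarith : 0 ≤ ρ - 1)]
    calc _ ≤ ((∑ p ∈ cls P ρ v ×ˢ cls P ρ v,
          ((Finset.Ioc 0 ⌊z⌋₊).filter fun a => p.1 * p.2 ∣ a).card : ℕ) : ℝ) := by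
            exact_mod_cast Finset.card_biUnion_le
      _ ≤ ∑ p ∈ cls P ρ v ×ˢ cls P ρ v, z / (P * ρ ^ v) ^ 2 := by
        push_cast
        refine Finset.sum_le_sum fun p hp => ?_
        rw [Finset.mem_product] at hp
        have e1 := ((mem_cls hP.le (by linarith)).1 hp.1).1.1
        have e2 := ((mem_cls hP.le (by linarith)).1 hp.2).1.1
        rw [Nat.Ioc_filter_dvd_card_eq_div]
        refine Nat.cast_div_le.trans ?_
        push_cast
        rw [pow_two]
        gcongr
        exact Nat.floor_le hz
      _ = ((cls P ρ v).card : ℝ) ^ 2 * (z / (P * ρ ^ v) ^ 2) := by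
        rw [Finset.sum_const, Finset.card_product, nsmul_eq_mul]; push_cast; ring
      _ ≤ (2 * (P * ρ ^ v) * (ρ - 1)) ^ 2 * (z / (P * ρ ^ v) ^ 2) := by gcongr
      _ = _ := by field_simp; ring
  calc _ ≤ (((Finset.range n).biUnion fun v => (cls P ρ v ×ˢ cls P ρ v).biUnion
        fun p => (Finset.Ioc 0 ⌊z⌋₊).filter fun a => p.1 * p.2 ∣ a).card : ℝ) := by
          exact_mod_cast Finset.card_le_card hsub
    _ ≤ ((∑ v ∈ Finset.range n, ((cls P ρ v ×ˢ cls P ρ v).biUnion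
        fun p => (Finset.Ioc 0 ⌊z⌋₊).filter fun a => p.1 * p.2 ∣ a).card : ℕ) : ℝ) := by
          exact_mod_cast Finset.card_biUnion_le
    _ ≤ ∑ v ∈ Finset.range n, 4 * (ρ - 1) ^ 2 * z := by
      push_cast; exact Finset.sum_le_sum fun v _ => h2 v
    _ = _ := by rw [Finset.sum_const, Finset.card_range, nsmul_eq_mul]

/-- Few elements of `ivl q y r` are not in `good q y r P ρ n`. -/
theorem card_sdiff_good_le (hq : 1 ≤ q) (hq2 : q ≤ 2) (hy : 1 < y) (hP : 2 ≤ P) (hρ : 1 ≤ ρ)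
    (h1 : 1 ≤ P * (ρ - 1)) (i j : ℕ) (hPi : P ≤ 2 ^ 2 ^ i)
    (hyQ : 2 * y ≤ (P * ρ ^ n) ^ 2 ^ j) :
    ((ivl q y r \ good q y r P ρ n).card : ℝ) ≤ 12 * y * Real.exp (2 + 24 * i + 24 * j) / Real.log y
      + 8 * n * (ρ - 1) ^ 2 * y + 3 * (ρ - 1) * y + 2 := by
  classical
  have hq0 : 0 ≤ q := by linarith
  have hy0 : 0 ≤ y := by linarith
  have hP0 : 0 < P := by linarith
  set S1 := (ivl q y r).filter fun a : ℕ => ∀ p : ℕ, p.Prime → p ∣ a → P < p →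
    ¬ (p : ℝ) ≤ P * ρ ^ n
  set S2 := (Finset.Ioc 0 ⌊2 * y⌋₊).filter fun a => ∃ v < n, ∃ p ∈ cls P ρ v, ∃ p' ∈ cls P ρ v,
      p * p' ∣ a
  set S3 := Finset.Ioc ⌊y⌋₊ ⌊ρ * y⌋₊
  set S4 := Finset.Ioc ⌊q * y / ρ⌋₊ ⌊q * y⌋₊
  have hsub : ivl q y r \ good q y r P ρ n ⊆ S1 ∪ (S2 ∪ (S3 ∪ S4)) := by
    intro a ha
    rw [Finset.mem_sdiff] at ha
    have hm := (mem_ivl hq0 hy0).1 ha.1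
    simp only [Finset.mem_union]
    rcases sdiff_good_cases hq0 hy0 hP hρ ha.1 ha.2 with h | h | h | h
    · exact Or.inl (Finset.mem_filter.2 ⟨ha.1, h⟩)
    · refine Or.inr (Or.inl (Finset.mem_filter.2 ⟨Finset.mem_Ioc.2 ⟨?_, ?_⟩, h⟩))
      · have : (0 : ℝ) < a := by linarith
        exact_mod_cast this
      · exact Nat.le_floor (by nlinarith)
    · refine Or.inr (Or.inr (Or.inl (Finset.mem_Ioc.2 ⟨?_, Nat.le_floor h⟩)))
      exact (Nat.floor_lt hy0).2 hm.1.1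
    · refine Or.inr (Or.inr (Or.inr (Finset.mem_Ioc.2 ⟨?_, Nat.le_floor hm.1.2⟩)))
      exact (Nat.floor_lt (by positivity)).2 h
  have hly := Real.log_pos hy
  have c1 : (S1.card : ℝ) ≤ 12 * y * Real.exp (2 + 24 * i + 24 * j) / Real.log y := by
    rw [le_div_iff₀ hly]
    refine sifted_card_le y P (P * ρ ^ n) i j hy.le hPi ?_ hyQ S1 fun a ha => ?_
    · exact hP.trans (le_mul_of_one_le_right hP0.le (one_le_pow₀ hρ))
    · have h := Finset.mem_filter.1 ha
      have hm := (mem_ivl hq0 hy0).1 h.1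
      exact ⟨hm.1.1, by nlinarith, h.2⟩
  have c2 : (S2.card : ℝ) ≤ n * (4 * (ρ - 1) ^ 2 * (2 * y)) :=
    card_pair_multiples_le (by positivity) hP0 hρ h1
  have c3 : (S3.card : ℝ) ≤ ρ * y - y + 1 := card_Ioc_floor_le hy0 (by nlinarith)
  have c4 : (S4.card : ℝ) ≤ q * y - q * y / ρ + 1 :=
    card_Ioc_floor_le (by positivity) (div_le_self (by positivity) hρ)
  have c4' : q * y - q * y / ρ ≤ 2 * (ρ - 1) * y := by
    have e : q * y - q * y / ρ = q * y * ((ρ - 1) / ρ) := by field_simp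
    have e2 : (ρ - 1) / ρ ≤ ρ - 1 := div_le_self (by linarith) hρ
    rw [e]
    calc q * y * ((ρ - 1) / ρ) ≤ 2 * y * (ρ - 1) := by gcongr
      _ = _ := by ring
  have := Finset.card_le_card hsub
  have u1 := Finset.card_union_le S1 (S2 ∪ (S3 ∪ S4))
  have u2 := Finset.card_union_le S2 (S3 ∪ S4)
  have u3 := Finset.card_union_le S3 S4
  have : ((ivl q y r \ good q y r P ρ n).card : ℝ) ≤ S1.card + (S2.card + (S3.card + S4.card)) := by
    exact_mod_cast by omega
  linarith
end Decomposition

section VarianceCore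

theorem tail_integrable (T : ℝ) (hT : 0 < T) :
    Integrable ((Set.Ioi T).indicator fun ξ : ℝ => ξ ^ (-2 : ℝ)) ∧
    ∫ ξ, (Set.Ioi T).indicator (fun ξ : ℝ => ξ ^ (-2 : ℝ)) ξ = 1 / T := by
  constructor
  · exact (integrable_indicator_iff measurableSet_Ioi).2 (integrableOn_Ioi_rpow_of_lt (by norm_num) hT)
  · rw [integral_indicator measurableSet_Ioi, integral_Ioi_rpow_of_lt (by norm_num) hT]
    norm_num [Real.rpow_neg_one]

theorem dirPoly_four_integrable (A B C D : Finset ℕ) (hA : ∀ n ∈ A, 1 ≤ n) (hB : ∀ n ∈ B, 1 ≤ n)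
    (hC : ∀ n ∈ C, 1 ≤ n) (hD : ∀ n ∈ D, 1 ≤ n) (δ : ℝ) :
    Integrable fun ξ => ‖dirPoly A ξ * dirPoly B ξ * dirPoly C ξ * dirPoly D ξ‖ ^ 2 *
      ‖FourierTransform.fourier (stepKer δ) ξ‖ ^ 2 := by
  have := (expSum_plancherel (A ×ˢ B ×ˢ C ×ˢ D)
    (fun t => Real.log ((t.1 * t.2.1 * t.2.2.1 * t.2.2.2 : ℕ) : ℝ)) _
    (stepKer_integrable δ) (stepKer_memLp δ)).1
  refine this.congr (Filter.Eventually.of_forall fun ξ => ?_)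
  simp only
  rw [expSum_four A B C D hA hB hC hD]

/-- Splitting the frequency range, and the middle range according to the size of the factors `p v`,
to bound a mean square with kernel `stepKer δ - stepKer δ₀`. -/
theorem variance_core (n : ℕ) (p r : ℕ → Finset ℕ) (G B C M : Finset ℕ)
    (hr1 : ∀ v < n, ∀ a ∈ r v, 1 ≤ a) (hB1 : ∀ a ∈ B, 1 ≤ a) (hC1 : ∀ a ∈ C, 1 ≤ a)
    (hM1 : ∀ a ∈ M, 1 ≤ a)
    (hG : ∀ ξ, dirPoly G ξ = ∑ v ∈ Finset.range n, dirPoly (p v) ξ * dirPoly (r v) ξ)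
    (F0 F1 T0 T1 Mb U δ δ0 : ℝ) (lam E : ℕ → ℝ)
    (hF0 : ∀ ξ, ‖dirPoly G ξ * dirPoly B ξ * dirPoly C ξ * dirPoly M ξ‖ ^ 2 ≤ F0)
    (hF1 : ∀ v < n, ∀ ξ, ‖dirPoly (p v) ξ * (dirPoly (r v) ξ * dirPoly B ξ * dirPoly C ξ)‖ ^ 2 ≤ F1)
    (hT0 : 0 < T0) (hT1 : 0 < T1)
    (hM : ∀ ξ, T0 ≤ |ξ| → |ξ| ≤ T1 → ‖dirPoly M ξ‖ ≤ Mb)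
    (hδ : 0 < δ) (hδ0 : 0 < δ0)
    (hU : ∀ v < n, volume.real {ξ : ℝ | |ξ| ≤ T1 ∧ lam v ≤ ‖dirPoly (p v) ξ‖} ≤ U)
    (hE : ∀ v < n, ∫ ξ, ‖dirPoly (r v) ξ * dirPoly B ξ * dirPoly C ξ * dirPoly M ξ‖ ^ 2 *
      ‖FourierTransform.fourier (stepKer δ) ξ‖ ^ 2 ≤ E v)
    (hE0 : ∀ v < n, ∫ ξ, ‖dirPoly (r v) ξ * dirPoly B ξ * dirPoly C ξ * dirPoly M ξ‖ ^ 2 *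
      ‖FourierTransform.fourier (stepKer δ0) ξ‖ ^ 2 ≤ E v) :
    ∫ ξ, ‖dirPoly G ξ * dirPoly B ξ * dirPoly C ξ * dirPoly M ξ‖ ^ 2 *
      ‖FourierTransform.fourier (stepKer δ) ξ - FourierTransform.fourier (stepKer δ0) ξ‖ ^ 2 ≤
    F0 * (2 * Real.pi * T0 * (δ + δ0)) ^ 2 * (2 * T0)
      + F0 * ((1 / δ + 1 / δ0) / Real.pi) ^ 2 * (2 / T1)
      + n * ∑ v ∈ Finset.range n, (4 * F1 * Mb ^ 2 * U + 4 * lam v ^ 2 * E v) := by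
  classical
  have hpi := Real.pi_pos
  set kd := FourierTransform.fourier (stepKer δ) with hkd
  set k0 := FourierTransform.fourier (stepKer δ0) with hk0
  set A : ℕ → Set ℝ := fun v => {ξ : ℝ | |ξ| ≤ T1 ∧ lam v ≤ ‖dirPoly (p v) ξ‖}
  have hAm : ∀ v, MeasurableSet (A v) := fun v =>
    ((isClosed_le continuous_abs continuous_const).inter
      (isClosed_le continuous_const (dirPoly_continuous _).norm)).measurableSet
  have hAf : ∀ v, volume (A v) ≠ ⊤ := fun v => by
    refine ne_top_of_le_ne_top (b := volume (Set.Icc (-T1) T1)) (by simp) (measure_mono ?_)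
    exact fun ξ hξ => abs_le.1 hξ.1
  set tl := (Set.Ioi T1).indicator fun ξ : ℝ => ξ ^ (-2 : ℝ)
  set W : ℕ → ℝ → ℝ := fun v ξ =>
    ‖dirPoly (r v) ξ * dirPoly B ξ * dirPoly C ξ * dirPoly M ξ‖ ^ 2
  set g1 : ℝ → ℝ := (Set.Icc (-T0) T0).indicator fun _ => F0 * (2 * Real.pi * T0 * (δ + δ0)) ^ 2
  set g3 : ℝ → ℝ := fun ξ => F0 * ((1 / δ + 1 / δ0) / Real.pi) ^ 2 * (tl ξ + tl (-ξ))
  set g2 : ℕ → ℝ → ℝ := fun v ξ => (A v).indicator (fun _ => 4 * F1 * Mb ^ 2) ξ +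
    2 * lam v ^ 2 * (W v ξ * ‖kd ξ‖ ^ 2 + W v ξ * ‖k0 ξ‖ ^ 2)
  have hF0' : 0 ≤ F0 := le_trans (by positivity) (hF0 0)
  have htl0 : ∀ ξ, 0 ≤ tl ξ := fun ξ => Set.indicator_nonneg
    (fun x hx => Real.rpow_nonneg (hT1.le.trans (le_of_lt hx)) _) ξ
  obtain ⟨ht1, ht2⟩ := tail_integrable T1 hT1
  have i1 : Integrable g1 :=
    (integrable_indicator_iff measurableSet_Icc).2 (integrableOn_const (by simp) enorm_ne_top)
  have i3 : Integrable g3 := (ht1.add ht1.comp_neg).const_mul _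
  have iW : ∀ v < n, Integrable (fun ξ => W v ξ * ‖kd ξ‖ ^ 2) := fun v hv =>
    dirPoly_four_integrable _ _ _ _ (hr1 v hv) hB1 hC1 hM1 δ
  have iW0 : ∀ v < n, Integrable (fun ξ => W v ξ * ‖k0 ξ‖ ^ 2) := fun v hv =>
    dirPoly_four_integrable _ _ _ _ (hr1 v hv) hB1 hC1 hM1 δ0
  have iA : ∀ v, Integrable ((A v).indicator (fun _ => 4 * F1 * Mb ^ 2)) := fun v =>
    (integrable_indicator_iff (hAm v)).2 (integrableOn_const (hAf v) enorm_ne_top)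
  have i2 : ∀ v ∈ Finset.range n, Integrable (g2 v) := fun v hv =>
    (iA v).add (((iW v (Finset.mem_range.1 hv)).add (iW0 v (Finset.mem_range.1 hv))).const_mul _)
  have i2s : Integrable (fun ξ => n * ∑ v ∈ Finset.range n, g2 v ξ) :=
    (integrable_finsetSum _ i2).const_mul _
  have h20 : ∀ v < n, ∀ ξ, 0 ≤ g2 v ξ := by
    intro v hv ξ
    have : 0 ≤ F1 := le_trans (by positivity) (hF1 v hv 0)
    refine add_nonneg (Set.indicator_nonneg (fun _ _ => by positivity) _) ?_
    positivity
  have h10 : ∀ ξ, 0 ≤ g1 ξ := fun ξ => Set.indicator_nonneg (fun _ _ => by positivity) _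
  have h30 : ∀ ξ, 0 ≤ g3 ξ := fun ξ =>
    mul_nonneg (by positivity) (add_nonneg (htl0 _) (htl0 _))
  have h2s0 : ∀ ξ, 0 ≤ n * ∑ v ∈ Finset.range n, g2 v ξ := fun ξ =>
    mul_nonneg (by positivity) (Finset.sum_nonneg fun v hv => h20 v (Finset.mem_range.1 hv) ξ)
  have hpt : ∀ ξ, ‖dirPoly G ξ * dirPoly B ξ * dirPoly C ξ * dirPoly M ξ‖ ^ 2 *
      ‖kd ξ - k0 ξ‖ ^ 2 ≤ g1 ξ + g3 ξ + n * ∑ v ∈ Finset.range n, g2 v ξ := by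
    intro ξ
    have n1 := stepKer_fourier_le_one δ ξ hδ
    have n2 := stepKer_fourier_le_one δ0 ξ hδ0
    rcases le_or_gt |ξ| T0 with hξ | hξ
    · have e : g1 ξ = F0 * (2 * Real.pi * T0 * (δ + δ0)) ^ 2 :=
        Set.indicator_of_mem (Set.mem_Icc.2 (abs_le.1 hξ)) _
      have hk : ‖kd ξ - k0 ξ‖ ≤ 2 * Real.pi * T0 * (δ + δ0) := by
        have e1 : kd ξ - k0 ξ = (kd ξ - 1) - (k0 ξ - 1) := by ring
        rw [e1]
        refine (norm_sub_le _ _).trans ?_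
        have a1 := stepKer_fourier_sub_one_le δ ξ hδ
        have a2 := stepKer_fourier_sub_one_le δ0 ξ hδ0
        have a3 : 2 * Real.pi * |ξ| * δ ≤ 2 * Real.pi * T0 * δ := by gcongr
        have a4 : 2 * Real.pi * |ξ| * δ0 ≤ 2 * Real.pi * T0 * δ0 := by gcongr
        calc _ ≤ 2 * Real.pi * |ξ| * δ + 2 * Real.pi * |ξ| * δ0 := add_le_add a1 a2
          _ ≤ _ := by linarith
      have : ‖dirPoly G ξ * dirPoly B ξ * dirPoly C ξ * dirPoly M ξ‖ ^ 2 * ‖kd ξ - k0 ξ‖ ^ 2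
          ≤ F0 * (2 * Real.pi * T0 * (δ + δ0)) ^ 2 := by
        gcongr; exact hF0 ξ
      linarith [h30 ξ, h2s0 ξ]
    rcases lt_or_ge T1 |ξ| with hξ1 | hξ1
    · have hξ0 : 0 < |ξ| := hT1.trans hξ1
      have hξne := abs_pos.1 hξ0
      have e : 1 / |ξ| ^ 2 ≤ tl ξ + tl (-ξ) := by
        have key : ∀ z, T1 < z → tl z = 1 / z ^ 2 := by
          intro z hz
          have hz0 : 0 < z := hT1.trans hz
          rw [show tl z = z ^ (-2 : ℝ) from Set.indicator_of_mem hz _, Real.rpow_neg hz0.le, one_div]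
          norm_cast
        rcases le_total 0 ξ with h | h
        · rw [abs_of_nonneg h] at hξ1 ⊢
          rw [key ξ hξ1]; linarith [htl0 (-ξ)]
        · rw [abs_of_nonpos h] at hξ1 ⊢
          rw [key (-ξ) hξ1]; linarith [htl0 ξ]
      have hk : ‖kd ξ - k0 ξ‖ ≤ (1 / δ + 1 / δ0) / Real.pi * (1 / |ξ|) := by
        refine (norm_sub_le _ _).trans ?_
        have a1 := stepKer_fourier_decay δ ξ hδ hξne
        have a2 := stepKer_fourier_decay δ0 ξ hδ0 hξne
        calc _ ≤ 1 / (Real.pi * |ξ| * δ) + 1 / (Real.pi * |ξ| * δ0) := add_le_add a1 a2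
          _ = _ := by field_simp
      have : ‖dirPoly G ξ * dirPoly B ξ * dirPoly C ξ * dirPoly M ξ‖ ^ 2 * ‖kd ξ - k0 ξ‖ ^ 2
          ≤ F0 * ((1 / δ + 1 / δ0) / Real.pi * (1 / |ξ|)) ^ 2 := by
        gcongr; exact hF0 ξ
      have e3 : F0 * ((1 / δ + 1 / δ0) / Real.pi * (1 / |ξ|)) ^ 2 ≤ g3 ξ := by
        rw [mul_pow, ← mul_assoc, one_div_pow]
        exact mul_le_mul_of_nonneg_left e (by positivity)
      linarith [h10 ξ, h2s0 ξ]
    have hsum : ‖dirPoly G ξ * dirPoly B ξ * dirPoly C ξ * dirPoly M ξ‖ ^ 2 ≤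
        n * ∑ v ∈ Finset.range n,
          ‖dirPoly (p v) ξ * (dirPoly (r v) ξ * dirPoly B ξ * dirPoly C ξ * dirPoly M ξ)‖ ^ 2 := by
      have e : dirPoly G ξ * dirPoly B ξ * dirPoly C ξ * dirPoly M ξ = ∑ v ∈ Finset.range n,
          dirPoly (p v) ξ * (dirPoly (r v) ξ * dirPoly B ξ * dirPoly C ξ * dirPoly M ξ) := by
        rw [hG, Finset.sum_mul, Finset.sum_mul, Finset.sum_mul]
        exact Finset.sum_congr rfl fun v _ => by ring
      rw [e]
      calc _ ≤ (∑ v ∈ Finset.range n, ‖dirPoly (p v) ξ *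
            (dirPoly (r v) ξ * dirPoly B ξ * dirPoly C ξ * dirPoly M ξ)‖) ^ 2 := by
              gcongr; exact norm_sum_le _ _
        _ ≤ _ := by
          have := sq_sum_le_card_mul_sum_sq (s := Finset.range n) (f := fun v => ‖dirPoly (p v) ξ *
            (dirPoly (r v) ξ * dirPoly B ξ * dirPoly C ξ * dirPoly M ξ)‖)
          rwa [Finset.card_range] at this
    have hk2 : ‖kd ξ - k0 ξ‖ ^ 2 ≤ 2 * (‖kd ξ‖ ^ 2 + ‖k0 ξ‖ ^ 2) := by
      have := norm_sub_le (kd ξ) (k0 ξ)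
      calc _ ≤ (‖kd ξ‖ + ‖k0 ξ‖) ^ 2 := by gcongr
        _ ≤ _ := by nlinarith [sq_nonneg (‖kd ξ‖ - ‖k0 ξ‖)]
    have hk4 : ‖kd ξ - k0 ξ‖ ^ 2 ≤ 4 := by
      have := norm_sub_le (kd ξ) (k0 ξ)
      calc _ ≤ (2 : ℝ) ^ 2 := by gcongr; linarith
        _ = 4 := by norm_num
    have hv : ∀ v < n, ‖dirPoly (p v) ξ *
        (dirPoly (r v) ξ * dirPoly B ξ * dirPoly C ξ * dirPoly M ξ)‖ ^ 2 * ‖kd ξ - k0 ξ‖ ^ 2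
        ≤ g2 v ξ := by
      intro v hv
      have hF1' : 0 ≤ F1 := le_trans (by positivity) (hF1 v hv 0)
      rcases le_or_gt (lam v) ‖dirPoly (p v) ξ‖ with h | h
      · have e : (A v).indicator (fun _ => 4 * F1 * Mb ^ 2) ξ = 4 * F1 * Mb ^ 2 :=
          Set.indicator_of_mem (show ξ ∈ A v from ⟨hξ1, h⟩) _
        have h0 : 0 ≤ 2 * lam v ^ 2 * (W v ξ * ‖kd ξ‖ ^ 2 + W v ξ * ‖k0 ξ‖ ^ 2) := by positivity
        have h1 : ‖dirPoly (p v) ξ *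
            (dirPoly (r v) ξ * dirPoly B ξ * dirPoly C ξ * dirPoly M ξ)‖ ^ 2 ≤ F1 * Mb ^ 2 := by
          rw [← mul_assoc (dirPoly (p v) ξ), norm_mul _ (dirPoly M ξ), mul_pow]
          gcongr
          · exact hF1 v hv ξ
          · exact hM ξ hξ.le hξ1
        have := mul_le_mul h1 hk4 (by positivity) (by positivity)
        simp only [g2, e]
        linarith
      · have h0 : 0 ≤ (A v).indicator (fun _ => 4 * F1 * Mb ^ 2) ξ :=
          Set.indicator_nonneg (fun _ _ => by positivity) _
        have h1 : ‖dirPoly (p v) ξ *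
            (dirPoly (r v) ξ * dirPoly B ξ * dirPoly C ξ * dirPoly M ξ)‖ ^ 2
            ≤ lam v ^ 2 * W v ξ := by
          rw [norm_mul, mul_pow]
          gcongr
        have := mul_le_mul h1 hk2 (by positivity) (by positivity)
        simp only [g2]
        linarith
    calc _ ≤ (n * ∑ v ∈ Finset.range n, ‖dirPoly (p v) ξ *
          (dirPoly (r v) ξ * dirPoly B ξ * dirPoly C ξ * dirPoly M ξ)‖ ^ 2) * ‖kd ξ - k0 ξ‖ ^ 2 := by
            gcongr
      _ = n * ∑ v ∈ Finset.range n, ‖dirPoly (p v) ξ *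
          (dirPoly (r v) ξ * dirPoly B ξ * dirPoly C ξ * dirPoly M ξ)‖ ^ 2 * ‖kd ξ - k0 ξ‖ ^ 2 := by
            rw [mul_assoc, Finset.sum_mul]
      _ ≤ n * ∑ v ∈ Finset.range n, g2 v ξ := by
        gcongr with v hvv
        exact hv v (Finset.mem_range.1 hvv)
      _ ≤ _ := by linarith [h10 ξ, h30 ξ]
  have hle := integral_mono_of_nonneg (μ := volume)
    (Filter.Eventually.of_forall fun ξ => by positivity)
    ((i1.add i3).add i2s) (Filter.Eventually.of_forall hpt)
  refine hle.trans ?_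
  have s1 : ∫ ξ, g1 ξ = F0 * (2 * Real.pi * T0 * (δ + δ0)) ^ 2 * (2 * T0) := by
    rw [integral_indicator measurableSet_Icc, setIntegral_const, smul_eq_mul, mul_comm,
      Real.volume_real_Icc_of_le (by linarith)]
    ring
  have s3 : ∫ ξ, g3 ξ = F0 * ((1 / δ + 1 / δ0) / Real.pi) ^ 2 * (2 / T1) := by
    simp only [g3]
    rw [integral_const_mul, integral_add ht1 ht1.comp_neg, integral_neg_eq_self tl, ht2]
    ring
  have s2 : ∀ v < n, ∫ ξ, g2 v ξ ≤ 4 * F1 * Mb ^ 2 * U + 4 * lam v ^ 2 * E v := by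
    intro v hv
    have hF1' : 0 ≤ F1 := le_trans (by positivity) (hF1 v hv 0)
    have j : Integrable fun ξ => 2 * lam v ^ 2 * (W v ξ * ‖kd ξ‖ ^ 2 + W v ξ * ‖k0 ξ‖ ^ 2) :=
      ((iW v hv).add (iW0 v hv)).const_mul _
    simp only [g2]
    rw [integral_add (iA v) j, integral_const_mul,
      integral_add (iW v hv) (iW0 v hv), integral_indicator (hAm v), setIntegral_const, smul_eq_mul,
      mul_comm (volume.real (A v))]
    have b1 := hU v hv
    have b2 := hE v hv
    have b3 := hE0 v hv
    have b4 : 4 * F1 * Mb ^ 2 * volume.real (A v) ≤ 4 * F1 * Mb ^ 2 * U := by gcongr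
    have b5 : 2 * lam v ^ 2 * ((∫ ξ, W v ξ * ‖kd ξ‖ ^ 2) + ∫ ξ, W v ξ * ‖k0 ξ‖ ^ 2) ≤
        2 * lam v ^ 2 * (E v + E v) := by gcongr
    linarith
  have e := integral_add (i1.add i3) i2s
  have e2 := integral_add i1 i3
  simp only [Pi.add_apply] at e e2 ⊢
  rw [e, e2, s1, s3, integral_const_mul, integral_finsetSum _ i2]
  gcongr with v hvv
  exact s2 v (Finset.mem_range.1 hvv)

end VarianceCore

section GoodVariance

theorem norm_dirPoly_le_card (S : Finset ℕ) (ξ : ℝ) : ‖dirPoly S ξ‖ ≤ S.card := by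
  rw [dirPoly, expSum]
  refine (norm_sum_le _ _).trans ?_
  simp only [Complex.norm_exp_ofReal_mul_I]
  simp

theorem card_le_of_mem_bounds {S : Finset ℕ} {z : ℝ} (hz : 0 ≤ z)
    (h : ∀ a ∈ S, 1 ≤ a ∧ (a : ℝ) ≤ z) : (S.card : ℝ) ≤ z := by
  have : S ⊆ Finset.Icc 1 ⌊z⌋₊ := fun a ha =>
    Finset.mem_Icc.2 ⟨(h a ha).1, Nat.le_floor (h a ha).2⟩
  have := Finset.card_le_card this
  rw [Nat.card_Icc, Nat.add_sub_cancel] at this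
  exact le_trans (by exact_mod_cast this) (Nat.floor_le hz)

theorem prime_large_values_pow (S : Finset ℕ) (hS : ∀ p ∈ S, p.Prime) {x V ρ α : ℝ} (hx : 1 ≤ x)
    (hV : 1 ≤ V) (hρ : 1 ≤ ρ) (hα : 0 ≤ α) (hSV : ∀ p ∈ S, (p : ℝ) ≤ V * ρ) (hSc : (S.card : ℝ) ≤ V)
    (l : ℕ) (h1 : x ^ 9 ≤ V ^ l) (h2 : V ^ l ≤ x ^ 10) (h3 : ρ ^ l ≤ 3) :
    volume.real {ξ : ℝ | |ξ| ≤ x ^ 9 ∧ V ^ (1 - α) ≤ ‖dirPoly S ξ‖} ≤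
      64 * l.factorial * x ^ (20 * α) := by
  have hV0 : 0 < V := by linarith
  have hx0 : 0 < x := by linarith
  have h := prime_large_values S hS (V * ρ) (by positivity) hSV l (x ^ 9) (V ^ (1 - α))
    (by positivity) (by positivity)
  set u := volume.real {ξ : ℝ | |ξ| ≤ x ^ 9 ∧ V ^ (1 - α) ≤ ‖dirPoly S ξ‖}
  have e1 : (V ^ (1 - α)) ^ (2 * l) = V ^ l * V ^ l * (V ^ l) ^ (-(2 * α)) := by
    rw [← Real.rpow_natCast, ← Real.rpow_natCast, ← Real.rpow_mul hV0.le, ← Real.rpow_mul hV0.le,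
      ← Real.rpow_add hV0, ← Real.rpow_add hV0]
    congr 1; push_cast; ring
  have e2 : (V ^ l) ^ (2 * α) ≤ x ^ (20 * α) := by
    calc _ ≤ (x ^ 10) ^ (2 * α) := Real.rpow_le_rpow (by positivity) h2 (by positivity)
      _ = x ^ (20 * α) := by
        rw [← Real.rpow_natCast, ← Real.rpow_mul hx0.le]; congr 1; push_cast; ring
  have hVl : 0 < V ^ l := by positivity
  have h4 : V ^ l * V ^ l * (V ^ l) ^ (-(2 * α)) * u ≤
      V ^ l * V ^ l * (64 * l.factorial) := by
    rw [← e1]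
    refine h.trans ?_
    have a1 : 4 * Real.pi * x ^ 9 + (V * ρ) ^ l ≤ 16 * V ^ l := by
      rw [mul_pow]
      have := Real.pi_lt_d2
      have : 4 * Real.pi * x ^ 9 ≤ 13 * V ^ l := by gcongr; linarith
      nlinarith
    calc _ ≤ 4 * (16 * V ^ l) * (l.factorial * V ^ l) := by gcongr
      _ = _ := by ring
  have h5 : (V ^ l) ^ (-(2 * α)) * u ≤ 64 * l.factorial := by
    rw [mul_assoc] at h4
    exact le_of_mul_le_mul_left h4 (by positivity)
  rw [Real.rpow_neg hVl.le, inv_mul_le_iff₀ (by positivity)] at h5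
  calc u ≤ _ := h5
    _ ≤ x ^ (20 * α) * (64 * l.factorial) := by gcongr
    _ = _ := by ring

/-- A number of moments suited to `prime_large_values_pow`. -/
theorem exists_moment {x V K : ℝ} (hK : 1 ≤ K) (hL : 10 ≤ Real.log (Real.log x))
    (hKL : K * Real.log (Real.log x) ≤ Real.log x) (hV : Real.log x ^ K ≤ V) (hVx : V ≤ x)
    (hx : 1 ≤ x) :
    ∃ l : ℕ, x ^ 9 ≤ V ^ l ∧ V ^ l ≤ x ^ 10 ∧ (1 + 1 / Real.log x ^ 2) ^ l ≤ 3 ∧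
      (l.factorial : ℝ) ≤ x ^ (10 / K) := by
  set L := Real.log x with hLdef
  have hL0 : 10 ≤ L := hL.trans ((le_mul_of_one_le_left (by linarith) hK).trans hKL)
  have hx0 : 0 < x := by linarith
  have hlV : K * Real.log L ≤ Real.log V := by
    rw [← Real.log_rpow (by linarith)]
    exact Real.log_le_log (Real.rpow_pos_of_pos (by linarith) _) hV
  have hlV0 : 0 < Real.log V := lt_of_lt_of_le (by positivity) hlV
  have hV0 : 0 < V := lt_of_lt_of_le (Real.rpow_pos_of_pos (by linarith) _) hV
  have hVe : ∀ l : ℕ, V ^ l = Real.exp (l * Real.log V) := fun l => by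
    rw [Real.exp_nat_mul, Real.exp_log hV0]
  have hxe : ∀ l : ℕ, x ^ l = Real.exp (l * L) := fun l => by
    rw [Real.exp_nat_mul, Real.exp_log hx0]
  have hlVx : Real.log V ≤ L := Real.log_le_log hV0 hVx
  have c1 := Nat.le_ceil (9 * L / Real.log V)
  have c2 := Nat.ceil_lt_add_one (a := 9 * L / Real.log V) (by positivity)
  set l := ⌈9 * L / Real.log V⌉₊ with hl
  have c3 : (l : ℝ) * (K * Real.log L) ≤ 10 * L := by
    have : (l : ℝ) * (K * Real.log L) ≤ (9 * L / Real.log V + 1) * (K * Real.log L) := by gcongr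
    have e : 9 * L / Real.log V * (K * Real.log L) ≤ 9 * L := by
      rw [div_mul_eq_mul_div, div_le_iff₀ hlV0]; gcongr
    linarith
  have c4 : (l : ℝ) ≤ L := by
    have h10 : 10 * (l : ℝ) ≤ l * (K * Real.log L) := by
      rw [mul_comm]; gcongr; nlinarith
    linarith
  refine ⟨l, ?_, ?_, ?_, ?_⟩
  · rw [hxe, hVe, Real.exp_le_exp]
    rw [div_le_iff₀ hlV0] at c1
    push_cast; linarith
  · rw [hxe, hVe, Real.exp_le_exp]
    have : (l : ℝ) * Real.log V ≤ (9 * L / Real.log V + 1) * Real.log V := by gcongr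
    have e : 9 * L / Real.log V * Real.log V = 9 * L := by field_simp
    push_cast; linarith
  · have : (1 + 1 / L ^ 2 : ℝ) ≤ Real.exp (1 / L ^ 2) := by
      linarith [Real.add_one_le_exp (1 / L ^ 2)]
    calc _ ≤ Real.exp (1 / L ^ 2) ^ l := by gcongr
      _ = Real.exp (l * (1 / L ^ 2)) := by rw [Real.exp_nat_mul]
      _ ≤ Real.exp 1 := by
        rw [Real.exp_le_exp, mul_one_div, div_le_one (by positivity)]; nlinarith
      _ ≤ 3 := by linarith [Real.exp_one_lt_d9]
  · calc (l.factorial : ℝ) ≤ (l : ℝ) ^ l := by exact_mod_cast Nat.factorial_le_pow l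
      _ ≤ L ^ l := by gcongr
      _ = Real.exp (l * Real.log L) := by rw [Real.exp_nat_mul, Real.exp_log (by linarith)]
      _ ≤ Real.exp (L * (10 / K)) := by
        rw [Real.exp_le_exp, mul_div_assoc', le_div_iff₀ (by linarith)]; linarith
      _ = x ^ (10 / K) := by rw [Real.rpow_def_of_pos hx0]

set_option maxHeartbeats 1000000 in
theorem good_variance_explicit {σ K0 Y0 : ℝ} (hσ : 0 < σ) (hσ1 : σ ≤ 1) (hK0 : 0 ≤ K0)
    (hvdc : ∀ q y ξ : ℝ, ∀ r : ℕ, Y0 ≤ y → 1 ≤ q → q ≤ 2 → y ^ (1 / 16 : ℝ) ≤ |ξ| →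
      |ξ| ≤ y ^ (10 : ℕ) → ‖dirPoly (ivl q y r) ξ‖ ≤ K0 * y ^ (1 - σ))
    {x η : ℝ} {K A0 : ℕ} (hη : 0 ≤ η) (hη1 : η ≤ 1) (hK : 20 / σ ≤ K)
    (hx : 1 ≤ x) (hL : 10 ≤ Real.log (Real.log x)) (hKL : K * Real.log (Real.log x) ≤ Real.log x)
    (hLA : Real.log x ^ (10 * A0) ≤ x) (hY0 : Y0 ≤ x / Real.log x ^ A0)
    {q y y4 δ : ℝ} {r r4 n : ℕ} (hq : 1 ≤ q) (hq2 : q ≤ 2) (hy0 : 0 ≤ y) (hy : y ≤ x)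
    (hy4 : x / Real.log x ^ A0 ≤ y4) (hy4x : y4 ≤ x) (hn : (n : ℝ) ≤ Real.log x ^ 3)
    (hV : Real.log x ^ K * (1 + 1 / Real.log x ^ 2) ^ n ≤ x ^ η)
    {B C : Finset ℕ} (hB : ∀ b ∈ B, 1 ≤ b ∧ (b : ℝ) ≤ 2 * x) (hC : ∀ b ∈ C, 1 ≤ b ∧ (b : ℝ) ≤ 2 * x)
    (hδ : x ^ (-4 + η) ≤ δ) (hδ1 : δ ≤ x ^ (-(1 / 4) : ℝ)) :
    ∫ ξ, ‖dirPoly (good q y r (Real.log x ^ K) (1 + 1 / Real.log x ^ 2) n) ξ * dirPoly B ξ *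
        dirPoly C ξ * dirPoly (ivl q y4 r4) ξ‖ ^ 2 *
      ‖FourierTransform.fourier (stepKer δ) ξ -
        FourierTransform.fourier (stepKer (x ^ (-(1 / 4) : ℝ))) ξ‖ ^ 2 ≤
    100000 * x ^ (8 - 5 / 16 : ℝ) + 512 * x ^ 7 + Real.log x ^ 6 * (16384 * K0 ^ 2 * x ^ (8 - σ)
      + 2048 * 5 ^ 64 * Real.log x ^ 64 * x ^ 8 * Real.log x ^ (-(σ / 20 * K))) := by
  set L := Real.log x with hLdef
  set ρ := 1 + 1 / L ^ 2 with hρdef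
  set P := L ^ K with hPdef
  set δ0 := x ^ (-(1 / 4) : ℝ) with hδ0def
  have hx0 : 0 < x := by linarith
  have hK20 : 20 ≤ (K : ℝ) := le_trans (by rw [le_div_iff₀ hσ]; linarith) hK
  have hL10 : 10 ≤ L := hL.trans ((le_mul_of_one_le_left (by linarith) (by linarith)).trans hKL)
  have hρ1 : 1 ≤ ρ := by rw [hρdef]; linarith [show 0 ≤ 1 / L ^ 2 by positivity]
  have hρ2 : ρ - 1 ≤ 1 / 2 := by
    have : 1 / L ^ 2 ≤ 1 / 10 ^ 2 := by gcongr
    rw [hρdef]; linarith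
  have hP1 : L ≤ P := le_self_pow₀ (by linarith) (by rintro rfl; norm_num at hK20)
  have hP0 : 0 < P := by linarith
  have hδ00 : 0 < δ0 := by positivity
  have hδp : 0 < δ := lt_of_lt_of_le (by positivity) hδ
  set V : ℕ → ℝ := fun v => P * ρ ^ v with hVdef
  have hVP : ∀ v, P ≤ V v := fun v => le_mul_of_one_le_right hP0.le (one_le_pow₀ hρ1)
  have hV2 : ∀ v, 2 ≤ V v := fun v => by linarith [hVP v]
  have hVx : ∀ v < n, V v ≤ x ^ η := fun v hv => le_trans (by simp only [hVdef]; gcongr) hV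
  have hxη : x ^ η ≤ x := by
    calc x ^ η ≤ x ^ (1 : ℝ) := Real.rpow_le_rpow_of_exponent_le hx hη1
      _ = x := Real.rpow_one x
  have hcls : ∀ v, ∀ p ∈ cls P ρ v, p.Prime ∧ (p : ℝ) ≤ V v * ρ := fun v p hp => by
    have := (mem_cls hP0.le (by linarith)).1 hp
    exact ⟨this.2, by simp only [hVdef]; rw [mul_assoc, ← pow_succ]; exact this.1.2⟩
  have hclsc : ∀ v, ((cls P ρ v).card : ℝ) ≤ V v := fun v => by
    have := card_cls_le hP0.le hρ1 v
    have h2 := hV2 v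
    simp only [hVdef] at h2 ⊢
    nlinarith
  have hcof : ∀ v, ∀ m ∈ cof q y r P ρ v, 1 ≤ m ∧ (m : ℝ) ≤ 2 * x / V v := fun v m hm => by
    have hm := (mem_cof (by linarith) hy0 hP0.le (by linarith)).1 hm
    have hV0 : 0 < V v := by linarith [hV2 v]
    refine ⟨?_, hm.1.2.trans ?_⟩
    · have : (0 : ℝ) < m := lt_of_le_of_lt (by positivity) hm.1.1
      exact_mod_cast this
    · have : V v ≤ P * ρ ^ (v + 1) := by simp only [hVdef]; gcongr; omega
      gcongr
  have hivl : ∀ y' r', 0 ≤ y' → y' ≤ x → ∀ m ∈ ivl q y' r', 1 ≤ m ∧ (m : ℝ) ≤ 2 * x :=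
    fun y' r' h0 h1 m hm => by
    have hm := (mem_ivl (by linarith) h0).1 hm
    refine ⟨?_, hm.1.2.trans (by gcongr)⟩
    have : (0 : ℝ) < m := by linarith [hm.1.1]
    exact_mod_cast this
  have hy40 : 0 ≤ y4 := le_trans (by positivity) hy4
  have nrm : ∀ S : Finset ℕ, (∀ m ∈ S, 1 ≤ m ∧ (m : ℝ) ≤ 2 * x) → ∀ ξ, ‖dirPoly S ξ‖ ≤ 2 * x :=
    fun S hS ξ => (norm_dirPoly_le_card S ξ).trans (card_le_of_mem_bounds (by positivity) hS)
  have hM2 := hivl y4 r4 hy40 hy4x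
  have hvd : ∀ ξ, x ^ (1 / 16 : ℝ) ≤ |ξ| → |ξ| ≤ x ^ 9 →
      ‖dirPoly (ivl q y4 r4) ξ‖ ≤ K0 * x ^ (1 - σ) := by
    intro ξ h1 h2
    refine (hvdc q y4 ξ r4 (hY0.trans hy4) hq hq2 ?_ ?_).trans ?_
    · refine le_trans ?_ h1
      gcongr
    · refine h2.trans ?_
      calc x ^ 9 = x ^ 10 / x := by field_simp
        _ ≤ x ^ 10 / L ^ (10 * A0) := by gcongr
        _ = (x / L ^ A0) ^ 10 := by rw [div_pow, ← pow_mul, mul_comm A0]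
        _ ≤ y4 ^ 10 := by gcongr
    · gcongr
  set X : ℕ → ℝ := fun v => 16 * x ^ 4 / V v
  have hXδ : ∀ δ', x ^ (-4 + η) ≤ δ' → ∀ v < n, 1 / δ' ≤ X v := by
    intro δ' hδ' v hv
    calc 1 / δ' ≤ 1 / x ^ (-4 + η) := by gcongr
      _ = x ^ 4 / x ^ η := by
        rw [one_div, ← Real.rpow_neg hx0.le, neg_add, neg_neg, ← sub_eq_add_neg,
          Real.rpow_sub hx0]
        norm_cast
      _ ≤ x ^ 4 / V v := by
        have := hV2 v
        have := hVx v hv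
        gcongr
      _ ≤ X v := by
        have := hV2 v
        simp only [X]; gcongr
        nlinarith [pow_pos hx0 4]
  have hX1 : ∀ v < n, 1 ≤ X v := by
    intro v hv
    refine le_trans ?_ (hXδ δ hδ v hv)
    rw [le_div_iff₀ hδp, one_mul]
    exact hδ1.trans (Real.rpow_le_one_of_one_le_of_nonpos hx (by norm_num))
  have hXlog : ∀ v < n, 1 + Real.log (X v) ≤ 5 * L := by
    intro v hv
    have hX0 : 0 < X v := by linarith [hX1 v hv]
    have : X v ≤ 8 * x ^ 4 := by
      simp only [X]
      rw [div_le_iff₀ (by linarith [hV2 v])]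
      nlinarith [hV2 v, pow_pos hx0 4]
    have h2 := Real.log_le_log hX0 this
    rw [Real.log_mul (by norm_num) (by positivity), Real.log_pow] at h2
    have h8 : Real.log 8 ≤ 7 := by
      have := Real.log_le_sub_one_of_pos (show (0 : ℝ) < 8 by norm_num); linarith
    push_cast at h2
    linarith
  have hmv : ∀ δ', x ^ (-4 + η) ≤ δ' → ∀ v < n, ∫ ξ, ‖dirPoly (cof q y r P ρ v) ξ * dirPoly B ξ *
      dirPoly C ξ * dirPoly (ivl q y4 r4) ξ‖ ^ 2 *
      ‖FourierTransform.fourier (stepKer δ') ξ‖ ^ 2 ≤ 2 * X v ^ 2 * (5 * L) ^ 64 := by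
    intro δ' hδ' v hv
    have hδ'0 : 0 < δ' := lt_of_lt_of_le (by positivity) hδ'
    have hX1' := hX1 v hv
    refine (dirPoly_four_mean_value _ B C _ (fun a ha => (hcof v a ha).1) (fun a ha => (hB a ha).1)
      (fun a ha => (hC a ha).1) (fun a ha => (hM2 a ha).1) (X v) δ' hδ'0 hX1' ?_).trans ?_
    · intro a ha b hb c hc d hd
      have hV0 : 0 < V v := by linarith [hV2 v]
      calc (a : ℝ) * b * c * d ≤ (2 * x / V v) * (2 * x) * (2 * x) * (2 * x) := by
            have := (hcof v a ha).2
            have := (hB b hb).2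
            have := (hC c hc).2
            have := (hM2 d hd).2
            gcongr
        _ = X v := by simp only [X]; ring
    · have h1 := hXδ δ' hδ' v hv
      have h2 := hXlog v hv
      have h3 : 0 ≤ Real.log (X v) := Real.log_nonneg hX1'
      calc _ ≤ (X v + X v) * (X v * (5 * L) ^ 64) := by gcongr
        _ = _ := by ring
  have hδ0' : x ^ (-4 + η) ≤ δ0 := hδ.trans hδ1
  have hα : (0 : ℝ) ≤ σ / 40 := by positivity
  have key := variance_core n (cls P ρ) (cof q y r P ρ) (good q y r P ρ n) B C (ivl q y4 r4)
    (fun v _ a ha => (hcof v a ha).1) (fun a ha => (hB a ha).1) (fun a ha => (hC a ha).1)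
    (fun a ha => (hM2 a ha).1) (dirPoly_good (by linarith) hy0 (by linarith) hρ1)
    (256 * x ^ 8) (64 * x ^ 6) (x ^ (1 / 16 : ℝ)) (x ^ 9) (K0 * x ^ (1 - σ))
    (64 * x ^ (σ / 2) * x ^ (20 * (σ / 40))) δ δ0 (fun v => V v ^ (1 - σ / 40))
    (fun v => 2 * X v ^ 2 * (5 * L) ^ 64) ?_ ?_ (by positivity) (by positivity) hvd hδp hδ00 ?_
    (hmv δ hδ) (hmv δ0 hδ0')
  · refine key.trans ?_
    have t1 : 256 * x ^ 8 * (2 * Real.pi * x ^ (1 / 16 : ℝ) * (δ + δ0)) ^ 2 *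
        (2 * x ^ (1 / 16 : ℝ)) ≤ 100000 * x ^ (8 - 5 / 16 : ℝ) := by
      have hpi := Real.pi_lt_d2
      have hpi0 := Real.pi_pos
      calc _ ≤ 256 * x ^ 8 * (2 * 3.15 * x ^ (1 / 16 : ℝ) * (δ0 + δ0)) ^ 2 *
            (2 * x ^ (1 / 16 : ℝ)) := by gcongr
        _ = (512 * (4 * 3.15) ^ 2) * (x ^ (8 : ℝ) * x ^ (1 / 16 : ℝ) * x ^ (1 / 16 : ℝ) *
            x ^ (1 / 16 : ℝ) * δ0 * δ0) := by
          rw [show (x ^ 8 : ℝ) = x ^ (8 : ℝ) by norm_cast]; ring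
        _ = (512 * (4 * 3.15) ^ 2) * x ^ (8 - 5 / 16 : ℝ) := by
          simp only [hδ0def]
          rw [← Real.rpow_add hx0, ← Real.rpow_add hx0, ← Real.rpow_add hx0, ← Real.rpow_add hx0,
            ← Real.rpow_add hx0]
          norm_num
        _ ≤ _ := by gcongr; norm_num
    have t2 : 256 * x ^ 8 * ((1 / δ + 1 / δ0) / Real.pi) ^ 2 * (2 / x ^ 9) ≤ 512 * x ^ 7 := by
      have hd : ∀ δ', x ^ (-4 + η) ≤ δ' → 1 / δ' ≤ x ^ 4 := by
        intro δ' hδ'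
        calc 1 / δ' ≤ 1 / x ^ (-4 + η) := by gcongr
          _ = x ^ (4 - η) := by
            rw [one_div, ← Real.rpow_neg hx0.le]; congr 1; ring
          _ ≤ x ^ (4 : ℝ) := Real.rpow_le_rpow_of_exponent_le hx (by linarith)
          _ = x ^ 4 := by norm_cast
      have h3 := Real.pi_gt_three
      have : (1 / δ + 1 / δ0) / Real.pi ≤ x ^ 4 := by
        rw [div_le_iff₀ Real.pi_pos]
        nlinarith [hd δ hδ, hd δ0 hδ0', pow_pos hx0 4]
      calc _ ≤ 256 * x ^ 8 * (x ^ 4) ^ 2 * (2 / x ^ 9) := by gcongr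
        _ = _ := by field_simp; ring
    have t3 : ∀ v ∈ Finset.range n, 4 * (64 * x ^ 6) * (K0 * x ^ (1 - σ)) ^ 2 *
        (64 * x ^ (σ / 2) * x ^ (20 * (σ / 40))) +
        4 * (V v ^ (1 - σ / 40)) ^ 2 * (2 * X v ^ 2 * (5 * L) ^ 64) ≤
        16384 * K0 ^ 2 * x ^ (8 - σ) + 2048 * 5 ^ 64 * L ^ 64 * x ^ 8 * L ^ (-(σ / 20 * K)) := by
      intro v hv
      have hV0 : 0 < V v := by linarith [hV2 v]
      refine add_le_add (le_of_eq ?_) ?_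
      · rw [show (x ^ 6 : ℝ) = x ^ (6 : ℝ) by norm_cast]
        calc _ = 16384 * K0 ^ 2 * (x ^ (6 : ℝ) * x ^ (1 - σ) * x ^ (1 - σ) * x ^ (σ / 2) *
              x ^ (20 * (σ / 40))) := by ring
          _ = _ := by
            rw [← Real.rpow_add hx0, ← Real.rpow_add hx0, ← Real.rpow_add hx0, ← Real.rpow_add hx0]
            congr 2; ring
      · have e1 : (V v ^ (1 - σ / 40)) ^ 2 = V v ^ 2 * V v ^ (-(σ / 20)) := by
          rw [← Real.rpow_natCast, ← Real.rpow_natCast, ← Real.rpow_mul hV0.le,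
            ← Real.rpow_add hV0]
          congr 1; push_cast; ring
        have e2 : V v ^ (-(σ / 20)) ≤ L ^ (-(σ / 20 * K)) := by
          have : L ^ (-(σ / 20 * K)) = P ^ (-(σ / 20)) := by
            rw [hPdef, ← Real.rpow_natCast, ← Real.rpow_mul (by linarith)]; congr 1; ring
          rw [this]
          exact Real.rpow_le_rpow_of_nonpos hP0 (hVP v) (by linarith)
        rw [e1]
        calc _ = 2048 * 5 ^ 64 * L ^ 64 * x ^ 8 * V v ^ (-(σ / 20)) := by
              simp only [X]; field_simp; ring
          _ ≤ _ := by gcongr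
    have t4 := Finset.sum_le_card_nsmul _ _ _ t3
    rw [Finset.card_range, nsmul_eq_mul] at t4
    have t5 : (n : ℝ) * ∑ v ∈ Finset.range n, (4 * (64 * x ^ 6) * (K0 * x ^ (1 - σ)) ^ 2 *
        (64 * x ^ (σ / 2) * x ^ (20 * (σ / 40))) +
        4 * (V v ^ (1 - σ / 40)) ^ 2 * (2 * X v ^ 2 * (5 * L) ^ 64)) ≤
        L ^ 6 * (16384 * K0 ^ 2 * x ^ (8 - σ) +
          2048 * 5 ^ 64 * L ^ 64 * x ^ 8 * L ^ (-(σ / 20 * K))) := by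
      calc _ ≤ (n : ℝ) * (n * (16384 * K0 ^ 2 * x ^ (8 - σ) +
          2048 * 5 ^ 64 * L ^ 64 * x ^ 8 * L ^ (-(σ / 20 * K)))) := by gcongr
        _ ≤ L ^ 3 * (L ^ 3 * (16384 * K0 ^ 2 * x ^ (8 - σ) +
          2048 * 5 ^ 64 * L ^ 64 * x ^ 8 * L ^ (-(σ / 20 * K)))) := by gcongr
        _ = _ := by ring
    linarith
  · intro ξ
    have g1 := nrm (good q y r P ρ n) (fun m hm => hivl y r hy0 hy m
      (good_subset (by linarith) hy0 (by linarith) hρ1 hm)) ξ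
    rw [norm_mul, norm_mul, norm_mul]
    calc _ ≤ (2 * x * (2 * x) * (2 * x) * (2 * x)) ^ 2 := by
          gcongr
          exacts [nrm B hB ξ, nrm C hC ξ, nrm _ hM2 ξ]
      _ = _ := by ring
  · intro v hv ξ
    have hV0 : 0 < V v := by linarith [hV2 v]
    rw [norm_mul, norm_mul, norm_mul]
    calc _ ≤ (V v * (2 * x / V v * (2 * x) * (2 * x))) ^ 2 := by
          gcongr
          · exact (norm_dirPoly_le_card _ ξ).trans (hclsc v)
          · exact (norm_dirPoly_le_card _ ξ).trans (card_le_of_mem_bounds (by positivity) (hcof v))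
          · exact nrm B hB ξ
          · exact nrm C hC ξ
      _ = _ := by field_simp; ring
  · intro v hv
    have hKK : (1 : ℝ) ≤ K := by linarith
    obtain ⟨l, l1, l2, l3, l4⟩ := exists_moment (V := V v) hKK hL hKL
      (by rw [Real.rpow_natCast]; exact hVP v) ((hVx v hv).trans hxη) hx
    refine (prime_large_values_pow (cls P ρ v) (fun p hp => (hcls v p hp).1) hx
      (by linarith [hV2 v]) hρ1 hα (fun p hp => (hcls v p hp).2) (hclsc v) l l1 l2 l3).trans ?_
    gcongr
    refine l4.trans (Real.rpow_le_rpow_of_exponent_le hx ?_)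
    rw [div_le_iff₀ hσ] at hK
    rw [div_le_iff₀ (by linarith)]
    linarith

theorem eventually_mul_log_pow_le (c : ℝ) (k : ℕ) {s : ℝ} (hs : 0 < s) :
    ∀ᶠ x in Filter.atTop, c * Real.log x ^ k ≤ x ^ s := by
  have h := isLittleO_log_rpow_rpow_atTop (k : ℝ) hs
  have h2 := h.def (c := 1 / (|c| + 1)) (by positivity)
  filter_upwards [h2, Filter.eventually_ge_atTop 1] with x hx hx1
  have hL := Real.log_nonneg hx1
  rw [Real.rpow_natCast, Real.norm_of_nonneg (by positivity), Real.norm_of_nonneg (by positivity),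
    one_div_mul_eq_div, le_div_iff₀ (by positivity)] at hx
  have : 0 ≤ Real.log x ^ k := by positivity
  nlinarith [le_abs_self c]

theorem good_variance (A0 B0 : ℕ) : ∃ K : ℕ, 2 ≤ K ∧ ∀ η : ℝ, 0 ≤ η → η ≤ 1 →
    ∀ᶠ x : ℝ in Filter.atTop, ∀ (q y y4 δ : ℝ) (r r4 n : ℕ) (B C : Finset ℕ), 1 ≤ q → q ≤ 2 →
      0 ≤ y → y ≤ x → x / Real.log x ^ A0 ≤ y4 → y4 ≤ x → (n : ℝ) ≤ Real.log x ^ 3 →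
      Real.log x ^ K * (1 + 1 / Real.log x ^ 2) ^ n ≤ x ^ η →
      (∀ b ∈ B, 1 ≤ b ∧ (b : ℝ) ≤ 2 * x) → (∀ b ∈ C, 1 ≤ b ∧ (b : ℝ) ≤ 2 * x) →
      x ^ (-4 + η) ≤ δ → δ ≤ x ^ (-(1 / 4) : ℝ) →
      ∫ ξ, ‖dirPoly (good q y r (Real.log x ^ K) (1 + 1 / Real.log x ^ 2) n) ξ * dirPoly B ξ *
        dirPoly C ξ * dirPoly (ivl q y4 r4) ξ‖ ^ 2 *
      ‖FourierTransform.fourier (stepKer δ) ξ -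
        FourierTransform.fourier (stepKer (x ^ (-(1 / 4) : ℝ))) ξ‖ ^ 2 ≤
      x ^ 8 / Real.log x ^ B0 := by
  obtain ⟨σ, hσ, hσ1, K0, Y0, hK0, hY01, hvdc⟩ := norm_dirPoly_ivl_le
  have hK := Nat.le_ceil (20 * (B0 + 71) / σ)
  set K := ⌈20 * (B0 + 71) / σ⌉₊
  have hKc : (20 * (B0 + 71) : ℝ) ≤ K * σ := by rwa [div_le_iff₀ hσ] at hK
  refine ⟨K, ?_, fun η hη hη1 => ?_⟩
  · by_contra! h
    have h1 : (K : ℝ) ≤ 1 := by exact_mod_cast Nat.le_of_lt_succ h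
    have : (0 : ℝ) ≤ B0 := by positivity
    have : (K : ℝ) * σ ≤ 1 * 1 := by gcongr
    linarith
  have hlog := Real.tendsto_log_atTop
  filter_upwards [Filter.eventually_ge_atTop 1,
    (hlog.comp hlog).eventually_ge_atTop 10,
    hlog.eventually (eventually_mul_log_pow_le K 1 one_pos),
    eventually_mul_log_pow_le 1 (10 * A0) one_pos,
    eventually_mul_log_pow_le Y0 A0 one_pos,
    eventually_mul_log_pow_le 400000 B0 (show (0 : ℝ) < 5 / 16 by norm_num),
    eventually_mul_log_pow_le 2048 B0 one_pos,
    eventually_mul_log_pow_le (4 * (16384 * K0 ^ 2)) (6 + B0) hσ,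
    hlog.eventually_ge_atTop (8192 * 5 ^ 64)] with x hx hLL hKL hA hY h1 h2 h3 h4
    q y y4 δ r r4 n B C hq hq2 hy0 hy hy4 hy4x hn hV hB hC hδ hδ1
  simp only [Function.comp] at hLL
  rw [Real.rpow_one] at hKL hA hY h2
  rw [pow_one] at hKL
  rw [one_mul] at hA
  set L := Real.log x with hL
  have hx0 : 0 < x := by linarith
  have hL1 : 1 ≤ L := le_trans (by norm_num) h4
  have hLB : 0 < L ^ B0 := by positivity
  refine (good_variance_explicit hσ hσ1 hK0 hvdc hη hη1 ?_ hx hLL hKL hA ?_ hq hq2 hy0 hy hy4 hy4x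
    hn hV hB hC hδ hδ1).trans ?_
  · rw [div_le_iff₀ hσ]
    have : (0 : ℝ) ≤ B0 := by positivity
    linarith
  · rwa [le_div_iff₀ (by positivity)]
  rw [← hL, le_div_iff₀ hLB, add_mul, add_mul]
  have hx8 : (x ^ 8 : ℝ) = x ^ (8 : ℝ) := by norm_cast
  have u1 : 100000 * x ^ (8 - 5 / 16 : ℝ) * L ^ B0 ≤ x ^ 8 / 4 := by
    rw [Real.rpow_sub hx0, ← hx8]
    calc _ = x ^ 8 / 4 * (400000 * L ^ B0) / x ^ (5 / 16 : ℝ) := by ring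
      _ ≤ x ^ 8 / 4 * x ^ (5 / 16 : ℝ) / x ^ (5 / 16 : ℝ) := by gcongr
      _ = _ := by field_simp
  have u2 : 512 * x ^ 7 * L ^ B0 ≤ x ^ 8 / 4 := by
    calc _ = x ^ 7 / 4 * (2048 * L ^ B0) := by ring
      _ ≤ x ^ 7 / 4 * x := by gcongr
      _ = _ := by ring
  have u3 : L ^ 6 * (16384 * K0 ^ 2 * x ^ (8 - σ)) * L ^ B0 ≤ x ^ 8 / 4 := by
    rw [Real.rpow_sub hx0, ← hx8]
    calc _ = x ^ 8 / 4 * (4 * (16384 * K0 ^ 2) * L ^ (6 + B0)) / x ^ σ := by ring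
      _ ≤ x ^ 8 / 4 * x ^ σ / x ^ σ := by gcongr
      _ = _ := by field_simp
  have u4 : L ^ 6 * (2048 * 5 ^ 64 * L ^ 64 * x ^ 8 * L ^ (-(σ / 20 * K))) * L ^ B0 ≤ x ^ 8 / 4 := by
    have e : L ^ (-(σ / 20 * K)) ≤ (L ^ (B0 + 71))⁻¹ := by
      rw [← Real.rpow_natCast, ← Real.rpow_neg (by linarith)]
      refine Real.rpow_le_rpow_of_exponent_le hL1 ?_
      push_cast
      linarith
    calc _ ≤ L ^ 6 * (2048 * 5 ^ 64 * L ^ 64 * x ^ 8 * (L ^ (B0 + 71))⁻¹) * L ^ B0 := by gcongr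
      _ = x ^ 8 / 4 * ((8192 * 5 ^ 64) / L) := by field_simp; ring
      _ ≤ x ^ 8 / 4 * 1 := by
        gcongr
        exact (div_le_one (by linarith)).2 h4
      _ = _ := mul_one _
  rw [mul_add (L ^ 6), add_mul]
  have : 0 ≤ x ^ 8 := by positivity
  linarith

end GoodVariance

section GoodCard

set_option maxHeartbeats 1000000 in
theorem eventually_card_sdiff_good_le (A0 K : ℕ) {η : ℝ} (hη : 0 < η) (hη1 : η ≤ 1) (hK : 2 ≤ K) :
    ∀ᶠ x : ℝ in Filter.atTop, ∃ n : ℕ, (n : ℝ) ≤ Real.log x ^ 3 ∧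
      Real.log x ^ K * (1 + 1 / Real.log x ^ 2) ^ n ≤ x ^ η ∧
      ∀ (q y : ℝ) (r : ℕ), 1 ≤ q → q ≤ 2 → x / Real.log x ^ A0 ≤ y → y ≤ x →
        ((ivl q y r \ good q y r (Real.log x ^ K) (1 + 1 / Real.log x ^ 2) n).card : ℝ) ≤
          y * Real.log x ^ (-(3 / 4) : ℝ) := by
  obtain ⟨j, hj⟩ := pow_unbounded_of_one_lt (16 / η) (one_lt_two (α := ℝ))
  have hlog := Real.tendsto_log_atTop
  have hi : ∀ᶠ z : ℝ in Filter.atTop, (K : ℝ) * z ≤ Real.log 2 * 2 ^ ⌊z / 240⌋₊ := by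
    have h1 := (Filter.tendsto_id (α := ℝ) (x := Filter.atTop)).atTop_div_const (show (0 : ℝ) < 240 by norm_num)
    have h2 := Filter.tendsto_id.eventually (isLittleO_pow_const_const_pow_of_one_lt (R := ℝ) 1
      (one_lt_two (α := ℝ))|>.def (c := Real.log 2 / (960 * (K + 1))) (by positivity))
    have h3 := (tendsto_nat_floor_atTop (α := ℝ)).comp h1
    filter_upwards [h3.eventually h2, Filter.eventually_ge_atTop 240] with z hz hz2
    simp only [Function.comp, id] at hz
    rw [pow_one, Real.norm_of_nonneg (by positivity), Real.norm_of_nonneg (by positivity)] at hz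
    have hf := Nat.lt_floor_add_one (z / 240)
    have hf1 : (1 : ℝ) ≤ ⌊z / 240⌋₊ := by
      have : 1 ≤ ⌊z / 240⌋₊ := Nat.le_floor (by push_cast; linarith)
      exact_mod_cast this
    have hzf : z ≤ 480 * (⌊z / 240⌋₊ : ℝ) := by linarith
    have hl2 := Real.log_pos (one_lt_two (α := ℝ))
    set F := (⌊z / 240⌋₊ : ℝ)
    set R := (2 : ℝ) ^ ⌊z / 240⌋₊
    have : F * (960 * (K + 1)) ≤ Real.log 2 * R := by
      rw [div_mul_eq_mul_div, le_div_iff₀ (by positivity)] at hz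
      exact hz
    have : (K : ℝ) * z ≤ K * (480 * F) := by gcongr
    have : 0 ≤ (K : ℝ) * F := by positivity
    nlinarith
  filter_upwards [Filter.eventually_ge_atTop 1, hlog.eventually_ge_atTop 10,
    (hlog.comp hlog).eventually hi, (hlog.comp hlog).eventually_ge_atTop 0,
    eventually_mul_log_pow_le 1 K (show 0 < η / 2 by positivity),
    eventually_mul_log_pow_le 1 A0 (show (0 : ℝ) < 1 / 2 by norm_num),
    eventually_mul_log_pow_le 8 (A0 + 1) one_pos,
    hlog.eventually (eventually_mul_log_pow_le 1 1 (show (0 : ℝ) < 1 / 20 by norm_num)),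
    hlog.eventually_ge_atTop (4 / η),
    hlog.eventually ((tendsto_rpow_atTop (show (0 : ℝ) < 3 / 20 by norm_num)).eventually_ge_atTop
      (4 * (24 * Real.exp (2 + 24 * j)))),
    hlog.eventually ((tendsto_rpow_atTop (show (0 : ℝ) < 1 / 4 by norm_num)).eventually_ge_atTop
      32)]
    with x hx hL10 hPi hLL hPη hLA hLA1 h20 hLη hLe hL32
  simp only [Function.comp] at hPi hLL
  clear h20
  set L := Real.log x with hL
  have hx0 : 0 < x := by linarith
  have hL0 : 0 < L := by linarith
  rw [one_mul] at hPη hLA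
  rw [Real.rpow_one] at hLA1
  set ρ := 1 + 1 / L ^ 2 with hρ
  have hρ1 : 1 ≤ ρ := by rw [hρ]; linarith [show 0 ≤ 1 / L ^ 2 by positivity]
  set P := L ^ K with hP
  have hP1 : L ≤ P := le_self_pow₀ (by linarith) (by omega)
  set n := ⌊η / 2 * L ^ 3⌋₊ with hn
  have hn1 : (n : ℝ) ≤ η / 2 * L ^ 3 := Nat.floor_le (by positivity)
  have hn2 : η / 2 * L ^ 3 < n + 1 := Nat.lt_floor_add_one _
  have hxe : ∀ s : ℝ, x ^ s = Real.exp (s * L) := fun s => by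
    rw [Real.rpow_def_of_pos hx0, mul_comm]
  have hρn : ρ ^ n = Real.exp (n * Real.log ρ) := by
    rw [Real.exp_nat_mul, Real.exp_log (by linarith)]
  have hlρ1 : Real.log ρ ≤ 1 / L ^ 2 := by
    have := Real.log_le_sub_one_of_pos (show 0 < ρ by linarith)
    rw [hρ] at this ⊢; linarith
  have hlρ2 : 1 / (2 * L ^ 2) ≤ Real.log ρ := by
    have := Real.one_sub_inv_le_log_of_pos (show 0 < ρ by linarith)
    refine le_trans ?_ this
    have e : 1 - ρ⁻¹ = 1 / (L ^ 2 + 1) := by rw [hρ]; field_simp; ring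
    rw [e]
    gcongr
    nlinarith
  have hρup : ρ ^ n ≤ x ^ (η / 2) := by
    rw [hρn, hxe, Real.exp_le_exp]
    calc (n : ℝ) * Real.log ρ ≤ (η / 2 * L ^ 3) * (1 / L ^ 2) := by
          gcongr
          exact Real.log_nonneg hρ1
      _ = _ := by field_simp
  have hηL : 4 ≤ η * L := by rw [div_le_iff₀ hη] at hLη; linarith
  have hρlo : x ^ (η / 8) ≤ ρ ^ n := by
    rw [hρn, hxe, Real.exp_le_exp]
    have : η / 4 * L ^ 3 ≤ n := by nlinarith [pow_pos hL0 2, pow_pos hL0 3]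
    calc _ = (η / 4 * L ^ 3) * (1 / (2 * L ^ 2)) := by field_simp; norm_num
      _ ≤ _ := by gcongr
  refine ⟨n, ?_, ?_, ?_⟩
  · exact hn1.trans (mul_le_of_le_one_left (by positivity) (by linarith))
  · calc _ ≤ x ^ (η / 2) * x ^ (η / 2) := by gcongr
      _ = _ := by rw [← Real.rpow_add hx0]; congr 1; ring
  intro q y r hq hq2 hy hyx
  have hy12 : x ^ (1 / 2 : ℝ) ≤ y := by
    refine le_trans ?_ hy
    rw [le_div_iff₀ (by positivity)]
    calc _ ≤ x ^ (1 / 2 : ℝ) * x ^ (1 / 2 : ℝ) := by gcongr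
      _ = x := by rw [← Real.rpow_add hx0]; norm_num
  have hly : L / 2 ≤ Real.log y := by
    have := Real.log_le_log (by positivity) hy12
    rw [Real.log_rpow hx0] at this; linarith
  have hy0 : 0 < y := lt_of_lt_of_le (by positivity) hy12
  have hy1 : 1 < y := by
    by_contra! h
    have := Real.log_nonpos hy0.le h
    linarith
  have hy8 : 8 * L ≤ y := by
    refine le_trans ?_ hy
    rw [le_div_iff₀ (by positivity)]
    calc _ = 8 * L ^ (A0 + 1) := by ring
      _ ≤ x := hLA1
  set i := ⌊Real.log L / 240⌋₊ with hi
  have hi1 : (i : ℝ) ≤ Real.log L / 240 := Nat.floor_le (by positivity)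
  have hPi' : P ≤ 2 ^ 2 ^ i := by
    rw [← Real.log_le_log_iff (by positivity) (by positivity), Real.log_pow, Real.log_pow]
    push_cast
    linarith
  have hyQ : 2 * y ≤ (P * ρ ^ n) ^ 2 ^ j := by
    rw [div_lt_iff₀ hη] at hj
    calc 2 * y ≤ x * x := by
          have : 2 ≤ x := by linarith [Real.log_le_sub_one_of_pos hx0]
          gcongr
      _ = x ^ (2 : ℝ) := by rw [← pow_two]; norm_cast
      _ ≤ x ^ (η / 8 * (2 ^ j : ℕ)) := Real.rpow_le_rpow_of_exponent_le hx (by push_cast; linarith)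
      _ = (x ^ (η / 8)) ^ 2 ^ j := by rw [Real.rpow_mul hx0.le, Real.rpow_natCast]
      _ ≤ _ := by
        gcongr
        exact hρlo.trans (le_mul_of_one_le_left (by positivity) (by linarith))
  have hρe : ρ - 1 = 1 / L ^ 2 := by rw [hρ]; ring
  have hPρ : 1 ≤ P * (ρ - 1) := by
    rw [hρe, mul_one_div, one_le_div (by positivity)]
    exact pow_le_pow_right₀ (by linarith) hK
  refine (card_sdiff_good_le hq hq2 hy1 (by linarith) hρ1 hPρ i j hPi' hyQ).trans ?_
  set E := Real.exp (2 + 24 * (j : ℝ)) with hE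
  have hE0 : 0 < E := Real.exp_pos _
  set M := L ^ (-(3 / 4) : ℝ) with hM
  have hM0 : 0 < M := by positivity
  have hexp : Real.exp (2 + 24 * (i : ℝ) + 24 * j) ≤ E * L ^ (1 / 10 : ℝ) := by
    rw [hE, Real.rpow_def_of_pos hL0, ← Real.exp_add, Real.exp_le_exp]
    linarith
  have t1 : 12 * y * Real.exp (2 + 24 * (i : ℝ) + 24 * j) / Real.log y ≤ y * M / 4 := by
    rw [div_le_iff₀ (by linarith)]
    have e1 : L ^ (1 / 10 : ℝ) * L ^ (3 / 20 : ℝ) = M * L := by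
      rw [hM, ← Real.rpow_add hL0]
      nth_rewrite 3 [← Real.rpow_one L]
      rw [← Real.rpow_add hL0]; norm_num
    have e2 : 0 < L ^ (1 / 10 : ℝ) := by positivity
    calc _ ≤ 12 * y * (E * L ^ (1 / 10 : ℝ)) := by gcongr
      _ = y / 8 * (L ^ (1 / 10 : ℝ) * (4 * (24 * E))) := by ring
      _ ≤ y / 8 * (L ^ (1 / 10 : ℝ) * L ^ (3 / 20 : ℝ)) := by gcongr
      _ = y * M / 4 * (L / 2) := by rw [e1]; ring
      _ ≤ _ := by gcongr
  have e3 : 32 / L ≤ M := by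
    rw [div_le_iff₀ hL0]
    have : M * L = L ^ (1 / 4 : ℝ) := by
      rw [hM]
      nth_rewrite 2 [← Real.rpow_one L]
      rw [← Real.rpow_add hL0]; norm_num
    linarith
  have t2 : 8 * n * (ρ - 1) ^ 2 * y ≤ 8 * y / L := by
    rw [hρe]
    calc _ ≤ 8 * L ^ 3 * (1 / L ^ 2) ^ 2 * y := by
          gcongr
          exact hn1.trans (mul_le_of_le_one_left (by positivity) (by linarith))
      _ = _ := by field_simp
  have t3 : 3 * (ρ - 1) * y ≤ 3 * y / L := by
    rw [hρe]
    calc _ = 3 * y / L ^ 2 := by ring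
      _ ≤ _ := by
        gcongr
        exact le_self_pow₀ (by linarith) two_ne_zero
  have t4 : 2 ≤ y / L := by rw [le_div_iff₀ hL0]; linarith
  have t5 : y * (32 / L) ≤ y * M := by gcongr
  have t6 : 8 * y / L = 8 * (y / L) := by ring
  have t7 : 3 * y / L = 3 * (y / L) := by ring
  have t8 : y * (32 / L) = 32 * (y / L) := by ring
  linarith

end GoodCard

section BoxVariance

/-- The logarithm of `cd/(ab)` for `t = (a, b, c, d)`. -/
noncomputable def logRatio (t : ℕ × ℕ × ℕ × ℕ) : ℝ :=
  (-Real.log t.1) + ((-Real.log t.2.1) + (Real.log t.2.2.1 + Real.log t.2.2.2))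

theorem norm_expSum_logRatio (A B C D : Finset ℕ) (ξ : ℝ) :
    ‖expSum (A ×ˢ B ×ˢ C ×ˢ D) logRatio ξ‖ =
      ‖dirPoly A ξ‖ * ‖dirPoly B ξ‖ * ‖dirPoly C ξ‖ * ‖dirPoly D ξ‖ := by
  have hneg : ∀ S : Finset ℕ, ‖expSum S (fun n => -Real.log n) ξ‖ = ‖dirPoly S ξ‖ := fun S => by
    rw [norm_dirPoly_eq, ← abs_neg, ← norm_dirPoly_eq, dirPoly, expSum, expSum]
    congr 1
    refine Finset.sum_congr rfl fun n _ => ?_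
    congr 3; ring
  have := expSum_product A (B ×ˢ C ×ˢ D) (fun n => -Real.log n)
    (fun t : ℕ × ℕ × ℕ => (-Real.log t.1) + (Real.log t.2.1 + Real.log t.2.2)) ξ
  rw [expSum_product B (C ×ˢ D) (fun n => -Real.log n)
    (fun t : ℕ × ℕ => Real.log t.1 + Real.log t.2), expSum_product C D (fun n => Real.log n)
    (fun n => Real.log n)] at this
  rw [show logRatio = fun t : ℕ × ℕ × ℕ × ℕ =>
    (-Real.log t.1) + ((-Real.log t.2.1) + (Real.log t.2.2.1 + Real.log t.2.2.2)) from rfl, this,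
    norm_mul, norm_mul, norm_mul, hneg, hneg, ← dirPoly, ← dirPoly]
  ring

theorem volume_ge_le_of_integral_le {f : ℝ → ℝ} (hf : Integrable f) (hf0 : ∀ x, 0 ≤ f x) {ε V : ℝ}
    (hε : 0 < ε) (hV : ∫ x, f x ≤ V) : volume {x | ε ≤ f x} ≤ ENNReal.ofReal (V / ε) := by
  have h := meas_ge_le_lintegral_div (μ := volume) hf.aemeasurable.ennreal_ofReal
    (ε := ENNReal.ofReal ε) (by simpa using hε) ENNReal.ofReal_ne_top
  rw [← ofReal_integral_eq_lintegral_ofReal hf (Filter.Eventually.of_forall hf0),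
    ← ENNReal.ofReal_div_of_pos hε] at h
  refine (measure_mono fun x hx => ?_).trans (h.trans (ENNReal.ofReal_le_ofReal (by gcongr)))
  exact ENNReal.ofReal_le_ofReal hx

theorem volume_winCount_ge_le {ι : Type*} (T : Finset ι) (l : ι → ℝ) {w τ V : ℝ} (hw : 0 < w)
    (hτ : 0 < τ) (hV : (T.card : ℝ) ≤ V) :
    volume {θ | τ ≤ winCount T l w θ / w} ≤ ENNReal.ofReal (V / τ) := by
  refine volume_ge_le_of_integral_le ((winCount_integrable T l w).div_const w)
    (fun θ => by positivity) hτ ?_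
  rw [integral_div, integral_winCount T l w hw.le, mul_div_cancel_left₀ _ hw.ne']
  exact hV

theorem fourier_sub {f g : ℝ → ℂ} (hf : Integrable f) (hg : Integrable g) (ξ : ℝ) :
    FourierTransform.fourier (fun x => f x - g x) ξ =
      FourierTransform.fourier f ξ - FourierTransform.fourier g ξ := by
  simp only [Real.fourier_eq]
  rw [← integral_sub]
  · simp only [smul_sub]
  · exact (Real.fourierIntegral_convergent_iff ξ).2 hf
  · exact (Real.fourierIntegral_convergent_iff ξ).2 hg

theorem volume_winCount_sub_ge_le {ι : Type*} (T : Finset ι) (l : ι → ℝ) {δ δ0 τ V : ℝ}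
    (hτ : 0 < τ)
    (hV : ∫ ξ, ‖expSum T l ξ‖ ^ 2 * ‖FourierTransform.fourier (stepKer δ) ξ -
      FourierTransform.fourier (stepKer δ0) ξ‖ ^ 2 ≤ V) :
    volume {θ | τ ≤ |winCount T l δ θ / δ - winCount T l δ0 θ / δ0|} ≤
      ENNReal.ofReal (V / τ ^ 2) := by
  set k : ℝ → ℂ := fun x => stepKer δ x - stepKer δ0 x
  have hk : Integrable k := (stepKer_integrable δ).sub (stepKer_integrable δ0)
  have hk2 : MemLp k 2 := (stepKer_memLp δ).sub (stepKer_memLp δ0)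
  have hp := (expSum_plancherel T l k hk hk2).2
  have hs : ∀ θ, ‖∑ t ∈ T, k (θ - l t)‖ = |winCount T l δ θ / δ - winCount T l δ0 θ / δ0| := by
    intro θ
    simp only [k]
    rw [Finset.sum_sub_distrib, sum_stepKer_eq, sum_stepKer_eq, ← Complex.ofReal_sub,
      Complex.norm_real, Real.norm_eq_abs]
  have h2 : MemLp (fun θ => ∑ t ∈ T, k (θ - l t)) 2 := memLp_finsetSum _ fun t _ =>
    hk2.comp_measurePreserving (measurePreserving_sub_right volume (l t))
  have hi : Integrable fun θ => ‖∑ t ∈ T, k (θ - l t)‖ ^ 2 := h2.integrable_norm_pow two_ne_zero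
  refine (measure_mono fun θ hθ => ?_).trans
    (volume_ge_le_of_integral_le hi (fun θ => by positivity) (by positivity : 0 < τ ^ 2) (V := V) ?_)
  · simp only [Set.mem_ofPred_eq, hs] at hθ ⊢
    gcongr
  · rw [← hp]
    simpa only [k, fourier_sub (stepKer_integrable δ) (stepKer_integrable δ0)] using hV

theorem winCount_union {ι : Type*} [DecidableEq ι] {S T : Finset ι} (h : Disjoint S T) (l : ι → ℝ)
    (w θ : ℝ) : winCount (S ∪ T) l w θ = winCount S l w θ + winCount T l w θ := by
  rw [winCount, Finset.filter_union, Finset.card_union_of_disjoint]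
  · rfl
  · exact Finset.disjoint_filter_filter h

/-- Splitting the first three factors of a box. -/
theorem winCount_box_split {A B C D A' B' C' : Finset ℕ} (hA : A' ⊆ A) (hB : B' ⊆ B) (hC : C' ⊆ C)
    (l : ℕ × ℕ × ℕ × ℕ → ℝ) (w θ : ℝ) :
    winCount (A ×ˢ B ×ˢ C ×ˢ D) l w θ = winCount (A' ×ˢ B ×ˢ C ×ˢ D) l w θ +
      (winCount ((A \ A') ×ˢ B' ×ˢ C ×ˢ D) l w θ +
      (winCount ((A \ A') ×ˢ (B \ B') ×ˢ C' ×ˢ D) l w θ +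
      winCount ((A \ A') ×ˢ (B \ B') ×ˢ (C \ C') ×ˢ D) l w θ)) := by
  rw [← winCount_union, ← winCount_union, ← winCount_union]
  · congr 1
    ext ⟨a, b, c, d⟩
    simp only [Finset.mem_union, Finset.mem_product, Finset.mem_sdiff]
    have := @hA a; have := @hB b; have := @hC c
    tauto
  all_goals
    rw [Finset.disjoint_left]
    rintro ⟨a, b, c, d⟩
    simp only [Finset.mem_union, Finset.mem_product, Finset.mem_sdiff]
    tauto

end BoxVariance

section BoxDiscrepancy

theorem volume_box_discrepancy_le (A0 : ℕ) {η : ℝ} (hη : 0 < η) (hη1 : η ≤ 1) :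
    ∀ᶠ x : ℝ in Filter.atTop, ∀ (q ya yb yc yd δ : ℝ) (r s : ℕ), 1 ≤ q → q ≤ 2 →
      x / Real.log x ^ A0 ≤ ya → ya ≤ x → x / Real.log x ^ A0 ≤ yb → yb ≤ x →
      x / Real.log x ^ A0 ≤ yc → yc ≤ x → x / Real.log x ^ A0 ≤ yd → yd ≤ x →
      x ^ (-4 + η) ≤ δ → δ ≤ x ^ (-(1 / 4) : ℝ) →
      volume {θ | ya * yb * yc * yd * Real.log x ^ (-(1 / 10) : ℝ) <
        |winCount (ivl q ya r ×ˢ ivl q yb r ×ˢ ivl q yc s ×ˢ ivl q yd s) logRatio δ θ / δ -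
        winCount (ivl q ya r ×ˢ ivl q yb r ×ˢ ivl q yc s ×ˢ ivl q yd s) logRatio
          (x ^ (-(1 / 4) : ℝ)) θ / x ^ (-(1 / 4) : ℝ)|} ≤
      ENNReal.ofReal (Real.log x ^ (-(21 / 10) : ℝ)) := by
  obtain ⟨K, hK, hvar⟩ := good_variance A0 (8 * A0 + 4)
  have hlog := Real.tendsto_log_atTop
  filter_upwards [hvar η hη.le hη1, eventually_card_sdiff_good_le A0 K hη hη1 hK,
    Filter.eventually_ge_atTop 1, hlog.eventually_ge_atTop 2,
    hlog.eventually ((tendsto_rpow_atTop (show (0 : ℝ) < 1 / 20 by norm_num)).eventually_ge_atTop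
      64)] with x hv ⟨n, hn, hPn, hcard⟩ hx hL2 hL64
    q ya yb yc yd δ r s hq hq2 hya hyax hyb hybx hyc hycx hyd hydx hδ hδ1
  replace hv := fun (y y4 : ℝ) (r r4 : ℕ) (B C : Finset ℕ) a b c d e f =>
    hv q y y4 δ r r4 n B C hq hq2 a b c d hn hPn e f hδ hδ1
  replace hcard := fun (y : ℝ) (r : ℕ) => hcard q y r hq hq2
  set L := Real.log x
  have hx0 : 0 < x := by linarith
  have hL0 : 0 < L := by linarith
  have hxL : 0 < x / L ^ A0 := by positivity
  have hρ : 1 ≤ 1 + 1 / L ^ 2 := by linarith [show 0 ≤ 1 / L ^ 2 by positivity]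
  have hP : 2 ≤ L ^ K := hL2.trans (le_self_pow₀ (by linarith) (by omega))
  set δ0 := x ^ (-(1 / 4) : ℝ)
  have hδ00 : 0 < δ0 := by positivity
  have hδ' : 0 < δ := lt_of_lt_of_le (by positivity) hδ
  set Y := ya * yb * yc * yd
  have ha0 : 0 < ya := by linarith
  have hb0 : 0 < yb := by linarith
  have hc0 : 0 < yc := by linarith
  have hd0 : 0 < yd := by linarith
  have hY0 : 0 < Y := by positivity
  set M := L ^ (-(1 / 10) : ℝ)
  have hM0 : 0 < M := by positivity
  set τ := Y * M / 4
  have hτ : 0 < τ := by positivity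
  have hIb : ∀ (y : ℝ) (r : ℕ), 0 ≤ y → y ≤ x → ∀ b ∈ ivl q y r, 1 ≤ b ∧ (b : ℝ) ≤ 2 * x := by
    intro y r hy hyx b hb
    rw [mem_ivl (by linarith) hy] at hb
    refine ⟨?_, hb.1.2.trans (by gcongr)⟩
    have : (0 : ℝ) < b := by linarith
    exact_mod_cast this
  set Ia := ivl q ya r
  set Ib := ivl q yb r
  set Ic := ivl q yc s
  set Id := ivl q yd s
  set Ga := good q ya r (L ^ K) (1 + 1 / L ^ 2) n
  set Gb := good q yb r (L ^ K) (1 + 1 / L ^ 2) n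
  set Gc := good q yc s (L ^ K) (1 + 1 / L ^ 2) n
  have hGa : Ga ⊆ Ia := good_subset (by linarith) ha0.le hP hρ
  have hGb : Gb ⊆ Ib := good_subset (by linarith) hb0.le hP hρ
  have hGc : Gc ⊆ Ic := good_subset (by linarith) hc0.le hP hρ
  have hIa' := hIb ya r ha0.le hyax
  have hIb' := hIb yb r hb0.le hybx
  have hIc' := hIb yc s hc0.le hycx
  have hHa' : ∀ b ∈ Ia \ Ga, 1 ≤ b ∧ (b : ℝ) ≤ 2 * x := fun b hb => hIa' b (Finset.sdiff_subset hb)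
  have hHb' : ∀ b ∈ Ib \ Gb, 1 ≤ b ∧ (b : ℝ) ≤ 2 * x := fun b hb => hIb' b (Finset.sdiff_subset hb)
  set T1 := Ga ×ˢ Ib ×ˢ Ic ×ˢ Id
  set T2 := (Ia \ Ga) ×ˢ Gb ×ˢ Ic ×ˢ Id
  set T3 := (Ia \ Ga) ×ˢ (Ib \ Gb) ×ˢ Gc ×ˢ Id
  set T4 := (Ia \ Ga) ×ˢ (Ib \ Gb) ×ˢ (Ic \ Gc) ×ˢ Id
  have hYx : x ^ 4 / L ^ (4 * A0) ≤ Y := by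
    calc _ = (x / L ^ A0) * (x / L ^ A0) * (x / L ^ A0) * (x / L ^ A0) := by
          rw [mul_comm 4, pow_mul]; field_simp
      _ ≤ ya * yb * yc * yd := by gcongr
  have hVτ : x ^ 8 / L ^ (8 * A0 + 4) / τ ^ 2 ≤ 16 * L ^ (-(38 / 10) : ℝ) := by
    rw [div_le_iff₀ (by positivity)]
    have e1 : L ^ (-(38 / 10) : ℝ) * M ^ 2 = (L ^ 4)⁻¹ := by
      rw [← Real.rpow_natCast, ← Real.rpow_natCast, ← Real.rpow_mul hL0.le, ← Real.rpow_neg hL0.le,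
        ← Real.rpow_add hL0]
      norm_num
    calc x ^ 8 / L ^ (8 * A0 + 4) = (x ^ 4 / L ^ (4 * A0)) ^ 2 * (L ^ 4)⁻¹ := by
          field_simp; ring
      _ ≤ Y ^ 2 * (L ^ 4)⁻¹ := by gcongr
      _ = _ := by rw [← e1]; ring
  have b1 : volume {θ | τ ≤ |winCount T1 logRatio δ θ / δ - winCount T1 logRatio δ0 θ / δ0|} ≤
      ENNReal.ofReal (16 * L ^ (-(38 / 10) : ℝ)) := by
    refine (volume_winCount_sub_ge_le T1 logRatio hτ ?_).trans (ENNReal.ofReal_le_ofReal hVτ)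
    refine le_trans (le_of_eq ?_) (hv ya yd r s Ib Ic ha0.le hyax hyd hydx hIb' hIc')
    simp only [T1, norm_expSum_logRatio, norm_mul]; rfl
  have b2 : volume {θ | τ ≤ |winCount T2 logRatio δ θ / δ - winCount T2 logRatio δ0 θ / δ0|} ≤
      ENNReal.ofReal (16 * L ^ (-(38 / 10) : ℝ)) := by
    refine (volume_winCount_sub_ge_le T2 logRatio hτ ?_).trans (ENNReal.ofReal_le_ofReal hVτ)
    refine le_trans (le_of_eq ?_) (hv yb yd r s (Ia \ Ga) Ic hb0.le hybx hyd hydx hHa' hIc')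
    simp only [T2, norm_expSum_logRatio, norm_mul]
    refine integral_congr_ae (Filter.Eventually.of_forall fun ξ => ?_)
    simp only [Gb, Id]
    ring
  have b3 : volume {θ | τ ≤ |winCount T3 logRatio δ θ / δ - winCount T3 logRatio δ0 θ / δ0|} ≤
      ENNReal.ofReal (16 * L ^ (-(38 / 10) : ℝ)) := by
    refine (volume_winCount_sub_ge_le T3 logRatio hτ ?_).trans (ENNReal.ofReal_le_ofReal hVτ)
    refine le_trans (le_of_eq ?_) (hv yc yd s s (Ia \ Ga) (Ib \ Gb) hc0.le hycx hyd hydx hHa' hHb')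
    simp only [T3, norm_expSum_logRatio, norm_mul]
    refine integral_congr_ae (Filter.Eventually.of_forall fun ξ => ?_)
    simp only [Gc, Id]
    ring
  have hT4 : (T4.card : ℝ) ≤ 2 * Y * L ^ (-(9 / 4) : ℝ) := by
    have hd : (Id.card : ℝ) ≤ 2 * yd := by
      refine card_le_of_mem_bounds (by positivity) fun a ha => ⟨(hIb yd s hd0.le hydx a ha).1, ?_⟩
      rw [mem_ivl (by linarith) hd0.le] at ha
      exact ha.1.2.trans (by gcongr)
    have e : L ^ (-(9 / 4) : ℝ) = L ^ (-(3 / 4) : ℝ) * L ^ (-(3 / 4) : ℝ) * L ^ (-(3 / 4) : ℝ) := by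
      rw [← Real.rpow_add hL0, ← Real.rpow_add hL0]; norm_num
    simp only [T4, Finset.card_product]
    push_cast
    calc _ ≤ (ya * L ^ (-(3 / 4) : ℝ)) * ((yb * L ^ (-(3 / 4) : ℝ)) *
          ((yc * L ^ (-(3 / 4) : ℝ)) * (2 * yd))) := by
          gcongr
          · exact hcard ya r hya hyax
          · exact hcard yb r hyb hybx
          · exact hcard yc s hyc hycx
      _ = _ := by rw [e]; ring
  have hVτ4 : 2 * Y * L ^ (-(9 / 4) : ℝ) / τ = 8 * L ^ (-(43 / 20) : ℝ) := by
    have e : L ^ (-(43 / 20) : ℝ) * M = L ^ (-(9 / 4) : ℝ) := by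
      rw [← Real.rpow_add hL0]; norm_num
    rw [div_eq_iff hτ.ne', ← e]; ring
  have b4 : ∀ w, 0 < w → volume {θ | τ ≤ winCount T4 logRatio w θ / w} ≤
      ENNReal.ofReal (8 * L ^ (-(43 / 20) : ℝ)) := fun w hw => by
    rw [← hVτ4]
    exact volume_winCount_ge_le T4 logRatio hw hτ hT4
  refine (measure_mono (t := {θ | τ ≤ |winCount T1 logRatio δ θ / δ -
      winCount T1 logRatio δ0 θ / δ0|} ∪ ({θ | τ ≤ |winCount T2 logRatio δ θ / δ -
      winCount T2 logRatio δ0 θ / δ0|} ∪ ({θ | τ ≤ |winCount T3 logRatio δ θ / δ -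
      winCount T3 logRatio δ0 θ / δ0|} ∪ ({θ | τ ≤ winCount T4 logRatio δ θ / δ} ∪
      {θ | τ ≤ winCount T4 logRatio δ0 θ / δ0})))) fun θ hθ => ?_).trans ?_
  · simp only [Set.mem_union, Set.mem_ofPred_eq] at hθ ⊢
    by_contra! hc
    obtain ⟨c1, c2, c3, c4, c5⟩ := hc
    rw [winCount_box_split hGa hGb hGc, winCount_box_split hGa hGb hGc] at hθ
    change Y * M < |((winCount T1 logRatio δ θ + (winCount T2 logRatio δ θ +
      (winCount T3 logRatio δ θ + winCount T4 logRatio δ θ)) : ℕ) : ℝ) / δ -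
      ((winCount T1 logRatio δ0 θ + (winCount T2 logRatio δ0 θ +
      (winCount T3 logRatio δ0 θ + winCount T4 logRatio δ0 θ)) : ℕ) : ℝ) / δ0| at hθ
    push_cast at hθ
    have p1 : 0 ≤ (winCount T4 logRatio δ θ : ℝ) / δ := by positivity
    have p2 : 0 ≤ (winCount T4 logRatio δ0 θ : ℝ) / δ0 := by positivity
    rw [abs_lt] at c1 c2 c3
    refine absurd hθ (not_lt.2 ?_)
    rw [abs_le]
    simp only [add_div]
    have : τ = Y * M / 4 := rfl
    constructor <;> linarith
  · refine (measure_union_le _ _).trans ((add_le_add b1 ((measure_union_le _ _).trans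
      (add_le_add b2 ((measure_union_le _ _).trans (add_le_add b3 ((measure_union_le _ _).trans
      (add_le_add (b4 δ hδ') (b4 δ0 hδ00)))))))).trans ?_)
    rw [← ENNReal.ofReal_add (by positivity) (by positivity),
      ← ENNReal.ofReal_add (by positivity) (by positivity),
      ← ENNReal.ofReal_add (by positivity) (by positivity),
      ← ENNReal.ofReal_add (by positivity) (by positivity)]
    refine ENNReal.ofReal_le_ofReal ?_
    have e1 : L ^ (-(38 / 10) : ℝ) ≤ L ^ (-(43 / 20) : ℝ) :=
      Real.rpow_le_rpow_of_exponent_le (by linarith) (by norm_num)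
    have e2 : L ^ (-(43 / 20) : ℝ) * L ^ (1 / 20 : ℝ) = L ^ (-(21 / 10) : ℝ) := by
      rw [← Real.rpow_add hL0]; norm_num
    have e3 : 0 < L ^ (-(43 / 20) : ℝ) := by positivity
    linarith [mul_le_mul_of_nonneg_left hL64 e3.le]

end BoxDiscrepancy

section Remainder

theorem volume_exp_window_le_div_right {p s Δ : ℝ} (hp : 0 < p) (hs : 0 < s) (hΔ : 0 ≤ Δ) :
    volume {θ : ℝ | 0 ≤ Real.exp θ * p - s ∧ Real.exp θ * p - s ≤ Δ} ≤ ENNReal.ofReal (Δ / s) := by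
  refine (measure_mono (t := Set.Icc (Real.log (s / p)) (Real.log (s / p) + Δ / s))
    fun θ hθ => ?_).trans (by rw [Real.volume_Icc]; simp)
  obtain ⟨h1, h2⟩ := hθ
  constructor
  · rw [Real.log_le_iff_le_exp (by positivity), div_le_iff₀ hp]; linarith
  · have h3 : Real.exp θ ≤ (s + Δ) / p := by rw [le_div_iff₀ hp]; linarith
    rw [← Real.le_log_iff_exp_le (by positivity)] at h3
    have e : (s + Δ) / p = s / p * (1 + Δ / s) := by field_simp
    rw [e, Real.log_mul (by positivity) (by positivity)] at h3
    have := Real.log_le_sub_one_of_pos (show 0 < 1 + Δ / s by positivity)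
    linarith

theorem volume_exp_window_le_div_left {p s Δ R : ℝ} (hp : 0 < p) :
    volume ({θ : ℝ | 0 ≤ Real.exp θ * p - s ∧ Real.exp θ * p - s ≤ Δ} ∩ Set.Icc (-R) R) ≤
      ENNReal.ofReal (Real.exp R * Δ / p) := by
  refine (Real.volume_le_diam _).trans (Metric.ediam_le fun θ₁ h₁ θ₂ h₂ => ?_)
  wlog h : θ₁ ≤ θ₂ generalizing θ₁ θ₂
  · rw [edist_comm]; exact this θ₂ h₂ θ₁ h₁ (by linarith)
  obtain ⟨⟨h1, h2⟩, h3, h4⟩ := h₁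
  obtain ⟨⟨h5, h6⟩, h7, h8⟩ := h₂
  rw [edist_dist, Real.dist_eq, abs_sub_comm, abs_of_nonneg (by linarith)]
  refine ENNReal.ofReal_le_ofReal ?_
  rw [le_div_iff₀ hp]
  have e1 : Real.exp θ₂ = Real.exp θ₁ * Real.exp (θ₂ - θ₁) := by
    rw [← Real.exp_add]; congr 1; ring
  have e2 := Real.add_one_le_exp (θ₂ - θ₁)
  have e3 : 1 ≤ Real.exp R * Real.exp θ₁ := by
    rw [← Real.exp_add]; exact Real.one_le_exp (by linarith)
  have e4 : (Real.exp θ₂ - Real.exp θ₁) * p ≤ Δ := by linarith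
  have e5 : Real.exp θ₁ * (θ₂ - θ₁) ≤ Real.exp θ₂ - Real.exp θ₁ := by
    rw [e1]; nlinarith [Real.exp_pos θ₁]
  have e6 : 0 ≤ (θ₂ - θ₁) * p := mul_nonneg (by linarith) hp.le
  calc (θ₂ - θ₁) * p ≤ (Real.exp R * Real.exp θ₁) * ((θ₂ - θ₁) * p) := le_mul_of_one_le_left e6 e3
    _ = Real.exp R * (Real.exp θ₁ * (θ₂ - θ₁) * p) := by ring
    _ ≤ Real.exp R * ((Real.exp θ₂ - Real.exp θ₁) * p) := by gcongr
    _ ≤ _ := by gcongr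

open Classical in
theorem volume_card_filter_ge_le {ι : Type*} (T : Finset ι) (E : ι → Set ℝ)
    (hE : ∀ t ∈ T, MeasurableSet (E t)) {M B : ℝ} (hM : 0 < M) {b : ι → ℝ} (hb0 : ∀ t ∈ T, 0 ≤ b t)
    (hb : ∀ t ∈ T, volume (E t) ≤ ENNReal.ofReal (b t)) (hB : ∑ t ∈ T, b t ≤ B) :
    volume {θ | M ≤ ((T.filter fun t => θ ∈ E t).card : ℝ)} ≤ ENNReal.ofReal (B / M) := by
  have hm : AEMeasurable (fun θ => ∑ t ∈ T, (E t).indicator (fun _ => (1 : ENNReal)) θ) volume :=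
    Finset.aemeasurable_fun_sum _ fun t ht => (measurable_const.indicator (hE t ht)).aemeasurable
  have h := meas_ge_le_lintegral_div (μ := volume) hm (ε := ENNReal.ofReal M) (by simpa using hM)
    ENNReal.ofReal_ne_top
  rw [lintegral_finsetSum' _ fun t ht => (measurable_const.indicator (hE t ht)).aemeasurable] at h
  refine (measure_mono fun θ hθ => ?_).trans (h.trans ?_)
  · simp only [Set.mem_ofPred_eq] at hθ ⊢
    simp only [Set.indicator_apply]
    rw [← Finset.sum_filter, Finset.sum_const, nsmul_eq_mul, mul_one]
    calc _ ≤ ENNReal.ofReal ((T.filter fun t => θ ∈ E t).card : ℝ) := ENNReal.ofReal_le_ofReal hθ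
      _ = _ := by simp
  · rw [ENNReal.ofReal_div_of_pos hM]
    gcongr
    refine le_trans (Finset.sum_le_sum fun t ht => ?_)
      ((ENNReal.ofReal_sum_of_nonneg hb0).symm.le.trans (ENNReal.ofReal_le_ofReal hB))
    rw [lintegral_indicator (hE t ht), setLIntegral_one]
    exact hb t ht

theorem sum_inv_mul_le (X : ℕ) :
    ∑ p ∈ Finset.Icc 1 X ×ˢ Finset.Icc 1 X, 1 / ((p.1 : ℝ) * p.2) ≤ (1 + Real.log X) ^ 2 := by
  rw [Finset.sum_product, pow_two]
  have h := sum_inv_Icc_le X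
  have h0 : 0 ≤ ∑ n ∈ Finset.Icc 1 X, 1 / (n : ℝ) := Finset.sum_nonneg fun _ _ => by positivity
  calc _ = (∑ n ∈ Finset.Icc 1 X, 1 / (n : ℝ)) * ∑ n ∈ Finset.Icc 1 X, 1 / (n : ℝ) := by
        rw [Finset.sum_mul_sum]
        simp only [one_div_mul_one_div]
    _ ≤ _ := by gcongr

open Classical in
/-- First moment bound for the number of quadruples with one pair in a sparse set. -/
theorem volume_card_window_ge_le (X : ℕ) (S : Finset (ℕ × ℕ)) (hS : S ⊆ Finset.Icc 1 X ×ˢ Finset.Icc 1 X)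
    {R Δ M : ℝ} (hR : 0 ≤ R) (hΔ : 0 ≤ Δ) (hM : 0 < M) :
    volume ({θ : ℝ | M ≤ (((S ×ˢ (Finset.Icc 1 X ×ˢ Finset.Icc 1 X) ∪
      (Finset.Icc 1 X ×ˢ Finset.Icc 1 X) ×ˢ S).filter fun t =>
        0 ≤ Real.exp θ * (t.1.1 * t.1.2) - t.2.1 * t.2.2 ∧
        Real.exp θ * (t.1.1 * t.1.2) - t.2.1 * t.2.2 ≤ Δ).card : ℝ)} ∩ Set.Icc (-R) R) ≤
      ENNReal.ofReal (2 * Real.exp R * Δ * S.card * (1 + Real.log X) ^ 2 / M) := by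
  set Q := Finset.Icc 1 X ×ˢ Finset.Icc 1 X
  set E : (ℕ × ℕ) × (ℕ × ℕ) → Set ℝ := fun t =>
    {θ : ℝ | 0 ≤ Real.exp θ * (t.1.1 * t.1.2) - t.2.1 * t.2.2 ∧
        Real.exp θ * (t.1.1 * t.1.2) - t.2.1 * t.2.2 ≤ Δ} ∩ Set.Icc (-R) R
  set b1 : (ℕ × ℕ) × (ℕ × ℕ) → ℝ := fun t => Real.exp R * Δ * (1 / ((t.1.1 : ℝ) * t.1.2))
  set b2 : (ℕ × ℕ) × (ℕ × ℕ) → ℝ := fun t => Real.exp R * Δ * (1 / ((t.2.1 : ℝ) * t.2.2))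
  have hQpos : ∀ p ∈ Q, 0 < (p.1 : ℝ) * p.2 := fun p hp => by
    simp only [Q, Finset.mem_product, Finset.mem_Icc] at hp
    have h1 : (0 : ℝ) < p.1 := by exact_mod_cast hp.1.1
    have h2 : (0 : ℝ) < p.2 := by exact_mod_cast hp.2.1
    positivity
  have hEm : ∀ t, MeasurableSet (E t) := fun t => by
    exact ((measurableSet_Icc (a := 0) (b := Δ)).preimage (show Measurable fun θ : ℝ =>
      Real.exp θ * (t.1.1 * t.1.2) - t.2.1 * t.2.2 by fun_prop)).inter measurableSet_Icc
  have h1 : ∀ t ∈ Q ×ˢ Q, volume (E t) ≤ ENNReal.ofReal (b1 t) := fun t ht => by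
    rw [Finset.mem_product] at ht
    refine (volume_exp_window_le_div_left (hQpos _ ht.1)).trans (le_of_eq ?_)
    simp only [b1, mul_one_div]
  have h2 : ∀ t ∈ Q ×ˢ Q, volume (E t) ≤ ENNReal.ofReal (b2 t) := fun t ht => by
    rw [Finset.mem_product] at ht
    refine (measure_mono Set.inter_subset_left).trans
      ((volume_exp_window_le_div_right (hQpos _ ht.1) (hQpos _ ht.2) hΔ).trans
      (ENNReal.ofReal_le_ofReal ?_))
    simp only [b2, mul_one_div]
    gcongr
    exact le_mul_of_one_le_left hΔ (Real.one_le_exp hR)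
  have hsum := sum_inv_mul_le X
  have hs1 : ∑ t ∈ Q ×ˢ S, b1 t ≤ Real.exp R * Δ * S.card * (1 + Real.log X) ^ 2 := by
    rw [Finset.sum_product]
    simp only [b1, Finset.sum_const, nsmul_eq_mul]
    rw [← Finset.mul_sum, ← Finset.mul_sum]
    calc _ = Real.exp R * Δ * S.card * ∑ p ∈ Q, 1 / ((p.1 : ℝ) * p.2) := by ring
      _ ≤ _ := by gcongr
  have hs2 : ∑ t ∈ S ×ˢ Q, b2 t ≤ Real.exp R * Δ * S.card * (1 + Real.log X) ^ 2 := by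
    rw [Finset.sum_product]
    simp only [b2, Finset.sum_const, nsmul_eq_mul]
    rw [← Finset.mul_sum]
    calc _ = Real.exp R * Δ * S.card * ∑ p ∈ Q, 1 / ((p.1 : ℝ) * p.2) := by ring
      _ ≤ _ := by gcongr
  have hSQ : S ×ˢ Q ⊆ Q ×ˢ Q := Finset.product_subset_product hS subset_rfl
  have hQS : Q ×ˢ S ⊆ Q ×ˢ Q := Finset.product_subset_product subset_rfl hS
  have hb10 : ∀ t, 0 ≤ b1 t := fun t => by positivity
  have hb20 : ∀ t, 0 ≤ b2 t := fun t => by positivity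
  refine (measure_mono fun θ hθ => ?_).trans (volume_card_filter_ge_le (S ×ˢ Q ∪ Q ×ˢ S) E
    (fun t _ => hEm t) hM (b := fun t => if t ∈ S ×ˢ Q then b2 t else b1 t)
    (fun t _ => ?_) (fun t ht => ?_) ?_)
  · obtain ⟨h3, h4⟩ := hθ
    simp only [Set.mem_ofPred_eq] at h3 ⊢
    refine le_trans h3 (Nat.cast_le.2 (Finset.card_le_card fun t ht => ?_))
    simp only [Finset.mem_filter] at ht ⊢
    exact ⟨ht.1, ht.2, h4⟩
  · by_cases h : t ∈ S ×ˢ Q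
    · rw [if_pos h]; exact hb20 t
    · rw [if_neg h]; exact hb10 t
  · by_cases h : t ∈ S ×ˢ Q
    · rw [if_pos h]; exact h2 t (hSQ h)
    · rw [if_neg h]; exact h1 t (hQS ((Finset.mem_union.1 ht).resolve_left h))
  · have e : S ×ˢ Q ∪ Q ×ˢ S = S ×ˢ Q ∪ (Q ×ˢ S) \ (S ×ˢ Q) := by
      rw [Finset.union_sdiff_self_eq_union]
    rw [e, Finset.sum_union Finset.disjoint_sdiff]
    have s1 : ∑ t ∈ S ×ˢ Q, (if t ∈ S ×ˢ Q then b2 t else b1 t) = ∑ t ∈ S ×ˢ Q, b2 t :=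
      Finset.sum_congr rfl fun t ht => if_pos ht
    have s2 : ∑ t ∈ (Q ×ˢ S) \ (S ×ˢ Q), (if t ∈ S ×ˢ Q then b2 t else b1 t) ≤ ∑ t ∈ Q ×ˢ S, b1 t := by
      rw [Finset.sum_congr rfl fun t ht => if_neg (Finset.mem_sdiff.1 ht).2]
      exact Finset.sum_le_sum_of_subset_of_nonneg Finset.sdiff_subset fun t _ _ => hb10 t
    linarith

end Remainder

section RemainderAE

theorem ae_eventually_notMem_of_volume_le {s : ℕ → Set ℝ} {b : ℕ → ℝ} (hb : Summable b)
    (h : ∀ᶠ k in Filter.atTop, volume (s k) ≤ ENNReal.ofReal (b k)) :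
    ∀ᵐ θ : ℝ, ∀ᶠ k in Filter.atTop, θ ∉ s k := by
  obtain ⟨k0, hk0⟩ := Filter.eventually_atTop.1 h
  have h1 : ∑' k, volume (s (k + k0)) ≠ ⊤ := by
    refine ne_top_of_le_ne_top ?_ (ENNReal.tsum_le_tsum fun k => hk0 (k + k0) (by omega))
    exact ((summable_nat_add_iff k0).2 hb).tsum_ofReal_ne_top
  filter_upwards [ae_eventually_notMem h1] with θ hθ
  obtain ⟨k1, hk1⟩ := Filter.eventually_atTop.1 hθ
  refine Filter.eventually_atTop.2 ⟨k1 + k0, fun k hk => ?_⟩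
  have := hk1 (k - k0) (by omega)
  rwa [Nat.sub_add_cancel (by omega)] at this

open Classical in
/-- Pairs of positive integers up to `q ^ k` with a small or a repeated coordinate. -/
noncomputable def thinPairs (q : ℝ) (k : ℕ) : Finset (ℕ × ℕ) :=
  (Finset.Icc 1 ⌊q ^ k⌋₊ ×ˢ Finset.Icc 1 ⌊q ^ k⌋₊).filter fun p =>
    (p.1 : ℝ) * k ^ 5 ≤ q ^ k ∨ (p.2 : ℝ) * k ^ 5 ≤ q ^ k ∨ p.1 = p.2

theorem card_thinPairs_le {q : ℝ} {k : ℕ} (hq : 0 < q) (hk : 1 ≤ k) (h : (k : ℝ) ^ 5 ≤ q ^ k) :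
    ((thinPairs q k).card : ℝ) ≤ 3 * q ^ (2 * k) / k ^ 5 := by
  have hk0 : (0 : ℝ) < k := by exact_mod_cast hk
  set x := q ^ k with hx
  have hx0 : 0 < x := by positivity
  have hsub : thinPairs q k ⊆ (Finset.Icc 1 ⌊x / k ^ 5⌋₊ ×ˢ Finset.Icc 1 ⌊x⌋₊ ∪
      Finset.Icc 1 ⌊x⌋₊ ×ˢ Finset.Icc 1 ⌊x / k ^ 5⌋₊) ∪
      (Finset.Icc 1 ⌊x⌋₊).image fun a => (a, a) := by
    rintro ⟨a, b⟩ hab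
    simp only [thinPairs, Finset.mem_filter, Finset.mem_product, Finset.mem_Icc] at hab
    simp only [Finset.mem_union, Finset.mem_product, Finset.mem_Icc, Finset.mem_image]
    obtain ⟨⟨ha, hb⟩, h1 | h1 | rfl⟩ := hab
    · exact Or.inl (Or.inl ⟨⟨ha.1, Nat.le_floor ((le_div_iff₀ (by positivity)).2 h1)⟩, hb⟩)
    · exact Or.inl (Or.inr ⟨ha, ⟨hb.1, Nat.le_floor ((le_div_iff₀ (by positivity)).2 h1)⟩⟩)
    · exact Or.inr ⟨a, ha, rfl⟩
  have h1 : (thinPairs q k).card ≤ ⌊x / k ^ 5⌋₊ * ⌊x⌋₊ + ⌊x⌋₊ * ⌊x / k ^ 5⌋₊ + ⌊x⌋₊ := by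
    refine (Finset.card_le_card hsub).trans ((Finset.card_union_le _ _).trans ?_)
    refine add_le_add ((Finset.card_union_le _ _).trans (le_of_eq ?_))
      (Finset.card_image_le.trans (le_of_eq ?_)) <;> simp
  have f1 : (⌊x / k ^ 5⌋₊ : ℝ) ≤ x / k ^ 5 := Nat.floor_le (by positivity)
  have f2 : (⌊x⌋₊ : ℝ) ≤ x := Nat.floor_le hx0.le
  have f3 : x ≤ x ^ 2 / k ^ 5 := by
    rw [le_div_iff₀ (by positivity), pow_two]; gcongr
  calc ((thinPairs q k).card : ℝ) ≤ ⌊x / k ^ 5⌋₊ * ⌊x⌋₊ + ⌊x⌋₊ * ⌊x / k ^ 5⌋₊ + ⌊x⌋₊ := by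
        exact_mod_cast h1
    _ ≤ x / k ^ 5 * x + x * (x / k ^ 5) + x ^ 2 / k ^ 5 := by
      have := f2.trans f3
      gcongr
    _ = _ := by rw [mul_comm 2 k, pow_mul, ← hx]; ring

open Classical in
/-- Quadruples with a thin pair and `e ^ θ a b - c d` in `[0, Δ]`. -/
noncomputable def thinQuads (q : ℝ) (k : ℕ) (θ Δ : ℝ) : Finset ((ℕ × ℕ) × (ℕ × ℕ)) :=
  ((thinPairs q k ×ˢ (Finset.Icc 1 ⌊q ^ k⌋₊ ×ˢ Finset.Icc 1 ⌊q ^ k⌋₊)) ∪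
    ((Finset.Icc 1 ⌊q ^ k⌋₊ ×ˢ Finset.Icc 1 ⌊q ^ k⌋₊) ×ˢ thinPairs q k)).filter fun t =>
      0 ≤ Real.exp θ * (t.1.1 * t.1.2) - t.2.1 * t.2.2 ∧
      Real.exp θ * (t.1.1 * t.1.2) - t.2.1 * t.2.2 ≤ Δ

theorem ae_card_thinQuads_lt {q : ℝ} (hq : 1 < q) :
    ∀ᵐ θ : ℝ, ∀ᶠ k : ℕ in Filter.atTop, ∀ u ≤ 4 * k,
      ((thinQuads q k θ (q ^ u / q ^ (2 * k))).card : ℝ) < q ^ u * (k : ℝ) ^ (-(1 / 2) : ℝ) := by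
  have hq0 : 0 < q := by linarith
  have hlq := Real.log_pos hq
  have key : ∀ R : ℕ, ∀ᵐ θ : ℝ, ∀ᶠ k : ℕ in Filter.atTop, θ ∉ ⋃ u ∈ Finset.range (4 * k + 1),
      ({θ : ℝ | q ^ u * (k : ℝ) ^ (-(1 / 2) : ℝ) ≤ ((thinQuads q k θ (q ^ u / q ^ (2 * k))).card : ℝ)} ∩
        Set.Icc (-(R : ℝ)) R) := by
    intro R
    refine ae_eventually_notMem_of_volume_le (b := fun k => 30 * Real.exp R * (1 + Real.log q) ^ 2 *
      (k : ℝ) ^ (-(3 / 2) : ℝ)) ((Real.summable_nat_rpow.2 (by norm_num)).mul_left _) ?_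
    have h5 := (isLittleO_pow_const_const_pow_of_one_lt (R := ℝ) 5 hq).def one_pos
    filter_upwards [Filter.eventually_ge_atTop 1, h5] with k hk h5
    rw [one_mul, Real.norm_of_nonneg (by positivity), Real.norm_of_nonneg (by positivity)] at h5
    have hk1 : (1 : ℝ) ≤ k := by exact_mod_cast hk
    have hk0 : (0 : ℝ) < k := by linarith
    have hX : 1 + Real.log ⌊q ^ k⌋₊ ≤ k * (1 + Real.log q) := by
      have h1 : 1 ≤ ⌊q ^ k⌋₊ := Nat.le_floor (by push_cast; exact one_le_pow₀ hq.le)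
      have h2 : Real.log ⌊q ^ k⌋₊ ≤ Real.log (q ^ k) :=
        Real.log_le_log (by exact_mod_cast h1) (Nat.floor_le (by positivity))
      rw [Real.log_pow] at h2
      linarith
    have hX0 : 0 ≤ 1 + Real.log ⌊q ^ k⌋₊ := by
      have := Real.log_natCast_nonneg ⌊q ^ k⌋₊
      linarith
    refine (measure_biUnion_finset_le _ _).trans ((Finset.sum_le_card_nsmul _ _
      (ENNReal.ofReal (6 * Real.exp R * (1 + Real.log q) ^ 2 * (k : ℝ) ^ (-(5 / 2) : ℝ))) ?_).trans ?_)
    · intro u _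
      refine (volume_card_window_ge_le ⌊q ^ k⌋₊ (thinPairs q k) (Finset.filter_subset _ _)
        R.cast_nonneg (by positivity) (by positivity)).trans (ENNReal.ofReal_le_ofReal ?_)
      rw [div_le_iff₀ (by positivity)]
      have e1 : (k : ℝ) ^ (-(5 / 2) : ℝ) * (k : ℝ) ^ (-(1 / 2) : ℝ) = k ^ 2 / k ^ 5 := by
        rw [← Real.rpow_add hk0]
        norm_num
        field_simp
      calc _ ≤ 2 * Real.exp R * (q ^ u / q ^ (2 * k)) * (3 * q ^ (2 * k) / k ^ 5) *
            (k * (1 + Real.log q)) ^ 2 := by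
            gcongr
            exact card_thinPairs_le hq0 hk h5
        _ = 6 * Real.exp R * (1 + Real.log q) ^ 2 * (k ^ 2 / k ^ 5) * q ^ u := by
          field_simp; ring
        _ = _ := by rw [← e1]; ring
    · rw [nsmul_eq_mul, Finset.card_range, ← ENNReal.ofReal_natCast, ← ENNReal.ofReal_mul (by positivity)]
      refine ENNReal.ofReal_le_ofReal ?_
      have e1 : (k : ℝ) * (k : ℝ) ^ (-(5 / 2) : ℝ) = (k : ℝ) ^ (-(3 / 2) : ℝ) := by
        nth_rewrite 1 [← Real.rpow_one (k : ℝ)]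
        rw [← Real.rpow_add hk0]; norm_num
      have e2 : ((4 * k + 1 : ℕ) : ℝ) ≤ 5 * k := by push_cast; linarith
      calc _ ≤ 5 * (k : ℝ) * (6 * Real.exp R * (1 + Real.log q) ^ 2 * (k : ℝ) ^ (-(5 / 2) : ℝ)) := by
            gcongr
        _ = _ := by rw [← e1]; ring
  filter_upwards [ae_all_iff.2 key] with θ hθ
  obtain ⟨R, hR⟩ := exists_nat_ge |θ|
  filter_upwards [hθ R] with k hk u hu
  by_contra! hc
  exact hk (Set.mem_biUnion (Finset.mem_coe.2 (Finset.mem_range.2 (by omega))) ⟨hc, abs_le.1 hR⟩)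

end RemainderAE

section BoxAE

open Classical in
/-- Exponents `j < k` with `q ^ j` not much smaller than `q ^ k`. -/
noncomputable def boxIdx (q : ℝ) (k : ℕ) : Finset ℕ :=
  (Finset.range k).filter fun j => q ^ k / (k * Real.log q) ^ 6 ≤ q ^ j

theorem eventually_card_boxIdx_le {q : ℝ} (hq : 1 < q) (hq2 : q ≤ 2) :
    ∀ᶠ k : ℕ in Filter.atTop, ((boxIdx q k).card : ℝ) ≤ (k : ℝ) ^ (1 / 100 : ℝ) := by
  have hl := Real.log_pos hq
  have hl1 : Real.log q ≤ 1 := by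
    have := Real.log_le_sub_one_of_pos (show 0 < q by linarith)
    linarith
  have h1 := (isLittleO_log_rpow_atTop (show (0 : ℝ) < 1 / 100 by norm_num)).def
    (c := Real.log q / 12) (by positivity)
  filter_upwards [tendsto_natCast_atTop_atTop.eventually h1, Filter.eventually_ge_atTop 1,
    tendsto_natCast_atTop_atTop.eventually
      ((tendsto_rpow_atTop (show (0 : ℝ) < 1 / 100 by norm_num)).eventually_ge_atTop 2)] with k h1 hk h2
  have hk1 : (1 : ℝ) ≤ k := by exact_mod_cast hk
  have hk0 : (0 : ℝ) < k := by linarith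
  rw [Real.norm_of_nonneg (Real.log_nonneg hk1), Real.norm_of_nonneg (by positivity)] at h1
  have hD : ∀ n ∈ boxIdx q k, ∀ m ∈ boxIdx q k, (n : ℝ) - m ≤ 6 * Real.log k / Real.log q := by
    intro n hn m hm
    simp only [boxIdx, Finset.mem_filter, Finset.mem_range] at hn hm
    rw [le_div_iff₀ hl]
    have hm2 := hm.2
    rw [div_le_iff₀ (by positivity)] at hm2
    have h3 := Real.log_le_log (by positivity) hm2
    rw [Real.log_mul (by positivity) (by positivity), Real.log_pow, Real.log_pow, Real.log_pow,
      Real.log_mul (by positivity) (by positivity)] at h3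
    have h4 : (n : ℝ) ≤ k := by exact_mod_cast hn.1.le
    have h5 : Real.log (Real.log q) ≤ 0 := Real.log_nonpos hl.le hl1
    push_cast at h3
    nlinarith
  have hk' := Real.log_nonneg hk1
  refine (card_le_of_diff_le _ _ (by positivity) hD).trans ?_
  have : 6 * Real.log k / Real.log q ≤ (k : ℝ) ^ (1 / 100 : ℝ) / 2 := by
    rw [div_le_iff₀ hl]; linarith
  linarith

/-- The product box with sides `(q ^ jᵢ, q ^ (jᵢ + 1)]` and prescribed parities. -/
noncomputable def qbox (q : ℝ) (j : ℕ × ℕ × ℕ × ℕ) (r s : ℕ) : Finset (ℕ × ℕ × ℕ × ℕ) :=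
  ivl q (q ^ j.1) r ×ˢ ivl q (q ^ j.2.1) r ×ˢ ivl q (q ^ j.2.2.1) s ×ˢ ivl q (q ^ j.2.2.2) s

theorem ae_box_discrepancy {q η : ℝ} (hq : 1 < q) (hq2 : q ≤ 2) (hη : 0 < η) (hη1 : η ≤ 1) :
    ∀ᵐ θ : ℝ, ∀ᶠ k : ℕ in Filter.atTop, ∃ δ0 : ℝ,
      ∀ j ∈ boxIdx q k ×ˢ boxIdx q k ×ˢ boxIdx q k ×ˢ boxIdx q k, ∀ r < 2, ∀ s < 2, ∀ u : ℕ,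
        (q ^ k) ^ (-4 + η) ≤ (q ^ u)⁻¹ → (q ^ u)⁻¹ ≤ (q ^ k) ^ (-(1 / 4) : ℝ) →
        |winCount (qbox q j r s) logRatio (q ^ u)⁻¹ θ / (q ^ u)⁻¹ -
          winCount (qbox q j r s) logRatio δ0 θ / δ0| ≤
        q ^ j.1 * q ^ j.2.1 * q ^ j.2.2.1 * q ^ j.2.2.2 * (k * Real.log q) ^ (-(1 / 10) : ℝ) := by
  have hq0 : 0 < q := by linarith
  have hl := Real.log_pos hq
  set ok : ℕ → ℕ → Prop := fun k u =>
    (q ^ k) ^ (-4 + η) ≤ (q ^ u)⁻¹ ∧ (q ^ u)⁻¹ ≤ (q ^ k) ^ (-(1 / 4) : ℝ)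
  set bad : ℕ → (ℕ × ℕ × ℕ × ℕ) × ℕ × ℕ × ℕ → Set ℝ := fun k i =>
    {θ | ok k i.2.2.2 ∧ q ^ i.1.1 * q ^ i.1.2.1 * q ^ i.1.2.2.1 * q ^ i.1.2.2.2 *
        (k * Real.log q) ^ (-(1 / 10) : ℝ) <
      |winCount (qbox q i.1 i.2.1 i.2.2.1) logRatio (q ^ i.2.2.2)⁻¹ θ / (q ^ i.2.2.2)⁻¹ -
          winCount (qbox q i.1 i.2.1 i.2.2.1) logRatio ((q ^ k) ^ (-(1 / 4) : ℝ)) θ /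
          (q ^ k) ^ (-(1 / 4) : ℝ)|}
  set ind : ℕ → Finset ((ℕ × ℕ × ℕ × ℕ) × ℕ × ℕ × ℕ) := fun k =>
    (boxIdx q k ×ˢ boxIdx q k ×ˢ boxIdx q k ×ˢ boxIdx q k) ×ˢ Finset.range 2 ×ˢ Finset.range 2 ×ˢ
      Finset.range (4 * k + 1)
  have key : ∀ᵐ θ : ℝ, ∀ᶠ k : ℕ in Filter.atTop, θ ∉ ⋃ i ∈ ind k, bad k i := by
    refine ae_eventually_notMem_of_volume_le (b := fun k => 20 * Real.log q ^ (-(21 / 10) : ℝ) *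
      (k : ℝ) ^ (-(53 / 50) : ℝ)) ((Real.summable_nat_rpow.2 (by norm_num)).mul_left _) ?_
    filter_upwards [(tendsto_pow_atTop_atTop_of_one_lt hq).eventually
      (volume_box_discrepancy_le 6 hη hη1), eventually_card_boxIdx_le hq hq2,
      Filter.eventually_ge_atTop 1] with k hv hJ hk
    have hk1 : (1 : ℝ) ≤ k := by exact_mod_cast hk
    have hk0 : (0 : ℝ) < k := by linarith
    rw [Real.log_pow] at hv
    refine (measure_biUnion_finset_le _ _).trans ((Finset.sum_le_card_nsmul _ _
      (ENNReal.ofReal ((k * Real.log q) ^ (-(21 / 10) : ℝ))) ?_).trans ?_)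
    · rintro ⟨⟨j1, j2, j3, j4⟩, r, s, u⟩ hi
      simp only [ind, Finset.mem_product, Finset.mem_range] at hi
      have hJ' : ∀ j ∈ boxIdx q k, q ^ k / (k * Real.log q) ^ 6 ≤ q ^ j ∧ q ^ j ≤ q ^ k := by
        intro j hj
        simp only [boxIdx, Finset.mem_filter, Finset.mem_range] at hj
        exact ⟨hj.2, pow_le_pow_right₀ hq.le hj.1.le⟩
      by_cases ho : ok k u
      · obtain ⟨⟨h1, h2, h3, h4⟩, -⟩ := hi
        refine (measure_mono fun θ hθ => hθ.2).trans (hv q (q ^ j1) (q ^ j2) (q ^ j3) (q ^ j4)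
          (q ^ u)⁻¹ r s hq.le hq2 (hJ' _ h1).1 (hJ' _ h1).2 (hJ' _ h2).1 (hJ' _ h2).2 (hJ' _ h3).1
          (hJ' _ h3).2 (hJ' _ h4).1 (hJ' _ h4).2 ho.1 ho.2)
      · have : bad k ((j1, j2, j3, j4), r, s, u) = ∅ :=
          Set.eq_empty_of_forall_notMem fun θ hθ => ho hθ.1
        rw [this]; simp
    · rw [nsmul_eq_mul, ← ENNReal.ofReal_natCast, ← ENNReal.ofReal_mul (by positivity)]
      refine ENNReal.ofReal_le_ofReal ?_
      simp only [ind, Finset.card_product, Finset.card_range]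
      have e2 : ((4 * k + 1 : ℕ) : ℝ) ≤ 5 * k := by push_cast; linarith
      have e3 : (k : ℝ) ^ (1 / 100 : ℝ) * ((k : ℝ) ^ (1 / 100 : ℝ) * ((k : ℝ) ^ (1 / 100 : ℝ) *
          (k : ℝ) ^ (1 / 100 : ℝ))) * k * (k : ℝ) ^ (-(21 / 10) : ℝ) = (k : ℝ) ^ (-(53 / 50) : ℝ) := by
        nth_rewrite 5 [← Real.rpow_one (k : ℝ)]
        simp only [← Real.rpow_add hk0]
        norm_num
      rw [Real.mul_rpow hk0.le hl.le, Nat.cast_mul, Nat.cast_mul, Nat.cast_mul, Nat.cast_mul,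
        Nat.cast_mul, Nat.cast_mul]
      calc _ ≤ (k : ℝ) ^ (1 / 100 : ℝ) * ((k : ℝ) ^ (1 / 100 : ℝ) * ((k : ℝ) ^ (1 / 100 : ℝ) *
            (k : ℝ) ^ (1 / 100 : ℝ))) * ((2 : ℕ) * ((2 : ℕ) * (5 * k))) *
            ((k : ℝ) ^ (-(21 / 10) : ℝ) * Real.log q ^ (-(21 / 10) : ℝ)) := by gcongr
        _ = _ := by rw [← e3]; push_cast; ring
  filter_upwards [key] with θ hθ
  filter_upwards [hθ, Filter.eventually_ge_atTop 1] with k hk hk1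
  refine ⟨(q ^ k) ^ (-(1 / 4) : ℝ), fun j hj r hr s hs u hu1 hu2 => ?_⟩
  by_contra! hc
  refine hk (Set.mem_biUnion (x := (j, r, s, u)) (Finset.mem_coe.2 ?_) ⟨⟨hu1, hu2⟩, hc⟩)
  simp only [ind, Finset.mem_product, Finset.mem_range] at hj ⊢
  refine ⟨hj, hr, hs, ?_⟩
  have h1 : (q ^ (4 * k))⁻¹ ≤ (q ^ u)⁻¹ := by
    refine le_trans ?_ hu1
    rw [mul_comm 4 k, pow_mul, ← Real.rpow_natCast (q ^ k) 4, ← Real.rpow_neg (by positivity)]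
    refine Real.rpow_le_rpow_of_exponent_le (one_le_pow₀ hq.le) (by push_cast; linarith)
  rw [inv_le_inv₀ (by positivity) (by positivity)] at h1
  have := (pow_le_pow_iff_right₀ hq).1 h1
  omega

end BoxAE

section QuadSet

open Classical in
/-- Quadruples `(a, b, c, d)` of positive integers with `a ≡ b`, `c ≡ d` modulo `2`,
`β (a + b)² + (d - c)² ≤ M` and `β a b - c d ∈ [0, D]`. -/
noncomputable def quadSet (β M D : ℝ) : Finset (ℕ × ℕ × ℕ × ℕ) :=
  (Finset.Icc 1 ⌊√(2 * M) + √(M / β)⌋₊ ×ˢ Finset.Icc 1 ⌊√(2 * M) + √(M / β)⌋₊ ×ˢ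
    Finset.Icc 1 ⌊√(2 * M) + √(M / β)⌋₊ ×ˢ Finset.Icc 1 ⌊√(2 * M) + √(M / β)⌋₊).filter fun t =>
      (t.1 % 2 = t.2.1 % 2 ∧ t.2.2.1 % 2 = t.2.2.2 % 2) ∧
      β * ((t.1 : ℝ) + t.2.1) ^ 2 + ((t.2.2.2 : ℝ) - t.2.2.1) ^ 2 ≤ M ∧
      0 ≤ β * (t.1 * t.2.1) - t.2.2.1 * t.2.2.2 ∧ β * (t.1 * t.2.1) - t.2.2.1 * t.2.2.2 ≤ D

theorem mem_quadSet {β : ℝ} (hβ : 0 < β) {M D : ℝ} {a b c d : ℕ} :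
    (a, b, c, d) ∈ quadSet β M D ↔ (0 < a ∧ 0 < b ∧ 0 < c ∧ 0 < d) ∧ (a % 2 = b % 2 ∧ c % 2 = d % 2) ∧
      β * ((a : ℝ) + b) ^ 2 + ((d : ℝ) - c) ^ 2 ≤ M ∧
      0 ≤ β * (a * b) - c * d ∧ β * (a * b) - c * d ≤ D := by
  simp only [quadSet, Finset.mem_filter, Finset.mem_product, Finset.mem_Icc]
  constructor
  · rintro ⟨⟨ha, hb, hc, hd⟩, h⟩
    exact ⟨⟨ha.1, hb.1, hc.1, hd.1⟩, h⟩
  · rintro ⟨⟨ha, hb, hc, hd⟩, h⟩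
    refine ⟨?_, h⟩
    obtain ⟨-, h1, h2, -⟩ := h
    have e1 : β * ((a : ℝ) + b) ^ 2 ≤ M := by nlinarith [sq_nonneg ((d : ℝ) - c)]
    have e2 : (a : ℝ) + b ≤ √(M / β) := by
      refine Real.le_sqrt_of_sq_le ?_
      rw [le_div_iff₀ hβ]
      linarith
    have e3 : (c : ℝ) + d ≤ √(2 * M) := by
      refine Real.le_sqrt_of_sq_le ?_
      have : (a : ℝ) * b ≤ (a + b) ^ 2 / 4 := by nlinarith [sq_nonneg ((a : ℝ) - b)]
      nlinarith [mul_le_mul_of_nonneg_left this hβ.le]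
    have s1 := Real.sqrt_nonneg (M / β)
    have s2 := Real.sqrt_nonneg (2 * M)
    have ha0 : (0 : ℝ) ≤ a := by positivity
    have hb0 : (0 : ℝ) ≤ b := by positivity
    have hc0 : (0 : ℝ) ≤ c := by positivity
    have hd0 : (0 : ℝ) ≤ d := by positivity
    exact ⟨⟨ha, Nat.le_floor (by linarith)⟩, ⟨hb, Nat.le_floor (by linarith)⟩,
      ⟨hc, Nat.le_floor (by linarith)⟩, ⟨hd, Nat.le_floor (by linarith)⟩⟩

theorem le_of_mem_quadSet {β M D : ℝ} {a b c d : ℕ} (h : (a, b, c, d) ∈ quadSet β M D) :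
    (1 ≤ a ∧ (a : ℝ) ≤ √(2 * M) + √(M / β)) ∧ (1 ≤ b ∧ (b : ℝ) ≤ √(2 * M) + √(M / β)) ∧
      (1 ≤ c ∧ (c : ℝ) ≤ √(2 * M) + √(M / β)) ∧ (1 ≤ d ∧ (d : ℝ) ≤ √(2 * M) + √(M / β)) := by
  have h0 : 0 ≤ √(2 * M) + √(M / β) := by positivity
  simp only [quadSet, Finset.mem_filter, Finset.mem_product, Finset.mem_Icc, Nat.le_floor_iff h0] at h
  exact h.1

theorem mem_qbox {q : ℝ} (hq : 0 < q) {j : ℕ × ℕ × ℕ × ℕ} {r s a b c d : ℕ} :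
    (a, b, c, d) ∈ qbox q j r s ↔
      ((q ^ j.1 < a ∧ a ≤ q * q ^ j.1) ∧ a % 2 = r) ∧
      ((q ^ j.2.1 < b ∧ b ≤ q * q ^ j.2.1) ∧ b % 2 = r) ∧
      ((q ^ j.2.2.1 < c ∧ c ≤ q * q ^ j.2.2.1) ∧ c % 2 = s) ∧
      ((q ^ j.2.2.2 < d ∧ d ≤ q * q ^ j.2.2.2) ∧ d % 2 = s) := by
  have h : ∀ i : ℕ, (0 : ℝ) ≤ q ^ i := fun i => by positivity
  simp only [qbox, Finset.mem_product, mem_ivl hq.le (h _)]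

theorem sub_logRatio {θ : ℝ} {a b c d : ℕ} (ha : 0 < a) (hb : 0 < b) (hc : 0 < c) (hd : 0 < d) :
    θ - logRatio (a, b, c, d) = Real.log (Real.exp θ * (a * b) / (c * d)) := by
  have ha' : (a : ℝ) ≠ 0 := by positivity
  have hb' : (b : ℝ) ≠ 0 := by positivity
  have hc' : (c : ℝ) ≠ 0 := by positivity
  have hd' : (d : ℝ) ≠ 0 := by positivity
  have he := (Real.exp_pos θ).ne'
  rw [Real.log_div (mul_ne_zero he (mul_ne_zero ha' hb')) (mul_ne_zero hc' hd'),
    Real.log_mul he (mul_ne_zero ha' hb'), Real.log_exp, Real.log_mul ha' hb', Real.log_mul hc' hd',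
    logRatio]
  ring

theorem card_quadSet_qbox_le {q θ M D w : ℝ} (hq : 1 < q) {j : ℕ × ℕ × ℕ × ℕ} {r s : ℕ} (hw : 0 ≤ w)
    (hD : D ≤ w * (q ^ j.2.2.1 * q ^ j.2.2.2)) :
    ((quadSet (Real.exp θ) M D).filter (· ∈ qbox q j r s)).card ≤
      winCount (qbox q j r s) logRatio w θ := by
  have hq0 : 0 < q := by linarith
  refine Finset.card_le_card ?_
  rintro ⟨a, b, c, d⟩ h
  rw [Finset.mem_filter, mem_quadSet (Real.exp_pos θ)] at h
  rw [Finset.mem_filter]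
  obtain ⟨⟨⟨ha, hb, hc, hd⟩, -, -, h1, h2⟩, h3⟩ := h
  refine ⟨h3, ?_⟩
  rw [mem_qbox hq0] at h3
  rw [sub_logRatio ha hb hc hd]
  have ha' : (0 : ℝ) < a := by positivity
  have hb' : (0 : ℝ) < b := by positivity
  have hcd : (0 : ℝ) < c * d := by positivity
  have he := Real.exp_pos θ
  refine ⟨Real.log_nonneg ?_, ?_⟩
  · rw [le_div_iff₀ hcd]; linarith
  · rw [Real.log_le_iff_le_exp (by positivity), div_le_iff₀ hcd]
    have h4 : w * (q ^ j.2.2.1 * q ^ j.2.2.2) ≤ w * (c * d) :=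
      mul_le_mul_of_nonneg_left (mul_le_mul h3.2.2.1.1.1.le h3.2.2.2.1.1.le (by positivity)
        (by positivity)) hw
    have h5 := mul_le_mul_of_nonneg_right (Real.add_one_le_exp w) hcd.le
    linarith

theorem quadForm_eq (β a b c d : ℝ) : β * (a + b) ^ 2 + (d - c) ^ 2 =
    β * a ^ 2 + β * b ^ 2 + c ^ 2 + d ^ 2 + 2 * (β * (a * b) - c * d) := by
  ring

theorem winCount_qbox_le {q θ M D D1 w1 : ℝ} (hq : 1 < q) {j : ℕ × ℕ × ℕ × ℕ} {r s : ℕ}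
    (hw1 : 0 ≤ w1) (he : Real.exp w1 - 1 ≤ q * w1)
    (hD1 : q ^ 3 * (q ^ j.2.2.1 * q ^ j.2.2.2) * w1 ≤ D1) (hM : 2 * D1 ≤ (q ^ 3 - q ^ 2) * M)
    (hne : ((quadSet (Real.exp θ) M D).filter (· ∈ qbox q j r s)).Nonempty) :
    winCount (qbox q j r s) logRatio w1 θ ≤
      ((quadSet (Real.exp θ) (q ^ 3 * M) D1).filter (· ∈ qbox q j r s)).card := by
  have hq0 : 0 < q := by linarith
  have hβ := Real.exp_pos θ
  set β := Real.exp θ with hβd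
  obtain ⟨⟨a0, b0, c0, d0⟩, h0⟩ := hne
  rw [Finset.mem_filter, mem_quadSet hβ, mem_qbox hq0] at h0
  obtain ⟨⟨⟨ha0, hb0, hc0, hd0⟩, -, hS, hS1, -⟩, ⟨A, -⟩, ⟨B, -⟩, ⟨C, -⟩, D', -⟩ := h0
  refine Finset.card_le_card ?_
  rintro ⟨a, b, c, d⟩ h
  rw [Finset.mem_filter] at h
  obtain ⟨hbox, h1, h2⟩ := h
  rw [Finset.mem_filter, mem_quadSet hβ]
  refine ⟨?_, hbox⟩
  rw [mem_qbox hq0] at hbox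
  obtain ⟨⟨a1, ar⟩, ⟨b1, br⟩, ⟨c1, cs⟩, d1, ds⟩ := hbox
  have pos : ∀ {i n : ℕ}, q ^ i < (n : ℝ) → 0 < n := fun h => by
    have : (0 : ℝ) < _ := (by positivity : (0 : ℝ) ≤ q ^ _).trans_lt h
    exact_mod_cast this
  have ha := pos a1.1
  have hb := pos b1.1
  have hc := pos c1.1
  have hd := pos d1.1
  rw [sub_logRatio ha hb hc hd] at h1 h2
  have ha' : (0 : ℝ) < a := by positivity
  have hb' : (0 : ℝ) < b := by positivity
  have hc' : (0 : ℝ) < c := by positivity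
  have hd' : (0 : ℝ) < d := by positivity
  have hcd : (0 : ℝ) < c * d := by positivity
  have k1 : 0 ≤ β * (a * b) - c * d := by
    have : 1 ≤ β * (a * b) / (c * d) := by
      by_contra! hlt
      exact absurd (Real.log_neg (by positivity) hlt) (not_lt.2 h1)
    rw [le_div_iff₀ hcd] at this
    linarith
  have k2 : β * (a * b) - c * d ≤ D1 := by
    rw [Real.log_le_iff_le_exp (by positivity), div_le_iff₀ hcd] at h2
    have e1 : (c : ℝ) * d ≤ (q * q ^ j.2.2.1) * (q * q ^ j.2.2.2) :=
      mul_le_mul c1.2 d1.2 hd'.le (by positivity)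
    have e2 : (Real.exp w1 - 1) * (c * d) ≤ (q * w1) * ((q * q ^ j.2.2.1) * (q * q ^ j.2.2.2)) :=
      mul_le_mul he e1 hcd.le (by positivity)
    calc β * (a * b) - c * d ≤ (Real.exp w1 - 1) * (c * d) := by linarith
      _ ≤ (q * w1) * ((q * q ^ j.2.2.1) * (q * q ^ j.2.2.2)) := e2
      _ = q ^ 3 * (q ^ j.2.2.1 * q ^ j.2.2.2) * w1 := by ring
      _ ≤ D1 := hD1
  refine ⟨⟨ha, hb, hc, hd⟩, ⟨ar.trans br.symm, cs.trans ds.symm⟩, ?_, k1, k2⟩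
  have sq_le : ∀ {i n m : ℕ}, (n : ℝ) ≤ q * q ^ i → q ^ i < (m : ℝ) → (n : ℝ) ^ 2 ≤ q ^ 2 * (m : ℝ) ^ 2 :=
    fun {i n m} h1 h2 => by
      rw [← mul_pow]
      exact pow_le_pow_left₀ (by positivity) (h1.trans (by gcongr)) 2
  have sa := mul_le_mul_of_nonneg_left (sq_le a1.2 A.1) hβ.le
  have sb := mul_le_mul_of_nonneg_left (sq_le b1.2 B.1) hβ.le
  have sc := sq_le c1.2 C.1
  have sd := sq_le d1.2 D'.1
  rw [quadForm_eq] at hS ⊢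
  have s0 : β * (a0 : ℝ) ^ 2 + β * (b0 : ℝ) ^ 2 + (c0 : ℝ) ^ 2 + (d0 : ℝ) ^ 2 ≤ M := by linarith
  have s1 := mul_le_mul_of_nonneg_left s0 (sq_nonneg q)
  linarith

end QuadSet

section QuadCover

theorem exists_boxIdx {q : ℝ} (hq : 1 < q) {k n : ℕ} (hk1 : q * (k : ℝ) ^ 5 ≤ (k * Real.log q) ^ 6)
    (hk2 : (k : ℝ) ^ 5 ≤ q ^ k) (hn : q ^ k < n * (k : ℝ) ^ 5) (hn2 : (n : ℝ) ≤ q ^ k) :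
    ∃ j ∈ boxIdx q k, q ^ j < (n : ℝ) ∧ (n : ℝ) ≤ q * q ^ j := by
  have hq0 : 0 < q := by linarith
  have hk0 : (0 : ℝ) < (k : ℝ) ^ 5 := by
    rcases (by positivity : (0 : ℝ) ≤ (k : ℝ) ^ 5).eq_or_lt with h | h
    · rw [← h, mul_zero] at hn
      exact absurd hn (not_lt.2 (by positivity))
    · exact h
  have hn1 : (1 : ℝ) < n := by
    by_contra! h
    have := mul_le_mul_of_nonneg_right h hk0.le
    linarith
  obtain ⟨z, hz⟩ := exists_mem_Ioc_zpow (show (0 : ℝ) < n by linarith) hq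
  have hz0 : 0 ≤ z := by
    by_contra! h
    have : q ^ (z + 1) ≤ q ^ (0 : ℤ) := zpow_le_zpow_right₀ hq.le (by omega)
    rw [zpow_zero] at this
    linarith [hz.2]
  lift z to ℕ using hz0 with j
  have h1 : q ^ j < (n : ℝ) := by simpa using hz.1
  have h2 : (n : ℝ) ≤ q * q ^ j := by
    have := hz.2
    rw [zpow_add_one₀ hq0.ne', zpow_natCast] at this
    linarith
  refine ⟨j, ?_, h1, h2⟩
  rw [boxIdx, Finset.mem_filter, Finset.mem_range]
  refine ⟨(pow_lt_pow_iff_right₀ hq).1 (h1.trans_le hn2), ?_⟩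
  rw [div_le_iff₀ ((mul_pos hq0 hk0).trans_le hk1)]
  calc q ^ k ≤ n * (k : ℝ) ^ 5 := hn.le
    _ ≤ q * q ^ j * (k : ℝ) ^ 5 := by gcongr
    _ = q ^ j * (q * (k : ℝ) ^ 5) := by ring
    _ ≤ _ := by gcongr

theorem pow_interval_unique {q : ℝ} (hq : 1 < q) {i j : ℕ} {x : ℝ} (h1 : q ^ i < x) (h2 : x ≤ q * q ^ i)
    (h3 : q ^ j < x) (h4 : x ≤ q * q ^ j) : i = j := by
  rw [← pow_succ'] at h2 h4
  have := (pow_lt_pow_iff_right₀ hq).1 (h1.trans_le h4)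
  have := (pow_lt_pow_iff_right₀ hq).1 (h3.trans_le h2)
  omega

open Classical in
theorem card_thin_quadSet_le {q θ M D Δ : ℝ} {k : ℕ} (hcov : √(2 * M) + √(M / Real.exp θ) ≤ q ^ k)
    (hΔ : D ≤ Δ) :
    ((quadSet (Real.exp θ) M D).filter fun t =>
      (t.1, t.2.1) ∈ thinPairs q k ∨ (t.2.2.1, t.2.2.2) ∈ thinPairs q k).card ≤
      (thinQuads q k θ Δ).card := by
  refine Finset.card_le_card_of_injOn (fun t => ((t.1, t.2.1), (t.2.2.1, t.2.2.2))) ?_ ?_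
  · rintro ⟨a, b, c, d⟩ h
    rw [Finset.mem_coe, Finset.mem_filter] at h
    obtain ⟨h1, h2⟩ := h
    obtain ⟨ha, hb, hc, hd⟩ := le_of_mem_quadSet h1
    rw [mem_quadSet (Real.exp_pos θ)] at h1
    have m : ∀ {n : ℕ}, 1 ≤ n ∧ (n : ℝ) ≤ √(2 * M) + √(M / Real.exp θ) → n ∈ Finset.Icc 1 ⌊q ^ k⌋₊ :=
      fun h => Finset.mem_Icc.2 ⟨h.1, Nat.le_floor (h.2.trans hcov)⟩
    rw [Finset.mem_coe, thinQuads, Finset.mem_filter, Finset.mem_union]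
    simp only [Finset.mem_product]
    exact ⟨h2.imp (fun h => ⟨h, m hc, m hd⟩) fun h => ⟨⟨m ha, m hb⟩, h⟩, h1.2.2.2.1, h1.2.2.2.2.trans hΔ⟩
  · rintro ⟨a, b, c, d⟩ - ⟨a', b', c', d'⟩ - h
    simp only [Prod.mk.injEq] at h ⊢
    tauto

open Classical in
theorem card_quadSet_le_add {q θ M D M1 D1 μ E1 E2 : ℝ} {k : ℕ} (hq : 1 < q)
    (hcov : √(2 * M) + √(M / Real.exp θ) ≤ q ^ k) (hk1 : q * (k : ℝ) ^ 5 ≤ (k * Real.log q) ^ 6)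
    (hk2 : (k : ℝ) ^ 5 ≤ q ^ k) (hμ : 0 ≤ μ)
    (hE1 : (((quadSet (Real.exp θ) M D).filter fun t =>
      (t.1, t.2.1) ∈ thinPairs q k ∨ (t.2.2.1, t.2.2.2) ∈ thinPairs q k).card : ℝ) ≤ E1)
    (hE2 : ∀ j ∈ boxIdx q k ×ˢ boxIdx q k ×ˢ boxIdx q k ×ˢ boxIdx q k, ∀ r < 2, ∀ s < 2,
      (((quadSet (Real.exp θ) M D).filter (· ∈ qbox q j r s)).card : ℝ) ≤
        μ * ((quadSet (Real.exp θ) M1 D1).filter (· ∈ qbox q j r s)).card + E2) :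
    ((quadSet (Real.exp θ) M D).card : ℝ) ≤
      E1 + μ * (quadSet (Real.exp θ) M1 D1).card + 4 * ((boxIdx q k).card : ℝ) ^ 4 * E2 := by
  have hq0 : 0 < q := by linarith
  set S := quadSet (Real.exp θ) M D
  set S1 := quadSet (Real.exp θ) M1 D1
  set I := (boxIdx q k ×ˢ boxIdx q k ×ˢ boxIdx q k ×ˢ boxIdx q k) ×ˢ
    (Finset.range 2 ×ˢ Finset.range 2) with hI
  have hcard : (I.card : ℝ) = 4 * ((boxIdx q k).card : ℝ) ^ 4 := by
    rw [hI]
    simp only [Finset.card_product, Finset.card_range]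
    push_cast
    ring
  have hsub : S ⊆ (S.filter fun t => (t.1, t.2.1) ∈ thinPairs q k ∨ (t.2.2.1, t.2.2.2) ∈ thinPairs q k) ∪
      I.biUnion fun i => S.filter (· ∈ qbox q i.1 i.2.1 i.2.2) := by
    rintro ⟨a, b, c, d⟩ h
    obtain ⟨ha, hb, hc, hd⟩ := le_of_mem_quadSet h
    by_cases ht : (a, b) ∈ thinPairs q k ∨ (c, d) ∈ thinPairs q k
    · exact Finset.mem_union_left _ (Finset.mem_filter.2 ⟨h, ht⟩)
    refine Finset.mem_union_right _ (Finset.mem_biUnion.2 ?_)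
    have h' := (mem_quadSet (Real.exp_pos θ)).1 h
    have m : ∀ {n : ℕ}, 1 ≤ n ∧ (n : ℝ) ≤ √(2 * M) + √(M / Real.exp θ) → n ∈ Finset.Icc 1 ⌊q ^ k⌋₊ :=
      fun h => Finset.mem_Icc.2 ⟨h.1, Nat.le_floor (h.2.trans hcov)⟩
    simp only [thinPairs, Finset.mem_filter, Finset.mem_product, m ha, m hb, m hc, m hd, true_and,
      not_or, not_le] at ht
    obtain ⟨⟨ta, tb, -⟩, tc, td, -⟩ := ht
    obtain ⟨j1, i1, e1⟩ := exists_boxIdx hq hk1 hk2 ta (ha.2.trans hcov)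
    obtain ⟨j2, i2, e2⟩ := exists_boxIdx hq hk1 hk2 tb (hb.2.trans hcov)
    obtain ⟨j3, i3, e3⟩ := exists_boxIdx hq hk1 hk2 tc (hc.2.trans hcov)
    obtain ⟨j4, i4, e4⟩ := exists_boxIdx hq hk1 hk2 td (hd.2.trans hcov)
    refine ⟨((j1, j2, j3, j4), (a % 2, c % 2)), ?_, Finset.mem_filter.2 ⟨h, (mem_qbox hq0).2
      ⟨⟨e1, rfl⟩, ⟨e2, h'.2.1.1.symm⟩, ⟨e3, rfl⟩, ⟨e4, h'.2.1.2.symm⟩⟩⟩⟩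
    simp only [hI, Finset.mem_product, Finset.mem_range]
    exact ⟨⟨i1, i2, i3, i4⟩, Nat.mod_lt _ two_pos, Nat.mod_lt _ two_pos⟩
  have hdisj : ∀ i ∈ I, ∀ i' ∈ I, i ≠ i' → Disjoint (S1.filter (· ∈ qbox q i.1 i.2.1 i.2.2))
      (S1.filter (· ∈ qbox q i'.1 i'.2.1 i'.2.2)) := by
    rintro ⟨⟨j1, j2, j3, j4⟩, r, s⟩ - ⟨⟨i1, i2, i3, i4⟩, r', s'⟩ - hne
    rw [Finset.disjoint_left]
    rintro ⟨a, b, c, d⟩ h h'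
    rw [Finset.mem_filter, mem_qbox hq0] at h h'
    obtain ⟨-, ⟨a1, ar⟩, ⟨b1, -⟩, ⟨c1, cs⟩, d1, -⟩ := h
    obtain ⟨-, ⟨a2, ar'⟩, ⟨b2, -⟩, ⟨c2, cs'⟩, d2, -⟩ := h'
    refine hne ?_
    have f1 := pow_interval_unique hq a1.1 a1.2 a2.1 a2.2
    have f2 := pow_interval_unique hq b1.1 b1.2 b2.1 b2.2
    have f3 := pow_interval_unique hq c1.1 c1.2 c2.1 c2.2
    have f4 := pow_interval_unique hq d1.1 d1.2 d2.1 d2.2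
    simp only at f1 f2 f3 f4 ar ar' cs cs'
    rw [f1, f2, f3, f4, ← ar, ← ar', ← cs, ← cs']
  have hsum1 : ∑ i ∈ I, ((S1.filter (· ∈ qbox q i.1 i.2.1 i.2.2)).card : ℝ) ≤ S1.card := by
    rw [← Nat.cast_sum, ← Finset.card_biUnion hdisj]
    exact_mod_cast Finset.card_le_card (Finset.biUnion_subset.2 fun i _ => Finset.filter_subset _ _)
  have hsum : ((I.biUnion fun i => S.filter (· ∈ qbox q i.1 i.2.1 i.2.2)).card : ℝ) ≤
      μ * S1.card + 4 * ((boxIdx q k).card : ℝ) ^ 4 * E2 := by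
    calc ((I.biUnion fun i => S.filter (· ∈ qbox q i.1 i.2.1 i.2.2)).card : ℝ)
        ≤ ∑ i ∈ I, ((S.filter (· ∈ qbox q i.1 i.2.1 i.2.2)).card : ℝ) := by
          exact_mod_cast Finset.card_biUnion_le
      _ ≤ ∑ i ∈ I, (μ * ((S1.filter (· ∈ qbox q i.1 i.2.1 i.2.2)).card : ℝ) + E2) := by
          refine Finset.sum_le_sum fun i hi => ?_
          obtain ⟨h1, h2⟩ := Finset.mem_product.1 hi
          obtain ⟨h2, h3⟩ := Finset.mem_product.1 h2
          exact hE2 _ h1 _ (Finset.mem_range.1 h2) _ (Finset.mem_range.1 h3)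
      _ = μ * ∑ i ∈ I, ((S1.filter (· ∈ qbox q i.1 i.2.1 i.2.2)).card : ℝ) + I.card * E2 := by
          rw [Finset.sum_add_distrib, Finset.mul_sum, Finset.sum_const, nsmul_eq_mul]
      _ ≤ _ := by
          rw [hcard]
          gcongr
  have hfin : (S.card : ℝ) ≤ ((S.filter fun t => (t.1, t.2.1) ∈ thinPairs q k ∨
      (t.2.2.1, t.2.2.2) ∈ thinPairs q k).card : ℝ) +
      (I.biUnion fun i => S.filter (· ∈ qbox q i.1 i.2.1 i.2.2)).card := by
    exact_mod_cast (Finset.card_le_card hsub).trans (Finset.card_union_le _ _)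
  linarith

end QuadCover

section QuadCompare

theorem exists_inv_pow_near {q z : ℝ} (hq : 1 < q) (hz : 0 < z) (hz1 : z ≤ 1) :
    ∃ u : ℕ, z ≤ (q ^ u)⁻¹ ∧ (q ^ u)⁻¹ < q * z := by
  obtain ⟨u, h1, h2⟩ := exists_nat_pow_near ((one_le_inv₀ hz).2 hz1) hq
  have hu : 0 < q ^ u := by positivity
  refine ⟨u, (le_inv_comm₀ hz hu).2 h1, ?_⟩
  rw [inv_lt_iff_one_lt_mul₀ hu]
  rw [inv_lt_iff_one_lt_mul₀ hz, pow_succ'] at h2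
  linarith

theorem card_quadSet_qbox_compare {q θ M D D1 x L η ρ K : ℝ} (hq : 1 < q) (hq2 : q ≤ 2)
    {j : ℕ × ℕ × ℕ × ℕ} {r s : ℕ}
    (hdisc : ∀ u : ℕ, x ^ (-4 + η / 2) ≤ (q ^ u)⁻¹ → (q ^ u)⁻¹ ≤ x ^ (-(1 / 4) : ℝ) →
      |winCount (qbox q j r s) logRatio (q ^ u)⁻¹ θ / (q ^ u)⁻¹ - K| ≤
        q ^ j.1 * q ^ j.2.1 * q ^ j.2.2.1 * q ^ j.2.2.2 * ρ)
    (hx : 1 ≤ x) (hL : 0 < L) (hρ : 0 ≤ ρ)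
    (hy1 : q ^ j.1 ≤ x) (hy2 : q ^ j.2.1 ≤ x) (hy3 : q ^ j.2.2.1 ≤ x) (hy4 : q ^ j.2.2.2 ≤ x)
    (hz3 : x / L ^ 6 ≤ q ^ j.2.2.1) (hz4 : x / L ^ 6 ≤ q ^ j.2.2.2)
    (h1 : 2 * L ^ 12 ≤ x ^ (1 / 20 : ℝ)) (h2 : 16 ≤ x ^ (η / 2)) (h3 : x ^ (-(1 / 4) : ℝ) ≤ q - 1)
    (hM : 2 * D1 ≤ (q ^ 3 - q ^ 2) * M)
    (hD : x ^ (-2 + η) ≤ D) (hD' : D ≤ x ^ (17 / 10 : ℝ))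
    (hD1 : x ^ (-2 + η) ≤ D1) (hD1' : D1 ≤ x ^ (17 / 10 : ℝ)) :
    (((quadSet (Real.exp θ) M D).filter (· ∈ qbox q j r s)).card : ℝ) ≤
      q ^ 5 * D / D1 * ((quadSet (Real.exp θ) (q ^ 3 * M) D1).filter (· ∈ qbox q j r s)).card +
        2 * q * D * x ^ 2 * ρ := by
  have hq0 : 0 < q := by linarith
  have hx0 : 0 < x := by linarith
  have hDp : 0 < D := lt_of_lt_of_le (by positivity) hD
  have hD1p : 0 < D1 := lt_of_lt_of_le (by positivity) hD1
  rcases ((quadSet (Real.exp θ) M D).filter (· ∈ qbox q j r s)).eq_empty_or_nonempty with he | hne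
  · rw [he, Finset.card_empty, Nat.cast_zero]
    positivity
  set y1 := q ^ j.1 with hy1d
  set y2 := q ^ j.2.1 with hy2d
  set y3 := q ^ j.2.2.1 with hy3d
  set y4 := q ^ j.2.2.2 with hy4d
  have y1p : 0 < y1 := by positivity
  have y2p : 0 < y2 := by positivity
  have y3p : 0 < y3 := by positivity
  have y4p : 0 < y4 := by positivity
  have hyyp : 0 < y3 * y4 := by positivity
  have hyy : y3 * y4 ≤ x ^ 2 := by rw [pow_two]; gcongr
  have hyl : x ^ 2 / L ^ 12 ≤ y3 * y4 := by
    calc x ^ 2 / L ^ 12 = x / L ^ 6 * (x / L ^ 6) := by field_simp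
      _ ≤ _ := by gcongr
  have hlow : ∀ {E : ℝ}, x ^ (-2 + η) ≤ E → x ^ (-4 + η / 2) ≤ E / (q ^ 4 * (y3 * y4)) := by
    intro E hE
    rw [le_div_iff₀ (by positivity)]
    have hq4 : q ^ 4 ≤ x ^ (η / 2) := (pow_le_pow_left₀ hq0.le hq2 4).trans (by norm_num; linarith)
    calc x ^ (-4 + η / 2) * (q ^ 4 * (y3 * y4)) ≤ x ^ (-4 + η / 2) * (x ^ (η / 2) * x ^ (2 : ℝ)) := by
          rw [Real.rpow_two]; gcongr
      _ = x ^ (-2 + η) := by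
          rw [← Real.rpow_add hx0, ← Real.rpow_add hx0]; congr 1; ring
      _ ≤ E := hE
  have hupp : ∀ {E : ℝ}, 0 < E → E ≤ x ^ (17 / 10 : ℝ) → q * (E / (y3 * y4)) ≤ x ^ (-(1 / 4) : ℝ) := by
    intro E hE0 hE
    have hx2 : 0 < x ^ 2 / L ^ 12 := by positivity
    calc q * (E / (y3 * y4)) ≤ 2 * (x ^ (17 / 10 : ℝ) / (x ^ 2 / L ^ 12)) := by gcongr
      _ = 2 * L ^ 12 * x ^ (17 / 10 : ℝ) / x ^ 2 := by field_simp
      _ ≤ x ^ (1 / 20 : ℝ) * x ^ (17 / 10 : ℝ) / x ^ (2 : ℝ) := by rw [Real.rpow_two]; gcongr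
      _ = x ^ (-(1 / 4) : ℝ) := by
          rw [← Real.rpow_add hx0, ← Real.rpow_sub hx0]; congr 1; norm_num
  have hx4 : x ^ (-(1 / 4) : ℝ) ≤ 1 := Real.rpow_le_one_of_one_le_of_nonpos hx (by norm_num)
  have hq4 : 1 ≤ q ^ 4 := one_le_pow₀ hq.le
  set z := D / (y3 * y4) with hz
  set z1 := D1 / (q ^ 4 * (y3 * y4)) with hz1
  have hzp : 0 < z := by positivity
  have hz1p : 0 < z1 := by positivity
  have hz_eq : z * (y3 * y4) = D := by rw [hz]; field_simp
  have hz1_eq : z1 * (q ^ 4 * (y3 * y4)) = D1 := by rw [hz1]; field_simp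
  have hzq : q * z ≤ x ^ (-(1 / 4) : ℝ) := hupp hDp hD'
  have hzq1 : q * z1 ≤ x ^ (-(1 / 4) : ℝ) := by
    refine le_trans ?_ (hupp hD1p hD1')
    rw [hz1]
    exact mul_le_mul_of_nonneg_left (div_le_div_of_nonneg_left hD1p.le hyyp
      (le_mul_of_one_le_left hyyp.le hq4)) hq0.le
  have hzl : x ^ (-4 + η / 2) ≤ z := (hlow hD).trans <| by
    rw [hz]
    exact div_le_div_of_nonneg_left hDp.le hyyp (le_mul_of_one_le_left hyyp.le hq4)
  obtain ⟨u, u1, u2⟩ := exists_inv_pow_near hq hzp ((le_mul_of_one_le_left hzp.le hq.le).trans (hzq.trans hx4))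
  obtain ⟨v, v1, v2⟩ := exists_inv_pow_near hq hz1p ((le_mul_of_one_le_left hz1p.le hq.le).trans (hzq1.trans hx4))
  have d1 := hdisc u (hzl.trans u1) (u2.le.trans hzq)
  have d2 := hdisc v ((hlow hD1).trans v1) (v2.le.trans hzq1)
  set w := (q ^ u)⁻¹ with hw
  set w1 := (q ^ v)⁻¹ with hw1
  have hwp : 0 < w := by positivity
  have hw1p : 0 < w1 := by positivity
  have hw14 : w1 ≤ x ^ (-(1 / 4) : ℝ) := v2.le.trans hzq1
  have c1 : (((quadSet (Real.exp θ) M D).filter (· ∈ qbox q j r s)).card : ℝ) ≤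
      winCount (qbox q j r s) logRatio w θ := by
    refine Nat.cast_le.2 (card_quadSet_qbox_le hq hwp.le ?_)
    rw [← hz_eq]
    gcongr
  have hexp : Real.exp w1 - 1 ≤ q * w1 := by
    have h := (abs_le.1 (Real.abs_exp_sub_one_sub_id_le (x := w1) (by
      rw [abs_of_pos hw1p]; linarith))).2
    have h' := mul_le_mul_of_nonneg_right (hw14.trans h3) hw1p.le
    linarith
  have c2 : (winCount (qbox q j r s) logRatio w1 θ : ℝ) ≤
      ((quadSet (Real.exp θ) (q ^ 3 * M) D1).filter (· ∈ qbox q j r s)).card := by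
    refine Nat.cast_le.2 (winCount_qbox_le hq hw1p.le hexp ?_ hM hne)
    calc q ^ 3 * (y3 * y4) * w1 ≤ q ^ 3 * (y3 * y4) * (q * z1) := by gcongr
      _ = D1 := by rw [← hz1_eq]; ring
  set n := (winCount (qbox q j r s) logRatio w θ : ℝ)
  set n1 := (winCount (qbox q j r s) logRatio w1 θ : ℝ)
  set m := (((quadSet (Real.exp θ) (q ^ 3 * M) D1).filter (· ∈ qbox q j r s)).card : ℝ)
  have hn : n / w ≤ n1 / w1 + 2 * (y1 * y2 * y3 * y4 * ρ) := by
    have := (abs_le.1 d1).2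
    have := (abs_le.1 d2).1
    linarith
  have hww : w / w1 ≤ q ^ 5 * D / D1 := by
    rw [div_le_div_iff₀ hw1p hD1p, ← hz1_eq, ← hz_eq]
    calc w * (z1 * (q ^ 4 * (y3 * y4))) ≤ (q * z) * (w1 * (q ^ 4 * (y3 * y4))) := by gcongr
      _ = _ := by ring
  refine c1.trans ?_
  calc n = w * (n / w) := by field_simp
    _ ≤ w * (n1 / w1 + 2 * (y1 * y2 * y3 * y4 * ρ)) := by gcongr
    _ = w / w1 * n1 + 2 * w * (y3 * y4) * (y1 * y2) * ρ := by ring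
    _ ≤ q ^ 5 * D / D1 * m + 2 * (q * z) * (y3 * y4) * (x * x) * ρ := by gcongr
    _ = _ := by rw [← hz_eq]; ring

end QuadCompare

section QuadCompareAE

open Classical in
theorem filter_diag_subset_thin {q θ M D : ℝ} {k : ℕ} (hcov : √(2 * M) + √(M / Real.exp θ) ≤ q ^ k) :
    ((quadSet (Real.exp θ) M D).filter fun t => t.1 = t.2.1 ∨ t.2.2.1 = t.2.2.2) ⊆
      (quadSet (Real.exp θ) M D).filter fun t =>
        (t.1, t.2.1) ∈ thinPairs q k ∨ (t.2.2.1, t.2.2.2) ∈ thinPairs q k := by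
  rintro ⟨a, b, c, d⟩ h
  rw [Finset.mem_filter] at h ⊢
  refine ⟨h.1, ?_⟩
  obtain ⟨ha, hb, hc, hd⟩ := le_of_mem_quadSet h.1
  have m : ∀ {n : ℕ}, 1 ≤ n ∧ (n : ℝ) ≤ √(2 * M) + √(M / Real.exp θ) → n ∈ Finset.Icc 1 ⌊q ^ k⌋₊ :=
    fun h => Finset.mem_Icc.2 ⟨h.1, Nat.le_floor (h.2.trans hcov)⟩
  simp only [thinPairs, Finset.mem_filter, Finset.mem_product]
  exact h.2.imp (fun h => ⟨⟨m ha, m hb⟩, Or.inr (Or.inr h)⟩) fun h => ⟨⟨m hc, m hd⟩, Or.inr (Or.inr h)⟩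

open Classical in
theorem ae_quadSet_compare_pow {q η : ℝ} (hq : 1 < q) (hq2 : q ≤ 2) (hη : 0 < η) (hη1 : η ≤ 1) :
    ∀ᵐ θ : ℝ, ∀ ε > 0, ∀ C > 0, ∀ᶠ k : ℕ in Filter.atTop, ∀ M D D1 : ℝ,
      √(2 * M) + √(M / Real.exp θ) ≤ q ^ k → (q ^ k) ^ 2 ≤ C * M →
      (q ^ k) ^ (-2 + η) ≤ D → D ≤ (q ^ k) ^ (17 / 10 : ℝ) →
      (q ^ k) ^ (-2 + η) ≤ D1 → D1 ≤ (q ^ k) ^ (17 / 10 : ℝ) →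
      ((quadSet (Real.exp θ) M D).card : ℝ) ≤
        q ^ 5 * D / D1 * (quadSet (Real.exp θ) (q ^ 3 * M) D1).card + ε * D * (q ^ k) ^ 2 ∧
      (((quadSet (Real.exp θ) M D).filter fun t => t.1 = t.2.1 ∨ t.2.2.1 = t.2.2.2).card : ℝ) ≤
        ε * D * (q ^ k) ^ 2 := by
  have hq0 : 0 < q := by linarith
  have hl := Real.log_pos hq
  have hqx : Filter.Tendsto (fun k : ℕ => q ^ k) Filter.atTop Filter.atTop :=
    tendsto_pow_atTop_atTop_of_one_lt hq
  filter_upwards [ae_card_thinQuads_lt hq, ae_box_discrepancy hq hq2 (half_pos hη) (by linarith)]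
    with θ hthin hdisc ε hε C hC
  have T : ∀ {s : ℝ}, 0 < s → ∀ B : ℝ, ∀ᶠ k : ℕ in Filter.atTop, B ≤ (q ^ k) ^ s := fun hs B =>
    hqx.eventually ((tendsto_rpow_atTop hs).eventually_ge_atTop B)
  have Tk : ∀ {s B : ℝ}, 0 < s → 0 < B → ∀ᶠ k : ℕ in Filter.atTop, (k : ℝ) ^ (-s) ≤ B :=
    fun hs hB => tendsto_natCast_atTop_atTop.eventually
      ((tendsto_rpow_neg_atTop hs).eventually_le_const hB)
  have h5 := (isLittleO_pow_const_const_pow_of_one_lt (R := ℝ) 5 hq).def one_pos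
  have hq3 : 0 < q ^ 3 - q ^ 2 := by nlinarith [pow_pos hq0 2]
  filter_upwards [hthin, hdisc, eventually_card_boxIdx_le hq hq2, h5,
    hqx.eventually (eventually_mul_log_pow_le 2 12 (show (0 : ℝ) < 1 / 20 by norm_num)),
    T (half_pos hη) 16,
    hqx.eventually ((tendsto_rpow_neg_atTop (show (0 : ℝ) < 1 / 4 by norm_num)).eventually_le_const
      (show 0 < q - 1 by linarith)),
    T (show (0 : ℝ) < 3 / 10 by norm_num) (max 2 (2 * C / (q ^ 3 - q ^ 2))),
    Filter.eventually_ge_atTop 1,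
    tendsto_natCast_atTop_atTop.eventually (Filter.eventually_ge_atTop (q / Real.log q ^ 6)),
    Tk (show (0 : ℝ) < 1 / 2 by norm_num) (show 0 < ε / 4 by positivity),
    Tk (show (0 : ℝ) < 3 / 50 by norm_num)
      (show 0 < ε / 32 / Real.log q ^ (-(1 / 10) : ℝ) by positivity)]
    with k hthin hdisc hcardI h5 e1 e2 e3 e4 hk e6 e7 e8 M D D1 hcov hM hD hD' hD1 hD1'
  have hk0 : (0 : ℝ) < k := by exact_mod_cast hk
  rw [Real.log_pow] at e1
  rw [one_mul, Real.norm_of_nonneg (by positivity), Real.norm_of_nonneg (by positivity)] at h5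
  set x := q ^ k with hx
  have hx1 : 1 ≤ x := one_le_pow₀ hq.le
  have hx0 : 0 < x := by linarith
  set L := k * Real.log q with hL
  have hL0 : 0 < L := by positivity
  have hDp : 0 < D := lt_of_lt_of_le (by positivity) hD
  have hD1p : 0 < D1 := lt_of_lt_of_le (by positivity) hD1
  have hE1 : (((quadSet (Real.exp θ) M D).filter fun t =>
      (t.1, t.2.1) ∈ thinPairs q k ∨ (t.2.2.1, t.2.2.2) ∈ thinPairs q k).card : ℝ) ≤
      ε / 2 * D * x ^ 2 := by
    have hz : 1 ≤ D * x ^ 2 := by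
      calc (1 : ℝ) ≤ x ^ η := Real.one_le_rpow hx1 hη.le
        _ = x ^ (-2 + η) * x ^ (2 : ℝ) := by rw [← Real.rpow_add hx0]; congr 1; ring
        _ ≤ D * x ^ 2 := by rw [Real.rpow_two]; gcongr
    obtain ⟨u, u1, u2⟩ := exists_nat_pow_near hz hq
    have u3 : q ^ (u + 1) ≤ 2 * (D * x ^ 2) := by rw [pow_succ']; gcongr
    have hu : u + 1 ≤ 4 * k := by
      rw [← pow_le_pow_iff_right₀ hq]
      calc q ^ (u + 1) ≤ 2 * (D * x ^ 2) := u3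
        _ ≤ x ^ (3 / 10 : ℝ) * (x ^ (17 / 10 : ℝ) * x ^ (2 : ℝ)) := by
            rw [Real.rpow_two]
            have := (le_max_left _ _).trans e4
            gcongr
        _ = x ^ (4 : ℝ) := by rw [← Real.rpow_add hx0, ← Real.rpow_add hx0]; norm_num
        _ = q ^ (4 * k) := by
            rw [mul_comm 4 k, pow_mul, ← hx]
            norm_cast
    have hΔ : D ≤ q ^ (u + 1) / q ^ (2 * k) := by
      rw [mul_comm 2 k, pow_mul, ← hx, le_div_iff₀ (by positivity)]
      exact u2.le
    calc _ ≤ ((thinQuads q k θ (q ^ (u + 1) / q ^ (2 * k))).card : ℝ) := by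
          exact_mod_cast card_thin_quadSet_le hcov hΔ
      _ ≤ q ^ (u + 1) * (k : ℝ) ^ (-(1 / 2) : ℝ) := (hthin _ hu).le
      _ ≤ 2 * (D * x ^ 2) * (ε / 4) := by gcongr
      _ = _ := by ring
  refine ⟨?_, ?_⟩
  · obtain ⟨δ0, hδ0⟩ := hdisc
    have hk1 : q * (k : ℝ) ^ 5 ≤ L ^ 6 := by
      rw [div_le_iff₀ (by positivity)] at e6
      calc q * (k : ℝ) ^ 5 ≤ k * Real.log q ^ 6 * (k : ℝ) ^ 5 := by gcongr
        _ = L ^ 6 := by rw [hL]; ring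
    have hM' : 2 * D1 ≤ (q ^ 3 - q ^ 2) * M := by
      have h := (le_max_right _ _).trans e4
      rw [div_le_iff₀ hq3] at h
      have h2 : C * (2 * D1) ≤ C * ((q ^ 3 - q ^ 2) * M) := by
        calc C * (2 * D1) = 2 * C * D1 := by ring
          _ ≤ x ^ (3 / 10 : ℝ) * (q ^ 3 - q ^ 2) * x ^ (17 / 10 : ℝ) := by gcongr
          _ = (q ^ 3 - q ^ 2) * x ^ (2 : ℝ) := by
              rw [mul_right_comm, ← Real.rpow_add hx0, mul_comm]; norm_num
          _ ≤ (q ^ 3 - q ^ 2) * (C * M) := by rw [Real.rpow_two]; gcongr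
          _ = _ := by ring
      exact le_of_mul_le_mul_left h2 hC
    have hbox : ∀ {i : ℕ}, i ∈ boxIdx q k → q ^ i ≤ x ∧ x / L ^ 6 ≤ q ^ i := fun {i} hi => by
      rw [boxIdx, Finset.mem_filter, Finset.mem_range] at hi
      exact ⟨pow_le_pow_right₀ hq.le hi.1.le, hi.2⟩
    have key := card_quadSet_le_add (M1 := q ^ 3 * M) (D1 := D1) (μ := q ^ 5 * D / D1)
      (E2 := 2 * q * D * x ^ 2 * L ^ (-(1 / 10) : ℝ)) hq hcov hk1 h5 (by positivity) hE1
      (fun j hj r hr s hs => by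
        have hd := hδ0 j hj r hr s hs
        simp only [Finset.mem_product] at hj
        exact card_quadSet_qbox_compare hq hq2 hd hx1 hL0 (by positivity) (hbox hj.1).1 (hbox hj.2.1).1
          (hbox hj.2.2.1).1 (hbox hj.2.2.2).1 (hbox hj.2.2.1).2 (hbox hj.2.2.2).2 e1 e2 e3 hM'
          hD hD' hD1 hD1')
    refine key.trans ?_
    have : 4 * ((boxIdx q k).card : ℝ) ^ 4 * (2 * q * D * x ^ 2 * L ^ (-(1 / 10) : ℝ)) ≤
        ε / 2 * D * x ^ 2 := by
      rw [le_div_iff₀ (by positivity)] at e8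
      calc _ ≤ 4 * ((k : ℝ) ^ (1 / 100 : ℝ)) ^ 4 * (2 * 2 * D * x ^ 2 * L ^ (-(1 / 10) : ℝ)) := by gcongr
        _ = 16 * D * x ^ 2 * ((k : ℝ) ^ (-(3 / 50) : ℝ) * Real.log q ^ (-(1 / 10) : ℝ)) := by
            rw [hL, Real.mul_rpow hk0.le hl.le, ← Real.rpow_natCast, ← Real.rpow_mul hk0.le,
              show (-(3 / 50) : ℝ) = 1 / 100 * (4 : ℕ) + -(1 / 10) by norm_num, Real.rpow_add hk0]
            ring
        _ ≤ 16 * D * x ^ 2 * (ε / 32) := by gcongr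
        _ = _ := by ring
    linarith
  · refine (Nat.cast_le.2 (Finset.card_le_card (filter_diag_subset_thin hcov))).trans (hE1.trans ?_)
    have : 0 < ε * D * x ^ 2 := by positivity
    linarith

end QuadCompareAE

section QuadCompareReal

open Classical in
theorem ae_quadSet_compare {q η : ℝ} (hq : 1 < q) (hq2 : q ≤ 2) (hη : 0 < η) (hη1 : η ≤ 1) :
    ∀ᵐ θ : ℝ, ∀ ε > 0, ∀ᶠ M : ℝ in Filter.atTop, ∀ D D1 : ℝ,
      M ^ (-1 + η) ≤ D → D ≤ M ^ (4 / 5 : ℝ) → M ^ (-1 + η) ≤ D1 → D1 ≤ M ^ (4 / 5 : ℝ) →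
      ((quadSet (Real.exp θ) M D).card : ℝ) ≤
        q ^ 5 * D / D1 * (quadSet (Real.exp θ) (q ^ 3 * M) D1).card + ε * D * M ∧
      (((quadSet (Real.exp θ) M D).filter fun t => t.1 = t.2.1 ∨ t.2.2.1 = t.2.2.2).card : ℝ) ≤
        ε * D * M := by
  filter_upwards [ae_quadSet_compare_pow hq hq2 hη hη1] with θ hθ ε hε
  set c := √2 + √(1 / Real.exp θ) with hc
  have hc1 : 1 ≤ c := by
    have h1 : (1 : ℝ) ≤ √2 := Real.one_le_sqrt.2 (by norm_num)
    have h2 := Real.sqrt_nonneg (1 / Real.exp θ)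
    linarith
  obtain ⟨K, hK⟩ := Filter.eventually_atTop.1 (hθ (ε / (q ^ 2 * c ^ 2)) (by positivity) (q ^ 2 * c ^ 2)
    (by positivity))
  filter_upwards [Filter.eventually_ge_atTop 1, Filter.eventually_ge_atTop ((q ^ K) ^ 2)]
    with M hM1 hMK D D1 hD hD' hD1 hD1'
  have hq0 : 0 < q := by linarith
  have hs1 : 1 ≤ √M := Real.one_le_sqrt.2 hM1
  have hsM : √M ^ 2 = M := Real.sq_sqrt (by linarith)
  have hsc : √(2 * M) + √(M / Real.exp θ) = c * √M := by
    rw [Real.sqrt_mul (by norm_num), div_eq_mul_one_div, mul_comm M, Real.sqrt_mul (by positivity), hc]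
    ring
  have hscl : √M ≤ c * √M := le_mul_of_one_le_left (by linarith) hc1
  obtain ⟨n, n1, n2⟩ := exists_nat_pow_near (hs1.trans hscl) hq
  set x := q ^ (n + 1) with hx
  have hxM : √M ≤ x := hscl.trans n2.le
  have hx2 : x ^ 2 ≤ q ^ 2 * c ^ 2 * M := by
    calc x ^ 2 ≤ (q * (c * √M)) ^ 2 := by
          refine pow_le_pow_left₀ (by positivity) ?_ 2
          rw [hx, pow_succ']
          gcongr
      _ = q ^ 2 * c ^ 2 * √M ^ 2 := by ring
      _ = _ := by rw [hsM]
  have hnK : K ≤ n + 1 := by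
    refine ((pow_lt_pow_iff_right₀ hq).1 (lt_of_le_of_lt ?_ n2)).le
    exact (Real.le_sqrt_of_sq_le hMK).trans hscl
  have hlow : x ^ (-2 + η) ≤ M ^ (-1 + η) := by
    calc x ^ (-2 + η) ≤ √M ^ (-2 + η) :=
          Real.rpow_le_rpow_of_nonpos (by linarith) hxM (by linarith)
      _ = M ^ (-1 + η / 2) := by
          rw [Real.sqrt_eq_rpow, ← Real.rpow_mul (by linarith)]; congr 1; ring
      _ ≤ _ := Real.rpow_le_rpow_of_exponent_le hM1 (by linarith)
  have hupp : M ^ (4 / 5 : ℝ) ≤ x ^ (17 / 10 : ℝ) := by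
    calc M ^ (4 / 5 : ℝ) ≤ M ^ (17 / 20 : ℝ) := Real.rpow_le_rpow_of_exponent_le hM1 (by norm_num)
      _ = √M ^ (17 / 10 : ℝ) := by
          rw [Real.sqrt_eq_rpow, ← Real.rpow_mul (by linarith)]; congr 1; norm_num
      _ ≤ _ := Real.rpow_le_rpow (by linarith) hxM (by norm_num)
  have hDp : 0 ≤ D := le_trans (by positivity) hD
  obtain ⟨h1, h2⟩ := hK (n + 1) hnK M D D1 (hsc.trans_le n2.le) hx2 (hlow.trans hD) (hD'.trans hupp)
    (hlow.trans hD1) (hD1'.trans hupp)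
  have herr : ε / (q ^ 2 * c ^ 2) * D * x ^ 2 ≤ ε * D * M := by
    calc ε / (q ^ 2 * c ^ 2) * D * x ^ 2 ≤ ε / (q ^ 2 * c ^ 2) * D * (q ^ 2 * c ^ 2 * M) := by gcongr
      _ = _ := by field_simp
  exact ⟨h1.trans (by gcongr), h2.trans herr⟩

end QuadCompareReal

section Opposite

/-- Pairs of lattice points `(m, n)`, `(m', n')` with `m' < m`, `n < n'` whose values of
`β x² + y²` differ by at most `D`. -/
def IsOpposite (β M D : ℝ) (t : ℕ × ℕ × ℕ × ℕ) : Prop :=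
  t.2.2.1 < t.1 ∧ t.2.1 < t.2.2.2 ∧ 4 * (β * (t.1 : ℝ) ^ 2 + (t.2.1 : ℝ) ^ 2) ≤ M ∧
    0 ≤ β * ((t.1 : ℝ) ^ 2 - (t.2.2.1 : ℝ) ^ 2) + ((t.2.1 : ℝ) ^ 2 - (t.2.2.2 : ℝ) ^ 2) ∧
    β * ((t.1 : ℝ) ^ 2 - (t.2.2.1 : ℝ) ^ 2) + ((t.2.1 : ℝ) ^ 2 - (t.2.2.2 : ℝ) ^ 2) ≤ D

theorem card_quadSet_eq {β : ℝ} (hβ : 0 < β) (M D : ℝ) :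
    (quadSet β M D).card = 4 * ((quadSet β M D).filter fun t => t.1 < t.2.1 ∧ t.2.2.1 < t.2.2.2).card +
      ((quadSet β M D).filter fun t => t.1 = t.2.1 ∨ t.2.2.1 = t.2.2.2).card := by
  set V := quadSet β M D
  have hs1 : (V.filter fun t => t.2.1 < t.1 ∧ t.2.2.1 < t.2.2.2).card =
      (V.filter fun t => t.1 < t.2.1 ∧ t.2.2.1 < t.2.2.2).card := by
    refine Finset.card_bij' (fun t _ => (t.2.1, t.1, t.2.2.1, t.2.2.2))
      (fun t _ => (t.2.1, t.1, t.2.2.1, t.2.2.2)) ?_ ?_ (fun _ _ => rfl) (fun _ _ => rfl) <;>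
    · rintro ⟨a, b, c, d⟩ h
      rw [Finset.mem_filter, mem_quadSet hβ] at h ⊢
      simp only at h ⊢
      rw [add_comm (b : ℝ), mul_comm (b : ℝ)]
      tauto
  have hs2 : ∀ p : ℕ → ℕ → Prop, [DecidableRel p] → (V.filter fun t => p t.1 t.2.1 ∧ t.2.2.2 < t.2.2.1).card =
      (V.filter fun t => p t.1 t.2.1 ∧ t.2.2.1 < t.2.2.2).card := by
    intro p _
    refine Finset.card_bij' (fun t _ => (t.1, t.2.1, t.2.2.2, t.2.2.1))
      (fun t _ => (t.1, t.2.1, t.2.2.2, t.2.2.1)) ?_ ?_ (fun _ _ => rfl) (fun _ _ => rfl) <;>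
    · rintro ⟨a, b, c, d⟩ h
      rw [Finset.mem_filter, mem_quadSet hβ] at h ⊢
      simp only at h ⊢
      rw [mul_comm (d : ℝ), show ((c : ℝ) - d) ^ 2 = (d - c) ^ 2 by ring]
      tauto
  have e1 := Finset.card_filter_add_card_filter_not (s := V) fun t => t.1 = t.2.1 ∨ t.2.2.1 = t.2.2.2
  have e2 := Finset.card_filter_add_card_filter_not
    (s := V.filter fun t => ¬(t.1 = t.2.1 ∨ t.2.2.1 = t.2.2.2)) fun t => t.1 < t.2.1
  have e3 := Finset.card_filter_add_card_filter_not
    (s := V.filter fun t => t.1 ≠ t.2.1 ∧ t.2.2.1 ≠ t.2.2.2 ∧ t.1 < t.2.1) fun t => t.2.2.1 < t.2.2.2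
  have e4 := Finset.card_filter_add_card_filter_not
    (s := V.filter fun t => t.1 ≠ t.2.1 ∧ t.2.2.1 ≠ t.2.2.2 ∧ ¬ t.1 < t.2.1) fun t => t.2.2.1 < t.2.2.2
  have h1 := hs2 (fun a b => a < b)
  have h2 := hs2 (fun a b => b < a)
  simp only [Finset.filter_filter] at e2 e3 e4
  have c : ∀ {P Q : ℕ × ℕ × ℕ × ℕ → Prop} [DecidablePred P] [DecidablePred Q], (∀ t, P t ↔ Q t) →
      (V.filter P).card = (V.filter Q).card := fun h => by
    congr 1; exact Finset.filter_congr fun t _ => h t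
  rw [c (Q := fun t => t.1 ≠ t.2.1 ∧ t.2.2.1 ≠ t.2.2.2 ∧ t.1 < t.2.1) (by intro t; grind),
    c (P := fun t => ¬(t.1 = t.2.1 ∨ t.2.2.1 = t.2.2.2) ∧ ¬ t.1 < t.2.1)
      (Q := fun t => t.1 ≠ t.2.1 ∧ t.2.2.1 ≠ t.2.2.2 ∧ ¬ t.1 < t.2.1) (by intro t; grind)] at e2
  rw [c (Q := fun t => t.1 < t.2.1 ∧ t.2.2.1 < t.2.2.2) (by intro t; grind),
    c (P := fun t => (t.1 ≠ t.2.1 ∧ t.2.2.1 ≠ t.2.2.2 ∧ t.1 < t.2.1) ∧ ¬ t.2.2.1 < t.2.2.2)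
      (Q := fun t => t.1 < t.2.1 ∧ t.2.2.2 < t.2.2.1) (by intro t; grind)] at e3
  rw [c (Q := fun t => t.2.1 < t.1 ∧ t.2.2.1 < t.2.2.2) (by intro t; grind),
    c (P := fun t => (t.1 ≠ t.2.1 ∧ t.2.2.1 ≠ t.2.2.2 ∧ ¬ t.1 < t.2.1) ∧ ¬ t.2.2.1 < t.2.2.2)
      (Q := fun t => t.2.1 < t.1 ∧ t.2.2.2 < t.2.2.1) (by intro t; grind)] at e4
  omega

theorem card_opposite_le {β : ℝ} (hβ : 0 < β) {M D : ℝ} {F : Finset (ℕ × ℕ × ℕ × ℕ)}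
    (hF : ∀ t ∈ F, IsOpposite β M D t) :
    F.card ≤ ((quadSet β M D).filter fun t => t.1 < t.2.1 ∧ t.2.2.1 < t.2.2.2).card +
      ((quadSet β M D).filter fun t => t.1 = t.2.1 ∨ t.2.2.1 = t.2.2.2).card := by
  refine le_trans ?_ (Finset.card_union_le _ _)
  refine Finset.card_le_card_of_injOn (fun t => (t.1 - t.2.2.1, t.1 + t.2.2.1, t.2.2.2 - t.2.1,
    t.2.2.2 + t.2.1)) ?_ ?_
  · rintro ⟨m, n, m', n'⟩ h
    obtain ⟨h1, h2, h3, h4, h5⟩ := hF _ (Finset.mem_coe.1 h)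
    simp only at h1 h2 h3 h4 h5
    rw [Finset.mem_coe, Finset.mem_union, Finset.mem_filter, Finset.mem_filter, mem_quadSet hβ]
    simp only
    push_cast [h1.le, h2.le]
    have hV : (0 < m - m' ∧ 0 < m + m' ∧ 0 < n' - n ∧ 0 < n' + n) ∧
        ((m - m') % 2 = (m + m') % 2 ∧ (n' - n) % 2 = (n' + n) % 2) ∧
        β * ((m : ℝ) - m' + (m + m')) ^ 2 + ((n' : ℝ) + n - (n' - n)) ^ 2 ≤ M ∧
        0 ≤ β * (((m : ℝ) - m') * (m + m')) - (n' - n) * (n' + n) ∧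
        β * (((m : ℝ) - m') * (m + m')) - (n' - n) * (n' + n) ≤ D :=
      ⟨by omega, by omega, by linarith, by linarith, by linarith⟩
    have : (m - m' < m + m' ∧ n' - n < n' + n) ∨ (m - m' = m + m' ∨ n' - n = n' + n) := by omega
    exact this.imp (fun h => ⟨hV, h⟩) fun h => ⟨hV, h⟩
  · rintro ⟨m, n, m', n'⟩ h ⟨k, l, k', l'⟩ h' heq
    obtain ⟨h1, h2, -⟩ := hF _ (Finset.mem_coe.1 h)
    obtain ⟨h3, h4, -⟩ := hF _ (Finset.mem_coe.1 h')
    simp only [Prod.mk.injEq] at h1 h2 h3 h4 heq ⊢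
    omega

theorem le_card_opposite {β : ℝ} (hβ : 0 < β) {M D : ℝ} {F : Finset (ℕ × ℕ × ℕ × ℕ)}
    (hF : ∀ t, IsOpposite β M D t → 0 < t.2.1 → 0 < t.2.2.1 → t ∈ F) :
    ((quadSet β M D).filter fun t => t.1 < t.2.1 ∧ t.2.2.1 < t.2.2.2).card ≤ F.card := by
  refine Finset.card_le_card_of_injOn (fun t => ((t.1 + t.2.1) / 2, (t.2.2.2 - t.2.2.1) / 2,
    (t.2.1 - t.1) / 2, (t.2.2.1 + t.2.2.2) / 2)) ?_ ?_
  · rintro ⟨a, b, c, d⟩ h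
    rw [Finset.mem_coe, Finset.mem_filter, mem_quadSet hβ] at h
    obtain ⟨⟨⟨ha, hb, hc, hd⟩, ⟨p1, p2⟩, h3, h4, h5⟩, h6, h7⟩ := h
    simp only at h6 h7
    obtain ⟨m, hm⟩ : ∃ m, a + b = 2 * m := ⟨(a + b) / 2, by omega⟩
    obtain ⟨m', hm'⟩ : ∃ m, b - a = 2 * m := ⟨(b - a) / 2, by omega⟩
    obtain ⟨n, hn⟩ : ∃ m, d - c = 2 * m := ⟨(d - c) / 2, by omega⟩
    obtain ⟨n', hn'⟩ : ∃ m, c + d = 2 * m := ⟨(c + d) / 2, by omega⟩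
    have ea : (a : ℝ) = m - m' := by
      rw [eq_sub_iff_add_eq]; norm_cast; omega
    have eb : (b : ℝ) = m + m' := by norm_cast; omega
    have ec : (c : ℝ) = n' - n := by
      rw [eq_sub_iff_add_eq]; norm_cast; omega
    have ed : (d : ℝ) = n' + n := by norm_cast; omega
    rw [ea, eb, ec, ed] at h3
    rw [ea, eb, ec, ed] at h4 h5
    simp only [hm, hm', hn, hn']
    refine hF _ ⟨?_, ?_, ?_, ?_, ?_⟩ ?_ ?_ <;> simp only [Nat.mul_div_cancel_left _ two_pos]
    · omega
    · omega
    · linarith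
    · linarith
    · linarith
    · omega
    · omega
  · rintro ⟨a, b, c, d⟩ h ⟨a', b', c', d'⟩ h' heq
    rw [Finset.mem_coe, Finset.mem_filter, mem_quadSet hβ] at h h'
    obtain ⟨⟨-, ⟨p1, p2⟩, -⟩, h1, h2⟩ := h
    obtain ⟨⟨-, ⟨p3, p4⟩, -⟩, h3, h4⟩ := h'
    simp only [Prod.mk.injEq] at h1 h2 h3 h4 heq ⊢
    omega

theorem abs_four_mul_card_opposite_sub_le {β : ℝ} (hβ : 0 < β) {M D : ℝ}
    {F : Finset (ℕ × ℕ × ℕ × ℕ)} (hF : ∀ t ∈ F, IsOpposite β M D t)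
    (hF' : ∀ t, IsOpposite β M D t → 0 < t.2.1 → 0 < t.2.2.1 → t ∈ F) :
    |4 * (F.card : ℝ) - (quadSet β M D).card| ≤
      4 * ((quadSet β M D).filter fun t => t.1 = t.2.1 ∨ t.2.2.1 = t.2.2.2).card := by
  have h1 := card_quadSet_eq hβ M D
  have h2 := card_opposite_le hβ hF
  have h3 := le_card_opposite hβ hF'
  rw [abs_le]
  constructor
  · have : (quadSet β M D).card ≤ 4 * F.card +
        4 * ((quadSet β M D).filter fun t => t.1 = t.2.1 ∨ t.2.2.1 = t.2.2.2).card := by omega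
    have : ((quadSet β M D).card : ℝ) ≤ 4 * F.card +
        4 * ((quadSet β M D).filter fun t => t.1 = t.2.1 ∨ t.2.2.1 = t.2.2.2).card := by
      exact_mod_cast this
    linarith
  · have : 4 * F.card ≤ (quadSet β M D).card +
        4 * ((quadSet β M D).filter fun t => t.1 = t.2.1 ∨ t.2.2.1 = t.2.2.2).card := by omega
    have : 4 * (F.card : ℝ) ≤ (quadSet β M D).card +
        4 * ((quadSet β M D).filter fun t => t.1 = t.2.1 ∨ t.2.2.1 = t.2.2.2).card := by
      exact_mod_cast this
    linarith

end Opposite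

section PairSet

/-- Pairs of distinct lattice points `(m, n)`, `(m', n')` with `m, m' > 0`, `4 (β m² + n²) ≤ M` and
`(β m² + n²) - (β m'² + n'²) ∈ [0, D]`. -/
noncomputable def pairSet (β M D : ℝ) : Finset (ℕ × ℕ × ℕ × ℕ) :=
  open Classical in
  (Finset.range (⌊√M + √(M / β)⌋₊ + 1) ×ˢ Finset.range (⌊√M + √(M / β)⌋₊ + 1) ×ˢ
    Finset.range (⌊√M + √(M / β)⌋₊ + 1) ×ˢ Finset.range (⌊√M + √(M / β)⌋₊ + 1)).filter fun t =>
      (0 < t.1 ∧ 0 < t.2.2.1 ∧ ¬(t.1 = t.2.2.1 ∧ t.2.1 = t.2.2.2)) ∧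
      4 * (β * (t.1 : ℝ) ^ 2 + (t.2.1 : ℝ) ^ 2) ≤ M ∧
      0 ≤ β * ((t.1 : ℝ) ^ 2 - (t.2.2.1 : ℝ) ^ 2) + ((t.2.1 : ℝ) ^ 2 - (t.2.2.2 : ℝ) ^ 2) ∧
      β * ((t.1 : ℝ) ^ 2 - (t.2.2.1 : ℝ) ^ 2) + ((t.2.1 : ℝ) ^ 2 - (t.2.2.2 : ℝ) ^ 2) ≤ D

theorem le_floor_of_quadForm_le {β M : ℝ} (hβ : 0 < β) {m n : ℕ}
    (h : 4 * (β * (m : ℝ) ^ 2 + (n : ℝ) ^ 2) ≤ M) :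
    m < ⌊√M + √(M / β)⌋₊ + 1 ∧ n < ⌊√M + √(M / β)⌋₊ + 1 := by
  have hm : 0 ≤ β * (m : ℝ) ^ 2 := by positivity
  have hn : 0 ≤ (n : ℝ) ^ 2 := by positivity
  have h1 : (m : ℝ) ≤ √(M / β) := by
    refine Real.le_sqrt_of_sq_le ?_
    rw [le_div_iff₀ hβ]
    linarith
  have h2 : (n : ℝ) ≤ √M := Real.le_sqrt_of_sq_le (by linarith)
  have s1 := Real.sqrt_nonneg M
  have s2 := Real.sqrt_nonneg (M / β)
  exact ⟨Nat.lt_succ_of_le (Nat.le_floor (by linarith)), Nat.lt_succ_of_le (Nat.le_floor (by linarith))⟩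

theorem mem_pairSet {β : ℝ} (hβ : 0 < β) {M D : ℝ} {m n m' n' : ℕ} :
    (m, n, m', n') ∈ pairSet β M D ↔ (0 < m ∧ 0 < m' ∧ ¬(m = m' ∧ n = n')) ∧
      4 * (β * (m : ℝ) ^ 2 + (n : ℝ) ^ 2) ≤ M ∧
      0 ≤ β * ((m : ℝ) ^ 2 - (m' : ℝ) ^ 2) + ((n : ℝ) ^ 2 - (n' : ℝ) ^ 2) ∧
      β * ((m : ℝ) ^ 2 - (m' : ℝ) ^ 2) + ((n : ℝ) ^ 2 - (n' : ℝ) ^ 2) ≤ D := by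
  simp only [pairSet, Finset.mem_filter, Finset.mem_product, Finset.mem_range]
  refine ⟨fun h => h.2, fun h => ⟨?_, h⟩⟩
  obtain ⟨-, h1, h2, -⟩ := h
  have h3 := le_floor_of_quadForm_le hβ h1
  have h4 := le_floor_of_quadForm_le (m := m') (n := n') hβ (M := M) (by linarith)
  exact ⟨h3.1, h3.2, h4.1, h4.2⟩

theorem abs_four_mul_card_pairSet_sub_le {β : ℝ} (hβ : 0 < β) (M D : ℝ) :
    |4 * ((pairSet β M D).card : ℝ) - (quadSet β M D).card - (quadSet β⁻¹ (M / β) (D / β)).card| ≤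
      4 * ((quadSet β M D).filter fun t => t.1 = t.2.1 ∨ t.2.2.1 = t.2.2.2).card +
      4 * ((quadSet β⁻¹ (M / β) (D / β)).filter fun t => t.1 = t.2.1 ∨ t.2.2.1 = t.2.2.2).card +
      4 * ((pairSet β M D).filter fun t => t.2.2.1 ≤ t.1 ∧ t.2.2.2 ≤ t.2.1).card := by
  set P := pairSet β M D with hP
  have hβi : 0 < β⁻¹ := by positivity
  have e1 := Finset.card_filter_add_card_filter_not (s := P) fun t => t.2.2.1 ≤ t.1 ∧ t.2.2.2 ≤ t.2.1
  have e2 := Finset.card_filter_add_card_filter_not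
    (s := P.filter fun t => ¬(t.2.2.1 ≤ t.1 ∧ t.2.2.2 ≤ t.2.1)) fun t => t.2.2.1 < t.1
  simp only [Finset.filter_filter] at e2
  set P1 := P.filter fun t => ¬(t.2.2.1 ≤ t.1 ∧ t.2.2.2 ≤ t.2.1) ∧ t.2.2.1 < t.1
  set P2 := P.filter fun t => ¬(t.2.2.1 ≤ t.1 ∧ t.2.2.2 ≤ t.2.1) ∧ ¬ t.2.2.1 < t.1
  set sw : ℕ × ℕ × ℕ × ℕ → ℕ × ℕ × ℕ × ℕ := fun t => (t.2.1, t.1, t.2.2.2, t.2.2.1) with hsw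
  have hc2 : (P2.image sw).card = P2.card := by
    refine Finset.card_image_of_injective _ ?_
    rintro ⟨a, b, c, d⟩ ⟨a', b', c', d'⟩ h
    simp only [hsw, Prod.mk.injEq] at h ⊢
    tauto
  have k1 := abs_four_mul_card_opposite_sub_le hβ (M := M) (D := D) (F := P1) (by
    rintro ⟨m, n, m', n'⟩ h
    rw [Finset.mem_filter, mem_pairSet hβ] at h
    obtain ⟨⟨-, h1, h2, h3⟩, h4, h5⟩ := h
    simp only at h4 h5
    exact ⟨h5, by simp only; omega, h1, h2, h3⟩) (by
    rintro ⟨m, n, m', n'⟩ ⟨h1, h2, h3, h4, h5⟩ h6 h7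
    simp only at h1 h2 h3 h4 h5 h6 h7
    rw [Finset.mem_filter, mem_pairSet hβ]
    exact ⟨⟨by omega, h3, h4, h5⟩, by simp only; omega⟩)
  have k2 := abs_four_mul_card_opposite_sub_le hβi (M := M / β) (D := D / β) (F := P2.image sw) (by
    intro t ht
    obtain ⟨⟨m, n, m', n'⟩, h, rfl⟩ := Finset.mem_image.1 ht
    rw [Finset.mem_filter, mem_pairSet hβ] at h
    obtain ⟨⟨-, h1, h2, h3⟩, h4, h5⟩ := h
    simp only at h4 h5
    have hmm : m < m' := by
      by_contra! hlt
      have heq : m = m' := by omega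
      subst heq
      have : (n : ℝ) < n' := by exact_mod_cast (by omega : n < n')
      have : (n : ℝ) ^ 2 < (n' : ℝ) ^ 2 := by gcongr
      linarith
    have hnn : n' < n := by
      by_contra! hle
      have : (m : ℝ) < m' := by exact_mod_cast hmm
      have : (m : ℝ) ^ 2 < (m' : ℝ) ^ 2 := by gcongr
      have := mul_lt_mul_of_pos_left this hβ
      have : (n : ℝ) ≤ n' := by exact_mod_cast hle
      have : (n : ℝ) ^ 2 ≤ (n' : ℝ) ^ 2 := by gcongr
      linarith
    have hfac : β⁻¹ * ((n : ℝ) ^ 2 - (n' : ℝ) ^ 2) + ((m : ℝ) ^ 2 - (m' : ℝ) ^ 2) =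
        (β * ((m : ℝ) ^ 2 - (m' : ℝ) ^ 2) + ((n : ℝ) ^ 2 - (n' : ℝ) ^ 2)) / β := by
      field_simp; ring
    refine ⟨hnn, hmm, ?_, ?_, ?_⟩
    · simp only [hsw]
      rw [le_div_iff₀ hβ]
      calc 4 * (β⁻¹ * (n : ℝ) ^ 2 + (m : ℝ) ^ 2) * β = 4 * (β * (m : ℝ) ^ 2 + (n : ℝ) ^ 2) := by
            field_simp; ring
        _ ≤ M := h1
    · simp only [hsw]
      rw [hfac]
      positivity
    · simp only [hsw]
      rw [hfac]
      gcongr) (by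
    rintro ⟨n, m, n', m'⟩ ⟨h1, h2, h3, h4, h5⟩ h6 h7
    simp only at h1 h2 h3 h4 h5 h6 h7
    have hfac : β⁻¹ * ((n : ℝ) ^ 2 - (n' : ℝ) ^ 2) + ((m : ℝ) ^ 2 - (m' : ℝ) ^ 2) =
        (β * ((m : ℝ) ^ 2 - (m' : ℝ) ^ 2) + ((n : ℝ) ^ 2 - (n' : ℝ) ^ 2)) / β := by
      field_simp; ring
    rw [hfac] at h4 h5
    refine Finset.mem_image.2 ⟨(m, n, m', n'), ?_, rfl⟩
    rw [Finset.mem_filter, mem_pairSet hβ]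
    refine ⟨⟨by omega, ?_, ?_, ?_⟩, by simp only; omega⟩
    · rw [le_div_iff₀ hβ] at h3
      calc 4 * (β * (m : ℝ) ^ 2 + (n : ℝ) ^ 2) = 4 * (β⁻¹ * (n : ℝ) ^ 2 + (m : ℝ) ^ 2) * β := by
            field_simp; ring
        _ ≤ M := h3
    · rwa [le_div_iff₀ hβ, zero_mul] at h4
    · exact (div_le_div_iff_of_pos_right hβ).1 h5)
  rw [hc2] at k2
  have e3 : (P.card : ℝ) = ((P.filter fun t => t.2.2.1 ≤ t.1 ∧ t.2.2.2 ≤ t.2.1).card : ℝ) + P1.card +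
      P2.card := by
    rw [← e1, ← e2]; push_cast; ring
  rw [e3]
  have n3 : (0 : ℝ) ≤ ((P.filter fun t => t.2.2.1 ≤ t.1 ∧ t.2.2.2 ≤ t.2.1).card : ℝ) := by positivity
  rw [abs_le] at *
  constructor <;> linarith [k1.1, k1.2, k2.1, k2.2]

end PairSet

section Degenerate

open Classical in
/-- Pairs `l < k ≤ B` with `k² - l² ≤ Z`. -/
noncomputable def nearPairs (B : ℕ) (Z : ℝ) : Finset (ℕ × ℕ) :=
  (Finset.range (B + 1) ×ˢ Finset.range (B + 1)).filter fun p =>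
    p.2 < p.1 ∧ (p.1 : ℝ) ^ 2 - (p.2 : ℝ) ^ 2 ≤ Z

theorem card_nearPairs_le (B : ℕ) {Z : ℝ} (hZ : 0 ≤ Z) :
    ((nearPairs B Z).card : ℝ) ≤ Z * (1 + Real.log (2 * B : ℕ)) := by
  have h1 : (nearPairs B Z).card ≤
      ((Finset.Icc 1 (2 * B)).sigma fun b => Finset.Icc 1 ⌊Z / b⌋₊).card := by
    refine Finset.card_le_card_of_injOn (fun p => ⟨p.1 + p.2, p.1 - p.2⟩) ?_ ?_
    · rintro ⟨k, l⟩ h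
      simp only [nearPairs, Finset.mem_coe, Finset.mem_filter, Finset.mem_product, Finset.mem_range] at h
      obtain ⟨⟨h1, h2⟩, h3, h4⟩ := h
      rw [Finset.mem_coe, Finset.mem_sigma, Finset.mem_Icc, Finset.mem_Icc]
      dsimp only at h1 h2 h3 h4 ⊢
      refine ⟨⟨by omega, by omega⟩, by omega, Nat.le_floor ?_⟩
      have hpos : (0 : ℝ) < ((k + l : ℕ) : ℝ) := by exact_mod_cast (by omega : 0 < k + l)
      rw [le_div_iff₀ hpos]
      push_cast [h3.le]
      linarith
    · rintro ⟨k, l⟩ h ⟨k', l'⟩ h' heq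
      simp only [nearPairs, Finset.mem_coe, Finset.mem_filter] at h h'
      obtain ⟨-, h, -⟩ := h
      obtain ⟨-, h', -⟩ := h'
      simp only [Sigma.mk.injEq, heq_eq_eq, Prod.mk.injEq] at heq ⊢
      omega
  calc ((nearPairs B Z).card : ℝ) ≤ ∑ b ∈ Finset.Icc 1 (2 * B), (⌊Z / b⌋₊ : ℝ) := by
        rw [Finset.card_sigma] at h1
        simp only [Nat.card_Icc, Nat.add_sub_cancel] at h1
        exact_mod_cast h1
    _ ≤ ∑ b ∈ Finset.Icc 1 (2 * B), Z * (1 / (b : ℝ)) := by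
        refine Finset.sum_le_sum fun b _ => (Nat.floor_le (by positivity)).trans (le_of_eq ?_)
        ring
    _ ≤ _ := by
        rw [← Finset.mul_sum]
        exact mul_le_mul_of_nonneg_left (sum_inv_Icc_le _) hZ

theorem card_degenerate_le {β : ℝ} (hβ : 0 < β) {M D : ℝ} :
    ((pairSet β M D).filter fun t => t.2.2.1 ≤ t.1 ∧ t.2.2.2 ≤ t.2.1).card ≤
      (nearPairs ⌊√M + √(M / β)⌋₊ (D / β)).card * (⌊√M + √(M / β)⌋₊ + 1) +
      (⌊√M + √(M / β)⌋₊ + 1) * (nearPairs ⌊√M + √(M / β)⌋₊ D).card +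
      (nearPairs ⌊√M + √(M / β)⌋₊ (D / β)).card * (nearPairs ⌊√M + √(M / β)⌋₊ D).card := by
  set B := ⌊√M + √(M / β)⌋₊ with hB
  set dg := (Finset.range (B + 1)).image fun n => (n, n)
  have hdg : dg.card ≤ B + 1 := Finset.card_image_le.trans_eq (Finset.card_range _)
  have h1 : ((pairSet β M D).filter fun t => t.2.2.1 ≤ t.1 ∧ t.2.2.2 ≤ t.2.1).card ≤
      (nearPairs B (D / β) ×ˢ dg ∪ dg ×ˢ nearPairs B D ∪ nearPairs B (D / β) ×ˢ nearPairs B D).card := by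
    refine Finset.card_le_card_of_injOn (fun t => ((t.1, t.2.2.1), (t.2.1, t.2.2.2))) ?_ ?_
    · rintro ⟨m, n, m', n'⟩ h
      rw [Finset.mem_coe, Finset.mem_filter, mem_pairSet hβ] at h
      obtain ⟨⟨⟨-, -, hne⟩, h1, h2, h3⟩, h4, h5⟩ := h
      simp only at h4 h5
      obtain ⟨bm, bn⟩ := le_floor_of_quadForm_le hβ h1
      rw [← hB] at bm bn
      have sm : (m' : ℝ) ^ 2 ≤ (m : ℝ) ^ 2 := by gcongr
      have sn : (n' : ℝ) ^ 2 ≤ (n : ℝ) ^ 2 := by gcongr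
      have c1 : m' < m → (m, m') ∈ nearPairs B (D / β) := fun hlt => by
        simp only [nearPairs, Finset.mem_filter, Finset.mem_product, Finset.mem_range]
        refine ⟨⟨bm, by omega⟩, hlt, ?_⟩
        rw [le_div_iff₀ hβ]
        linarith
      have c2 : n' < n → (n, n') ∈ nearPairs B D := fun hlt => by
        simp only [nearPairs, Finset.mem_filter, Finset.mem_product, Finset.mem_range]
        refine ⟨⟨bn, by omega⟩, hlt, ?_⟩
        nlinarith
      have c3 : ∀ {k l : ℕ}, k < B + 1 → k = l → (k, l) ∈ dg := fun hk h =>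
        Finset.mem_image.2 ⟨_, Finset.mem_range.2 hk, by rw [h]⟩
      simp only [Finset.mem_coe, Finset.mem_union, Finset.mem_product]
      rcases h4.lt_or_eq with h6 | h6 <;> rcases h5.lt_or_eq with h7 | h7
      · exact Or.inr ⟨c1 h6, c2 h7⟩
      · exact Or.inl (Or.inl ⟨c1 h6, c3 bn h7.symm⟩)
      · exact Or.inl (Or.inr ⟨c3 bm h6.symm, c2 h7⟩)
      · exact absurd ⟨h6.symm, h7.symm⟩ hne
    · rintro ⟨a, b, c, d⟩ - ⟨a', b', c', d'⟩ - h
      simp only [Prod.mk.injEq] at h ⊢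
      tauto
  refine h1.trans ((Finset.card_union_le _ _).trans (Nat.add_le_add ((Finset.card_union_le _ _).trans ?_)
    (Finset.card_product _ _).le))
  rw [Finset.card_product, Finset.card_product]
  gcongr

theorem eventually_card_degenerate_le {β ε : ℝ} (hβ : 0 < β) (hε : 0 < ε) :
    ∀ᶠ M : ℝ in Filter.atTop, ∀ D : ℝ, 0 ≤ D → D ≤ M ^ (4 / 5 : ℝ) →
      (((pairSet β M D).filter fun t => t.2.2.1 ≤ t.1 ∧ t.2.2.2 ≤ t.2.1).card : ℝ) ≤ ε * D * M := by
  set c := 1 + √(1 / β) with hc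
  have hc1 : 1 ≤ c := by
    have := Real.sqrt_nonneg (1 / β)
    linarith
  set A := 1 + 1 / β with hA
  have hA1 : 1 ≤ A := by
    have : 0 < 1 / β := by positivity
    linarith
  filter_upwards [Filter.eventually_ge_atTop (Real.exp 1), Filter.eventually_ge_atTop ((2 * c) ^ 2),
    eventually_mul_log_pow_le (16 * c * A / ε) 1 (show (0 : ℝ) < 1 / 2 by norm_num),
    eventually_mul_log_pow_le (8 * A / ε) 2 (show (0 : ℝ) < 1 / 5 by norm_num)]
    with M hMe hMc hM1 hM2 D hD hD'
  have he := Real.add_one_le_exp 1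
  have hM0 : 1 ≤ M := by linarith
  have hMp : 0 < M := by linarith
  have hlog : 1 ≤ Real.log M := by rwa [Real.le_log_iff_exp_le hMp]
  have hs1 : 1 ≤ √M := Real.one_le_sqrt.2 hM0
  have hsM : √M * √M = M := Real.mul_self_sqrt hMp.le
  have hsc : √M + √(M / β) = c * √M := by
    rw [div_eq_mul_one_div, Real.sqrt_mul hMp.le, hc]
    ring
  have hBle := card_degenerate_le hβ (M := M) (D := D)
  rw [hsc] at hBle
  set B := ⌊c * √M⌋₊
  have hB : (B : ℝ) ≤ c * √M := Nat.floor_le (by positivity)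
  have hB1 : (B : ℝ) + 1 ≤ 2 * c * √M := by
    have : 1 ≤ c * √M := one_le_mul_of_one_le_of_one_le hc1 hs1
    linarith
  have h2c : 2 * c ≤ √M := Real.le_sqrt_of_sq_le hMc
  set ℓ := 1 + Real.log (2 * B : ℕ) with hℓ
  have hBpos : 0 < B := Nat.floor_pos.2 (one_le_mul_of_one_le_of_one_le hc1 hs1)
  have hℓ0 : 0 ≤ ℓ := by
    have := Real.log_natCast_nonneg (2 * B)
    linarith
  have hℓ1 : ℓ ≤ 2 * Real.log M := by
    have : Real.log (2 * B : ℕ) ≤ Real.log M := by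
      refine Real.log_le_log (by exact_mod_cast (by omega : 0 < 2 * B)) ?_
      push_cast
      nlinarith
    linarith
  have n1 := card_nearPairs_le B (Z := D / β) (by positivity)
  have n2 := card_nearPairs_le B hD
  rw [← hℓ] at n1 n2
  have hDβ : D / β ≤ D * A := by
    rw [hA, mul_add, mul_one_div]; linarith
  have hDA : D ≤ D * A := le_mul_of_one_le_right hD hA1
  have n1' : ((nearPairs B (D / β)).card : ℝ) ≤ D * A * (2 * Real.log M) :=
    n1.trans (mul_le_mul hDβ hℓ1 hℓ0 (by positivity))
  have n2' : ((nearPairs B D).card : ℝ) ≤ D * (2 * Real.log M) :=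
    n2.trans (mul_le_mul_of_nonneg_left hℓ1 hD)
  have n3 : ((nearPairs B D).card : ℝ) ≤ M ^ (4 / 5 : ℝ) * (2 * Real.log M) :=
    n2'.trans (mul_le_mul_of_nonneg_right hD' (by positivity))
  have n2'' : ((nearPairs B D).card : ℝ) ≤ D * A * (2 * Real.log M) :=
    n2'.trans (mul_le_mul_of_nonneg_right hDA (by positivity))
  rw [div_mul_eq_mul_div, div_le_iff₀ hε, pow_one, ← Real.sqrt_eq_rpow] at hM1
  rw [div_mul_eq_mul_div, div_le_iff₀ hε] at hM2
  calc _ ≤ ((nearPairs B (D / β)).card : ℝ) * (B + 1) + (B + 1) * (nearPairs B D).card +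
        (nearPairs B (D / β)).card * (nearPairs B D).card := by exact_mod_cast hBle
    _ ≤ D * A * (2 * Real.log M) * (2 * c * √M) + (2 * c * √M) * (D * A * (2 * Real.log M)) +
        D * A * (2 * Real.log M) * (M ^ (4 / 5 : ℝ) * (2 * Real.log M)) := by gcongr
    _ = D / 2 * (16 * c * A * Real.log M) * √M + D / 2 * (8 * A * Real.log M ^ 2) * M ^ (4 / 5 : ℝ) := by ring
    _ ≤ D / 2 * (√M * ε) * √M + D / 2 * (M ^ (1 / 5 : ℝ) * ε) * M ^ (4 / 5 : ℝ) := by gcongr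
    _ = D / 2 * ε * (√M * √M) + D / 2 * ε * (M ^ (1 / 5 : ℝ) * M ^ (4 / 5 : ℝ)) := by ring
    _ = ε * D * M := by
        rw [hsM, ← Real.rpow_add hMp]; norm_num; ring

end Degenerate

section LatticeCount

theorem integral_zero_sqrt_one_sub_sq {T : ℝ} (hT : 1 ≤ T) :
    ∫ u in (0 : ℝ)..T, √(1 - u ^ 2) = Real.pi / 4 := by
  have hc : Continuous fun u : ℝ => √(1 - u ^ 2) := by fun_prop
  have h1 : ∫ u in (1 : ℝ)..T, √(1 - u ^ 2) = 0 := by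
    rw [intervalIntegral.integral_congr (g := fun _ => 0), intervalIntegral.integral_zero]
    intro u hu
    rw [Set.uIcc_of_le hT] at hu
    exact Real.sqrt_eq_zero_of_nonpos (by nlinarith [hu.1])
  have h2 : ∫ u in (-1 : ℝ)..0, √(1 - u ^ 2) = ∫ u in (0 : ℝ)..1, √(1 - u ^ 2) := by
    have := intervalIntegral.integral_comp_neg (a := 0) (b := 1) fun u : ℝ => √(1 - u ^ 2)
    simpa using this.symm
  have h3 := intervalIntegral.integral_add_adjacent_intervals
    (hc.intervalIntegrable (μ := volume) (-1) 0) (hc.intervalIntegrable 0 1)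
  have h4 := intervalIntegral.integral_add_adjacent_intervals
    (hc.intervalIntegrable (μ := volume) 0 1) (hc.intervalIntegrable 1 T)
  rw [integral_sqrt_one_sub_sq] at h3
  linarith

theorem integral_sqrt_sub_mul_sq {β z T : ℝ} (hβ : 0 < β) (hz : 0 < z) (hT : √(z / β) ≤ T) :
    ∫ x in (0 : ℝ)..T, √(z - β * x ^ 2) = Real.pi / 4 * z / √β := by
  set R := √(z / β) with hR
  have hRp : 0 < R := Real.sqrt_pos.2 (by positivity)
  have hR2 : R ^ 2 = z / β := Real.sq_sqrt (by positivity)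
  have hsb : √β * √β = β := Real.mul_self_sqrt hβ.le
  have hsp : 0 < √β := Real.sqrt_pos.2 hβ
  have h1 : ∀ x : ℝ, √(z - β * x ^ 2) = √z * √(1 - (x / R) ^ 2) := fun x => by
    rw [← Real.sqrt_mul hz.le, div_pow, hR2]
    congr 1
    field_simp
  have h2 : R = √z / √β := by rw [hR, Real.sqrt_div hz.le]
  simp_rw [h1]
  rw [intervalIntegral.integral_const_mul,
    intervalIntegral.integral_comp_div (fun u => √(1 - u ^ 2)) hRp.ne', zero_div,
    integral_zero_sqrt_one_sub_sq ((one_le_div hRp).2 hT), smul_eq_mul, h2]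
  rw [show √z * (√z / √β * (Real.pi / 4)) = Real.pi / 4 * (√z * √z) / √β by ring,
    Real.mul_self_sqrt hz.le]

/-- Points `m > 0`, `n ≥ 0` with `4(βm² + n²) ≤ y`. -/
noncomputable def ellipsePts (β y : ℝ) : Finset (Σ _ : ℕ, ℕ) :=
  (Finset.Icc 1 ⌊√(y / 4 / β)⌋₊).sigma fun m => Finset.range (⌊√(y / 4 - β * (m : ℝ) ^ 2)⌋₊ + 1)

theorem mem_ellipsePts {β y : ℝ} (hβ : 0 < β) {p : Σ _ : ℕ, ℕ} :
    p ∈ ellipsePts β y ↔ 0 < p.1 ∧ 4 * (β * (p.1 : ℝ) ^ 2 + (p.2 : ℝ) ^ 2) ≤ y := by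
  obtain ⟨m, n⟩ := p
  simp only [ellipsePts, Finset.mem_sigma, Finset.mem_Icc, Finset.mem_range, Nat.lt_succ_iff]
  constructor
  · rintro ⟨⟨h1, h2⟩, h3⟩
    refine ⟨h1, ?_⟩
    have h4 := (Nat.le_floor_iff (Real.sqrt_nonneg _)).1 h2
    have h5 := (Nat.le_floor_iff (Real.sqrt_nonneg _)).1 h3
    have hm : (0 : ℝ) < m := by exact_mod_cast h1
    have h6 := (Real.le_sqrt' hm).1 h4
    rw [le_div_iff₀ hβ] at h6
    have h7 := (Real.le_sqrt n.cast_nonneg (by linarith)).1 h5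
    linarith
  · rintro ⟨h1, h2⟩
    have hm : (0 : ℝ) < m := by exact_mod_cast h1
    refine ⟨⟨h1, Nat.le_floor (Real.le_sqrt_of_sq_le ?_)⟩, Nat.le_floor (Real.le_sqrt_of_sq_le ?_)⟩
    · rw [le_div_iff₀ hβ]
      nlinarith [sq_nonneg (n : ℝ)]
    · linarith

theorem abs_card_ellipsePts_sub_le {β y : ℝ} (hβ : 0 < β) (hy : 0 ≤ y) :
    |((ellipsePts β y).card : ℝ) - Real.pi / (16 * √β) * y| ≤ (1 + √(1 / β)) * √y := by
  rcases hy.eq_or_lt with rfl | hy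
  · simp [ellipsePts]
  set X := ⌊√(y / 4 / β)⌋₊ with hX
  set f : ℝ → ℝ := fun x => √(y / 4 - β * x ^ 2) with hf
  have hcard : ((ellipsePts β y).card : ℝ) = ∑ m ∈ Finset.Icc 1 X, ((⌊f m⌋₊ : ℝ) + 1) := by
    rw [ellipsePts, Finset.card_sigma]
    simp [hf, hX]
  have hXs : √(y / 4 / β) ≤ (X : ℝ) + 1 := (Nat.lt_floor_add_one _).le
  have h_int : ∫ x in (0 : ℝ)..(0 : ℝ) + (X + 1 : ℕ), f x = Real.pi / (16 * √β) * y := by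
    rw [zero_add, integral_sqrt_sub_mul_sq hβ (by positivity) (by push_cast; exact hXs)]
    have : 0 < √β := Real.sqrt_pos.2 hβ
    field_simp
    norm_num
  have hanti : AntitoneOn f (Set.Icc 0 (0 + ((X + 1 : ℕ) : ℝ))) := fun a ha b _ hab =>
    Real.sqrt_le_sqrt (by have := ha.1; gcongr)
  have h1 := hanti.sum_le_integral
  have h2 := hanti.integral_le_sum
  rw [h_int] at h1 h2
  simp only [zero_add] at h1 h2
  have hlast : f ((X + 1 : ℕ) : ℝ) = 0 := by
    refine Real.sqrt_eq_zero_of_nonpos ?_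
    have := (Real.sqrt_le_left (by positivity)).1 hXs
    rw [div_le_iff₀ hβ] at this
    push_cast
    linarith
  have h3 : ∑ i ∈ Finset.range (X + 1), f ((i + 1 : ℕ) : ℝ) = ∑ m ∈ Finset.Icc 1 X, f m := by
    rw [Finset.sum_range_succ, hlast, add_zero, Finset.range_eq_Ico,
      Finset.sum_Ico_add' (fun i : ℕ => f (i : ℝ)) 0 X 1]
    rfl
  have h4 : ∑ i ∈ Finset.range (X + 1), f (i : ℝ) = f 0 + ∑ m ∈ Finset.Icc 1 X, f m := by
    rw [Finset.sum_range_succ', Nat.cast_zero, add_comm, Finset.range_eq_Ico,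
      Finset.sum_Ico_add' (fun i : ℕ => f (i : ℝ)) 0 X 1]
    rfl
  rw [h3] at h1
  rw [h4] at h2
  have hf0 : f 0 ≤ √y := Real.sqrt_le_sqrt (by norm_num; linarith)
  have hXy : (X : ℝ) ≤ √(1 / β) * √y := by
    rw [← Real.sqrt_mul (by positivity)]
    refine (Nat.floor_le (Real.sqrt_nonneg _)).trans (Real.sqrt_le_sqrt ?_)
    rw [one_div_mul_eq_div]
    gcongr
    linarith
  have h5 : ((ellipsePts β y).card : ℝ) ≤ ∑ m ∈ Finset.Icc 1 X, f m + X := by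
    rw [hcard, Finset.sum_add_distrib]
    gcongr
    · exact Nat.floor_le (Real.sqrt_nonneg _)
    · simp
  have h6 : ∑ m ∈ Finset.Icc 1 X, f m ≤ (ellipsePts β y).card := by
    rw [hcard]
    exact Finset.sum_le_sum fun i _ => (Nat.lt_floor_add_one _).le
  have := Real.sqrt_nonneg y
  have : 0 ≤ √(1 / β) * √y := by positivity
  rw [abs_le]
  constructor <;> linarith

end LatticeCount

section CoarsePairs

theorem card_ellipsePts_bounds {β : ℝ} (hβ : 0 < β) (y : ℝ) :
    Real.pi / (16 * √β) * y - (1 + √(1 / β)) * √y ≤ (ellipsePts β y).card ∧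
      (0 ≤ y → ((ellipsePts β y).card : ℝ) ≤ Real.pi / (16 * √β) * y + (1 + √(1 / β)) * √y) := by
  have hκ : 0 ≤ Real.pi / (16 * √β) := by positivity
  rcases le_total 0 y with hy | hy
  · have := abs_le.1 (abs_card_ellipsePts_sub_le hβ hy)
    exact ⟨by linarith, fun _ => by linarith⟩
  · refine ⟨?_, fun hy' => ?_⟩
    · have h1 : √y = 0 := Real.sqrt_eq_zero_of_nonpos hy
      have h2 : (0 : ℝ) ≤ (ellipsePts β y).card := Nat.cast_nonneg _
      have h3 := mul_nonpos_of_nonneg_of_nonpos hκ hy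
      rw [h1]
      linarith
    · have := abs_le.1 (abs_card_ellipsePts_sub_le hβ hy')
      linarith

/-- The quadratic form `4(βm² + n²)` on lattice points. -/
def pointForm (β : ℝ) (p : Σ _ : ℕ, ℕ) : ℝ := 4 * (β * (p.1 : ℝ) ^ 2 + (p.2 : ℝ) ^ 2)

open Classical in
/-- The points different from `p` whose form value lies in `[Q(p) - 4D, Q(p)]`. -/
noncomputable def lowerNeighbours (β D : ℝ) (p : Σ _ : ℕ, ℕ) : Finset (Σ _ : ℕ, ℕ) :=
  (ellipsePts β (pointForm β p)).filter fun r => r ≠ p ∧ pointForm β p ≤ pointForm β r + 4 * D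

theorem card_pairSet_eq_sum {β : ℝ} (hβ : 0 < β) (M D : ℝ) :
    (pairSet β M D).card = ∑ p ∈ ellipsePts β M, (lowerNeighbours β D p).card := by
  rw [← Finset.card_sigma]
  refine Finset.card_nbij' (fun t => ⟨⟨t.1, t.2.1⟩, ⟨t.2.2.1, t.2.2.2⟩⟩)
    (fun s => (s.1.1, s.1.2, s.2.1, s.2.2)) ?_ ?_ (fun _ _ => rfl) (fun _ _ => rfl)
  · rintro ⟨m, n, m', n'⟩ h
    rw [Finset.mem_coe, mem_pairSet hβ] at h
    obtain ⟨⟨h1, h2, h3⟩, h4, h5, h6⟩ := h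
    rw [Finset.mem_coe, Finset.mem_sigma, lowerNeighbours, Finset.mem_filter, mem_ellipsePts hβ,
      mem_ellipsePts hβ]
    simp only [pointForm, ne_eq, Sigma.mk.injEq, heq_eq_eq]
    exact ⟨⟨h1, h4⟩, ⟨h2, by linarith⟩, fun h => h3 ⟨h.1.symm, h.2.symm⟩, by linarith⟩
  · rintro ⟨⟨m, n⟩, ⟨m', n'⟩⟩ h
    rw [Finset.mem_coe, Finset.mem_sigma, lowerNeighbours, Finset.mem_filter, mem_ellipsePts hβ,
      mem_ellipsePts hβ] at h
    simp only [pointForm, ne_eq, Sigma.mk.injEq, heq_eq_eq] at h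
    obtain ⟨⟨h1, h2⟩, ⟨h3, h4⟩, h5, h6⟩ := h
    rw [Finset.mem_coe, mem_pairSet hβ]
    exact ⟨⟨h1, h3, fun h => h5 ⟨h.1.symm, h.2.symm⟩⟩, h2, by linarith, by linarith⟩

theorem card_lowerNeighbours_bounds {β D : ℝ} (hβ : 0 < β) (hD : 0 ≤ D) (p : Σ _ : ℕ, ℕ) :
    (lowerNeighbours β D p).card + (ellipsePts β (pointForm β p - (4 * D + 1))).card ≤
        (ellipsePts β (pointForm β p)).card ∧
      (ellipsePts β (pointForm β p)).card ≤
        (lowerNeighbours β D p).card + (ellipsePts β (pointForm β p - 4 * D)).card + 1 := by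
  classical
  constructor
  · rw [← Finset.card_union_of_disjoint]
    · refine Finset.card_le_card (Finset.union_subset (Finset.filter_subset _ _) fun r hr => ?_)
      rw [mem_ellipsePts hβ] at hr ⊢
      exact ⟨hr.1, by linarith⟩
    · refine Finset.disjoint_left.2 fun r h1 h2 => ?_
      have h3 := (Finset.mem_filter.1 h1).2.2
      have h4 := ((mem_ellipsePts hβ).1 h2).2
      rw [pointForm, pointForm] at *
      linarith
  · have : ellipsePts β (pointForm β p) ⊆
        lowerNeighbours β D p ∪ ellipsePts β (pointForm β p - 4 * D) ∪ {p} := fun r hr => by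
      simp only [Finset.mem_union, Finset.mem_singleton]
      by_cases h1 : r = p
      · exact Or.inr h1
      · by_cases h2 : pointForm β p ≤ pointForm β r + 4 * D
        · exact Or.inl (Or.inl (Finset.mem_filter.2 ⟨hr, h1, h2⟩))
        · refine Or.inl (Or.inr ((mem_ellipsePts hβ).2 ⟨((mem_ellipsePts hβ).1 hr).1, ?_⟩))
          rw [pointForm, pointForm] at *
          linarith
    refine (Finset.card_le_card this).trans ((Finset.card_union_le _ _).trans ?_)
    rw [Finset.card_singleton]
    exact Nat.add_le_add_right (Finset.card_union_le _ _) _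

theorem eventually_abs_card_pairSet_coarse {β ε : ℝ} (hβ : 0 < β) (hε : 0 < ε) :
    ∀ᶠ M : ℝ in Filter.atTop,
      |((pairSet β M (M ^ (3 / 4 : ℝ))).card : ℝ) - Real.pi ^ 2 / (64 * β) * (M ^ (3 / 4 : ℝ) * M)| ≤
        ε * (M ^ (3 / 4 : ℝ) * M) := by
  set κ := Real.pi / (16 * √β) with hκdef
  set C := 1 + √(1 / β) with hCdef
  have hκ : 0 < κ := by have := Real.sqrt_pos.2 hβ; positivity
  have hC : 0 < C := by have := Real.sqrt_nonneg (1 / β); positivity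
  have hκ2 : Real.pi ^ 2 / (64 * β) = 4 * κ ^ 2 := by
    rw [hκdef, div_pow, mul_pow, Real.sq_sqrt hβ.le]
    field_simp
    norm_num
  rw [hκ2]
  set K := 4 * κ * C + (κ + C) * (κ + 2 * C) + (κ + C) * (2 * C + 1) + 16 * κ * (κ + C) with hK
  have hKt := (tendsto_rpow_atTop (show (0 : ℝ) < 1 / 4 by norm_num)).eventually_ge_atTop (K / ε)
  filter_upwards [Filter.eventually_ge_atTop 1, hKt] with M hM1 hM
  have hMp : 0 < M := by linarith
  set D := M ^ (3 / 4 : ℝ) with hD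
  have hD1 : 1 ≤ D := Real.one_le_rpow hM1 (by norm_num)
  have hDM : D ≤ M := by
    conv_rhs => rw [← Real.rpow_one M]
    exact Real.rpow_le_rpow_of_exponent_le hM1 (by norm_num)
  set s := √M with hs
  have hs1 : 1 ≤ s := Real.one_le_sqrt.2 hM1
  have hsM : s ≤ M := by
    have := Real.mul_self_sqrt hMp.le
    rw [← hs] at this
    nlinarith
  have hDD : D * D = M * s := by
    rw [hs, Real.sqrt_eq_rpow, hD, ← Real.rpow_add hMp]
    conv_rhs => rw [← Real.rpow_one_add' hMp.le (by norm_num)]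
    norm_num
  have hDD' : D * M ^ (1 / 4 : ℝ) = M := by
    rw [hD, ← Real.rpow_add hMp]
    norm_num
  have hKε : K * (M * s) ≤ ε * (D * M) := by
    rw [div_le_iff₀ hε] at hM
    calc K * (M * s) = K * D * D := by rw [← hDD]; ring
      _ ≤ M ^ (1 / 4 : ℝ) * ε * D * D := by gcongr
      _ = ε * (D * (D * M ^ (1 / 4 : ℝ))) := by ring
      _ = _ := by rw [hDD']
  have hcM := card_ellipsePts_bounds hβ M
  have hc4 := (card_ellipsePts_bounds hβ (4 * D)).2 (by positivity)
  rw [← hκdef, ← hCdef, ← hs] at hcM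
  rw [← hκdef, ← hCdef] at hc4
  obtain ⟨hcl, hcu⟩ := hcM
  replace hcu := hcu hMp.le
  set c : ℝ := ((ellipsePts β M).card : ℝ) with hc
  have hc0 : 0 ≤ c := Nat.cast_nonneg _
  have hcK : c ≤ (κ + C) * M := by nlinarith
  have hs4 : √(4 * D) ≤ 4 * D := by
    rw [Real.sqrt_le_left (by positivity)]
    nlinarith
  have hc4K : ((ellipsePts β (4 * D)).card : ℝ) ≤ (κ + C) * (4 * D) := by nlinarith
  have hpt : ∀ p ∈ ellipsePts β M,
      ((lowerNeighbours β D p).card : ℝ) ≤ 4 * κ * D + (κ + 2 * C) * s ∧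
      4 * κ * D - (2 * C + 1) * s - 4 * κ * D * (if p ∈ ellipsePts β (4 * D) then 1 else 0) ≤
        (lowerNeighbours β D p).card := by
    intro p hp
    have hpM : pointForm β p ≤ M := ((mem_ellipsePts hβ).1 hp).2
    have hp1 := ((mem_ellipsePts hβ).1 hp).1
    have hp0 : 0 ≤ pointForm β p := by rw [pointForm]; positivity
    obtain ⟨b1, b2⟩ := card_lowerNeighbours_bounds hβ (D := D) (by linarith) p
    obtain ⟨e1, e2⟩ := card_ellipsePts_bounds hβ (pointForm β p)
    obtain ⟨e3, -⟩ := card_ellipsePts_bounds hβ (pointForm β p - (4 * D + 1))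
    obtain ⟨-, e4⟩ := card_ellipsePts_bounds hβ (pointForm β p - 4 * D)
    rw [← hκdef, ← hCdef] at e1 e2 e3 e4
    have b1' : ((lowerNeighbours β D p).card : ℝ) +
      (ellipsePts β (pointForm β p - (4 * D + 1))).card ≤ (ellipsePts β (pointForm β p)).card := by
      exact_mod_cast b1
    have b2' : ((ellipsePts β (pointForm β p)).card : ℝ) ≤ (lowerNeighbours β D p).card +
      (ellipsePts β (pointForm β p - 4 * D)).card + 1 := by exact_mod_cast b2
    replace e2 := e2 hp0
    have r1 : C * √(pointForm β p) ≤ C * s := mul_le_mul_of_nonneg_left (Real.sqrt_le_sqrt (by linarith)) hC.le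
    have r2 : C * √(pointForm β p - (4 * D + 1)) ≤ C * s := mul_le_mul_of_nonneg_left (Real.sqrt_le_sqrt (by linarith)) hC.le
    have r3 : C * √(pointForm β p - 4 * D) ≤ C * s := mul_le_mul_of_nonneg_left (Real.sqrt_le_sqrt (by linarith)) hC.le
    have r4 : κ ≤ κ * s := le_mul_of_one_le_right hκ.le hs1
    refine ⟨by linarith, ?_⟩
    split_ifs with h
    · have : (0 : ℝ) ≤ (lowerNeighbours β D p).card := Nat.cast_nonneg _
      have : 0 ≤ (2 * C + 1) * s := by positivity
      linarith
    · have h5 : 0 ≤ pointForm β p - 4 * D := by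
        by_contra! h6
        exact h ((mem_ellipsePts hβ).2 ⟨hp1, by rw [pointForm] at h6; linarith⟩)
      replace e4 := e4 h5
      linarith
  have hS : ((pairSet β M D).card : ℝ) = ∑ p ∈ ellipsePts β M, ((lowerNeighbours β D p).card : ℝ) := by
    rw [card_pairSet_eq_sum hβ, Nat.cast_sum]
  have hu : ((pairSet β M D).card : ℝ) ≤ c * (4 * κ * D + (κ + 2 * C) * s) := by
    rw [hS, hc, ← nsmul_eq_mul]
    exact Finset.sum_le_card_nsmul _ _ _ fun p hp => (hpt p hp).1
  have hl : c * (4 * κ * D - (2 * C + 1) * s) - 4 * κ * D * (ellipsePts β (4 * D)).card ≤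
      (pairSet β M D).card := by
    rw [hS]
    refine le_trans ?_ (Finset.sum_le_sum fun p hp => (hpt p hp).2)
    rw [Finset.sum_sub_distrib, Finset.sum_const, nsmul_eq_mul, ← Finset.mul_sum, ← hc,
      Finset.sum_boole]
    gcongr
    exact fun p hp => (Finset.mem_filter.1 hp).2
  have t1 : κ * C * (D * s) ≤ κ * C * (M * s) := by gcongr
  have t2 : c * ((κ + 2 * C) * s) ≤ (κ + C) * M * ((κ + 2 * C) * s) := by gcongr
  have t3 : c * ((2 * C + 1) * s) ≤ (κ + C) * M * ((2 * C + 1) * s) := by gcongr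
  have t4 : 4 * κ * D * (ellipsePts β (4 * D)).card ≤ 16 * κ * (κ + C) * (M * s) := by
    rw [← hDD]
    calc 4 * κ * D * ((ellipsePts β (4 * D)).card : ℝ) ≤ 4 * κ * D * ((κ + C) * (4 * D)) := by gcongr
      _ = _ := by ring
  have t5 : 4 * κ * D * c ≤ 4 * κ * D * (κ * M + C * s) := by gcongr
  have t6 : 4 * κ * D * (κ * M - C * s) ≤ 4 * κ * D * c := by gcongr
  have hMs : 0 ≤ M * s := by positivity
  have p1 : 0 ≤ (κ + C) * (κ + 2 * C) * (M * s) := by positivity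
  have p2 : 0 ≤ (κ + C) * (2 * C + 1) * (M * s) := by positivity
  have p3 : 0 ≤ 16 * κ * (κ + C) * (M * s) := by positivity
  refine abs_le.2 ⟨?_, ?_⟩
  · have : -(K * (M * s)) ≤ ((pairSet β M D).card : ℝ) - 4 * κ ^ 2 * (D * M) := by
      rw [hK]
      linarith
    linarith
  · have : ((pairSet β M D).card : ℝ) - 4 * κ ^ 2 * (D * M) ≤ K * (M * s) := by
      rw [hK]
      linarith
    linarith

end CoarsePairs

section Deduction

theorem eventually_mul_rpow_le_rpow (K : ℝ) {a b : ℝ} (hab : a < b) :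
    ∀ᶠ x : ℝ in Filter.atTop, K * x ^ a ≤ x ^ b := by
  filter_upwards [Filter.eventually_gt_atTop 0,
    (tendsto_rpow_atTop (sub_pos.2 hab)).eventually_ge_atTop K] with x hx h
  calc K * x ^ a ≤ x ^ (b - a) * x ^ a := by gcongr
    _ = x ^ b := by rw [← Real.rpow_add hx, sub_add_cancel]

/-- Comparison of the quadruple counts at two window sizes, together with a bound for the
quadruples with a coincidence. -/
def QuadCompare (q η β : ℝ) : Prop :=
  ∀ ε > 0, ∀ᶠ M : ℝ in Filter.atTop, ∀ D D1 : ℝ,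
    M ^ (-1 + η) ≤ D → D ≤ M ^ (4 / 5 : ℝ) → M ^ (-1 + η) ≤ D1 → D1 ≤ M ^ (4 / 5 : ℝ) →
    ((quadSet β M D).card : ℝ) ≤ q ^ 5 * D / D1 * (quadSet β (q ^ 3 * M) D1).card + ε * D * M ∧
    (((quadSet β M D).filter fun t => t.1 = t.2.1 ∨ t.2.2.1 = t.2.2.2).card : ℝ) ≤ ε * D * M

theorem QuadCompare.rescale {q η η1 β r ε : ℝ} (h : QuadCompare q η β) (hr : 0 < r) (hη : η < η1)
    (hε : 0 < ε) :
    ∀ᶠ M : ℝ in Filter.atTop, ∀ D D1 : ℝ,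
      M ^ (-1 + η1) ≤ D → D ≤ M ^ (7 / 9 : ℝ) → M ^ (-1 + η1) ≤ D1 → D1 ≤ M ^ (7 / 9 : ℝ) →
      ((quadSet β (r * M) (r * D)).card : ℝ) ≤
        q ^ 5 * D / D1 * (quadSet β (r * (q ^ 3 * M)) (r * D1)).card + ε * D * M ∧
      (((quadSet β (r * M) (r * D)).filter fun t => t.1 = t.2.1 ∨ t.2.2.1 = t.2.2.2).card : ℝ) ≤
        ε * D * M := by
  have ht : Filter.Tendsto (fun M : ℝ => r * M) Filter.atTop Filter.atTop :=
    Filter.tendsto_id.const_mul_atTop hr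
  filter_upwards [ht.eventually (h (ε / r ^ 2) (by positivity)), Filter.eventually_gt_atTop 0,
    eventually_mul_rpow_le_rpow (r ^ (-1 + η) / r) (show -1 + η < -1 + η1 by linarith),
    eventually_mul_rpow_le_rpow (r / r ^ (4 / 5 : ℝ)) (show (7 / 9 : ℝ) < 4 / 5 by norm_num)]
    with M hM hM0 h1 h2 D D1 hD hD' hD1 hD1'
  have lo : ∀ {x : ℝ}, M ^ (-1 + η1) ≤ x → (r * M) ^ (-1 + η) ≤ r * x := fun hx => by
    have := h1.trans hx
    rw [div_mul_eq_mul_div, div_le_iff₀ hr] at this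
    rw [Real.mul_rpow hr.le hM0.le]
    linarith
  have hi : ∀ {x : ℝ}, x ≤ M ^ (7 / 9 : ℝ) → r * x ≤ (r * M) ^ (4 / 5 : ℝ) := fun hx => by
    rw [div_mul_eq_mul_div, div_le_iff₀ (by positivity)] at h2
    rw [Real.mul_rpow hr.le hM0.le]
    nlinarith
  obtain ⟨a, b⟩ := hM (r * D) (r * D1) (lo hD) (hi hD') (lo hD1) (hi hD1')
  have hD1p : 0 < D1 := (Real.rpow_pos_of_pos hM0 _).trans_le hD1
  have e1 : ε / r ^ 2 * (r * D) * (r * M) = ε * D * M := by field_simp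
  have e2 : q ^ 5 * (r * D) / (r * D1) = q ^ 5 * D / D1 := by field_simp
  rw [e1, e2, mul_left_comm (q ^ 3)] at a
  rw [e1] at b
  exact ⟨a, b⟩

/-- The number of quadruples of both orientations. -/
noncomputable def quadTotal (β M D : ℝ) : ℝ :=
  (quadSet β M D).card + (quadSet β⁻¹ (M / β) (D / β)).card

theorem eventually_quadTotal_compare {q η η1 β ε : ℝ} (hβ : 0 < β) (h : QuadCompare q η β)
    (h' : QuadCompare q η β⁻¹) (hη : η < η1) (hε : 0 < ε) :
    ∀ᶠ M : ℝ in Filter.atTop, ∀ D D1 : ℝ,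
      M ^ (-1 + η1) ≤ D → D ≤ M ^ (7 / 9 : ℝ) → M ^ (-1 + η1) ≤ D1 → D1 ≤ M ^ (7 / 9 : ℝ) →
      |4 * ((pairSet β M D).card : ℝ) - quadTotal β M D| ≤ ε * D * M ∧
      quadTotal β M D ≤ q ^ 5 * D / D1 * quadTotal β (q ^ 3 * M) D1 + ε * D * M := by
  filter_upwards [h.rescale one_pos hη (show 0 < ε / 12 by positivity),
    h'.rescale (inv_pos.2 hβ) hη (show 0 < ε / 12 by positivity), Filter.eventually_ge_atTop 1,
    eventually_card_degenerate_le hβ (show 0 < ε / 12 by positivity)]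
    with M h1 h2 hM1 h3 D D1 hD hD' hD1 hD1'
  have hD0 : 0 ≤ D := (Real.rpow_nonneg (by linarith) _).trans hD
  have h45 : M ^ (7 / 9 : ℝ) ≤ M ^ (4 / 5 : ℝ) := Real.rpow_le_rpow_of_exponent_le hM1 (by norm_num)
  obtain ⟨a1, b1⟩ := h1 D D1 hD hD' hD1 hD1'
  obtain ⟨a2, b2⟩ := h2 D D1 hD hD' hD1 hD1'
  have h4 := h3 D hD0 (hD'.trans h45)
  have h5 := abs_four_mul_card_pairSet_sub_le hβ M D
  simp only [one_mul] at a1 b1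
  simp only [inv_mul_eq_div] at a2 b2
  have hp : 0 ≤ ε * D * M := by positivity
  rw [quadTotal, quadTotal, ← sub_sub, mul_add]
  exact ⟨by linarith, by linarith⟩

theorem eventually_abs_card_pairSet_sub_le {η β ε : ℝ} (hβ : 0 < β) (hη0 : 0 < η)
    (h : ∀ i : ℕ, QuadCompare (1 + 1 / ((i : ℝ) + 1)) η β)
    (h' : ∀ i : ℕ, QuadCompare (1 + 1 / ((i : ℝ) + 1)) η β⁻¹) (hη1 : η ≤ 1 / 2) (hε : 0 < ε) :
    ∀ᶠ M : ℝ in Filter.atTop, ∀ D : ℝ, M ^ (-1 + 3 * η) ≤ D → D ≤ M ^ (1 / 2 : ℝ) →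
      |((pairSet β M D).card : ℝ) - Real.pi ^ 2 / (64 * β) * (D * M)| ≤ ε * (D * M) := by
  set c := Real.pi ^ 2 / (64 * β)
  obtain ⟨q, hq1, hq2, hqβ, hqβ', hqu, hql⟩ : ∃ q : ℝ, 1 < q ∧ q ≤ 2 ∧ QuadCompare q η β ∧
      QuadCompare q η β⁻¹ ∧ q ^ 8 * (c + 2 * (ε / 8)) ≤ c + ε ∧
      q ^ 8 * (c - ε + ε / 8) ≤ c - 2 * (ε / 8) := by
    have ht : Filter.Tendsto (fun i : ℕ => 1 + 1 / ((i : ℝ) + 1)) Filter.atTop (nhds (1 + 0)) :=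
      tendsto_one_div_add_atTop_nhds_zero_nat.const_add 1
    rw [add_zero] at ht
    have t1 := ((ht.pow 8).mul_const (c + 2 * (ε / 8))).eventually_le_const
      (show 1 ^ 8 * (c + 2 * (ε / 8)) < c + ε by linarith)
    have t2 := ((ht.pow 8).mul_const (c - ε + ε / 8)).eventually_le_const
      (show 1 ^ 8 * (c - ε + ε / 8) < c - 2 * (ε / 8) by linarith)
    obtain ⟨i, i1, i2⟩ := (t1.and t2).exists
    have hi : (0 : ℝ) < (i : ℝ) + 1 := by positivity
    have hi' : 1 / ((i : ℝ) + 1) ≤ 1 := (div_le_one hi).2 (by linarith [i.cast_nonneg (α := ℝ)])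
    exact ⟨_, by linarith [one_div_pos.2 hi], by linarith, h i, h' i, i1, i2⟩
  have hq0 : 0 < q := by linarith
  set δ := ε / 8 with hδ
  have hδ0 : 0 < δ := by positivity
  have hc0 : 0 ≤ c := by positivity
  have hT := eventually_quadTotal_compare hβ hqβ hqβ' (show η < 2 * η by linarith) hδ0
  have hC := eventually_abs_card_pairSet_coarse hβ hδ0
  have tu : Filter.Tendsto (fun M : ℝ => q ^ 3 * M) Filter.atTop Filter.atTop :=
    Filter.tendsto_id.const_mul_atTop (by positivity)
  have tl : Filter.Tendsto (fun M : ℝ => M / q ^ 3) Filter.atTop Filter.atTop :=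
    Filter.tendsto_id.atTop_div_const (by positivity)
  filter_upwards [hT, tu.eventually hT, tl.eventually hT, tu.eventually hC, tl.eventually hC,
    Filter.eventually_ge_atTop 1, tl.eventually (Filter.eventually_ge_atTop 1),
    eventually_mul_rpow_le_rpow ((q ^ 3) ^ (3 / 4 : ℝ)) (show (3 / 4 : ℝ) < 7 / 9 by norm_num),
    eventually_mul_rpow_le_rpow (((q ^ 3) ^ (-1 + 2 * η))⁻¹) (show -1 + 2 * η < -1 + 3 * η by linarith),
    eventually_mul_rpow_le_rpow ((q ^ 3) ^ (7 / 9 : ℝ)) (show (1 / 2 : ℝ) < 7 / 9 by norm_num)]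
    with M hTM hTx hTw hCx hCw hM1 hw1 k1 k2 k3 D hD hD'
  have hM0 : 0 < M := by linarith
  have hD0 : 0 < D := (Real.rpow_pos_of_pos hM0 _).trans_le hD
  have hlo : M ^ (-1 + 2 * η) ≤ D :=
    (Real.rpow_le_rpow_of_exponent_le hM1 (by linarith)).trans hD
  have hhi : D ≤ M ^ (7 / 9 : ℝ) := hD'.trans (Real.rpow_le_rpow_of_exponent_le hM1 (by norm_num))
  have hrange : ∀ {y : ℝ}, 1 ≤ y →
      y ^ (-1 + 2 * η) ≤ y ^ (3 / 4 : ℝ) ∧ y ^ (3 / 4 : ℝ) ≤ y ^ (7 / 9 : ℝ) := fun hy =>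
    ⟨Real.rpow_le_rpow_of_exponent_le hy (by linarith),
      Real.rpow_le_rpow_of_exponent_le hy (by norm_num)⟩
  have hDM : 0 < D * M := by positivity
  have hq8 : 0 < q ^ 8 := by positivity
  have hq81 : 1 ≤ q ^ 8 := one_le_pow₀ hq1.le
  have hq31 : 1 ≤ q ^ 3 := one_le_pow₀ hq1.le
  refine abs_sub_le_iff.2 ⟨?_, ?_⟩
  · set x := q ^ 3 * M with hx
    have hMx : M ≤ x := le_mul_of_one_le_left hM0.le hq31
    have hx1 : 1 ≤ x := hM1.trans hMx
    set X := x ^ (3 / 4 : ℝ) with hX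
    have hX0 : 0 < X := Real.rpow_pos_of_pos (by linarith) _
    obtain ⟨u1, u2⟩ := hTM D X hlo hhi
      ((hrange hM1).1.trans (Real.rpow_le_rpow hM0.le hMx (by norm_num)))
      (by rwa [hX, hx, Real.mul_rpow (by positivity) hM0.le])
    obtain ⟨u3, -⟩ := hTx X X (hrange hx1).1 (hrange hx1).2 (hrange hx1).1 (hrange hx1).2
    rw [abs_le] at u1 u3 hCx
    have u4 : quadTotal β x X ≤ (4 * c + 5 * δ) * (X * x) := by linarith [hCx.2, u3.1]
    have u5 : q ^ 5 * D / X * quadTotal β x X ≤ q ^ 8 * (4 * c + 5 * δ) * (D * M) :=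
      calc q ^ 5 * D / X * quadTotal β x X ≤ q ^ 5 * D / X * ((4 * c + 5 * δ) * (X * x)) := by gcongr
        _ = _ := by rw [hx]; field_simp
    have u6 : q ^ 8 * (c + 2 * δ) * (D * M) ≤ (c + ε) * (D * M) := by gcongr
    have u7 : 1 * (δ * (D * M)) ≤ q ^ 8 * (δ * (D * M)) := by gcongr
    linarith [u1.2]
  · set w := M / q ^ 3 with hw
    have hqw : q ^ 3 * w = M := by rw [hw]; field_simp
    set W := w ^ (3 / 4 : ℝ) with hW
    have hW0 : 0 < W := Real.rpow_pos_of_pos (by linarith) _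
    have hwD : w ^ (-1 + 2 * η) ≤ D := by
      rw [hw, Real.div_rpow hM0.le (by positivity), div_eq_inv_mul]
      exact k2.trans hD
    have hDw : D ≤ w ^ (7 / 9 : ℝ) := by
      rw [hw, Real.div_rpow hM0.le (by positivity), le_div_iff₀ (by positivity), mul_comm]
      exact le_trans (by gcongr) k3
    obtain ⟨u1, -⟩ := hTM D D hlo hhi hlo hhi
    obtain ⟨u3, u2⟩ := hTw W D (hrange hw1).1 (hrange hw1).2 hwD hDw
    rw [hqw] at u2
    rw [abs_le] at u1 u3 hCw
    have u4 : (4 * c - 5 * δ) * (W * w) ≤ quadTotal β w W := by linarith [hCw.1, u3.2]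
    have u5 : (4 * c - 6 * δ) * (W * w) ≤ q ^ 5 * W / D * quadTotal β M D := by linarith
    have u6 : (4 * c - 6 * δ) * (D * M) ≤ q ^ 8 * quadTotal β M D := by
      have := mul_le_mul_of_nonneg_left u5 (show 0 ≤ q ^ 3 * D / W by positivity)
      calc (4 * c - 6 * δ) * (D * M) = q ^ 3 * D / W * ((4 * c - 6 * δ) * (W * w)) := by
            rw [← hqw]; field_simp
        _ ≤ _ := this
        _ = _ := by field_simp
    have u7 : q ^ 8 * (c - ε + δ) * (D * M) ≤ (c - 2 * δ) * (D * M) := by gcongr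
    have u8 : q ^ 8 * ((4 * (c - ε + δ)) * (D * M)) ≤ q ^ 8 * quadTotal β M D := by
      have : 0 ≤ δ * (D * M) := by positivity
      linarith
    have u9 := le_of_mul_le_mul_left u8 hq8
    have : 0 ≤ δ * (D * M) := by positivity
    linarith [u1.1]

end Deduction

section Torus

theorem lam_eq {α : ℝ × ℝ} (hα : α ∈ Rset) (m n : ℤ) :
    lam α m n = Real.pi / (4 * √(α.1 / α.2)) * (α.1 / α.2 * (m : ℝ) ^ 2 + (n : ℝ) ^ 2) := by
  obtain ⟨h1, h2⟩ := hα
  have e : √(α.1 * α.2) = √(α.1 / α.2) * α.2 := by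
    rw [show α.1 * α.2 = α.1 / α.2 * (α.2 * α.2) by field_simp, Real.sqrt_mul (by positivity),
      Real.sqrt_mul_self h2.le]
  have h3 : 0 < √(α.1 / α.2) := Real.sqrt_pos.2 (by positivity)
  rw [lam, qf, e]
  field_simp

theorem Pcorr_Icc_eq {α : ℝ × ℝ} (hα : α ∈ Rset) (N Δ : ℝ) :
    Pcorr α N (Set.Icc 0 Δ) = (1 / N) * (pairSet (α.1 / α.2) (16 * √(α.1 / α.2) / Real.pi * N)
      (4 * √(α.1 / α.2) / Real.pi * Δ)).card := by
  have hβ : 0 < α.1 / α.2 := div_pos hα.1 hα.2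
  set β := α.1 / α.2
  have ht : 0 < √β := Real.sqrt_pos.2 hβ
  have hπ := Real.pi_pos
  set f : ℕ × ℕ × ℕ × ℕ → (ℤ × ℤ) × (ℤ × ℤ) := fun t => ((t.1, t.2.1), (t.2.2.1, t.2.2.2)) with hf
  have hinj : Function.Injective f := by
    rintro ⟨a, b, c, d⟩ ⟨a', b', c', d'⟩ h
    simp only [hf, Prod.mk.injEq, Nat.cast_inj] at h ⊢
    tauto
  have key : ∀ m n m' n' : ℕ,
      (m, n, m', n') ∈ pairSet β (16 * √β / Real.pi * N) (4 * √β / Real.pi * Δ) ↔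
      ((m : ℤ), (n : ℤ)) ∈ idx ∧ ((m' : ℤ), (n' : ℤ)) ∈ idx ∧
      ((m : ℤ), (n : ℤ)) ≠ ((m' : ℤ), (n' : ℤ)) ∧
      lam α m n ≤ N ∧ lam α m' n' ≤ N ∧ lam α m n - lam α m' n' ∈ Set.Icc 0 Δ := by
    intro m n m' n'
    have e1 : lam α m n ≤ N ↔
        4 * (β * (m : ℝ) ^ 2 + (n : ℝ) ^ 2) ≤ 16 * √β / Real.pi * N := by
      rw [lam_eq hα, div_mul_eq_mul_div (16 * √β), le_div_iff₀ hπ, div_mul_eq_mul_div,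
        div_le_iff₀ (by positivity)]
      push_cast
      constructor <;> intro h <;> linarith
    have e2 : lam α m n - lam α m' n' = Real.pi / (4 * √β) *
        (β * ((m : ℝ) ^ 2 - (m' : ℝ) ^ 2) + ((n : ℝ) ^ 2 - (n' : ℝ) ^ 2)) := by
      rw [lam_eq hα, lam_eq hα]
      push_cast
      ring
    have hk : 0 < Real.pi / (4 * √β) := by positivity
    have e3 : ∀ x : ℝ, Real.pi / (4 * √β) * x ≤ Δ ↔ x ≤ 4 * √β / Real.pi * Δ := fun x => by
      rw [div_mul_eq_mul_div, div_mul_eq_mul_div, div_le_iff₀ (by positivity), le_div_iff₀ hπ]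
      constructor <;> intro h <;> linarith
    rw [mem_pairSet hβ, Set.mem_Icc, e1, ← e3]
    simp only [idx, Set.mem_ofPred_eq, ne_eq, Prod.mk.injEq, Nat.cast_inj, Nat.cast_pos,
      Nat.cast_nonneg, and_true]
    constructor
    · rintro ⟨⟨h1, h2, h3⟩, h4, h5, h6⟩
      have h7 : 0 ≤ lam α m n - lam α m' n' := by rw [e2]; positivity
      exact ⟨h1, h2, h3, h4, by linarith [e1.2 h4], h7, by rwa [e2]⟩
    · rintro ⟨h1, h2, h3, h4, -, h6, h7⟩
      rw [e2] at h6 h7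
      exact ⟨⟨h1, h2, h3⟩, h4, nonneg_of_mul_nonneg_right h6 hk, h7⟩
  rw [Pcorr]
  congr 2
  rw [← Set.ncard_coe_finset, ← Set.ncard_image_of_injective _ hinj]
  refine congrArg Set.ncard ?_
  ext ⟨⟨m, n⟩, ⟨m', n'⟩⟩
  constructor
  · intro h
    have h1 : 0 < m ∧ 0 ≤ n := h.1
    have h2 : 0 < m' ∧ 0 ≤ n' := h.2.1
    lift m to ℕ using h1.1.le
    lift n to ℕ using h1.2
    lift m' to ℕ using h2.1.le
    lift n' to ℕ using h2.2
    exact ⟨(m, n, m', n'), (key m n m' n').2 h, rfl⟩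
  · rintro ⟨⟨a, b, c, d⟩, h, heq⟩
    rw [← heq]
    exact (key a b c d).1 h

theorem Rmeasure_log_ratio_eq_zero {Z : Set ℝ} (hZ : volume Z = 0) :
    Rmeasure {α ∈ Rset | Real.log (α.1 / α.2) ∈ Z} = 0 := by
  refine withDensity_absolutelyContinuous _ _ ?_
  set Z' := toMeasurable volume Z
  have hZ' : volume Z' = 0 := by rw [measure_toMeasurable, hZ]
  have hm : MeasurableSet {α : ℝ × ℝ | (0 < α.1 ∧ 0 < α.2) ∧ Real.log (α.1 / α.2) ∈ Z'} := by
    refine ((measurableSet_lt measurable_const measurable_fst).inter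
      (measurableSet_lt measurable_const measurable_snd)).inter ?_
    exact (Real.measurable_log.comp (measurable_fst.div measurable_snd))
      (measurableSet_toMeasurable _ _)
  refine measure_mono_null (t := {α : ℝ × ℝ | (0 < α.1 ∧ 0 < α.2) ∧ Real.log (α.1 / α.2) ∈ Z'})
    (fun α h => ⟨h.1, subset_toMeasurable _ _ h.2⟩) ?_
  rw [Measure.volume_eq_prod, Measure.measure_prod_null hm]
  refine Filter.Eventually.of_forall fun x => ?_
  refine measure_mono_null (t := (fun θ => x * Real.exp (-θ)) '' Z') ?_
    (addHaar_image_eq_zero_of_differentiableOn_of_addHaar_eq_zero volume ?_ hZ')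
  · rintro y ⟨⟨h1, h2⟩, h3⟩
    refine ⟨_, h3, ?_⟩
    simp only at h1 h2 ⊢
    rw [← Real.log_inv, Real.exp_log (by positivity), inv_div]
    field_simp
  · fun_prop

theorem eventually_abs_Pcorr_sub_le {α : ℝ × ℝ} {η C δ : ℝ} (hα : α ∈ Rset) (hη0 : 0 < η)
    (hη1 : η ≤ 1 / 2)
    (h : ∀ i : ℕ, QuadCompare (1 + 1 / ((i : ℝ) + 1)) η (α.1 / α.2))
    (h' : ∀ i : ℕ, QuadCompare (1 + 1 / ((i : ℝ) + 1)) η (α.1 / α.2)⁻¹) (hδ : 0 < δ) :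
    ∀ᶠ N : ℝ in Filter.atTop, ∀ Δ : ℝ, N ^ (-1 + 4 * η) ≤ Δ → Δ ≤ C →
      |Pcorr α N (Set.Icc 0 Δ) - Δ| ≤ δ * Δ := by
  have hβ : 0 < α.1 / α.2 := div_pos hα.1 hα.2
  have hP := Pcorr_Icc_eq hα
  set β := α.1 / α.2
  have ht : 0 < √β := Real.sqrt_pos.2 hβ
  have hββ : √β * √β = β := Real.mul_self_sqrt hβ.le
  have hπ := Real.pi_pos
  have hk : 0 < 16 * √β / Real.pi := by positivity
  have hl : 0 < 4 * √β / Real.pi := by positivity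
  set k := 16 * √β / Real.pi with hkdef
  set l := 4 * √β / Real.pi with hldef
  have hkl : Real.pi ^ 2 / (64 * β) * (k * l) = 1 := by
    have e : k * l = 64 * β / Real.pi ^ 2 := by
      rw [hkdef, hldef, ← hββ, Real.sqrt_mul_self ht.le]
      ring
    rw [e]
    field_simp
  have tk : Filter.Tendsto (fun N : ℝ => k * N) Filter.atTop Filter.atTop :=
    Filter.tendsto_id.const_mul_atTop hk
  have hsqrt := ((tendsto_rpow_atTop (show (0 : ℝ) < 1 / 2 by norm_num)).comp tk).eventually_ge_atTop
    (l * C)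
  filter_upwards [tk.eventually (eventually_abs_card_pairSet_sub_le hβ hη0 h h' hη1
      (show 0 < δ * (Real.pi ^ 2 / (64 * β)) by positivity)),
    Filter.eventually_gt_atTop 0, hsqrt, eventually_mul_rpow_le_rpow (k ^ (-1 + 3 * η) / l)
      (show -1 + 3 * η < -1 + 4 * η by linarith)] with N hN hN0 h1 h2 Δ hΔ hΔC
  have hlo : (k * N) ^ (-1 + 3 * η) ≤ l * Δ := by
    rw [div_mul_eq_mul_div, div_le_iff₀ hl, ← Real.mul_rpow hk.le hN0.le] at h2
    exact h2.trans (by rw [mul_comm]; gcongr)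
  have hS := hN (l * Δ) hlo ((mul_le_mul_of_nonneg_left hΔC hl.le).trans h1)
  rw [hP]
  set S : ℝ := ((pairSet β (k * N) (l * Δ)).card : ℝ)
  have e1 : Real.pi ^ 2 / (64 * β) * (l * Δ * (k * N)) = N * Δ := by
    linear_combination N * Δ * hkl
  rw [mul_assoc δ, e1] at hS
  calc |1 / N * S - Δ| = (1 / N) * |S - N * Δ| := by
        rw [← abs_of_pos (one_div_pos.2 hN0), ← abs_mul, abs_of_pos (one_div_pos.2 hN0)]
        congr 1
        field_simp
    _ ≤ (1 / N) * (δ * (N * Δ)) := by gcongr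
    _ = δ * Δ := by field_simp

end Torus

/-- **Theorem 2.** For every `η > 0` there is a null set `ℱ ⊆ ℛ` such that for all
`α ∈ ℛ \ ℱ`, `P(α, N, [0,Δ]) = (1 + o(1))Δ` as `N → ∞`, uniformly in
`N^{-1+η} ≤ Δ ≤ C` for any fixed constant `C`. -/
theorem small_gaps_rectangular_tori (η : ℝ) (hη : 0 < η) :
    ∃ F : Set (ℝ × ℝ), F ⊆ Rset ∧ Rmeasure F = 0 ∧
      ∀ α ∈ Rset \ F, ∀ C : ℝ, 0 < C → ∀ δ : ℝ, 0 < δ → ∃ N₀ : ℝ, ∀ N : ℝ, N₀ ≤ N →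
        ∀ Δ : ℝ, N ^ (-1 + η) ≤ Δ → Δ ≤ C →
          |Pcorr α N (Set.Icc 0 Δ) - Δ| ≤ δ * Δ := by
  set η' := min η 1 / 4 with hη'
  have hη0 : 0 < η' := by positivity
  have hη1 : η' ≤ 1 / 2 := by linarith [min_le_right η 1]
  set G : Set ℝ := {θ | ∀ i : ℕ, QuadCompare (1 + 1 / ((i : ℝ) + 1)) η' (Real.exp θ)} with hG
  have hGae : ∀ᵐ θ : ℝ, θ ∈ G := by
    refine ae_all_iff.2 fun i => ?_
    have hi : (0 : ℝ) < (i : ℝ) + 1 := by positivity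
    have hi' : 1 / ((i : ℝ) + 1) ≤ 1 := (div_le_one hi).2 (by linarith [i.cast_nonneg (α := ℝ)])
    exact ae_quadSet_compare (by linarith [one_div_pos.2 hi]) (by linarith) hη0 (by linarith)
  have hGneg : ∀ᵐ θ : ℝ, -θ ∈ G :=
    (Measure.measurePreserving_neg (volume : Measure ℝ)).quasiMeasurePreserving.ae hGae
  refine ⟨{α ∈ Rset | Real.log (α.1 / α.2) ∈ {θ | ¬(θ ∈ G ∧ -θ ∈ G)}}, fun α h => h.1,
    Rmeasure_log_ratio_eq_zero (ae_iff.1 (hGae.and hGneg)), ?_⟩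
  rintro α ⟨hα, hαF⟩ C hC δ hδ
  have hβ : 0 < α.1 / α.2 := div_pos hα.1 hα.2
  have hgood : Real.log (α.1 / α.2) ∈ G ∧ -Real.log (α.1 / α.2) ∈ G := by
    by_contra hbad
    exact hαF ⟨hα, hbad⟩
  obtain ⟨g1, g2⟩ := hgood
  simp only [hG, Set.mem_ofPred_eq, Real.exp_neg, Real.exp_log hβ] at g1 g2
  obtain ⟨N₀, hN₀⟩ := Filter.eventually_atTop.1
    ((eventually_abs_Pcorr_sub_le (C := C) hα hη0 hη1 g1 g2 hδ).and (Filter.eventually_ge_atTop 1))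
  refine ⟨N₀, fun N hN Δ hΔ hΔC => (hN₀ N hN).1 Δ (le_trans ?_ hΔ) hΔC⟩
  exact Real.rpow_le_rpow_of_exponent_le (hN₀ N hN).2 (by linarith [min_le_left η 1])
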